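/- Let N⁺(X) denote the number of SL₃(ℤ)-equivalence classes of strongly irreducible integral ternary cubic forms f with Δ(f) > 0 and height H(f) < X, and let N⁻(X) denote the analogous count with Δ(f) < 0. Then lim_{X→∞} N⁺(X)/X^{5/6} = (32/45)·ζ(2)·ζ(3) and lim_{X→∞} N⁻(X)/X^{5/6} = (128/45)·ζ(2)·ζ(3). -/

import Mathlib

open MvPolynomial

/-- The action of a 3×3 matrix on ternary forms: `(γ·f)(x,y,z) = f((x,y,z)·γ)`. -/
noncomputable def actGL {R : Type*} [CommRing R] (γ : Matrix (Fin 3) (Fin 3) R)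
    (f : MvPolynomial (Fin 3) R) : MvPolynomial (Fin 3) R :=
  bind₁ (fun j => ∑ i : Fin 3, C (γ i j) * X i) f

/-- The Hessian of a ternary form: the determinant of the matrix of second partials. -/
noncomputable def hess {R : Type*} [CommRing R] (f : MvPolynomial (Fin 3) R) :
    MvPolynomial (Fin 3) R :=
  Matrix.det (Matrix.of fun i j => pderiv i (pderiv j f))

/-- The exponent vectors of the ten monomials of a ternary cubic form. -/
def expo : Fin 10 → Fin 3 → ℕ :=
  ![![3,0,0], ![0,3,0], ![0,0,3], ![2,1,0], ![2,0,1],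
    ![1,2,0], ![0,2,1], ![1,0,2], ![0,1,2], ![1,1,1]]

/-- The ternary cubic form with coefficient vector `c : Fin 10 → R`. -/
noncomputable def cubic {R : Type*} [CommRing R] (c : Fin 10 → R) : MvPolynomial (Fin 3) R :=
  ∑ k : Fin 10, C (c k) * ∏ i : Fin 3, X i ^ expo k i

/-- The coefficient vector of the Weierstrass cubic `x³ + A·x·z² + B·z³ − y²·z`. -/
noncomputable def wcoeffs {R : Type*} [CommRing R] (A B : R) : Fin 10 → R :=
  ![1, 0, B, 0, 0, 0, -1, A, 0, 0]

/-- The generic ternary cubic form, whose coefficients are the 10 indeterminates. -/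
noncomputable def genCubic (R : Type*) [CommRing R] :
    MvPolynomial (Fin 3) (MvPolynomial (Fin 10) R) :=
  cubic (fun k => X k)

/-- `P` and `Q` are the invariants `I` and `J`: they are homogeneous of degrees 4 and 6
in the ten coefficients, they satisfy the identity
`H(H(f)) = 12288·I(f)²·f + 512·J(f)·H(f)` (stated for the generic ternary cubic form,
hence for every ternary cubic form over every commutative `R`-algebra), and they are
normalized so that `x³ + A·x·z² + B·z³ − y²·z` has `I = −3A` and `J = −27B`. -/
def IsInvariantPair (R : Type*) [CommRing R] (P Q : MvPolynomial (Fin 10) R) : Prop :=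
  P.IsHomogeneous 4 ∧ Q.IsHomogeneous 6 ∧
  hess (hess (genCubic R)) =
    12288 * C P ^ 2 * genCubic R + 512 * C Q * hess (genCubic R) ∧
  ∀ A B : R, aeval (wcoeffs A B) P = -3 * A ∧ aeval (wcoeffs A B) Q = -27 * B

/-- The invariant `I` of the integral ternary cubic form with coefficients `c`,
where `P` is the degree-4 invariant polynomial. -/
noncomputable def Iinv (P : MvPolynomial (Fin 10) ℚ) (c : Fin 10 → ℤ) : ℚ :=
  aeval (fun k => (c k : ℚ)) P

/-- The invariant `J` of the integral ternary cubic form with coefficients `c`,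
where `Q` is the degree-6 invariant polynomial. -/
noncomputable def Jinv (Q : MvPolynomial (Fin 10) ℚ) (c : Fin 10 → ℤ) : ℚ :=
  aeval (fun k => (c k : ℚ)) Q

/-- The discriminant `Δ = (4I³ − J²)/27` of the integral ternary cubic form `c`. -/
noncomputable def Δinv (P Q : MvPolynomial (Fin 10) ℚ) (c : Fin 10 → ℤ) : ℚ :=
  (4 * Iinv P c ^ 3 - Jinv Q c ^ 2) / 27

/-- The height `H = max(|I|³, J²/4)` of the integral ternary cubic form `c`. -/
noncomputable def Hinv (P Q : MvPolynomial (Fin 10) ℚ) (c : Fin 10 → ℤ) : ℚ :=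
  max (|Iinv P c| ^ 3) (Jinv Q c ^ 2 / 4)

/-- An integral ternary cubic form is strongly irreducible if `f` and its Hessian have no
common nontrivial rational zero. -/
def StronglyIrred (c : Fin 10 → ℤ) : Prop :=
  ¬ ∃ v : Fin 3 → ℚ, v ≠ 0 ∧ eval v (cubic fun k => (c k : ℚ)) = 0 ∧
      eval v (hess (cubic fun k => (c k : ℚ))) = 0

/-- The `SL₃(ℤ)`-orbit (equivalence class) of the integral ternary cubic form `c`. -/
noncomputable def orbitZ (c : Fin 10 → ℤ) : Set (Fin 10 → ℤ) :=
  {c' | ∃ γ : Matrix.SpecialLinearGroup (Fin 3) ℤ,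
    actGL (γ : Matrix (Fin 3) (Fin 3) ℤ) (cubic c) = cubic c'}

/-- `ζ(2)`. -/
noncomputable def zeta2 : ℝ := ∑' n : ℕ, (1 : ℝ) / (n + 1) ^ 2

/-- `ζ(3)`. -/
noncomputable def zeta3 : ℝ := ∑' n : ℕ, (1 : ℝ) / (n + 1) ^ 3

/-- The number of `SL₃(ℤ)`-equivalence classes of strongly irreducible integral ternary
cubic forms with `Δ > 0` and height `< X`. -/
noncomputable def Npos (P Q : MvPolynomial (Fin 10) ℚ) (X : ℝ) : ℕ :=
  Set.ncard {T : Set (Fin 10 → ℤ) | ∃ c : Fin 10 → ℤ, StronglyIrred c ∧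
    0 < Δinv P Q c ∧ (Hinv P Q c : ℝ) < X ∧ T = orbitZ c}

/-- The number of `SL₃(ℤ)`-equivalence classes of strongly irreducible integral ternary
cubic forms with `Δ < 0` and height `< X`. -/
noncomputable def Nneg (P Q : MvPolynomial (Fin 10) ℚ) (X : ℝ) : ℕ :=
  Set.ncard {T : Set (Fin 10 → ℤ) | ∃ c : Fin 10 → ℤ, StronglyIrred c ∧
    Δinv P Q c < 0 ∧ (Hinv P Q c : ℝ) < X ∧ T = orbitZ c}

open MvPolynomial

section Sone
variable {R : Type*} [CommRing R]

/-- value of the cubic -/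
def fe (c : Fin 10 → R) (v : Fin 3 → R) : R :=
  c 0 * v 0 ^ 3 + c 1 * v 1 ^ 3 + c 2 * v 2 ^ 3 + c 3 * v 0 ^ 2 * v 1 + c 4 * v 0 ^ 2 * v 2
  + c 5 * v 0 * v 1 ^ 2 + c 6 * v 1 ^ 2 * v 2 + c 7 * v 0 * v 2 ^ 2 + c 8 * v 1 * v 2 ^ 2
  + c 9 * v 0 * v 1 * v 2

/-- gradient -/
def fg (c : Fin 10 → R) (v : Fin 3 → R) : Fin 3 → R :=
  ![3 * c 0 * v 0 ^ 2 + 2 * c 3 * v 0 * v 1 + 2 * c 4 * v 0 * v 2 + c 5 * v 1 ^ 2 + c 7 * v 2 ^ 2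
      + c 9 * v 1 * v 2,
    3 * c 1 * v 1 ^ 2 + c 3 * v 0 ^ 2 + 2 * c 5 * v 0 * v 1 + 2 * c 6 * v 1 * v 2 + c 8 * v 2 ^ 2
      + c 9 * v 0 * v 2,
    3 * c 2 * v 2 ^ 2 + c 4 * v 0 ^ 2 + c 6 * v 1 ^ 2 + 2 * c 7 * v 0 * v 2 + 2 * c 8 * v 1 * v 2
      + c 9 * v 0 * v 1]

/-- derivative of the cubic at `v` in direction `w` -/
def fd (c : Fin 10 → R) (v w : Fin 3 → R) : R :=
  w 0 * fg c v 0 + w 1 * fg c v 1 + w 2 * fg c v 2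

/-- polarization -/
def ft (c : Fin 10 → R) (u v w : Fin 3 → R) : R :=
  6 * c 0 * u 0 * v 0 * w 0 + 6 * c 1 * u 1 * v 1 * w 1 + 6 * c 2 * u 2 * v 2 * w 2
  + 2 * c 3 * (u 0 * v 0 * w 1 + u 0 * v 1 * w 0 + u 1 * v 0 * w 0)
  + 2 * c 4 * (u 0 * v 0 * w 2 + u 0 * v 2 * w 0 + u 2 * v 0 * w 0)
  + 2 * c 5 * (u 0 * v 1 * w 1 + u 1 * v 0 * w 1 + u 1 * v 1 * w 0)
  + 2 * c 6 * (u 1 * v 1 * w 2 + u 1 * v 2 * w 1 + u 2 * v 1 * w 1)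
  + 2 * c 7 * (u 0 * v 2 * w 2 + u 2 * v 0 * w 2 + u 2 * v 2 * w 0)
  + 2 * c 8 * (u 1 * v 2 * w 2 + u 2 * v 1 * w 2 + u 2 * v 2 * w 1)
  + c 9 * (u 0 * v 1 * w 2 + u 0 * v 2 * w 1 + u 1 * v 0 * w 2 + u 1 * v 2 * w 0
      + u 2 * v 0 * w 1 + u 2 * v 1 * w 0)

/-- action on coefficients -/
def act (g : Matrix (Fin 3) (Fin 3) R) (c : Fin 10 → R) : Fin 10 → R :=
  ![fe c (g 0), fe c (g 1), fe c (g 2), fd c (g 0) (g 1), fd c (g 0) (g 2), fd c (g 1) (g 0),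
    fd c (g 1) (g 2), fd c (g 2) (g 0), fd c (g 2) (g 1), ft c (g 0) (g 1) (g 2)]

theorem cubic_eq (c : Fin 10 → R) : cubic c = C (c 0) * X 0 ^ 3 + C (c 1) * X 1 ^ 3
   + C (c 2) * X 2 ^ 3 + C (c 3) * (X 0 ^ 2 * X 1) + C (c 4) * (X 0 ^ 2 * X 2)
   + C (c 5) * (X 0 * X 1 ^ 2) + C (c 6) * (X 1 ^ 2 * X 2) + C (c 7) * (X 0 * X 2 ^ 2)
   + C (c 8) * (X 1 * X 2 ^ 2) + C (c 9) * (X 0 * X 1 * X 2) := by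
  simp [cubic, Fin.sum_univ_succ, Fin.prod_univ_succ, expo]
  ring_nf

theorem eval_cubic (c : Fin 10 → R) (v : Fin 3 → R) : eval v (cubic c) = fe c v := by
  rw [cubic_eq]; simp [fe]; ring

theorem actGL_cubic (g : Matrix (Fin 3) (Fin 3) R) (c : Fin 10 → R) :
    actGL g (cubic c) = cubic (act g c) := by
  rw [cubic_eq, cubic_eq]
  simp only [actGL, map_add, map_mul, map_pow, bind₁_X_right, bind₁_C_right, Fin.sum_univ_three,
    act, fe, fd, fg, ft, Matrix.cons_val, map_ofNat]
  ring

end Sone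

open MvPolynomial

set_option linter.all false
section Soneb
variable {R : Type*} [CommRing R]

theorem actGL_add (g : Matrix (Fin 3) (Fin 3) R) (p q) :
    actGL g (p + q) = actGL g p + actGL g q := by simp [actGL]
theorem actGL_mul (g : Matrix (Fin 3) (Fin 3) R) (p q) :
    actGL g (p * q) = actGL g p * actGL g q := by simp [actGL]
theorem actGL_sub (g : Matrix (Fin 3) (Fin 3) R) (p q) :
    actGL g (p - q) = actGL g p - actGL g q := by simp [actGL]
theorem actGL_C (g : Matrix (Fin 3) (Fin 3) R) (a) :
    actGL g (C a) = C a := by simp [actGL]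
theorem actGL_X (g : Matrix (Fin 3) (Fin 3) R) (j) :
    actGL g (X j) = ∑ i : Fin 3, C (g i j) * X i := by simp [actGL]

theorem pderiv_actGL (g : Matrix (Fin 3) (Fin 3) R) (i : Fin 3) (f : MvPolynomial (Fin 3) R) :
    pderiv i (actGL g f) = ∑ j : Fin 3, C (g i j) * actGL g (pderiv j f) := by
  induction f using MvPolynomial.induction_on with
  | C a => simp [actGL_C, actGL]
  | add p q hp hq =>
    simp only [actGL_add, map_add, hp, hq, Fin.sum_univ_three]; ring
  | mul_X p n hp =>
    rw [actGL_mul, Derivation.leibniz, hp, actGL_X]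
    simp only [smul_eq_mul, Derivation.leibniz, pderiv_X, actGL_add, actGL_mul, actGL_X,
      Fin.sum_univ_three, map_add, pderiv_C]
    fin_cases n <;> fin_cases i <;> simp [Pi.single_apply, actGL_C, actGL] <;> ring

theorem hess_actGL (g : Matrix (Fin 3) (Fin 3) R) (f : MvPolynomial (Fin 3) R) :
    hess (actGL g f) = C g.det ^ 2 * actGL g (hess f) := by
  have key : (Matrix.of fun i j => pderiv i (pderiv j (actGL g f))) =
      (g.map C) * ((Matrix.of fun i j => pderiv i (pderiv j f)).map (actGL g)) * (g.map C).transpose := by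
    ext1 i j
    simp only [Matrix.mul_apply, Matrix.of_apply, Matrix.map_apply, Matrix.transpose_apply,
      pderiv_actGL, map_sum, Derivation.leibniz, smul_eq_mul, pderiv_C, mul_zero, add_zero]
    simp only [Fin.sum_univ_three]; ring
  unfold hess
  rw [key, Matrix.det_mul, Matrix.det_mul, Matrix.det_transpose]
  have h1 : (g.map C).det = (C g.det : MvPolynomial (Fin 3) R) := (RingHom.map_det C g).symm
  have h2 : ((Matrix.of fun i j => pderiv i (pderiv j f)).map (actGL g)).det
     = actGL g (Matrix.of fun i j => pderiv i (pderiv j f)).det := by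
    have := (AlgHom.map_det (bind₁ (fun j => ∑ i : Fin 3, C (g i j) * X i : Fin 3 → MvPolynomial (Fin 3) R)) (Matrix.of fun i j => pderiv i (pderiv j f))).symm
    exact this
  rw [h1, h2]; ring

theorem hess_C_mul (a : R) (f : MvPolynomial (Fin 3) R) : hess (C a * f) = C a ^ 3 * hess f := by
  have : (Matrix.of fun i j => pderiv i (pderiv j (C a * f))) =
      (C a : MvPolynomial (Fin 3) R) • (Matrix.of fun i j => pderiv i (pderiv j f)) := by
    ext1 i j; simp [Derivation.leibniz]
  unfold hess
  rw [this, Matrix.det_smul]; simp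

theorem eval_actGL (g : Matrix (Fin 3) (Fin 3) R) (f : MvPolynomial (Fin 3) R) (v : Fin 3 → R) :
    eval v (actGL g f) = eval (Matrix.vecMul v g) f := by
  induction f using MvPolynomial.induction_on with
  | C a => simp [actGL_C]
  | add p q hp hq => simp [actGL_add, hp, hq]
  | mul_X p n hp =>
    simp [actGL_mul, actGL_X, hp, Fin.sum_univ_three, Matrix.vecMul, dotProduct]
    ring

/-- value of the Hessian determinant -/
def he (c : Fin 10 → R) (v : Fin 3 → R) : R :=
  Matrix.det !![6 * c 0 * v 0 + 2 * c 3 * v 1 + 2 * c 4 * v 2,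
      2 * c 3 * v 0 + 2 * c 5 * v 1 + c 9 * v 2, 2 * c 4 * v 0 + 2 * c 7 * v 2 + c 9 * v 1;
      2 * c 3 * v 0 + 2 * c 5 * v 1 + c 9 * v 2, 6 * c 1 * v 1 + 2 * c 5 * v 0 + 2 * c 6 * v 2,
      2 * c 6 * v 1 + 2 * c 8 * v 2 + c 9 * v 0;
      2 * c 4 * v 0 + 2 * c 7 * v 2 + c 9 * v 1, 2 * c 6 * v 1 + 2 * c 8 * v 2 + c 9 * v 0,
      6 * c 2 * v 2 + 2 * c 7 * v 0 + 2 * c 8 * v 1]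

theorem eval_hess (c : Fin 10 → R) (v : Fin 3 → R) : eval v (hess (cubic c)) = he c v := by
  have h2 : ∀ i, pderiv i (2 : MvPolynomial (Fin 3) R) = 0 := fun i => by
    exact_mod_cast (pderiv i).map_natCast 2
  have h3 : ∀ i, pderiv i (3 : MvPolynomial (Fin 3) R) = 0 := fun i => by
    exact_mod_cast (pderiv i).map_natCast 3
  unfold hess he
  rw [RingHom.map_det]
  congr 1
  ext i j
  fin_cases i <;> fin_cases j <;>
    simp [cubic_eq, Derivation.leibniz, pderiv_X, Pi.single_apply, Derivation.leibniz_pow, h2, h3] <;> ring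

theorem fe_act (g : Matrix (Fin 3) (Fin 3) R) (c : Fin 10 → R) (v) :
    fe (act g c) v = fe c (Matrix.vecMul v g) := by
  rw [← eval_cubic, ← actGL_cubic, eval_actGL, eval_cubic]

theorem he_act (g : Matrix (Fin 3) (Fin 3) R) (c : Fin 10 → R) (v) :
    he (act g c) v = g.det ^ 2 * he c (Matrix.vecMul v g) := by
  rw [← eval_hess, ← actGL_cubic, hess_actGL, map_mul, eval_actGL, eval_hess]; simp

theorem map_cubic {S : Type*} [CommRing S] (φ : R →+* S) (c : Fin 10 → R) :
    MvPolynomial.map φ (cubic c) = cubic (fun k => φ (c k)) := by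
  simp [cubic_eq]

theorem map_hess {S : Type*} [CommRing S] (φ : R →+* S) (f : MvPolynomial (Fin 3) R) :
    MvPolynomial.map φ (hess f) = hess (MvPolynomial.map φ f) := by
  unfold hess
  rw [RingHom.map_det]
  congr 1
  ext1 i j
  simp [pderiv_map]

theorem cubic_inj {c c' : Fin 10 → R} (h : cubic c = cubic c') : c = c' := by
  have key : ∀ k : Fin 10, ∀ c : Fin 10 → R,
      coeff (Finsupp.equivFunOnFinite.symm (expo k)) (cubic c) = c k := by
    intro k c
    unfold cubic
    rw [coeff_sum]
    have : ∀ j, (∏ i : Fin 3, (X i : MvPolynomial (Fin 3) R) ^ expo j i) =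
        monomial (Finsupp.equivFunOnFinite.symm (expo j)) 1 := by
      intro j
      rw [monomial_eq, Finsupp.prod_fintype _ _ (by simp)]
      simp
    simp only [this, C_mul_monomial, mul_one, coeff_monomial]
    rw [Finset.sum_eq_single k]
    · simp
    · intro j _ hj
      rw [if_neg]
      intro h
      have h2 : expo j = expo k := Finsupp.equivFunOnFinite.symm.injective h
      have h3 : ∀ j k : Fin 10, expo j = expo k → j = k := by decide
      exact hj (h3 j k h2)
    · simp
  funext k
  rw [← key k c, ← key k c', h]

theorem act_mul (g h : Matrix (Fin 3) (Fin 3) R) (c : Fin 10 → R) :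
    act (g * h) c = act g (act h c) := by
  apply cubic_inj
  rw [← actGL_cubic, ← actGL_cubic, ← actGL_cubic]
  generalize cubic c = f
  induction f using MvPolynomial.induction_on with
  | C a => simp [actGL_C]
  | add p q hp hq => simp [actGL_add, hp, hq]
  | mul_X p n hp =>
    simp only [actGL_mul, actGL_X, hp, Fin.sum_univ_three, actGL_add, actGL_C, Matrix.mul_apply, map_add, map_mul]
    ring

theorem act_one (c : Fin 10 → R) : act 1 c = c := by
  funext k
  fin_cases k <;> simp [act, fe, fd, fg, ft]

theorem act_add (g : Matrix (Fin 3) (Fin 3) R) (c d : Fin 10 → R) :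
    act g (c + d) = act g c + act g d := by
  have h1 : ∀ v, fe (c + d) v = fe c v + fe d v := fun v => by simp only [fe, Pi.add_apply]; ring
  have h2 : ∀ v w, fd (c + d) v w = fd c v w + fd d v w := fun v w => by
    simp only [fd, fg, Pi.add_apply, Matrix.cons_val]; ring
  have h3 : ∀ u v w, ft (c + d) u v w = ft c u v w + ft d u v w := fun u v w => by
    simp only [ft, Pi.add_apply]; ring
  simp only [act, h1, h2, h3, Matrix.cons_add_cons, Matrix.empty_add_empty]

theorem act_smul (g : Matrix (Fin 3) (Fin 3) R) (t : R) (c : Fin 10 → R) :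
    act g (t • c) = t • act g c := by
  have h1 : ∀ v, fe (t • c) v = t * fe c v := fun v => by
    simp only [fe, Pi.smul_apply, smul_eq_mul]; ring
  have h2 : ∀ v w, fd (t • c) v w = t * fd c v w := fun v w => by
    simp only [fd, fg, Pi.smul_apply, smul_eq_mul, Matrix.cons_val]; ring
  have h3 : ∀ u v w, ft (t • c) u v w = t * ft c u v w := fun u v w => by
    simp only [ft, Pi.smul_apply, smul_eq_mul]; ring
  simp only [act, h1, h2, h3, Matrix.smul_cons, Matrix.smul_empty, smul_eq_mul]

theorem act_smul_left (g : Matrix (Fin 3) (Fin 3) R) (t : R) (c : Fin 10 → R) :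
    act (t • g) c = t ^ 3 • act g c := by
  have h1 : ∀ v, fe c (t • v) = t ^ 3 * fe c v := fun v => by
    simp only [fe, Pi.smul_apply, smul_eq_mul]; ring
  have h2 : ∀ v w, fd c (t • v) (t • w) = t ^ 3 * fd c v w := fun v w => by
    simp only [fd, fg, Pi.smul_apply, smul_eq_mul, Matrix.cons_val]; ring
  have h3 : ∀ u v w, ft c (t • u) (t • v) (t • w) = t ^ 3 * ft c u v w := fun u v w => by
    simp only [ft, Pi.smul_apply, smul_eq_mul]; ring
  have h0 : ∀ i, (t • g) i = t • g i := fun i => rfl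
  simp only [act, h0, h1, h2, h3, Matrix.smul_cons, Matrix.smul_empty, smul_eq_mul]

theorem act_map {S : Type*} [CommRing S] (φ : R →+* S) (g : Matrix (Fin 3) (Fin 3) R)
    (c : Fin 10 → R) : (fun k => φ (act g c k)) = act (g.map φ) (fun k => φ (c k)) := by
  have h1 : ∀ v : Fin 3 → R, fe (fun k => φ (c k)) (fun i => φ (v i)) = φ (fe c v) := fun v => by
    simp only [fe, map_add, map_mul, map_pow]
  have h2 : ∀ v w : Fin 3 → R, fd (fun k => φ (c k)) (fun i => φ (v i)) (fun i => φ (w i))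
      = φ (fd c v w) := fun v w => by
    simp only [fd, fg, map_add, map_mul, map_pow, Matrix.cons_val, map_ofNat]
  have h3 : ∀ u v w : Fin 3 → R, ft (fun k => φ (c k)) (fun i => φ (u i)) (fun i => φ (v i))
      (fun i => φ (w i)) = φ (ft c u v w) := fun u v w => by
    simp only [ft, map_add, map_mul, map_pow, map_ofNat]
  have h0 : ∀ i, (g.map φ) i = fun j => φ (g i j) := fun i => rfl
  simp only [act, h0, h1, h2, h3]
  funext k
  fin_cases k <;> rfl

theorem orbitZ_eq (c : Fin 10 → ℤ) : orbitZ c = {c' | ∃ γ : Matrix.SpecialLinearGroup (Fin 3) ℤ,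
    act (γ : Matrix (Fin 3) (Fin 3) ℤ) c = c'} := by
  ext c'
  simp only [orbitZ, actGL_cubic, Set.mem_setOf_eq]
  exact ⟨fun ⟨γ, h⟩ => ⟨γ, cubic_inj h⟩, fun ⟨γ, h⟩ => ⟨γ, by rw [h]⟩⟩

theorem SI_iff (c : Fin 10 → ℤ) : StronglyIrred c ↔
    ¬ ∃ v : Fin 3 → ℚ, v ≠ 0 ∧ fe (fun k => (c k : ℚ)) v = 0 ∧ he (fun k => (c k : ℚ)) v = 0 := by
  simp only [StronglyIrred, eval_cubic, eval_hess]

end Soneb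

open MvPolynomial
set_option linter.all false

section Sonec
variable {P Q : MvPolynomial (Fin 10) ℚ}

theorem hess_hess (hPQ : IsInvariantPair ℚ P Q) {A : Type*} [CommRing A] [Algebra ℚ A]
    (c : Fin 10 → A) : hess (hess (cubic c)) =
      12288 * C (aeval c P) ^ 2 * cubic c + 512 * C (aeval c Q) * hess (cubic c) := by
  have h := congrArg (MvPolynomial.map (aeval c : MvPolynomial (Fin 10) ℚ →ₐ[ℚ] A).toRingHom) hPQ.2.2.1
  have hg : MvPolynomial.map (aeval c : MvPolynomial (Fin 10) ℚ →ₐ[ℚ] A).toRingHom (genCubic ℚ)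
      = cubic c := by
    rw [genCubic, map_cubic]; simp
  simp only [map_hess, map_add, map_mul, map_pow, hg, map_C, map_ofNat] at h
  exact h

theorem wcoeffs_map {A B : Type*} [CommRing A] [CommRing B] (φ : A →+* B) (a b : A) :
    (fun k => φ (wcoeffs a b k)) = wcoeffs (φ a) (φ b) := by
  funext k; fin_cases k <;> simp [wcoeffs]

theorem aeval_map' {A B : Type*} [CommRing A] [CommRing B] [Algebra ℚ A] [Algebra ℚ B]
    (φ : A →ₐ[ℚ] B) (c : Fin 10 → A) (P : MvPolynomial (Fin 10) ℚ) :
    φ (aeval c P) = aeval (fun k => φ (c k)) P := by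
  rw [← AlgHom.comp_apply]; congr 1; ext; simp

theorem inv_gen (hPQ : IsInvariantPair ℚ P Q) :
    let g : Matrix (Fin 3) (Fin 3) (MvPolynomial ((Fin 3 × Fin 3) ⊕ Fin 10) ℚ) :=
      Matrix.of fun i j => X (Sum.inl (i, j))
    let c : Fin 10 → (MvPolynomial ((Fin 3 × Fin 3) ⊕ Fin 10) ℚ) := fun k => X (Sum.inr k)
    aeval (act g c) P = g.det ^ 4 * aeval c P ∧ aeval (act g c) Q = g.det ^ 6 * aeval c Q := by
  intro g c
  -- specialization at g = 1, c = W(1,0)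
  let φ : MvPolynomial ((Fin 3 × Fin 3) ⊕ Fin 10) ℚ →ₐ[ℚ] ℚ :=
    aeval (Sum.elim (fun p => (1 : Matrix (Fin 3) (Fin 3) ℚ) p.1 p.2) (wcoeffs 1 0))
  have hφg : g.map φ = 1 := by ext i j; simp [g, φ]
  have hφc : (fun k => φ (c k)) = wcoeffs 1 0 := by funext k; simp [c, φ]
  have hφd : φ g.det = 1 := by
    have h1 : φ g.det = (g.map φ).det := AlgHom.map_det φ g
    rw [h1, hφg]; simp
  have hφa : (fun k => φ (act g c k)) = wcoeffs 1 0 := by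
    have h1 : (fun k => φ (act g c k)) = act (g.map φ) (fun k => φ (c k)) :=
      act_map (φ : _ →+* ℚ) g c
    rw [h1, hφg, hφc, act_one]
  have hd : g.det ≠ 0 := fun h => by rw [h] at hφd; simp at hφd
  set d := g.det with hdd
  have e1 := hess_hess hPQ (act g c)
  have e2 := hess_hess hPQ c
  rw [← actGL_cubic, hess_actGL, ← C_pow, hess_C_mul, hess_actGL, e2] at e1
  set p := aeval c P
  set q := aeval c Q
  set p' := aeval (act g c) P
  set q' := aeval (act g c) Q
  have hofn : ∀ n : ℕ, actGL g ((n : MvPolynomial (Fin 3) _)) = n := by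
    intro n; simp [actGL]
  have h12 := hofn 12288
  have h51 := hofn 512
  push_cast at h12 h51
  simp only [actGL_add, actGL_mul, actGL_C, pow_two (C p), h12, h51] at e1
  have E : ∀ v : Fin 3 → MvPolynomial ((Fin 3 × Fin 3) ⊕ Fin 10) ℚ,
     12288 * (p' ^ 2 - d ^ 8 * p ^ 2) * fe (act g c) v
       + 512 * d ^ 2 * (q' - d ^ 6 * q) * eval v (actGL g (hess (cubic c))) = 0 := by
    intro v
    have := congrArg (eval v) e1
    simp only [map_add, map_mul, map_pow, map_ofNat, eval_C, actGL_cubic, eval_cubic] at this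
    linear_combination -this
  have hH : ∀ v, d ^ 2 * eval v (actGL g (hess (cubic c))) = he (act g c) v := by
    intro v
    rw [he_act, eval_actGL, eval_hess]
  have E' : ∀ v : Fin 3 → MvPolynomial ((Fin 3 × Fin 3) ⊕ Fin 10) ℚ,
     12288 * (p' ^ 2 - d ^ 8 * p ^ 2) * fe (act g c) v
       + 512 * (q' - d ^ 6 * q) * he (act g c) v = 0 := by
    intro v; rw [← E v, ← hH]; ring
  have fe1 : φ (fe (act g c) ![1,0,0]) = 1 := by
    have : φ (fe (act g c) ![1,0,0]) = fe (fun k => φ (act g c k)) ![1,0,0] := by simp [fe]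
    rw [this, hφa]; simp [fe, wcoeffs]
  have fe2 : φ (fe (act g c) ![1,1,0]) = 1 := by
    have : φ (fe (act g c) ![1,1,0]) = fe (fun k => φ (act g c k)) ![1,1,0] := by simp [fe]
    rw [this, hφa]; simp [fe, wcoeffs]
  have he1 : φ (he (act g c) ![1,0,0]) = 0 := by
    have : φ (he (act g c) ![1,0,0]) = he (fun k => φ (act g c k)) ![1,0,0] := by
      simp only [he, Matrix.det_fin_three]; simp [map_ofNat φ]
    rw [this, hφa]; simp [he, wcoeffs, Matrix.det_fin_three]
  have he2 : φ (he (act g c) ![1,1,0]) = -24 := by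
    have : φ (he (act g c) ![1,1,0]) = he (fun k => φ (act g c k)) ![1,1,0] := by
      simp only [he, Matrix.det_fin_three]; simp [map_ofNat φ]
    rw [this, hφa]; simp [he, wcoeffs, Matrix.det_fin_three]; norm_num
  set m := fe (act g c) ![1,0,0] * he (act g c) ![1,1,0] - fe (act g c) ![1,1,0] * he (act g c) ![1,0,0] with hm
  have hm0 : m ≠ 0 := by
    intro h
    have := congrArg φ h
    rw [hm, map_sub, map_mul, map_mul, fe1, fe2, he1, he2] at this
    norm_num at this
  have a1 : (p' ^ 2 - d ^ 8 * p ^ 2) * m * 12288 = 0 := by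
    linear_combination (he (act g c) ![1,1,0]) * E' ![1,0,0] - (he (act g c) ![1,0,0]) * E' ![1,1,0]
  have a2 : (q' - d ^ 6 * q) * m * 512 = 0 := by
    linear_combination (fe (act g c) ![1,0,0]) * E' ![1,1,0] - (fe (act g c) ![1,1,0]) * E' ![1,0,0]
  have n1 : (12288 : MvPolynomial ((Fin 3 × Fin 3) ⊕ Fin 10) ℚ) ≠ 0 := by norm_num
  have n2 : (512 : MvPolynomial ((Fin 3 × Fin 3) ⊕ Fin 10) ℚ) ≠ 0 := by norm_num
  have b1 : p' ^ 2 - d ^ 8 * p ^ 2 = 0 := by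
    rcases mul_eq_zero.1 a1 with h | h
    · rcases mul_eq_zero.1 h with h | h
      · exact h
      · exact absurd h hm0
    · exact absurd h n1
  have b2 : q' - d ^ 6 * q = 0 := by
    rcases mul_eq_zero.1 a2 with h | h
    · rcases mul_eq_zero.1 h with h | h
      · exact h
      · exact absurd h hm0
    · exact absurd h n2
  refine ⟨?_, by linear_combination b2⟩
  have b3 : (p' - d ^ 4 * p) * (p' + d ^ 4 * p) = 0 := by linear_combination b1
  rcases mul_eq_zero.1 b3 with h | h
  · linear_combination h
  · exfalso
    have := congrArg φ h
    have hp : φ p = -3 := by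
      show φ (aeval c P) = _
      rw [aeval_map', hφc, (hPQ.2.2.2 1 0).1]; norm_num
    have hp' : φ p' = -3 := by
      show φ (aeval (act g c) P) = _
      rw [aeval_map', hφa, (hPQ.2.2.2 1 0).1]; norm_num
    rw [map_add, map_mul, map_pow, hp, hp', hφd] at this
    norm_num at this

theorem inv_act (hPQ : IsInvariantPair ℚ P Q) {A : Type*} [CommRing A] [Algebra ℚ A]
    (g : Matrix (Fin 3) (Fin 3) A) (c : Fin 10 → A) :
    aeval (act g c) P = g.det ^ 4 * aeval c P ∧ aeval (act g c) Q = g.det ^ 6 * aeval c Q := by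
  have h := inv_gen hPQ
  dsimp only at h
  set g' : Matrix (Fin 3) (Fin 3) (MvPolynomial ((Fin 3 × Fin 3) ⊕ Fin 10) ℚ) :=
      Matrix.of fun i j => X (Sum.inl (i, j))
  set c' : Fin 10 → (MvPolynomial ((Fin 3 × Fin 3) ⊕ Fin 10) ℚ) := fun k => X (Sum.inr k)
  let φ : MvPolynomial ((Fin 3 × Fin 3) ⊕ Fin 10) ℚ →ₐ[ℚ] A :=
    aeval (Sum.elim (fun p => g p.1 p.2) c)
  have hφg : g'.map φ = g := by ext i j; simp [g', φ]
  have hφc : (fun k => φ (c' k)) = c := by funext k; simp [c', φ]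
  have hφd : φ g'.det = g.det := by
    have h1 : φ g'.det = (g'.map φ).det := AlgHom.map_det φ g'
    rw [h1, hφg]
  have hφa : (fun k => φ (act g' c' k)) = act g c := by
    have h1 : (fun k => φ (act g' c' k)) = act (g'.map φ) (fun k => φ (c' k)) :=
      act_map (φ : _ →+* A) g' c'
    rw [h1, hφg, hφc]
  have h1 := congrArg φ h.1
  have h2 := congrArg φ h.2
  rw [map_mul, map_pow, hφd, aeval_map', aeval_map', hφa, hφc] at h1 h2
  exact ⟨h1, h2⟩

theorem inv_W (hPQ : IsInvariantPair ℚ P Q) {A : Type*} [CommRing A] [Algebra ℚ A] (a b : A) :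
    aeval (wcoeffs a b) P = -3 * a ∧ aeval (wcoeffs a b) Q = -27 * b := by
  let w : Fin 10 → MvPolynomial (Fin 2) ℚ := wcoeffs (X 0) (X 1)
  have key : aeval w P = -3 * X 0 ∧ aeval w Q = -27 * X 1 := by
    constructor <;>
    · apply MvPolynomial.funext
      intro x
      have h0 : ∀ R' : MvPolynomial (Fin 10) ℚ, eval x (aeval w R') = aeval (wcoeffs (x 0) (x 1)) R' := by
        intro R'
        have := aeval_map' (aeval x : MvPolynomial (Fin 2) ℚ →ₐ[ℚ] ℚ) w R'
        rw [← coe_aeval_eq_eval]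
        refine this.trans ?_
        congr 2
        have := wcoeffs_map ((aeval x : MvPolynomial (Fin 2) ℚ →ₐ[ℚ] ℚ) : MvPolynomial (Fin 2) ℚ →+* ℚ) (X 0) (X 1)
        simpa using this
      rw [h0]
      first
      | rw [(hPQ.2.2.2 _ _).1]; simp
      | rw [(hPQ.2.2.2 _ _).2]; simp
  let ψ : MvPolynomial (Fin 2) ℚ →ₐ[ℚ] A := aeval ![a, b]
  have hw : (fun k => ψ (w k)) = wcoeffs a b := by
    have := wcoeffs_map (ψ : MvPolynomial (Fin 2) ℚ →+* A) (X 0) (X 1)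
    simpa [ψ] using this
  constructor
  · rw [← hw, ← aeval_map', key.1]; simp [ψ]
  · rw [← hw, ← aeval_map', key.2]; simp [ψ]

end Sonec

open MvPolynomial
set_option linter.all false

/-- what is used about the invariants, over the reals -/
structure InvPair (I J : (Fin 10 → ℝ) → ℝ) : Prop where
  contI : Continuous I
  contJ : Continuous J
  actI : ∀ (g : Matrix (Fin 3) (Fin 3) ℝ) c, I (act g c) = g.det ^ 4 * I c
  actJ : ∀ (g : Matrix (Fin 3) (Fin 3) ℝ) c, J (act g c) = g.det ^ 6 * J c
  wI : ∀ a b, I (wcoeffs a b) = -3 * a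
  wJ : ∀ a b, J (wcoeffs a b) = -27 * b
  sing : ∀ c : Fin 10 → ℝ, c 0 = 0 → c 3 = 0 → c 4 = 0 → 4 * I c ^ 3 - J c ^ 2 = 0

section Soned
variable {P Q : MvPolynomial (Fin 10) ℚ}

theorem act_diag {R : Type*} [CommRing R] (d : Fin 3 → R) (c : Fin 10 → R) :
    act (Matrix.diagonal d) c = ![d 0 ^ 3 * c 0, d 1 ^ 3 * c 1, d 2 ^ 3 * c 2,
      d 0 ^ 2 * d 1 * c 3, d 0 ^ 2 * d 2 * c 4, d 0 * d 1 ^ 2 * c 5, d 1 ^ 2 * d 2 * c 6,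
      d 0 * d 2 ^ 2 * c 7, d 1 * d 2 ^ 2 * c 8, d 0 * d 1 * d 2 * c 9] := by
  funext k
  fin_cases k <;> simp [act, fe, fd, fg, ft] <;> ring

theorem cont_fn10 {f : ℝ → Fin 10 → ℝ} (h : ∀ k, Continuous fun t => f t k) : Continuous f :=
  continuous_pi h

/-- limits along torus -/
theorem limit_const {F : (Fin 10 → ℝ) → ℝ} (hF : Continuous F) (f : ℝ → Fin 10 → ℝ)
    (hf : Continuous f) (r : ℝ) (h : ∀ t, t ≠ 0 → F (f t) = r) : F (f 0) = r := by
  have h1 : Continuous (fun t => F (f t)) := hF.comp hf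
  have : (fun t => F (f t)) = fun _ => r :=
    Continuous.ext_on (dense_compl_singleton (0 : ℝ)) h1 continuous_const (fun t ht => h t ht)
  exact congrFun this 0

theorem TL {F : (Fin 10 → ℝ) → ℝ} (hF : Continuous F)
    (hinv : ∀ (g : Matrix (Fin 3) (Fin 3) ℝ) c, g.det = 1 → F (act g c) = F c)
    (c : Fin 10 → ℝ) (h0 : c 0 = 0) (h3 : c 3 = 0) (h4 : c 4 = 0) :
    F c = F ![0,0,0,0,0,c 5,0,c 7,0,c 9] := by
  have := limit_const hF (fun t : ℝ => ![0, t ^ 3 * c 1, t ^ 3 * c 2, 0, 0, c 5, t ^ 3 * c 6, c 7,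
    t ^ 3 * c 8, c 9]) (by
      apply continuous_pi; intro k; fin_cases k <;> simp <;> fun_prop) (F c) (by
      intro t ht
      rw [← hinv (Matrix.diagonal ![t⁻¹ ^ 2, t, t]) c (by
        simp [Matrix.det_diagonal, Fin.prod_univ_three]; field_simp), act_diag]
      congr 1
      funext k
      fin_cases k <;> simp [h0, h3, h4] <;> field_simp <;> simp)
  rw [← this]
  simp

theorem fsplit (α β γ : ℂ) : ∃ h : Matrix (Fin 3) (Fin 3) ℂ,
    act h ![0,0,0,0,0,-1,0,3,0,0] = ![0,0,0,0,0,α,0,γ,0,β] := by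
  -- x (3 z'^2 - y'^2), y' = p y + q z, z' = r y + s z
  have key : ∃ p q r s : ℂ, 3 * r ^ 2 - p ^ 2 = α ∧ 6 * r * s - 2 * p * q = β ∧
      3 * s ^ 2 - q ^ 2 = γ := by
    obtain ⟨w, hw⟩ := IsAlgClosed.exists_pow_nat_eq (3 : ℂ) (n := 2) (by norm_num)
    have hw0 : w ≠ 0 := by rintro rfl; norm_num at hw
    by_cases ha : α = 0
    · refine ⟨-β / 2, (1 - γ) / 2, β / (2 * w), (1 + γ) / (2 * w), ?_, ?_, ?_⟩
      · field_simp; rw [hw, ha]; ring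
      · field_simp; rw [hw]; ring
      · field_simp; rw [hw]; ring
    · obtain ⟨u, hu⟩ := IsAlgClosed.exists_pow_nat_eq α (n := 2) (by norm_num)
      have hu0 : u ≠ 0 := by rintro rfl; apply ha; rw [← hu]; norm_num
      obtain ⟨v, hv⟩ := IsAlgClosed.exists_pow_nat_eq (-(γ - β ^ 2 / (4 * α))) (n := 2) (by norm_num)
      refine ⟨0, v, u / w, β / (2 * u * w), ?_, ?_, ?_⟩
      · field_simp; rw [hw, hu]; ring
      · field_simp; rw [hw]; ring
      · rw [hv]; field_simp; rw [hw, hu]; ring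
  obtain ⟨p, q, r, s, h1, h2, h3⟩ := key
  refine ⟨!![1,0,0;0,p,r;0,q,s], ?_⟩
  funext k
  fin_cases k <;> simp [act, fe, fd, fg, ft]
  · linear_combination h1
  · linear_combination h3
  · linear_combination h2

theorem aeval_cast (P : MvPolynomial (Fin 10) ℚ) (c : Fin 10 → ℝ) :
    ((aeval c P : ℝ) : ℂ) = aeval (fun k => (c k : ℂ)) P := by
  have := aeval_map' ((Algebra.ofId ℝ ℂ).restrictScalars ℚ) c P
  exact this

theorem invPair (hPQ : IsInvariantPair ℚ P Q) :
    InvPair (fun c => aeval c P) (fun c => aeval c Q) := by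
  have cont : ∀ P : MvPolynomial (Fin 10) ℚ, Continuous (fun c : Fin 10 → ℝ => (aeval c P : ℝ)) := by
    intro P
    have := (MvPolynomial.map (algebraMap ℚ ℝ) P).continuous_eval
    simpa [MvPolynomial.eval_map, MvPolynomial.aeval_def] using this
  refine ⟨cont P, cont Q, fun g c => (inv_act hPQ g c).1, fun g c => (inv_act hPQ g c).2,
    fun a b => (inv_W hPQ a b).1, fun a b => (inv_W hPQ a b).2, ?_⟩
  set F : (Fin 10 → ℝ) → ℝ := fun c => 4 * (aeval c P) ^ 3 - (aeval c Q) ^ 2 with hFd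
  have hF : Continuous F := by
    have h1 := cont P; have h2 := cont Q
    fun_prop
  have hinv : ∀ (g : Matrix (Fin 3) (Fin 3) ℝ) c, g.det = 1 → F (act g c) = F c := by
    intro g c hg
    simp only [hFd, (inv_act hPQ g c).1, (inv_act hPQ g c).2, hg]; ring
  have nod : F ![0,0,0,0,0,-1,0,3,0,0] = 0 := by
    have e1 : F (wcoeffs (-3) 2) = 0 := by
      simp only [hFd, (inv_W hPQ _ _).1, (inv_W hPQ _ _).2]; norm_num
    rw [← hinv (!![1,0,1;0,1,0;0,0,1]) _ (by simp [Matrix.det_fin_three])] at e1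
    have e2 : act (!![1,0,1;0,1,0;0,0,1]) (wcoeffs (-3) 2 : Fin 10 → ℝ) = ![0,0,2,0,0,-1,-1,3,0,0] := by
      funext k
      fin_cases k <;> simp [act, fe, fd, fg, ft, wcoeffs] <;> norm_num
    rw [e2, TL hF hinv _ (by simp) (by simp) (by simp)] at e1
    simpa using e1
  intro c h0 h3 h4
  show F c = 0
  rw [TL hF hinv c h0 h3 h4]
  obtain ⟨h, hh⟩ := fsplit (c 5) (c 9) (c 7)
  have hc : ∀ c : Fin 10 → ℝ, ((F c : ℝ) : ℂ) = 4 * (aeval (fun k => (c k : ℂ)) P) ^ 3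
      - (aeval (fun k => (c k : ℂ)) Q) ^ 2 := by
    intro c
    simp only [hFd]; push_cast; rw [aeval_cast, aeval_cast]
  have n1 := hc ![0,0,0,0,0,-1,0,3,0,0]
  rw [nod] at n1
  have v1 : (fun k => (((![0,0,0,0,0,-1,0,3,0,0] : Fin 10 → ℝ) k : ℝ) : ℂ)) = ![0,0,0,0,0,-1,0,3,0,0] := by
    funext k; fin_cases k <;> simp
  have v2 : (fun k => (((![0,0,0,0,0,c 5,0,c 7,0,c 9] : Fin 10 → ℝ) k : ℝ) : ℂ))
      = ![0,0,0,0,0,(c 5 : ℂ),0,(c 7 : ℂ),0,(c 9 : ℂ)] := by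
    funext k; fin_cases k <;> simp
  rw [v1] at n1
  apply Complex.ofReal_injective
  rw [hc, v2, ← hh, (inv_act hPQ _ _).1, (inv_act hPQ _ _).2]
  push_cast at n1 ⊢
  linear_combination -(h.det ^ 12) * n1

end Soned

theorem InvPair.red {I J : (Fin 10 → ℝ) → ℝ} (h : InvPair I J) (c : Fin 10 → ℝ) (h0 : c 0 = 0) (h1 : c 1 = 0) (h3 : c 3 = 0) (h5 : c 5 = 0) :
    4 * I c ^ 3 - J c ^ 2 = 0 := by
  have hF : Continuous (fun c => 4 * I c ^ 3 - J c ^ 2) := by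
    have h1 := h.contI; have h2 := h.contJ
    fun_prop
  have := limit_const hF (fun t : ℝ => ![0, 0, t ^ 6 * c 2, 0, c 4, 0, c 6, t ^ 3 * c 7,
    t ^ 3 * c 8, c 9]) (by
      apply continuous_pi; intro k; fin_cases k <;> simp <;> fun_prop) (4 * I c ^ 3 - J c ^ 2) (by
      intro t ht
      have hd : (Matrix.diagonal ![t⁻¹, t⁻¹, t ^ 2]).det = 1 := by
        simp [Matrix.det_diagonal, Fin.prod_univ_three]; field_simp
      have e1 := h.actI (Matrix.diagonal ![t⁻¹, t⁻¹, t ^ 2]) c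
      have e2 := h.actJ (Matrix.diagonal ![t⁻¹, t⁻¹, t ^ 2]) c
      rw [hd, one_pow, one_mul] at e1 e2
      rw [← e1, ← e2, act_diag]
      have : (![0, 0, t ^ 6 * c 2, 0, c 4, 0, c 6, t ^ 3 * c 7, t ^ 3 * c 8, c 9] : Fin 10 → ℝ) =
       ![(![t⁻¹, t⁻¹, t ^ 2] : Fin 3 → ℝ) 0 ^ 3 * c 0, (![t⁻¹, t⁻¹, t ^ 2] : Fin 3 → ℝ) 1 ^ 3 * c 1, (![t⁻¹, t⁻¹, t ^ 2] : Fin 3 → ℝ) 2 ^ 3 * c 2,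
      (![t⁻¹, t⁻¹, t ^ 2] : Fin 3 → ℝ) 0 ^ 2 * (![t⁻¹, t⁻¹, t ^ 2] : Fin 3 → ℝ) 1 * c 3, (![t⁻¹, t⁻¹, t ^ 2] : Fin 3 → ℝ) 0 ^ 2 * (![t⁻¹, t⁻¹, t ^ 2] : Fin 3 → ℝ) 2 * c 4, (![t⁻¹, t⁻¹, t ^ 2] : Fin 3 → ℝ) 0 * (![t⁻¹, t⁻¹, t ^ 2] : Fin 3 → ℝ) 1 ^ 2 * c 5, (![t⁻¹, t⁻¹, t ^ 2] : Fin 3 → ℝ) 1 ^ 2 * (![t⁻¹, t⁻¹, t ^ 2] : Fin 3 → ℝ) 2 * c 6,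
      (![t⁻¹, t⁻¹, t ^ 2] : Fin 3 → ℝ) 0 * (![t⁻¹, t⁻¹, t ^ 2] : Fin 3 → ℝ) 2 ^ 2 * c 7, (![t⁻¹, t⁻¹, t ^ 2] : Fin 3 → ℝ) 1 * (![t⁻¹, t⁻¹, t ^ 2] : Fin 3 → ℝ) 2 ^ 2 * c 8, (![t⁻¹, t⁻¹, t ^ 2] : Fin 3 → ℝ) 0 * (![t⁻¹, t⁻¹, t ^ 2] : Fin 3 → ℝ) 1 * (![t⁻¹, t⁻¹, t ^ 2] : Fin 3 → ℝ) 2 * c 9] := by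
        funext k
        fin_cases k <;> simp [h0, h1, h3, h5] <;> field_simp <;> simp
      rw [this])
  rw [← this]
  -- permute: (x,y,z) -> node
  have e1 := h.actI !![0,0,1;1,0,0;0,1,0] ![0, 0, 0 ^ 6 * c 2, 0, c 4, 0, c 6, 0 ^ 3 * c 7, 0 ^ 3 * c 8, c 9]
  have e2 := h.actJ !![0,0,1;1,0,0;0,1,0] ![0, 0, 0 ^ 6 * c 2, 0, c 4, 0, c 6, 0 ^ 3 * c 7, 0 ^ 3 * c 8, c 9]
  have hd : Matrix.det (!![0,0,1;1,0,0;0,1,0] : Matrix (Fin 3) (Fin 3) ℝ) = 1 := by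
    simp [Matrix.det_fin_three]
  rw [hd, one_pow, one_mul] at e1 e2
  rw [← e1, ← e2]
  apply h.sing <;> simp [act, fe, fd, fg, ft]

open MvPolynomial
set_option linter.all false

theorem odd_root (p : Polynomial ℝ) (hp : Odd p.natDegree) : ∃ x, p.eval x = 0 := by
  have main : ∀ p : Polynomial ℝ, Odd p.natDegree → 0 < p.leadingCoeff → ∃ x, p.eval x = 0 := by
    intro p hp hl
    have hd : 0 < p.degree := Polynomial.natDegree_pos_iff_degree_pos.1 hp.pos
    have h1 := p.tendsto_atTop_of_leadingCoeff_nonneg hd hl.le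
    have hq : (p.comp (-Polynomial.X)).natDegree = p.natDegree := by
      rw [Polynomial.natDegree_comp]; simp
    have hq2 : (p.comp (-Polynomial.X)).leadingCoeff ≤ 0 := by
      rw [Polynomial.leadingCoeff_comp (by simp)]
      simp [hp.neg_one_pow]; exact hl.le
    have hd2 : 0 < (p.comp (-Polynomial.X)).degree :=
      Polynomial.natDegree_pos_iff_degree_pos.1 (by rw [hq]; exact hp.pos)
    have h2 := (p.comp (-Polynomial.X)).tendsto_atBot_of_leadingCoeff_nonpos hd2 hq2
    obtain ⟨a, ha⟩ := (h1.eventually_ge_atTop 0).exists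
    obtain ⟨b, hb⟩ := (h2.eventually_le_atBot 0).exists
    have := mem_range_of_exists_le_of_exists_ge p.continuous
      ⟨-b, (by simpa using hb : p.eval (-b) ≤ 0)⟩ ⟨a, ha⟩
    exact this
  have h0 : p ≠ 0 := by rintro rfl; simp at hp
  rcases lt_or_gt_of_ne (Polynomial.leadingCoeff_ne_zero.2 h0) with h | h
  · obtain ⟨x, hx⟩ := main (-p) (by simpa using hp) (by simpa using h)
    exact ⟨x, by simpa using hx⟩
  · exact main p hp h

section
theorem cubic_root (a b c d : ℝ) (ha : a ≠ 0) : ∃ t : ℝ, a * t ^ 3 + b * t ^ 2 + c * t + d = 0 := by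
  have hd : (Polynomial.C a * Polynomial.X ^ 3 + Polynomial.C b * Polynomial.X ^ 2 + Polynomial.C c * Polynomial.X + Polynomial.C d : Polynomial ℝ).natDegree = 3 := by
    compute_degree!
  obtain ⟨x, hx⟩ := odd_root (Polynomial.C a * Polynomial.X ^ 3 + Polynomial.C b * Polynomial.X ^ 2 + Polynomial.C c * Polynomial.X + Polynomial.C d) (by rw [hd]; decide)
  exact ⟨x, by simpa using hx⟩

theorem nonic_root (b a8 a7 a6 a5 a4 a3 a2 a1 a0 : ℝ) (hb : b ≠ 0) : ∃ y : ℝ,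
    b * y ^ 9 + a8 * y ^ 8 + a7 * y ^ 7 + a6 * y ^ 6 + a5 * y ^ 5 + a4 * y ^ 4 + a3 * y ^ 3
      + a2 * y ^ 2 + a1 * y + a0 = 0 := by
  have hd : (Polynomial.C b * Polynomial.X ^ 9 + Polynomial.C a8 * Polynomial.X ^ 8 + Polynomial.C a7 * Polynomial.X ^ 7 + Polynomial.C a6 * Polynomial.X ^ 6 + Polynomial.C a5 * Polynomial.X ^ 5 + Polynomial.C a4 * Polynomial.X ^ 4
    + Polynomial.C a3 * Polynomial.X ^ 3 + Polynomial.C a2 * Polynomial.X ^ 2 + Polynomial.C a1 * Polynomial.X + Polynomial.C a0 : Polynomial ℝ).natDegree = 9 := by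
    compute_degree!
  obtain ⟨x, hx⟩ := odd_root _ (by rw [hd]; decide)
  exact ⟨x, by simpa using hx⟩
end

/-- existence of a flex -/
def Flex (c : Fin 10 → ℝ) : Prop := ∃ g : Matrix (Fin 3) (Fin 3) ℝ, g.det ≠ 0 ∧
  (act g c) 1 = 0 ∧ (act g c) 3 = 0 ∧ (act g c) 5 = 0

theorem Flex.of_act {g : Matrix (Fin 3) (Fin 3) ℝ} {c : Fin 10 → ℝ} (hg : g.det ≠ 0)
    (h : Flex (act g c)) : Flex c := by
  obtain ⟨k, hk, h1, h2, h3⟩ := h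
  refine ⟨k * g, by rw [Matrix.det_mul]; exact mul_ne_zero hk hg, ?_, ?_, ?_⟩ <;>
  rw [act_mul] <;> assumption

/-- discriminant up to a factor -/
def Dsc (I J : (Fin 10 → ℝ) → ℝ) (c : Fin 10 → ℝ) : ℝ := 4 * I c ^ 3 - J c ^ 2

section
variable {I J : (Fin 10 → ℝ) → ℝ}

theorem Dsc_act (h : InvPair I J) (g : Matrix (Fin 3) (Fin 3) ℝ) (c) :
    Dsc I J (act g c) = g.det ^ 12 * Dsc I J c := by
  unfold Dsc; rw [h.actI, h.actJ]; ring

theorem Dsc_act_ne (h : InvPair I J) {g : Matrix (Fin 3) (Fin 3) ℝ} {c} (hg : g.det ≠ 0)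
    (hc : Dsc I J c ≠ 0) : Dsc I J (act g c) ≠ 0 := by
  rw [Dsc_act h]; exact mul_ne_zero (pow_ne_zero _ hg) hc

theorem flex3 (h : InvPair I J) (c : Fin 10 → ℝ) (hc : Dsc I J c ≠ 0) (h0 : c 0 = 0) (h1 : c 1 = 0)
    (h3 : c 3 = 0) (h4 : c 4 = 1) (h5 : c 5 = 1) (h7 : c 7 = 0) (h9 : c 9 = 0) : Flex c := by
  by_cases h8 : c 8 = 0
  · refine ⟨!![-c 6,0,1;0,1,0;1,0,0], by simp [Matrix.det_fin_three], ?_, ?_, ?_⟩ <;>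
    simp [act, fe, fd, fg, h0, h1, h3, h4, h5, h7, h9, h8]
  -- D = y^4 + a y^2 + b y + e
  obtain ⟨a, ha⟩ : ∃ a, a = -4 * c 6 := ⟨_, rfl⟩
  obtain ⟨b, hb⟩ : ∃ b, b = -4 * c 8 := ⟨_, rfl⟩
  obtain ⟨e, he⟩ : ∃ e, e = -4 * c 2 := ⟨_, rfl⟩
  have hb0 : b ≠ 0 := by rw [hb]; simpa using h8
  obtain ⟨y, hy⟩ : ∃ y : ℝ, (8 * y ^ 6 + 12 * a * y ^ 4 + 16 * b * y ^ 3 + 24 * e * y ^ 2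
     + (4 * a * e - b ^ 2)) ^ 2 = 64 * (y ^ 4 + a * y ^ 2 + b * y + e) ^ 3 := by
    obtain ⟨y, hy⟩ := nonic_root (64 * b) (144 * a ^ 2 + 384 * e - 64 * (3 * e + 3 * a ^ 2))
      (384 * a * b - 64 * (6 * a * b))
      (256 * b ^ 2 + 576 * a * e + 16 * (4 * a * e - b ^ 2) - 64 * (a ^ 3 + 6 * a * e + 3 * b ^ 2))
      (768 * b * e - 64 * (3 * a ^ 2 * b + 6 * b * e))
      (576 * e ^ 2 + 24 * a * (4 * a * e - b ^ 2) - 64 * (3 * a ^ 2 * e + 3 * a * b ^ 2 + 3 * e ^ 2))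
      (32 * b * (4 * a * e - b ^ 2) - 64 * (b ^ 3 + 6 * a * b * e))
      (48 * e * (4 * a * e - b ^ 2) - 64 * (3 * a * e ^ 2 + 3 * b ^ 2 * e))
      (- 64 * (3 * b * e ^ 2)) ((4 * a * e - b ^ 2) ^ 2 - 64 * e ^ 3) (by simpa using hb0)
    exact ⟨y, by linear_combination hy⟩
  obtain ⟨N, hN⟩ : ∃ N, N = 8 * y ^ 6 + 12 * a * y ^ 4 + 16 * b * y ^ 3 + 24 * e * y ^ 2
     + (4 * a * e - b ^ 2) := ⟨_, rfl⟩
  obtain ⟨D, hD⟩ : ∃ D, D = y ^ 4 + a * y ^ 2 + b * y + e := ⟨_, rfl⟩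
  rw [← hN, ← hD] at hy
  have hND : N = 2 * D * (12 * y ^ 2 + 2 * a) - (4 * y ^ 3 + 2 * a * y + b) ^ 2 := by
    rw [hN, hD]; ring
  have hD0 : 0 ≤ D := by
    by_contra hneg
    push Not at hneg
    have : D ^ 3 < 0 := by
      have := Odd.pow_neg (n := 3) (by decide) hneg
      exact this
    nlinarith [sq_nonneg N]
  rcases hD0.eq_or_lt with hz | hpos
  · exfalso
    have hN0 : N = 0 := by rw [← hz] at hy; simpa using hy
    have hD' : 4 * y ^ 3 + 2 * a * y + b = 0 := by
      have : (4 * y ^ 3 + 2 * a * y + b) ^ 2 = 0 := by rw [hN0, ← hz] at hND; linarith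
      simpa using this
    have hdet : Matrix.det (!![-y ^ 2 / 2, y, 1; 1, 0, 0; 0, 1, 0] : Matrix (Fin 3) (Fin 3) ℝ) ≠ 0 := by
      simp [Matrix.det_fin_three]
    apply Dsc_act_ne h hdet hc
    apply h.sing
    · simp [act, fe, h0, h1, h3, h4, h5, h7, h9]
      linear_combination (-hz - hD) * (-1/4) + (y^2/4) * ha + y/4 * hb + he/4
    · simp [act, fd, fg, h0, h1, h3, h4, h5, h7, h9]; ring
    · simp [act, fd, fg, h0, h1, h3, h4, h5, h7, h9]
      linear_combination -1/4 * hD' + y/2 * ha + 1/4 * hb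
  · obtain ⟨s, hs, hsN⟩ : ∃ s : ℝ, s ^ 2 = D ∧ N = 8 * s ^ 3 := by
      have hq := Real.sq_sqrt hD0
      have : (N - 8 * (√D) ^ 3) * (N + 8 * (√D) ^ 3) = 0 := by
        have h6 : ((√D) ^ 3) ^ 2 = D ^ 3 := by rw [← pow_mul, mul_comm, pow_mul, hq]
        linear_combination hy - 64 * h6
      rcases mul_eq_zero.1 this with h' | h'
      · exact ⟨√D, hq, by linarith⟩
      · exact ⟨-√D, by rw [neg_sq]; exact hq, by rw [Odd.neg_pow (by decide)]; linarith⟩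
    have hs0 : s ≠ 0 := by rintro rfl; rw [← hs] at hpos; simp at hpos
    obtain ⟨m, hm⟩ : ∃ m, m = ((4 * y ^ 3 + 2 * a * y + b) / (2 * s) - 2 * y) / 2 := ⟨_, rfl⟩
    have hm2 : 4 * s * m = (4 * y ^ 3 + 2 * a * y + b) - 4 * y * s := by
      rw [hm]; field_simp; ring
    refine ⟨!![m, 1, 0; (s - y ^ 2) / 2, y, 1; 1, 0, 0], by simp [Matrix.det_fin_three], ?_, ?_, ?_⟩
    · simp [act, fe, h0, h1, h3, h4, h5, h7, h9]
      linear_combination 1/4 * hs + 1/4 * hD + (y^2/4) * ha + y/4 * hb + he/4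
    · simp [act, fd, fg, h0, h1, h3, h4, h5, h7, h9]
      have : s ^ 2 * (m * (m + 2 * y) + (s - y ^ 2) / 2 + c 6) = 0 := by
        have e1 : c 6 = - a / 4 := by linarith
        rw [e1]
        have e2 : 16 * s ^ 2 * m ^ 2 = ((4 * y ^ 3 + 2 * a * y + b) - 4 * y * s) ^ 2 := by
          rw [← hm2]; ring
        have e3 := hND
        rw [hsN, ← hs] at e3
        linear_combination e2 / 16 + (y * s / 2) * hm2 + e3 / 16
      have h2 := (mul_eq_zero.1 this).resolve_left (pow_ne_zero 2 hs0)
      linear_combination h2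
    · simp [act, fd, fg, h0, h1, h3, h4, h5, h7, h9]
      linear_combination 1/4 * hm2 + y/2 * ha + 1/4 * hb

theorem flex2 (h : InvPair I J) (c : Fin 10 → ℝ) (hc : Dsc I J c ≠ 0) (h0 : c 0 = 0)
    (h3 : c 3 = 0) (h4 : c 4 = 1) (h5 : c 5 = 1) : Flex c := by
  have hg : Matrix.det (!![1,0,0; -c 1,1,0;
     -((c 1 - c 9 / 2) ^ 2 + c 9 * (c 1 - c 9 / 2) + c 7) / 2, c 1 - c 9 / 2, 1] : Matrix (Fin 3) (Fin 3) ℝ) ≠ 0 := by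
    simp [Matrix.det_fin_three]
  apply Flex.of_act hg
  apply flex3 h _ (Dsc_act_ne h hg hc) <;>
  simp [act, fe, fd, fg, ft, h0, h3, h4, h5] <;> ring

theorem flex1 (h : InvPair I J) (c : Fin 10 → ℝ) (hc : Dsc I J c ≠ 0) (h0 : c 0 = 0)
    (h3 : c 3 = 0) : Flex c := by
  have h4 : c 4 ≠ 0 := fun h4 => hc (h.sing c h0 h3 h4)
  by_cases h5 : c 5 = 0
  · refine ⟨!![0,1,0;1,0,0;0,0,1], by simp [Matrix.det_fin_three], ?_, ?_, ?_⟩ <;>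
    simp [act, fe, fd, fg, h0, h3, h5]
  have hg : Matrix.det (Matrix.diagonal ![1 / c 5, 1, c 5 ^ 2 / c 4]) ≠ 0 := by
    simp [Matrix.det_diagonal, Fin.prod_univ_three, h4, h5]
  apply Flex.of_act hg
  apply flex2 h _ (Dsc_act_ne h hg hc) <;>
  simp [act_diag, h0, h3, h4, h5]
  field_simp

theorem flex0 (h : InvPair I J) (c : Fin 10 → ℝ) (hc : Dsc I J c ≠ 0) (h0 : c 0 = 0) : Flex c := by
  have hg : Matrix.det (!![1,0,0; 0, c 4, -c 3; 0, c 3, c 4] : Matrix (Fin 3) (Fin 3) ℝ) ≠ 0 := by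
    simp [Matrix.det_fin_three]
    intro h'
    have h3 : c 3 = 0 := by nlinarith [sq_nonneg (c 3), sq_nonneg (c 4)]
    have h4 : c 4 = 0 := by nlinarith [sq_nonneg (c 3), sq_nonneg (c 4)]
    exact hc (h.sing c h0 h3 h4)
  apply Flex.of_act hg
  apply flex1 h _ (Dsc_act_ne h hg hc) <;>
  simp [act, fe, fd, fg, h0] <;> ring

theorem flex (h : InvPair I J) (c : Fin 10 → ℝ) (hc : Dsc I J c ≠ 0) : Flex c := by
  by_cases h0 : c 0 = 0
  · exact flex0 h c hc h0
  obtain ⟨t, ht⟩ := cubic_root (c 0) (c 3) (c 5) (c 1) h0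
  have hg : Matrix.det (!![t,1,0; 1,0,0;0,0,1] : Matrix (Fin 3) (Fin 3) ℝ) ≠ 0 := by
    simp [Matrix.det_fin_three]
  apply Flex.of_act hg
  apply flex0 h _ (Dsc_act_ne h hg hc)
  simp [act, fe]
  linear_combination ht

theorem cube_root (a : ℝ) (ha : a ≠ 0) : ∃ r : ℝ, r ≠ 0 ∧ r ^ 3 = a := by
  obtain ⟨t, ht⟩ := cubic_root 1 0 0 (-a) one_ne_zero
  refine ⟨t, ?_, by linarith⟩
  rintro rfl
  apply ha; linarith

/-- equivalent to a Weierstrass form -/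
def WN (c : Fin 10 → ℝ) : Prop := ∃ g : Matrix (Fin 3) (Fin 3) ℝ, g.det = 1 ∧ ∃ A B, act g c = wcoeffs A B

theorem WN.of_act {g : Matrix (Fin 3) (Fin 3) ℝ} {c : Fin 10 → ℝ} (hg : g.det = 1)
    (h : WN (act g c)) : WN c := by
  obtain ⟨k, hk, A, B, h1⟩ := h
  exact ⟨k * g, by rw [Matrix.det_mul, hk, hg, one_mul], A, B, by rw [act_mul, h1]⟩

theorem wn3 (c : Fin 10 → ℝ) (h1 : c 1 = 0) (h3 : c 3 = 0) (h5 : c 5 = 0)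
    (h0 : c 0 ≠ 0) (h6 : c 6 ≠ 0) (h9 : c 9 = 0) (h8 : c 8 = 0) (h4 : c 4 = 0) : WN c := by
  obtain ⟨r, hr, hr3⟩ := cube_root _ h0
  refine ⟨Matrix.diagonal ![1 / r, -1 / (r * c 6), - r ^ 2 * c 6], ?_, c 7 * (1 / r) * (- r ^ 2 * c 6) ^ 2,
    c 2 * (- r ^ 2 * c 6) ^ 3, ?_⟩
  · simp [Matrix.det_diagonal, Fin.prod_univ_three]; field_simp
  · rw [act_diag]
    funext k
    fin_cases k <;> simp [wcoeffs, h1, h3, h4, h5, h8, h9]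
    · rw [← hr3]; field_simp
    · ring
    · field_simp
    · ring

theorem wn2 (h : InvPair I J) (c : Fin 10 → ℝ) (hc' : Dsc I J c ≠ 0) (h1 : c 1 = 0) (h3 : c 3 = 0)
    (h5 : c 5 = 0) : WN c := by
  have h0 : c 0 ≠ 0 := fun h0 => hc' (h.red c h0 h1 h3 h5)
  have h6 : c 6 ≠ 0 := fun h6 => by
    have hg : Matrix.det (!![0,1,0;1,0,0;0,0,1] : Matrix (Fin 3) (Fin 3) ℝ) ≠ 0 := by
      simp [Matrix.det_fin_three]
    apply Dsc_act_ne h hg hc'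
    apply h.sing <;> simp [act, fe, fd, fg, h1, h3, h5, h6]
  have hg : Matrix.det (!![1, - c 9 / (2 * c 6), 0; 0, 1, 0; 0, - c 8 / (2 * c 6), 1] : Matrix (Fin 3) (Fin 3) ℝ) = 1 := by
      simp [Matrix.det_fin_three]
  apply WN.of_act hg
  obtain ⟨c', hcd⟩ : ∃ c', c' = act (!![1, - c 9 / (2 * c 6), 0; 0, 1, 0; 0, - c 8 / (2 * c 6), 1]) c := ⟨_, rfl⟩
  have k1 : c' 1 = 0 := by rw [hcd]; simp [act, fe, h1]
  have k3 : c' 3 = 0 := by rw [hcd]; simp [act, fd, fg, h1, h3, h5]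
  have k5 : c' 5 = 0 := by rw [hcd]; simp [act, fd, fg, h1, h3, h5]
  have k0 : c' 0 ≠ 0 := by rw [hcd]; simp [act, fe, h1, h3, h5, h0]
  have k6 : c' 6 ≠ 0 := by rw [hcd]; simp [act, fd, fg, h1, h3, h5, h6]
  have k9 : c' 9 = 0 := by rw [hcd]; simp [act, ft, h1, h3, h5]; field_simp; ring
  have k8 : c' 8 = 0 := by rw [hcd]; simp [act, fd, fg, h1, h3, h5]; field_simp; ring
  rw [← hcd]
  clear hcd hc' h0 h1 h3 h5 h6 hg
  rename' c' => b
  have hg : Matrix.det (!![1, 0, 0; 0, 1, 0; - b 4 / (3 * b 0), 0, 1] : Matrix (Fin 3) (Fin 3) ℝ) = 1 := by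
      simp [Matrix.det_fin_three]
  apply WN.of_act hg
  apply wn3
  · simp [act, fe, k1]
  · simp [act, fd, fg, k1, k3]
  · simp [act, fd, fg, k1, k5]
  · simp [act, fe, k0]
  · simp [act, fd, fg, k1, k5, k6]
  · simp [act, ft, k1, k3, k5, k9]
  · simp [act, fd, fg, k1, k3, k5, k8, k9]
  · simp [act, fd, fg]; field_simp; ring

theorem normal_form (h : InvPair I J) (c : Fin 10 → ℝ) (hc : Dsc I J c ≠ 0) : WN c := by
  obtain ⟨g, hg, h1, h3, h5⟩ := flex h c hc
  -- normalize the determinant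
  obtain ⟨g, hg, h1, h3, h5⟩ : ∃ g : Matrix (Fin 3) (Fin 3) ℝ, g.det = 1 ∧
      (act g c) 1 = 0 ∧ (act g c) 3 = 0 ∧ (act g c) 5 = 0 := by
    refine ⟨Matrix.diagonal ![1, 1, 1 / g.det] * g, ?_, ?_⟩
    · rw [Matrix.det_mul]; simp [Matrix.det_diagonal, Fin.prod_univ_three, hg]
    · rw [act_mul, act_diag]; simp [h1, h3, h5]
  apply WN.of_act hg
  have hc' := Dsc_act_ne h (hg ▸ one_ne_zero) hc
  exact wn2 h _ hc' h1 h3 h5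

end

open MvPolynomial
set_option linter.all false

/-- translation by the 3-torsion point with parameters m, y -/
noncomputable def sg (m y : ℝ) : Matrix (Fin 3) (Fin 3) ℝ :=
  !![1 - m ^ 3 / (6 * y), -m + m * (1 - m ^ 3 / (6 * y)) + (y - m ^ 3 / 3) * (-m / (2 * y)), -m / (2 * y);
    m ^ 2 / (6 * y), -1 + m * (m ^ 2 / (6 * y)) + (y - m ^ 3 / 3) * (1 / (2 * y)), 1 / (2 * y);
    -m ^ 2 / 3 - m ^ 2 / 3 * (y - m ^ 3 / 3) / (2 * y),
    -(y - m ^ 3 / 3) + m * (-m ^ 2 / 3 - m ^ 2 / 3 * (y - m ^ 3 / 3) / (2 * y)) + (y - m ^ 3 / 3) * (-(y - m ^ 3 / 3) / (2 * y)),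
    -(y - m ^ 3 / 3) / (2 * y)]

noncomputable def Amy (m y : ℝ) : ℝ := 2 * m * y - m ^ 4 / 3
noncomputable def Bmy (m y : ℝ) : ℝ := y ^ 2 - 2 / 3 * m ^ 3 * y + 2 / 27 * m ^ 6

theorem disc_my (m y : ℝ) : 4 * Amy m y ^ 3 + 27 * Bmy m y ^ 2 = y ^ 3 * (27 * y - 4 * m ^ 3) := by
  unfold Amy Bmy; ring

theorem det_sg (m y : ℝ) (hy : y ≠ 0) : (sg m y).det = 1 := by
  simp only [sg, Matrix.det_fin_three, Matrix.of_apply, Matrix.cons_val]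
  field_simp; ring

theorem act_sg (m y : ℝ) (hy : y ≠ 0) :
    act (sg m y) (wcoeffs (Amy m y) (Bmy m y)) = wcoeffs (Amy m y) (Bmy m y) := by
  funext k
  fin_cases k <;>
  simp [act, fe, fd, fg, ft, wcoeffs, sg, Amy, Bmy] <;> field_simp <;> ring

theorem sg_ne_one (m y : ℝ) (hy : y ≠ 0) : sg m y ≠ 1 := by
  intro h
  have := congrFun (congrFun h 1) 2
  simp [sg] at this
  exact hy this

theorem sg_ne (m y : ℝ) (hy : y ≠ 0) : sg m y ≠ sg (-m) (-y) := by
  intro h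
  have := congrFun (congrFun h 1) 2
  simp [sg] at this
  have h1 : y⁻¹ = 0 := by linarith
  exact hy (inv_eq_zero.1 h1)

theorem A_neg (m y : ℝ) : Amy (-m) (-y) = Amy m y := by unfold Amy; ring
theorem B_neg (m y : ℝ) : Bmy (-m) (-y) = Bmy m y := by unfold Bmy; ring

theorem stab_fix (A B : ℝ) (g : Matrix (Fin 3) (Fin 3) ℝ) (hd : g.det = 1)
    (hg : act g (wcoeffs A B) = wcoeffs A B) (h2 : g 1 2 = 0) : g = 1 := by
  have e0 := congrFun hg 0
  have e1 := congrFun hg 1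
  have e3 := congrFun hg 3
  have e4 := congrFun hg 4
  have e5 := congrFun hg 5
  have e6 := congrFun hg 6
  have e8 := congrFun hg 8
  have e9 := congrFun hg 9
  simp [act, fe, fd, fg, ft, wcoeffs] at e0 e1 e3 e4 e5 e6 e8 e9
  rw [Matrix.det_fin_three] at hd
  rw [h2] at e1
  have h10 : g 1 0 = 0 := by
    have : g 1 0 ^ 3 = 0 := by linarith
    simpa using this
  rw [h10, h2] at hd e5
  have hp : g 1 1 ≠ 0 := by
    intro h; rw [h] at hd; simp at hd
  have h02 : g 0 2 = 0 := by
    have : g 1 1 ^ 2 * g 0 2 = 0 := by linarith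
    simpa [hp] using this
  rw [h02] at hd e0
  have h00 : g 0 0 = 1 := by
    have : (g 0 0 - 1) * ((g 0 0 + 1/2) ^ 2 + 3/4) = 0 := by linear_combination e0
    rcases mul_eq_zero.1 this with h | h
    · linarith
    · nlinarith [sq_nonneg (g 0 0 + 1/2)]
  rw [h00] at hd
  have hpw : g 1 1 * g 2 2 = 1 := by linarith
  rw [h10, h2] at e6
  have h11 : g 1 1 = 1 := by
    linear_combination -e6 - g 1 1 * hpw
  have h22 : g 2 2 = 1 := by rw [h11] at hpw; linarith
  rw [h10, h2, h02, h11, h22] at e9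
  have h01 : g 0 1 = 0 := by linarith
  rw [h00, h01, h02, h22] at e4
  have h20 : g 2 0 = 0 := by linarith
  rw [h10, h2, h11, h22, h20] at e8
  have h21 : g 2 1 = 0 := by linarith
  ext i j
  fin_cases i <;> fin_cases j <;> simp [h00, h01, h02, h10, h11, h2, h20, h21, h22]

theorem stab_cases (A B : ℝ) (hAB : 4 * A ^ 3 + 27 * B ^ 2 ≠ 0) (g : Matrix (Fin 3) (Fin 3) ℝ)
    (hd : g.det = 1) (hg : act g (wcoeffs A B) = wcoeffs A B) :
    g = 1 ∨ ∃ m y, y ≠ 0 ∧ A = Amy m y ∧ B = Bmy m y ∧ g = sg m y := by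
  by_cases h2 : g 1 2 = 0
  · exact Or.inl (stab_fix A B g hd hg h2)
  right
  have e1 := congrFun hg 1
  have e3 := congrFun hg 3
  have e5 := congrFun hg 5
  simp [act, fe, fd, fg, ft, wcoeffs] at e1 e3 e5
  obtain ⟨x, hx⟩ : ∃ x, x = g 1 0 / g 1 2 := ⟨_, rfl⟩
  obtain ⟨y, hy⟩ : ∃ y, y = g 1 1 / g 1 2 := ⟨_, rfl⟩
  have hx' : g 1 0 = x * g 1 2 := by rw [hx]; field_simp
  have hy' : g 1 1 = y * g 1 2 := by rw [hy]; field_simp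
  obtain ⟨p, hp⟩ : ∃ p, p = g 1 2 := ⟨_, rfl⟩
  rw [← hp] at h2 hx' hy'
  obtain ⟨d0, hd0⟩ : ∃ d, d = g 0 0 - x * g 0 2 := ⟨_, rfl⟩
  obtain ⟨d1, hd1⟩ : ∃ d, d = g 0 1 - y * g 0 2 := ⟨_, rfl⟩
  have g00 : g 0 0 = d0 + x * g 0 2 := by linarith
  have g01 : g 0 1 = d1 + y * g 0 2 := by linarith
  rw [Matrix.det_fin_three] at hd
  rw [hx', hy', ← hp] at e1 e3 e5 hd
  rw [g00, g01] at e3 e5 hd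
  have f1 : x ^ 3 + A * x + B - y ^ 2 = 0 := by
    have : p ^ 3 * (x ^ 3 + A * x + B - y ^ 2) = 0 := by linear_combination e1
    exact (mul_eq_zero.1 this).resolve_left (pow_ne_zero 3 h2)
  have f2 : (3 * x ^ 2 + A) * d0 - 2 * y * d1 = 0 := by
    have : p ^ 2 * ((3 * x ^ 2 + A) * d0 - 2 * y * d1) = 0 := by
      linear_combination e5 - 3 * p ^ 2 * g 0 2 * f1
    exact (mul_eq_zero.1 this).resolve_left (pow_ne_zero 2 h2)
  have f3 : 3 * x * d0 ^ 2 - d1 ^ 2 = 0 := by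
    have : p * (3 * x * d0 ^ 2 - d1 ^ 2) = 0 := by
      linear_combination e3 - 3 * p * g 0 2 ^ 2 * f1 - 2 * p * g 0 2 * f2
    exact (mul_eq_zero.1 this).resolve_left h2
  have hd00 : d0 ≠ 0 := by
    intro h
    rw [h] at f3
    have h1 : d1 = 0 := by
      have : d1 ^ 2 = 0 := by linarith
      simpa using this
    rw [h, h1] at hd
    have : (0 : ℝ) = 1 := by linear_combination hd
    norm_num at this
  obtain ⟨m, hm⟩ : ∃ m, m = d1 / d0 := ⟨_, rfl⟩
  have hm' : d1 = m * d0 := by rw [hm]; field_simp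
  have m1 : 3 * x = m ^ 2 := by
    have : d0 ^ 2 * (3 * x - m ^ 2) = 0 := by rw [hm'] at f3; linear_combination f3
    have := (mul_eq_zero.1 this).resolve_left (pow_ne_zero 2 hd00)
    linarith
  have m2 : 3 * x ^ 2 + A = 2 * m * y := by
    have : d0 * (3 * x ^ 2 + A - 2 * m * y) = 0 := by rw [hm'] at f2; linear_combination f2
    have := (mul_eq_zero.1 this).resolve_left hd00
    linarith
  have x1 : x = m ^ 2 / 3 := by linarith
  have hA : A = Amy m y := by unfold Amy; rw [x1] at m2; linear_combination m2
  have hB : B = Bmy m y := by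
    rw [x1, hA] at f1; unfold Amy at f1; unfold Bmy; linear_combination f1
  have hy0 : y ≠ 0 := by
    rintro rfl
    apply hAB; rw [hA, hB, disc_my]; ring
  obtain ⟨m', hmm⟩ : ∃ m', m = -m' := ⟨-m, by ring⟩
  obtain ⟨y', hyy⟩ : ∃ y', y = -y' := ⟨-y, by ring⟩
  rw [hmm, hyy, A_neg] at hA
  rw [hmm, hyy, B_neg] at hB
  have x1' : x = m' ^ 2 / 3 := by rw [x1, hmm]; ring
  have hy0' : y' ≠ 0 := by rintro rfl; apply hy0; rw [hyy]; ring
  have hy'' : g 1 1 = -y' * p := by rw [hy', hyy]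
  clear x1 hmm
  refine ⟨m', y', hy0', hA, hB, ?_⟩
  -- compare with sg
  have hds := det_sg m' y' hy0'
  have hu : IsUnit (sg m' y').det := by rw [hds]; exact isUnit_one
  have hfix : act (g * (sg m' y')⁻¹) (wcoeffs A B) = wcoeffs A B := by
    have h1 : act (sg m' y')⁻¹ (wcoeffs A B) = wcoeffs A B := by
      conv_lhs => rw [hA, hB, ← act_sg m' y' hy0']
      rw [← act_mul, Matrix.nonsing_inv_mul _ hu, act_one, hA, hB]
    rw [act_mul, h1, hg]
  have hdd : (g * (sg m' y')⁻¹).det = 1 := by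
    rw [Matrix.det_mul, Matrix.det_nonsing_inv, hds, Matrix.det_fin_three, hx', hy', ← hp, g00, g01]
    simp; linarith
  have hrow : (g * (sg m' y')⁻¹) 1 2 = 0 := by
    have hr : g 1 = (2 * y' * p) • (sg m' y') 1 := by
      funext j
      fin_cases j
      · simp [sg, hx', x1']; field_simp
        ring
      · simp [sg, hy'']; field_simp; ring
      · simp [sg, ← hp]; field_simp
    have : (g * (sg m' y')⁻¹) 1 2 = (2 * y' * p) * ((sg m' y') * (sg m' y')⁻¹) 1 2 := by
      simp only [Matrix.mul_apply, hr, Pi.smul_apply, smul_eq_mul, Finset.mul_sum, mul_assoc]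
    rw [this, Matrix.mul_nonsing_inv _ hu]; simp
  have := stab_fix A B _ hdd hfix hrow
  calc g = g * (sg m' y')⁻¹ * sg m' y' := by rw [Matrix.mul_assoc, Matrix.nonsing_inv_mul _ hu, Matrix.mul_one]
    _ = sg m' y' := by rw [this, Matrix.one_mul]

theorem exists_my (A B : ℝ) (hAB : 4 * A ^ 3 + 27 * B ^ 2 ≠ 0) :
    ∃ m y, y ≠ 0 ∧ A = Amy m y ∧ B = Bmy m y := by
  -- root of psi_3 with F > 0
  obtain ⟨x, hx, hF⟩ : ∃ x : ℝ, 3 * x ^ 4 + 6 * A * x ^ 2 + 12 * B * x - A ^ 2 = 0 ∧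
      0 < x ^ 3 + A * x + B := by
    by_cases hA : A = 0
    · have hB : B ≠ 0 := by rintro rfl; apply hAB; rw [hA]; norm_num
      rcases lt_or_gt_of_ne hB with h | h
      · obtain ⟨r, hr, hr3⟩ := cube_root (-4 * B) (by simpa using hB)
        exact ⟨r, by rw [hA]; linear_combination 3 * r * hr3, by rw [hA, hr3]; linarith⟩
      · exact ⟨0, by rw [hA]; norm_num, by simpa using h⟩
    · obtain ⟨K, hK⟩ : ∃ K : ℝ, K = 1 + 2 * |A| + 4 * |B| + A ^ 2 := ⟨_, rfl⟩
      have hA0 := abs_nonneg A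
      have hB0 := abs_nonneg B
      have hK1 : 1 ≤ K := by rw [hK]; nlinarith [sq_nonneg A]
      have hcont : Continuous (fun x : ℝ => 3 * x ^ 4 + 6 * A * x ^ 2 + 12 * B * x - A ^ 2) := by
        fun_prop
      have hbig : 0 ≤ 3 * K ^ 4 + 6 * A * K ^ 2 + 12 * B * K - A ^ 2 := by
        have a1 : -(6 * |A|) * K ^ 3 ≤ 6 * A * K ^ 2 := by
          have := neg_abs_le A
          have : K ^ 2 ≤ K ^ 3 := pow_le_pow_right₀ hK1 (by norm_num)
          nlinarith [sq_nonneg K, mul_nonneg hA0 (sub_nonneg.2 this)]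
        have a2 : -(12 * |B|) * K ^ 3 ≤ 12 * B * K := by
          have := neg_abs_le B
          have h3 : K ≤ K ^ 3 := by nlinarith [sq_nonneg K]
          nlinarith [mul_nonneg hB0 (sub_nonneg.2 h3)]
        have a3 : A ^ 2 ≤ 3 * A ^ 2 * K ^ 3 := by
          have h3 : 1 ≤ K ^ 3 := one_le_pow₀ hK1
          nlinarith [sq_nonneg A]
        have a4 : 3 * K ^ 4 = 3 * (1 + 2 * |A| + 4 * |B| + A ^ 2) * K ^ 3 := by rw [← hK]; ring
        have a5 : 0 ≤ K ^ 3 := by positivity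
        nlinarith
      obtain ⟨x, hxm, hx⟩ := intermediate_value_Icc (by linarith : (0:ℝ) ≤ K) hcont.continuousOn
        (show (0 : ℝ) ∈ Set.Icc _ _ from ⟨by simp; positivity, hbig⟩)
      simp only at hx
      have hx0 : 0 < x := by
        rcases hxm.1.eq_or_lt with h | h
        · exfalso; rw [← h] at hx; apply hA
          have : A ^ 2 = 0 := by linarith
          simpa using this
        · exact h
      refine ⟨x, hx, ?_⟩
      have e1 : 12 * x * (x ^ 3 + A * x + B) = (3 * x ^ 2 + A) ^ 2 := by linear_combination hx
      by_contra hneg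
      push Not at hneg
      have e2 : (3 * x ^ 2 + A) ^ 2 = 0 := by nlinarith [sq_nonneg (3 * x ^ 2 + A)]
      have e3 : 3 * x ^ 2 + A = 0 := by simpa using e2
      have e4 : x ^ 3 + A * x + B = 0 := by
        rw [e2] at e1
        have : (12 * x) ≠ 0 := by positivity
        exact (mul_eq_zero.1 e1).resolve_left this
      apply hAB
      have eA : A = -3 * x ^ 2 := by linarith
      have eB : B = 2 * x ^ 3 := by rw [eA] at e4; linarith
      rw [eA, eB]; ring
  have hs := Real.sq_sqrt hF.le
  have hs0 : √(x ^ 3 + A * x + B) ≠ 0 := (Real.sqrt_pos.2 hF).ne'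
  obtain ⟨y, hy⟩ : ∃ y, y = √(x ^ 3 + A * x + B) := ⟨_, rfl⟩
  rw [← hy] at hs hs0
  obtain ⟨m, hm⟩ : ∃ m, m = (3 * x ^ 2 + A) / (2 * y) := ⟨_, rfl⟩
  have hm' : 2 * m * y = 3 * x ^ 2 + A := by rw [hm]; field_simp
  have hm2 : m ^ 2 = 3 * x := by
    have : 4 * y ^ 2 * (m ^ 2 - 3 * x) = 0 := by
      have e1 : (2 * m * y) ^ 2 = (3 * x ^ 2 + A) ^ 2 := by rw [hm']
      linear_combination e1 - 12 * x * hs - hx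
    have := (mul_eq_zero.1 this).resolve_left (by positivity)
    linarith
  have hx3 : x = m ^ 2 / 3 := by linarith
  refine ⟨m, y, hs0, ?_, ?_⟩
  · unfold Amy; rw [hx3] at hm'; linear_combination -hm'
  · have hA : A = 2 * m * y - m ^ 4 / 3 := by rw [hx3] at hm'; linear_combination -hm'
    unfold Bmy; rw [hx3, hA] at hs; linear_combination -hs

theorem unique_my (m y n w : ℝ) (hy : y ≠ 0) (hw : w ≠ 0) (hA : Amy m y = Amy n w)
    (hB : Bmy m y = Bmy n w) : (n = m ∧ w = y) ∨ (n = -m ∧ w = -y) := by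
  obtain ⟨A, hA1⟩ : ∃ A, A = Amy m y := ⟨_, rfl⟩
  obtain ⟨B, hB1⟩ : ∃ B, B = Bmy m y := ⟨_, rfl⟩
  have psi : ∀ m y, A = Amy m y → B = Bmy m y →
      3 * (m ^ 2 / 3) ^ 4 + 6 * A * (m ^ 2 / 3) ^ 2 + 12 * B * (m ^ 2 / 3) - A ^ 2 = 0 := by
    intro m y hA hB; rw [hA, hB]; unfold Amy Bmy; ring
  have FF : ∀ m y, A = Amy m y → B = Bmy m y →
      (m ^ 2 / 3) ^ 3 + A * (m ^ 2 / 3) + B = y ^ 2 := by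
    intro m y hA hB; rw [hA, hB]; unfold Amy Bmy; ring
  have key : ∀ x1 x2 : ℝ, x1 < x2 → 3 * x1 ^ 4 + 6 * A * x1 ^ 2 + 12 * B * x1 - A ^ 2 = 0 →
      3 * x2 ^ 4 + 6 * A * x2 ^ 2 + 12 * B * x2 - A ^ 2 = 0 → 0 < x1 ^ 3 + A * x1 + B →
      0 ≤ x1 → False := by
    intro x1 x2 hlt h1 h2 hF h0
    set f : ℝ → ℝ := fun x => 3 * x ^ 4 + 6 * A * x ^ 2 + 12 * B * x - A ^ 2 with hf
    have hder : ∀ x, HasDerivAt f (12 * (x ^ 3 + A * x + B)) x := by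
      intro x
      have := ((((hasDerivAt_pow 4 x).const_mul 3).add ((hasDerivAt_pow 2 x).const_mul (6 * A))).add
        ((hasDerivAt_id x).const_mul (12 * B))).sub_const (A ^ 2)
      refine this.congr_deriv ?_
      norm_num; ring
    have hcont : Continuous f := by fun_prop
    obtain ⟨c, hc, hmax⟩ := isCompact_Icc.exists_isMaxOn (Set.nonempty_Icc.2 hlt.le) hcont.continuousOn
    -- f increases at x1
    have hpos : 0 < f c := by
      by_contra hneg
      push Not at hneg
      have hloc : ∀ x ∈ Set.Icc x1 x2, f x ≤ 0 := fun x hx => (hmax hx).trans hneg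
      have hF' : ∀ᶠ x in nhds x1, 0 < x ^ 3 + A * x + B := by
        have : Continuous (fun x : ℝ => x ^ 3 + A * x + B) := by fun_prop
        exact this.continuousAt.eventually (lt_mem_nhds hF)
      obtain ⟨ε, hε, hball⟩ := Metric.eventually_nhds_iff.1 hF'
      set z := x1 + min (ε / 2) (x2 - x1) with hz
      have hz1 : x1 < z := by
        have : 0 < min (ε / 2) (x2 - x1) := lt_min (by linarith) (by linarith)
        linarith
      have hz2 : z ≤ x2 := by have := min_le_right (ε / 2) (x2 - x1); linarith
      have hz3 : z ≤ x1 + ε / 2 := by have := min_le_left (ε / 2) (x2 - x1); linarith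
      have hmono : StrictMonoOn f (Set.Icc x1 z) := by
        apply strictMonoOn_of_deriv_pos (convex_Icc _ _) hcont.continuousOn
        intro x hx
        rw [interior_Icc] at hx
        rw [(hder x).deriv]
        have := hball (y := x) (by rw [Real.dist_eq, abs_lt]; constructor <;> linarith [hx.1, hx.2])
        linarith
      have h3 := hmono (Set.left_mem_Icc.2 hz1.le) (Set.right_mem_Icc.2 hz1.le) hz1
      have h4 := hloc z ⟨hz1.le, hz2⟩
      have h5 : f x1 = 0 := h1
      linarith
    have hc1 : c ≠ x1 := by rintro rfl; have : f c = 0 := h1; linarith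
    have hc2 : c ≠ x2 := by rintro rfl; have : f c = 0 := h2; linarith
    have hci : c ∈ Set.Ioo x1 x2 := ⟨lt_of_le_of_ne hc.1 (Ne.symm hc1), lt_of_le_of_ne hc.2 hc2⟩
    have hlm : IsLocalMax f c := hmax.isLocalMax (Icc_mem_nhds hci.1 hci.2)
    have hd0 := hlm.hasDerivAt_eq_zero (hder c)
    have : f c = 12 * c * (c ^ 3 + A * c + B) - (3 * c ^ 2 + A) ^ 2 := by simp only [hf]; ring
    have h6 : c ^ 3 + A * c + B = 0 := by linarith
    rw [h6] at this
    nlinarith [sq_nonneg (3 * c ^ 2 + A)]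
  have hA2 : A = Amy n w := by rw [hA1, hA]
  have hB2 : B = Bmy n w := by rw [hB1, hB]
  have hx : m ^ 2 / 3 = n ^ 2 / 3 := by
    rcases lt_trichotomy (m ^ 2 / 3) (n ^ 2 / 3) with h | h | h
    · exact (key _ _ h (psi m y hA1 hB1) (psi n w hA2 hB2) (by rw [FF m y hA1 hB1]; positivity) (by positivity)).elim
    · exact h
    · exact (key _ _ h (psi n w hA2 hB2) (psi m y hA1 hB1) (by rw [FF n w hA2 hB2]; positivity) (by positivity)).elim
  have hyw : y ^ 2 = w ^ 2 := by
    rw [← FF m y hA1 hB1, ← FF n w hA2 hB2, hx]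
  have hmy : m * y = n * w := by
    have e1 := hA1.symm.trans hA2
    unfold Amy at e1
    have : m ^ 4 = n ^ 4 := by
      have : m ^ 2 = n ^ 2 := by linarith
      calc m ^ 4 = (m ^ 2) ^ 2 := by ring
        _ = (n ^ 2) ^ 2 := by rw [this]
        _ = n ^ 4 := by ring
    linarith
  rcases sq_eq_sq_iff_eq_or_eq_neg.1 hyw with h | h
  · left
    rw [h] at hmy
    exact ⟨(mul_right_cancel₀ hw hmy).symm, h.symm⟩
  · right
    rw [h] at hmy
    refine ⟨?_, by linarith⟩
    have : (-m) * w = n * w := by linarith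
    exact (mul_right_cancel₀ hw this).symm

theorem my_bound (m y : ℝ) (hA : |Amy m y| ≤ 1) (hB : |Bmy m y| ≤ 1) : |m| ≤ 3 ∧ |y| ≤ 6 := by
  obtain ⟨x, hx⟩ : ∃ x, x = m ^ 2 / 3 := ⟨_, rfl⟩
  have hx0 : 0 ≤ x := by rw [hx]; positivity
  have psi : 3 * x ^ 4 + 6 * Amy m y * x ^ 2 + 12 * Bmy m y * x - Amy m y ^ 2 = 0 := by
    rw [hx]; unfold Amy Bmy; ring
  have FF : x ^ 3 + Amy m y * x + Bmy m y = y ^ 2 := by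
    rw [hx]; unfold Amy Bmy; ring
  rw [abs_le] at hA hB
  have hx3 : x ≤ 3 := by
    by_contra h
    push Not at h
    have a1 : Amy m y ^ 2 ≤ 1 := by nlinarith
    have a2 : -6 * x ^ 2 ≤ 6 * Amy m y * x ^ 2 := by nlinarith [sq_nonneg x]
    have a3 : -12 * x ≤ 12 * Bmy m y * x := by nlinarith
    have a4 : 9 * x ^ 2 ≤ x ^ 4 := by nlinarith [sq_nonneg x, mul_nonneg (sq_nonneg x) (by nlinarith : 0 ≤ x ^ 2 - 9)]
    nlinarith
  constructor
  · apply abs_le_of_sq_le_sq _ (by norm_num)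
    nlinarith
  · apply abs_le_of_sq_le_sq _ (by norm_num)
    have : x ^ 3 ≤ 27 := by
      calc x ^ 3 ≤ 3 ^ 3 := pow_le_pow_left₀ hx0 hx3 3
        _ = 27 := by norm_num
    nlinarith

open MvPolynomial
set_option linter.all false

abbrev M3 := Fin 3 → Fin 3 → ℝ
abbrev SLZ := Matrix.SpecialLinearGroup (Fin 3) ℤ

/-- left translation by an integral unimodular matrix -/
noncomputable def lt (γ : SLZ) (h : M3) : M3 :=
  fun i j => ∑ k, ((γ : Matrix (Fin 3) (Fin 3) ℤ) i k : ℝ) * h k j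

noncomputable def dt (h : M3) : ℝ := Matrix.det (Matrix.of h)

noncomputable def dot (v w : Fin 3 → ℝ) : ℝ := v 0 * w 0 + v 1 * w 1 + v 2 * w 2

theorem lt_eq (γ : SLZ) (h : M3) : Matrix.of (lt γ h) =
    (γ : Matrix (Fin 3) (Fin 3) ℤ).map (Int.castRingHom ℝ) * Matrix.of h := by
  ext i j
  simp [lt, Matrix.mul_apply]

theorem dt_lt (γ : SLZ) (h : M3) : dt (lt γ h) = dt h := by
  unfold dt
  rw [lt_eq, Matrix.det_mul]
  have : ((γ : Matrix (Fin 3) (Fin 3) ℤ).map (Int.castRingHom ℝ)).det = 1 := by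
    have := RingHom.map_det (Int.castRingHom ℝ) (γ : Matrix (Fin 3) (Fin 3) ℤ)
    rw [γ.2] at this
    simpa using this.symm
  rw [this, one_mul]

theorem lt_mul (γ δ : SLZ) (h : M3) : lt (γ * δ) h = lt γ (lt δ h) := by
  apply Matrix.of.injective
  rw [lt_eq, lt_eq, lt_eq, ← Matrix.mul_assoc]
  congr 1
  rw [← Matrix.map_mul]; rfl

theorem lt_one (h : M3) : lt 1 h = h := by
  apply Matrix.of.injective
  rw [lt_eq]; simp

theorem dt_eq (h : M3) : dt h = h 0 0 * h 1 1 * h 2 2 - h 0 0 * h 1 2 * h 2 1 - h 0 1 * h 1 0 * h 2 2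
    + h 0 1 * h 1 2 * h 2 0 + h 0 2 * h 1 0 * h 2 1 - h 0 2 * h 1 1 * h 2 0 := by
  unfold dt; rw [Matrix.det_fin_three]; rfl

theorem gram (h : M3) : dt h ^ 2 = dot (h 0) (h 0) * dot (h 1) (h 1) * dot (h 2) (h 2)
    + 2 * dot (h 1) (h 2) * dot (h 0) (h 2) * dot (h 0) (h 1)
    - dot (h 0) (h 0) * dot (h 1) (h 2) ^ 2 - dot (h 1) (h 1) * dot (h 0) (h 2) ^ 2
    - dot (h 2) (h 2) * dot (h 0) (h 1) ^ 2 := by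
  rw [dt_eq]; unfold dot; ring

theorem dot_self_nonneg (v : Fin 3 → ℝ) : 0 ≤ dot v v := by unfold dot; nlinarith [sq_nonneg (v 0), sq_nonneg (v 1), sq_nonneg (v 2)]

/-- integral combinations of rows of bounded norm are finitely many. -/
theorem row_bound (h : M3) (hd : dt h ≠ 0) : ∃ K : ℝ, 0 < K ∧ ∀ z : Fin 3 → ℝ,
    ∀ i, z i ^ 2 ≤ K * dot (fun j => ∑ k, z k * h k j) (fun j => ∑ k, z k * h k j) := by
  -- adjugate formula
  let N : Matrix (Fin 3) (Fin 3) ℝ := (Matrix.of h)⁻¹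
  have hu : IsUnit (Matrix.of h).det := isUnit_iff_ne_zero.2 hd
  have hz : ∀ z : Fin 3 → ℝ, ∀ i, z i = ∑ j, (∑ k, z k * h k j) * N j i := by
    intro z i
    have h1 : Matrix.vecMul (Matrix.vecMul z (Matrix.of h)) N = z := by
      rw [Matrix.vecMul_vecMul, Matrix.mul_nonsing_inv _ hu, Matrix.vecMul_one]
    have := congrFun h1 i
    simp only [Matrix.vecMul, dotProduct, Matrix.of_apply] at this
    exact this.symm
  refine ⟨1 + ∑ i, ∑ j, N j i ^ 2, ?_, ?_⟩
  · have : 0 ≤ ∑ i, ∑ j, N j i ^ 2 := Finset.sum_nonneg fun i _ => Finset.sum_nonneg fun j _ => sq_nonneg _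
    linarith
  intro z i
  rw [hz z i]
  have cs := Finset.sum_mul_sq_le_sq_mul_sq Finset.univ (fun j => ∑ k, z k * h k j) (fun j => N j i)
  have e1 : dot (fun j => ∑ k, z k * h k j) (fun j => ∑ k, z k * h k j) = ∑ j, (∑ k, z k * h k j) ^ 2 := by
    simp only [dot, Fin.sum_univ_three]; ring
  rw [e1]
  have h2 : ∑ j, N j i ^ 2 ≤ ∑ i, ∑ j, N j i ^ 2 :=
    Finset.single_le_sum (f := fun i => ∑ j, N j i ^ 2) (fun i _ => Finset.sum_nonneg fun j _ => sq_nonneg _) (Finset.mem_univ i)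
  have h3 : 0 ≤ ∑ j, (∑ k, z k * h k j) ^ 2 := Finset.sum_nonneg fun j _ => sq_nonneg _
  nlinarith

theorem finite_int_box (K : ℝ) : {z : Fin 3 → ℤ | ∀ i, (z i : ℝ) ^ 2 ≤ K}.Finite := by
  apply Set.Finite.subset (Set.finite_Icc (fun _ : Fin 3 => -⌈|K|⌉) (fun _ => ⌈|K|⌉))
  intro z hz
  have : ∀ i, |z i| ≤ ⌈|K|⌉ := by
    intro i
    have h1 := hz i
    have h2 : ((|z i| : ℤ) : ℝ) ≤ ((z i ^ 2 : ℤ) : ℝ) := by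
      exact_mod_cast (by
        rcases eq_or_ne (z i) 0 with h | h
        · rw [h]; norm_num
        · have : 1 ≤ |z i| := Int.one_le_abs h
          rw [← sq_abs]; nlinarith)
    have : ((|z i| : ℤ) : ℝ) ≤ ⌈|K|⌉ := by
      push_cast at h2 ⊢
      exact h2.trans (h1.trans ((le_abs_self K).trans (Int.le_ceil _)))
    exact_mod_cast this
  exact ⟨fun i => (abs_le.1 (this i)).1, fun i => (abs_le.1 (this i)).2⟩

theorem min_row (h : M3) (hd : dt h ≠ 0) (T : Set SLZ) (hT : T.Nonempty) (i : Fin 3) :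
    ∃ γ ∈ T, ∀ δ ∈ T, dot (lt γ h i) (lt γ h i) ≤ dot (lt δ h i) (lt δ h i) := by
  obtain ⟨γ0, h0⟩ := hT
  obtain ⟨K, hK, hb⟩ := row_bound h hd
  let φ : SLZ → (Fin 3 → ℤ) := fun γ => (γ : Matrix (Fin 3) (Fin 3) ℤ) i
  let q : (Fin 3 → ℤ) → ℝ := fun z => dot (fun j => ∑ k, (z k : ℝ) * h k j) (fun j => ∑ k, (z k : ℝ) * h k j)
  have hq : ∀ γ, dot (lt γ h i) (lt γ h i) = q (φ γ) := fun γ => rfl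
  let S := φ '' T ∩ {z | q z ≤ q (φ γ0)}
  have hfin : S.Finite := by
    apply (finite_int_box (K * q (φ γ0))).subset
    rintro z ⟨_, hz⟩ j
    exact (hb (fun k => (z k : ℝ)) j).trans (mul_le_mul_of_nonneg_left hz hK.le)
  obtain ⟨z, hz, hmin⟩ := Set.exists_min_image S q hfin ⟨φ γ0, ⟨γ0, h0, rfl⟩, le_refl (q (φ γ0))⟩
  obtain ⟨⟨γ, hγ, rfl⟩, hz2⟩ := hz
  refine ⟨γ, hγ, fun δ hδ => ?_⟩
  rw [hq, hq]
  by_cases hle : q (φ δ) ≤ q (φ γ0)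
  · exact hmin _ ⟨⟨δ, hδ, rfl⟩, hle⟩
  · exact hz2.trans (not_le.1 hle).le

/-- the Siegel-type domain -/
def Sie : Set M3 := {h | 0 < dt h ∧ |dot (h 0) (h 1)| ≤ dot (h 0) (h 0) ∧
  |dot (h 0) (h 2)| ≤ dot (h 0) (h 0) ∧ |dot (h 1) (h 2)| ≤ dot (h 1) (h 1) ∧
  dot (h 0) (h 0) ≤ dot (h 1) (h 1) ∧ dot (h 1) (h 1) ≤ dot (h 2) (h 2) ∧
  dot (h 0) (h 0) * dot (h 1) (h 1) * dot (h 2) (h 2) ≤ 4 * dt h ^ 2}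

def el (p q r : ℤ) : SLZ := ⟨!![1, 0, 0; r, 1, 0; p, q, 1], by simp [Matrix.det_fin_three]⟩
def sw01 : SLZ := ⟨!![0, 1, 0; -1, 0, 0; 0, 0, 1], by simp [Matrix.det_fin_three]⟩
def sw12 : SLZ := ⟨!![1, 0, 0; 0, 0, 1; 0, -1, 0], by simp [Matrix.det_fin_three]⟩

set_option maxHeartbeats 1000000 in
theorem gram_main (A B x y z : ℝ) (hA : 0 ≤ A) (hAB : A ≤ B) (hf : 2 * x ≤ B) (hg : 2 * y ≤ A) (hh : 2 * z ≤ A)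
    (hf0 : 0 ≤ x) (hg0 : 0 ≤ y) (hh0 : 0 ≤ z) (hex : 2 * (x + y + z) ≤ A + B) :
    A * B * B ≤ 4 * (A * B * B - 2 * (x * y * z) - A * x ^ 2 - B * y ^ 2 - B * z ^ 2) := by
  have hB : 0 ≤ B := by linarith
  have hyz : 0 ≤ y * z := mul_nonneg hg0 hh0
  have hyz2 : 0 ≤ (A / 2 - y) * (A / 2 - z) := mul_nonneg (by linarith) (by linarith)
  obtain ⟨s, hs⟩ : ∃ s, s = y + z := ⟨_, rfl⟩
  have hs0 : 0 ≤ s := by linarith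
  have hsA : s ≤ A := by linarith
  have hx4 : A * (4 * x ^ 2) ≤ A * (B * B) := mul_le_mul_of_nonneg_left (by nlinarith) hA
  have hBA : B * A ^ 2 ≤ A * (B * B) := by nlinarith [mul_nonneg (mul_nonneg hA hB) (sub_nonneg.2 hAB)]
  suffices hsuf : 4 * B * s ^ 2 - 8 * (y * z) * (B - x) + 4 * A * x ^ 2 ≤ 3 * A * B ^ 2 by
    rw [hs] at hsuf; linarith
  rcases le_or_gt s (A / 2) with hc | hc
  · have : 0 ≤ (y * z) * (B - x) := mul_nonneg hyz (by linarith)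
    have h5 : 4 * s ^ 2 ≤ A ^ 2 := by nlinarith
    have : B * (4 * s ^ 2) ≤ B * A ^ 2 := mul_le_mul_of_nonneg_left h5 hB
    have q5 : 0 ≤ A * B ^ 2 := by positivity
    linarith
  · have hw : (A / 2 * s - A ^ 2 / 4) * (B - x) ≤ (y * z) * (B - x) :=
      mul_le_mul_of_nonneg_right (by rw [hs]; nlinarith) (by linarith)
    rcases le_or_gt x ((B - A) / 2) with hx | hx
    · have q1 : s ^ 2 ≤ 3 * A * s / 2 - A ^ 2 / 2 := by nlinarith
      have q2 : B * s ^ 2 ≤ B * (3 * A * s / 2 - A ^ 2 / 2) := mul_le_mul_of_nonneg_left q1 hB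
      have q3 : s * (2 * A * B + 4 * A * x) ≤ A * (2 * A * B + 4 * A * x) :=
        mul_le_mul_of_nonneg_right hsA (by positivity)
      have q4 : A * (2 * A * B + 2 * A * x + 4 * x ^ 2) ≤ A * (2 * B ^ 2) := by
        apply mul_le_mul_of_nonneg_left _ hA
        have : 0 ≤ ((B - A) / 2 - x) * (2 * A + 4 * x + 2 * (B - A)) := mul_nonneg (by linarith) (by linarith)
        nlinarith
      have q5 : 0 ≤ A * B ^ 2 := by positivity
      linarith
    · obtain ⟨t, ht⟩ : ∃ t, t = (A + B) / 2 - x := ⟨_, rfl⟩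
      have hst : s ≤ t := by linarith
      have htA : t ≤ A := by linarith
      have htA2 : A / 2 ≤ t := by linarith
      have hx' : x = (A + B) / 2 - t := by linarith
      have q1 : s ^ 2 ≤ (A / 2 + t) * s - A * t / 2 := by nlinarith
      have q2 : B * s ^ 2 ≤ B * ((A / 2 + t) * s - A * t / 2) := mul_le_mul_of_nonneg_left q1 hB
      have q3 : s * (4 * B * t - 2 * A * B + 4 * A * x) ≤ t * (4 * B * t - 2 * A * B + 4 * A * x) :=
        mul_le_mul_of_nonneg_right hst (by nlinarith [mul_nonneg hA hf0, mul_nonneg hB (sub_nonneg.2 htA2)])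
      have q4 : 4 * B * t ^ 2 - 2 * (B - A + 2 * t) * A * t + (B - A + 2 * t) * A ^ 2 + A * (A + B - 2 * t) ^ 2
          ≤ 3 * A * B ^ 2 := by
        have q6 : t ^ 2 ≤ 3 * A * t / 2 - A ^ 2 / 2 := by nlinarith
        have q7 : B * t ^ 2 ≤ B * (3 * A * t / 2 - A ^ 2 / 2) := mul_le_mul_of_nonneg_left q6 hB
        have q5 : 0 ≤ A * B ^ 2 := by positivity
        linarith
      rw [hx'] at hw q3 ⊢
      linarith

theorem gram_ineq (A B C f g h : ℝ) (hA : 0 ≤ A) (hAB : A ≤ B) (hBC : B ≤ C) (hf : 2 * |f| ≤ B)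
    (hg : 2 * |g| ≤ A) (hh : 2 * |h| ≤ A)
    (hex : f * g * h < 0 → 2 * (|f| + |g| + |h|) ≤ A + B) :
    A * B * C ≤ 4 * (A * B * C + 2 * f * g * h - A * f ^ 2 - B * g ^ 2 - C * h ^ 2) := by
  have hf0 := abs_nonneg f
  have hg0 := abs_nonneg g
  have hh0 := abs_nonneg h
  have hC : 0 ≤ C := by linarith
  have hB : 0 ≤ B := by linarith
  have f2 : f ^ 2 = |f| ^ 2 := (sq_abs f).symm
  have g2 : g ^ 2 = |g| ^ 2 := (sq_abs g).symm
  have h2 : h ^ 2 = |h| ^ 2 := (sq_abs h).symm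
  have k1 : A * f ^ 2 ≤ A * B * C / 4 := by
    have : 4 * |f| ^ 2 ≤ B * B := by nlinarith
    have : 4 * |f| ^ 2 ≤ B * C := by nlinarith
    rw [f2]; nlinarith
  have k2 : B * g ^ 2 ≤ A * B * C / 4 := by
    have : 4 * |g| ^ 2 ≤ A * A := by nlinarith
    have : 4 * |g| ^ 2 ≤ A * C := by nlinarith
    rw [g2]; nlinarith
  have k3 : C * h ^ 2 ≤ A * B * C / 4 := by
    have : 4 * |h| ^ 2 ≤ A * A := by nlinarith
    have : 4 * |h| ^ 2 ≤ A * B := by nlinarith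
    rw [h2]; nlinarith
  rcases le_or_gt 0 (f * g * h) with hp | hp
  · nlinarith
  · have hex := hex hp
    have e : f * g * h = -(|f| * |g| * |h|) := by
      rw [← abs_mul, ← abs_mul, abs_of_neg hp]; ring
    have e2 : 2 * f * g * h = -(2 * (|f| * |g| * |h|)) := by linarith
    rw [e2, f2, g2, h2]
    rw [f2] at k1; rw [g2] at k2; rw [h2] at k3
    clear e e2 f2 g2 h2 hp
    generalize |f| = x at *
    generalize |g| = y at *
    generalize |h| = z at *
    -- 2x ≤ B, 2y ≤ A, 2z ≤ A, 2(x+y+z) ≤ A+B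
    -- reduce to C = B
    have hz2 : 4 * z ^ 2 ≤ A * B := by nlinarith
    have step : 0 ≤ (C - B) * (3 * (A * B) - 4 * z ^ 2) :=
      mul_nonneg (by linarith) (by nlinarith)
    have main : A * B * B ≤ 4 * (A * B * B - 2 * (x * y * z) - A * x ^ 2 - B * y ^ 2 - B * z ^ 2) := by
      exact gram_main A B x y z hA hAB hf hg hh hf0 hg0 hh0 hex
    nlinarith

theorem reduction (h0 : M3) (hd : 0 < dt h0) : ∃ γ, lt γ h0 ∈ Sie := by
  obtain ⟨γ0, -, m0⟩ := min_row h0 hd.ne' Set.univ Set.univ_nonempty 0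
  obtain ⟨γ1, g1, m1⟩ := min_row h0 hd.ne' {γ | dot (lt γ h0 0) (lt γ h0 0) = dot (lt γ0 h0 0) (lt γ0 h0 0)} ⟨γ0, rfl⟩ 1
  obtain ⟨γ2, ⟨g2, g2'⟩, m2⟩ := min_row h0 hd.ne' {γ | dot (lt γ h0 0) (lt γ h0 0) = dot (lt γ0 h0 0) (lt γ0 h0 0) ∧
    dot (lt γ h0 1) (lt γ h0 1) = dot (lt γ1 h0 1) (lt γ1 h0 1)} ⟨γ1, g1, rfl⟩ 2
  refine ⟨γ2, ?_⟩
  obtain ⟨h, hh⟩ : ∃ h, h = lt γ2 h0 := ⟨_, rfl⟩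
  have hdh : dt h = dt h0 := by rw [hh, dt_lt]
  rw [← hh]
  rw [← hh] at g2 g2' m2
  have n0 : ∀ E, dot (h 0) (h 0) ≤ dot (lt E h 0) (lt E h 0) := by
    intro E; rw [g2, hh, ← lt_mul]; exact m0 _ (Set.mem_univ _)
  have n1 : ∀ E, dot (lt E h 0) (lt E h 0) = dot (h 0) (h 0) → dot (h 1) (h 1) ≤ dot (lt E h 1) (lt E h 1) := by
    intro E hE; rw [g2', hh, ← lt_mul]; apply m1
    rw [hh, ← lt_mul, ← hh] at hE; exact hE.trans g2
  have n2 : ∀ E, dot (lt E h 0) (lt E h 0) = dot (h 0) (h 0) → dot (lt E h 1) (lt E h 1) = dot (h 1) (h 1) →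
      dot (h 2) (h 2) ≤ dot (lt E h 2) (lt E h 2) := by
    intro E hE hE'; rw [hh, ← lt_mul, ← hh]; apply m2
    rw [hh, ← lt_mul, ← hh] at hE hE'; exact ⟨hE.trans g2, hE'.trans g2'⟩
  have hAB : dot (h 0) (h 0) ≤ dot (h 1) (h 1) := by
    have := n0 sw01
    simpa [lt, sw01, Fin.sum_univ_three, dot] using this
  have hBC : dot (h 1) (h 1) ≤ dot (h 2) (h 2) := by
    have := n1 sw12 (by simp [lt, sw12, Fin.sum_univ_three, dot])
    simpa [lt, sw12, Fin.sum_univ_three, dot] using this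
  have i1 : ∀ r : ℤ, dot (h 1) (h 1) ≤ dot (h 1) (h 1) + 2 * r * dot (h 0) (h 1) + r ^ 2 * dot (h 0) (h 0) := by
    intro r
    have := n1 (el 0 0 r) (by simp [lt, el, Fin.sum_univ_three, dot])
    simp [lt, el, Fin.sum_univ_three, dot] at this
    simp only [dot]; nlinarith
  have i2 : ∀ p q : ℤ, dot (h 2) (h 2) ≤ dot (h 2) (h 2) + 2 * p * dot (h 0) (h 2) + 2 * q * dot (h 1) (h 2)
      + 2 * p * q * dot (h 0) (h 1) + p ^ 2 * dot (h 0) (h 0) + q ^ 2 * dot (h 1) (h 1) := by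
    intro p q
    have := n2 (el p q 0) (by simp [lt, el, Fin.sum_univ_three, dot]) (by simp [lt, el, Fin.sum_univ_three, dot])
    simp [lt, el, Fin.sum_univ_three, dot] at this
    simp only [dot]; nlinarith
  have a1 := i1 1
  have a2 := i1 (-1)
  have b1 := i2 1 0
  have b2 := i2 (-1) 0
  have b3 := i2 0 1
  have b4 := i2 0 (-1)
  have c1 := i2 1 1
  have c2 := i2 1 (-1)
  have c3 := i2 (-1) 1
  have c4 := i2 (-1) (-1)
  push_cast at a1 a2 b1 b2 b3 b4 c1 c2 c3 c4
  have p0 := dot_self_nonneg (h 0)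
  have p1 := dot_self_nonneg (h 1)
  have hG := gram h
  clear i1 i2 n0 n1 n2 m0 m1 m2
  refine ⟨by rw [hdh]; exact hd, ?_, ?_, ?_, hAB, hBC, ?_⟩
  · rw [abs_le]; constructor <;> linarith
  · rw [abs_le]; constructor <;> linarith
  · rw [abs_le]; constructor <;> linarith
  · rw [hG]
    apply gram_ineq _ _ _ _ _ _ p0 hAB hBC
    · have : |dot (h 1) (h 2)| ≤ dot (h 1) (h 1) / 2 := by rw [abs_le]; constructor <;> linarith
      linarith
    · have : |dot (h 0) (h 2)| ≤ dot (h 0) (h 0) / 2 := by rw [abs_le]; constructor <;> linarith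
      linarith
    · have : |dot (h 0) (h 1)| ≤ dot (h 0) (h 0) / 2 := by rw [abs_le]; constructor <;> linarith
      linarith
    · intro hneg
      have key : ∀ x y z : ℝ, x * y * z < 0 → (|x| + |y| + |z| = -x - y - z ∨ |x| + |y| + |z| = -x + y + z ∨
          |x| + |y| + |z| = x - y + z ∨ |x| + |y| + |z| = x + y - z) := by
        intro x y z hxyz
        rcases le_total 0 x with hx | hx <;> rcases le_total 0 y with hy | hy <;> rcases le_total 0 z with hz | hz <;>
        simp only [abs_of_nonneg, abs_of_nonpos, hx, hy, hz]
        · exact absurd hxyz (not_lt.2 (by positivity))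
        · right; right; right; ring
        · right; right; left; ring
        · exact absurd hxyz (not_lt.2 (by nlinarith [mul_nonneg hx (mul_nonneg_of_nonpos_of_nonpos hy hz)]))
        · right; left; trivial
        · exact absurd hxyz (not_lt.2 (by nlinarith [mul_nonneg hy (mul_nonneg_of_nonpos_of_nonpos hx hz)]))
        · exact absurd hxyz (not_lt.2 (by nlinarith [mul_nonneg hz (mul_nonneg_of_nonpos_of_nonpos hx hy)]))
        · left; ring
      rcases key _ _ _ hneg with e | e | e | e <;> rw [e] <;> linarith

open MvPolynomial
set_option linter.all false
open MeasureTheory ENNReal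

instance : Countable SLZ := by
  have : Countable (Matrix (Fin 3) (Fin 3) ℤ) := inferInstanceAs (Countable (Fin 3 → Fin 3 → ℤ))
  exact Subtype.countable

theorem dot_meas (i j : Fin 3) : Continuous (fun h : M3 => dot (h i) (h j)) := by
  unfold dot; fun_prop

theorem dt_cont : Continuous dt := by
  have : dt = fun h => _ := funext dt_eq
  rw [this]; fun_prop

theorem lt_cont (γ : SLZ) : Continuous (lt γ) := by
  unfold lt
  refine continuous_pi fun i => continuous_pi fun j => ?_
  fun_prop

theorem Sie_meas : MeasurableSet Sie := by
  unfold Sie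
  have h := fun i j => (dot_meas i j).measurable
  have hd := dt_cont.measurable
  simp only [Set.setOf_and]
  refine (measurableSet_lt measurable_const hd).inter ?_
  refine (measurableSet_le (continuous_abs.measurable.comp (h 0 1)) (h 0 0)).inter ?_
  refine (measurableSet_le (continuous_abs.measurable.comp (h 0 2)) (h 0 0)).inter ?_
  refine (measurableSet_le (continuous_abs.measurable.comp (h 1 2)) (h 1 1)).inter ?_
  refine (measurableSet_le (h 0 0) (h 1 1)).inter ?_
  refine (measurableSet_le (h 1 1) (h 2 2)).inter ?_
  exact measurableSet_le (((h 0 0).mul (h 1 1)).mul (h 2 2)) ((hd.pow_const 2).const_mul 4)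

theorem Sie_fin (h : M3) (hd : 0 < dt h) : {γ : SLZ | lt γ h ∈ Sie}.Finite := by
  obtain ⟨K, hK, hb⟩ := row_bound h hd.ne'
  have hinj : Function.Injective (fun γ : SLZ => fun i => (γ : Matrix (Fin 3) (Fin 3) ℤ) i) := by
    intro γ δ hγ; exact Subtype.ext hγ
  apply Set.Finite.of_finite_image _ hinj.injOn
  apply Set.Finite.subset (Set.Finite.pi' (fun _ : Fin 3 => finite_int_box (K * (4 * dt h ^ 2 * K ^ 2))))
  rintro _ ⟨γ, hγ, rfl⟩ i
  simp only [Set.mem_setOf_eq] at hγ ⊢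
  have hone : ∀ i, 1 ≤ K * dot (lt γ h i) (lt γ h i) := by
    intro i
    have hne : ∃ k, (γ : Matrix (Fin 3) (Fin 3) ℤ) i k ≠ 0 := by
      by_contra hcon
      push Not at hcon
      have : (γ : Matrix (Fin 3) (Fin 3) ℤ).det = 0 := Matrix.det_eq_zero_of_row_eq_zero i hcon
      rw [γ.2] at this; norm_num at this
    obtain ⟨k, hk⟩ := hne
    have h1 := hb (fun k => ((γ : Matrix (Fin 3) (Fin 3) ℤ) i k : ℝ)) k
    refine le_trans ?_ h1
    have : (1:ℤ) ≤ (γ : Matrix (Fin 3) (Fin 3) ℤ) i k ^ 2 := by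
      have := Int.one_le_abs hk
      rw [← sq_abs]; nlinarith
    exact_mod_cast this
  obtain ⟨-, -, -, -, hab, hbc, habc⟩ := hγ
  rw [dt_lt] at habc
  have hbd : dot (lt γ h 2) (lt γ h 2) ≤ 4 * dt h ^ 2 * K ^ 2 := by
    have o0 := hone 0
    have o1 := hone 1
    have p := dot_self_nonneg (lt γ h 2)
    generalize dot (lt γ h 0) (lt γ h 0) = A at *
    generalize dot (lt γ h 1) (lt γ h 1) = B at *
    generalize dot (lt γ h 2) (lt γ h 2) = C at *
    have h2 : 1 ≤ (K * A) * (K * B) := by nlinarith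
    calc C ≤ ((K * A) * (K * B)) * C := by nlinarith
      _ = K ^ 2 * (A * B * C) := by ring
      _ ≤ K ^ 2 * (4 * dt h ^ 2) := mul_le_mul_of_nonneg_left habc (by positivity)
      _ = _ := by ring
  intro k
  refine (hb (fun k => ((γ : Matrix (Fin 3) (Fin 3) ℤ) i k : ℝ)) k).trans (mul_le_mul_of_nonneg_left ?_ hK.le)
  change dot (lt γ h i) (lt γ h i) ≤ _
  fin_cases i
  · exact hab.trans (hbc.trans hbd)
  · exact hbc.trans hbd
  · exact hbd

noncomputable def si (h : M3) : ℝ≥0∞ := Sie.indicator 1 h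
noncomputable def cnt (h : M3) : ℝ≥0∞ := ∑' γ : SLZ, si (lt γ h)
noncomputable def wt (h : M3) : ℝ≥0∞ := si h / cnt h

theorem si_meas : Measurable si := measurable_one.indicator Sie_meas
theorem cnt_meas : Measurable cnt := Measurable.ennreal_tsum fun γ => si_meas.comp (lt_cont γ).measurable
theorem wt_meas : Measurable wt := si_meas.div cnt_meas

theorem cnt_lt (δ : SLZ) (h : M3) : cnt (lt δ h) = cnt h := by
  unfold cnt
  simp_rw [← lt_mul]
  exact (Equiv.mulRight δ).tsum_eq (fun γ => si (lt γ h))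

theorem cnt_ne_zero (h : M3) (hd : 0 < dt h) : cnt h ≠ 0 := by
  obtain ⟨γ, hγ⟩ := reduction h hd
  intro h0
  have := ENNReal.tsum_eq_zero.1 h0 γ
  simp [si, hγ] at this

theorem cnt_ne_top (h : M3) (hd : 0 < dt h) : cnt h ≠ ∞ := by
  have hf := Sie_fin h hd
  unfold cnt
  rw [tsum_eq_sum (s := hf.toFinset)]
  · refine (ENNReal.sum_lt_top.2 fun γ _ => ?_).ne
    unfold si Set.indicator
    split_ifs <;> simp
  · intro γ hγ
    simp only [Set.Finite.mem_toFinset, Set.mem_setOf_eq] at hγ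
    simp [si, hγ]

theorem sum_wt (h : M3) (hd : 0 < dt h) : ∑' γ : SLZ, wt (lt γ h) = 1 := by
  unfold wt
  simp_rw [cnt_lt, div_eq_mul_inv]
  rw [ENNReal.tsum_mul_right]
  exact ENNReal.mul_inv_cancel (cnt_ne_zero h hd) (cnt_ne_top h hd)

theorem wt_le (h : M3) : wt h ≤ Sie.indicator 1 h := by
  unfold wt si
  by_cases hs : h ∈ Sie
  · simp only [hs, Set.indicator_of_mem, Pi.one_apply]
    apply ENNReal.div_le_of_le_mul
    rw [one_mul]
    have := ENNReal.le_tsum (f := fun γ : SLZ => si (lt γ h)) 1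
    simp only [lt_one] at this
    simpa [si, hs, cnt] using this
  · simp [hs]

/-- the measure: Lebesgue restricted to 1 < det < 2 -/
noncomputable def mu : Measure M3 := (volume : Measure M3).restrict {h | 1 < dt h ∧ dt h < 2}

theorem mset_meas : MeasurableSet {h : M3 | 1 < dt h ∧ dt h < 2} := by
  have hd := dt_cont.measurable
  exact (measurableSet_lt measurable_const hd).inter (measurableSet_lt hd measurable_const)

theorem unfold_general {Γ Y : Type*} [Group Γ] [Countable Γ] [MulAction Γ Y] [Countable Y]
    {Ω : Type*} [MeasurableSpace Ω] (μ : Measure Ω) (T : Γ → Ω → Ω) (hT : ∀ γ, MeasurePreserving (T γ) μ μ)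
    (w : Ω → ℝ≥0∞) (hw : Measurable w) (hsum : ∀ᵐ h ∂μ, ∑' γ, w (T γ h) = 1)
    (Φ : Ω → Y → ℝ≥0∞) (hΦ : ∀ y, Measurable (fun h => Φ h y))
    (hinv : ∀ γ h y, Φ (T γ h) (γ • y) = Φ h y) (Cc : ℝ≥0∞) (S : Set Y) (hS : ∀ (γ : Γ) y, γ • y ∈ S ↔ y ∈ S)
    (hC : ∀ y ∈ S, ∫⁻ h, Φ h y ∂μ = Cc) (h0 : ∀ y ∉ S, ∀ h, Φ h y = 0)
    (hfin : ∀ y ∈ S, Finite (MulAction.stabilizer Γ y)) :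
    ∫⁻ h, w h * ∑' y, (Nat.card (MulAction.stabilizer Γ y) : ℝ≥0∞) * Φ h y ∂μ
      = Cc * ((Set.encard {o : Set Y | ∃ y ∈ S, o = MulAction.orbit Γ y} : ℕ∞) : ℝ≥0∞) := by
  classical
  -- decomposition of sums over Y
  have hstab : ∀ y ∈ S, ∑' δ : Γ, (if δ • y = y then (1:ℝ≥0∞) else 0) = Nat.card (MulAction.stabilizer Γ y) := by
    intro y hy
    have := hfin y hy
    have := Fintype.ofFinite (MulAction.stabilizer Γ y)
    have e : ∀ δ : Γ, (if δ • y = y then (1:ℝ≥0∞) else 0) =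
      (MulAction.stabilizer Γ y : Set Γ).indicator (fun _ => 1) δ := by
      intro δ; simp [Set.indicator, MulAction.mem_stabilizer_iff]
    simp_rw [e]
    rw [← tsum_subtype, tsum_fintype, Nat.card_eq_fintype_card]
    simp only [Finset.sum_const, Finset.card_univ, nsmul_eq_mul, mul_one]
    rfl
  have hfib : ∀ y ∈ S, ∑' ω : MulAction.orbitRel.Quotient Γ Y, ∑' γ : Γ,
      (if γ • ω.out = y then (1:ℝ≥0∞) else 0) = Nat.card (MulAction.stabilizer Γ y) := by
    intro y hy
    rw [tsum_eq_single (Quotient.mk'' y)]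
    · have hr : (MulAction.orbitRel Γ Y) (Quotient.mk'' y : MulAction.orbitRel.Quotient Γ Y).out y :=
        Quotient.exact' (Quotient.out_eq' _)
      obtain ⟨γ0, h0⟩ := hr
      simp only at h0
      rw [← hstab y hy, ← (Equiv.mulRight γ0⁻¹).tsum_eq]
      congr 1; funext δ
      have hi : ((Equiv.mulRight γ0⁻¹) δ • (Quotient.mk'' y : MulAction.orbitRel.Quotient Γ Y).out = y) ↔ δ • y = y := by
        rw [Equiv.coe_mulRight, ← h0, mul_smul, inv_smul_smul]
      by_cases hy2 : δ • y = y
      · rw [if_pos (hi.2 hy2), if_pos hy2]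
      · rw [if_neg (fun h => hy2 (hi.1 h)), if_neg hy2]
    · intro ω hω
      rw [ENNReal.tsum_eq_zero]
      intro γ
      rw [if_neg]
      rintro rfl
      apply hω
      rw [← Quotient.out_eq' ω]
      apply Quotient.sound'
      rw [Quotient.out_eq' ω]
      exact ⟨γ⁻¹, by simp⟩
  have horb : ∀ F : Y → ℝ≥0∞, (∀ y ∉ S, F y = 0) →
      ∑' y, (Nat.card (MulAction.stabilizer Γ y) : ℝ≥0∞) * F y =
      ∑' ω : MulAction.orbitRel.Quotient Γ Y, ∑' γ : Γ, F (γ • ω.out) := by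
    intro F hF
    have e2 : ∀ z : Y, F z = ∑' y, (if z = y then (1:ℝ≥0∞) else 0) * F y := by
      intro z
      rw [tsum_eq_single z]
      · simp
      · intro y hy; rw [if_neg (Ne.symm hy), zero_mul]
    have e3 : ∀ (ω : MulAction.orbitRel.Quotient Γ Y) (γ : Γ), F (γ • ω.out) =
        ∑' y, (if γ • ω.out = y then (1:ℝ≥0∞) else 0) * F y := fun ω γ => e2 _
    simp_rw [e3]
    simp_rw [ENNReal.tsum_comm (α := Γ) (β := Y)]
    rw [ENNReal.tsum_comm]
    congr 1; funext y
    simp_rw [ENNReal.tsum_mul_right]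
    by_cases hy : y ∈ S
    · rw [hfib y hy]
    · rw [hF y hy, mul_zero, mul_zero]
  have e4 : ∀ h, w h * ∑' y, (Nat.card (MulAction.stabilizer Γ y) : ℝ≥0∞) * Φ h y =
      ∑' ω : MulAction.orbitRel.Quotient Γ Y, ∑' γ : Γ, w h * Φ h (γ • ω.out) := by
    intro h
    rw [horb _ (fun y hy => h0 y hy h)]
    simp_rw [ENNReal.tsum_mul_left]
  simp_rw [e4]
  have hcq : Countable (MulAction.orbitRel.Quotient Γ Y) := Quotient.countable
  have mm : ∀ z, Measurable (fun h => w h * Φ h z) := fun z => hw.mul (hΦ z)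
  rw [lintegral_tsum (fun ω => (Measurable.ennreal_tsum fun γ => mm _).aemeasurable)]
  have e5 : ∀ ω : MulAction.orbitRel.Quotient Γ Y, ∫⁻ h, ∑' γ : Γ, w h * Φ h (γ • ω.out) ∂μ =
      ∫⁻ h, Φ h ω.out ∂μ := by
    intro ω
    rw [lintegral_tsum (fun γ => (mm _).aemeasurable)]
    have e6 : ∀ γ : Γ, ∫⁻ h, w h * Φ h (γ • ω.out) ∂μ = ∫⁻ h, w (T γ h) * Φ h ω.out ∂μ := by
      intro γ
      rw [← (hT γ).lintegral_comp (mm (γ • ω.out))]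
      simp only [hinv]
    simp_rw [e6]
    have mm2 : ∀ γ, Measurable (fun h => w (T γ h) * Φ h ω.out) := fun γ => (hw.comp (hT γ).measurable).mul (hΦ _)
    rw [← lintegral_tsum (fun γ => (mm2 γ).aemeasurable)]
    apply lintegral_congr_ae
    filter_upwards [hsum] with h hh
    rw [ENNReal.tsum_mul_right, hh, one_mul]
  simp_rw [e5]
  have e7 : ∀ ω : MulAction.orbitRel.Quotient Γ Y, ∫⁻ h, Φ h ω.out ∂μ =
      Cc * ({ω : MulAction.orbitRel.Quotient Γ Y | ω.out ∈ S}).indicator (fun _ => 1) ω := by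
    intro ω
    by_cases hω : ω.out ∈ S
    · simp [hC _ hω, hω]
    · simp [hω, h0 _ hω]
  simp_rw [e7]
  rw [ENNReal.tsum_mul_left, ← tsum_subtype, ENNReal.tsum_set_one]
  congr 2
  have : {o : Set Y | ∃ y ∈ S, o = MulAction.orbit Γ y} =
      (fun ω : MulAction.orbitRel.Quotient Γ Y => ω.orbit) '' {ω | ω.out ∈ S} := by
    ext o
    simp only [Set.mem_setOf_eq, Set.mem_image]
    constructor
    · rintro ⟨y, hy, rfl⟩
      refine ⟨Quotient.mk'' y, ?_, rfl⟩
      have hr : (MulAction.orbitRel Γ Y) (Quotient.mk'' y : MulAction.orbitRel.Quotient Γ Y).out y :=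
        Quotient.exact' (Quotient.out_eq' _)
      obtain ⟨γ0, h0⟩ := hr
      simp only at h0
      rw [← h0, hS]; exact hy
    · rintro ⟨ω, hω, rfl⟩
      exact ⟨_, hω, MulAction.orbitRel.Quotient.orbit_eq_orbit_out ω Quotient.out_eq'⟩
  rw [this, Set.InjOn.encard_image]
  exact (MulAction.orbitRel.Quotient.orbit_injective).injOn

open MvPolynomial
set_option linter.all false
open MeasureTheory ENNReal

/-- a multiplicative function of 3x3 matrices known on diagonal ones is a power of det -/
theorem mult_det (D : Matrix (Fin 3) (Fin 3) ℝ → ℝ) (k : ℕ) (hm : ∀ g h, D (g * h) = D g * D h)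
    (hd : ∀ d : Fin 3 → ℝ, D (Matrix.diagonal d) = (∏ i, d i) ^ k)
    (g : Matrix (Fin 3) (Fin 3) ℝ) (hg : g.det ≠ 0) : D g = g.det ^ k := by
  have h1 : D 1 = 1 := by rw [← Matrix.diagonal_one, hd]; simp
  refine Matrix.diagonal_transvection_induction_of_det_ne_zero (fun g => D g = g.det ^ k) g hg ?_ ?_ ?_
  · intro d _; rw [hd, Matrix.det_diagonal]
  · intro t
    have hij := t.hij
    obtain ⟨i, j, hij, c⟩ := t
    simp only [Matrix.TransvectionStruct.toMatrix]
    rw [Matrix.det_transvection_of_ne _ _ hij, one_pow]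
    have hsq : D (Matrix.transvection i j (c + c)) = D (Matrix.transvection i j c) ^ 2 := by
      rw [← Matrix.transvection_mul_transvection_same _ _ hij, hm, sq]
    have hinv : D (Matrix.transvection i j c) * D (Matrix.transvection i j (-c)) = 1 := by
      rw [← hm, Matrix.transvection_mul_transvection_same _ _ hij]; simp [h1]
    have hne : D (Matrix.transvection i j c) ≠ 0 := left_ne_zero_of_mul_eq_one hinv
    let d : Fin 3 → ℝ := fun a => if a = i then 2 else 1
    have hconj : Matrix.diagonal d * Matrix.transvection i j c = Matrix.transvection i j (c + c) * Matrix.diagonal d := by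
      ext a b
      rw [Matrix.diagonal_mul, Matrix.mul_diagonal]
      simp only [Matrix.transvection, Matrix.add_apply, Matrix.single_apply, Matrix.one_apply, d]
      by_cases ha : i = a
      · subst ha
        by_cases hb : j = b
        · subst hb; simp [hij, hij.symm]; ring
        · by_cases hab : i = b
          · subst hab; simp [hb]
          · simp [hb, hab]
      · by_cases hab : a = b
        · subst hab; simp [ha]
        · simp [ha, hab]
    have h2 := congrArg D hconj
    rw [hm, hm, hsq, hd, Fin.prod_univ_three] at h2
    have hdn : ((d 0 * d 1 * d 2) ^ k : ℝ) ≠ 0 := by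
      apply pow_ne_zero
      have : ∀ a, d a ≠ 0 := by intro a; simp only [d]; split_ifs <;> norm_num
      exact mul_ne_zero (mul_ne_zero (this 0) (this 1)) (this 2)
    rw [mul_comm] at h2
    have h3 := mul_right_cancel₀ hdn h2
    have : D (Matrix.transvection i j c) * (D (Matrix.transvection i j c) - 1) = 0 := by linarith
    rcases mul_eq_zero.1 this with h | h
    · exact absurd h hne
    · linarith
  · intro A B _ _ hA hB
    rw [hm, hA, hB, Matrix.det_mul, mul_pow]

noncomputable def actL (g : Matrix (Fin 3) (Fin 3) ℝ) : (Fin 10 → ℝ) →ₗ[ℝ] (Fin 10 → ℝ) where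
  toFun := act g
  map_add' := act_add g
  map_smul' := fun t c => by simpa using act_smul g t c

theorem actL_apply (g c) : actL g c = act g c := rfl

theorem det_actL (g : Matrix (Fin 3) (Fin 3) ℝ) (hg : g.det ≠ 0) :
    LinearMap.det (actL g) = g.det ^ 10 := by
  refine mult_det (fun g => LinearMap.det (actL g)) 10 ?_ ?_ g hg
  · intro g h
    rw [← LinearMap.det_comp]; congr 1
    exact LinearMap.ext fun c => act_mul g h c
  · intro d
    have : actL (Matrix.diagonal d) = Matrix.toLin' (Matrix.diagonal ![d 0 ^ 3, d 1 ^ 3, d 2 ^ 3,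
      d 0 ^ 2 * d 1, d 0 ^ 2 * d 2, d 0 * d 1 ^ 2, d 1 ^ 2 * d 2,
      d 0 * d 2 ^ 2, d 1 * d 2 ^ 2, d 0 * d 1 * d 2]) := by
      refine LinearMap.ext fun c => ?_
      rw [actL_apply, act_diag, Matrix.toLin'_apply]
      funext k
      rw [Matrix.mulVec_diagonal]
      fin_cases k <;> rfl
    rw [this, LinearMap.det_toLin', Matrix.det_diagonal, Fin.prod_univ_three]
    simp [Fin.prod_univ_succ]; ring

/-- left multiplication -/
noncomputable def lmL (g : Matrix (Fin 3) (Fin 3) ℝ) : M3 →ₗ[ℝ] M3 where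
  toFun h := fun i j => ∑ k, g i k * h k j
  map_add' h h' := by ext i j; simp [mul_add, Finset.sum_add_distrib]
  map_smul' t h := by ext i j; simp [Finset.mul_sum, mul_left_comm]

theorem of_lmL (g h) : Matrix.of (lmL g h) = g * Matrix.of h := by
  ext i j; simp [lmL, Matrix.mul_apply]

theorem dt_lmL (g h) : dt (lmL g h) = g.det * dt h := by
  unfold dt; rw [of_lmL, Matrix.det_mul]

theorem lmL_mul (g h m) : lmL (g * h) m = lmL g (lmL h m) := by
  apply Matrix.of.injective; rw [of_lmL, of_lmL, of_lmL, Matrix.mul_assoc]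

theorem lmL_one (m) : lmL 1 m = m := by
  apply Matrix.of.injective; rw [of_lmL, one_mul]

theorem det_lmL (g : Matrix (Fin 3) (Fin 3) ℝ) (hg : g.det ≠ 0) :
    LinearMap.det (lmL g) = g.det ^ 3 := by
  refine mult_det (fun g => LinearMap.det (lmL g)) 3 ?_ ?_ g hg
  · intro g h
    rw [← LinearMap.det_comp]; congr 1
    exact LinearMap.ext fun c => lmL_mul g h c
  · intro d
    have : lmL (Matrix.diagonal d) = LinearMap.pi (fun i => (d i • (LinearMap.id : (Fin 3 → ℝ) →ₗ[ℝ] (Fin 3 → ℝ))).comp (LinearMap.proj i)) := by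
      refine LinearMap.ext fun c => ?_
      ext i j
      simp [lmL, Matrix.diagonal_apply]
    rw [this, LinearMap.det_pi]
    simp [LinearMap.det_smul, Finset.prod_pow]

theorem lmL_lt (γ : SLZ) (h : M3) : lmL ((γ : Matrix (Fin 3) (Fin 3) ℤ).map (Int.castRingHom ℝ)) h = lt γ h := by
  apply Matrix.of.injective; rw [of_lmL, lt_eq]

theorem det_castR (γ : SLZ) : ((γ : Matrix (Fin 3) (Fin 3) ℤ).map (Int.castRingHom ℝ)).det = 1 := by
    have := RingHom.map_det (Int.castRingHom ℝ) (γ : Matrix (Fin 3) (Fin 3) ℤ)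
    rw [γ.2] at this
    simpa using this.symm

theorem lmL_cont (g) : Continuous (lmL g) := (lmL g).continuous_of_finiteDimensional

theorem mp_vol (g : Matrix (Fin 3) (Fin 3) ℝ) (hg : g.det = 1) :
    MeasurePreserving (lmL g) (volume : Measure M3) volume := by
  refine ⟨(lmL_cont g).measurable, ?_⟩
  have h1 := det_lmL g (by rw [hg]; norm_num)
  rw [Measure.map_linearMap_addHaar_eq_smul_addHaar _ (by rw [h1, hg]; norm_num), h1, hg]
  simp

theorem mp_mu (g : Matrix (Fin 3) (Fin 3) ℝ) (hg : g.det = 1) :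
    MeasurePreserving (lmL g) mu mu := by
  have := (mp_vol g hg).restrict_preimage mset_meas
  have e : (lmL g) ⁻¹' {h | 1 < dt h ∧ dt h < 2} = {h | 1 < dt h ∧ dt h < 2} := by
    ext h; simp [dt_lmL, hg]
  rw [e] at this
  exact this

theorem mp_lt (γ : SLZ) : MeasurePreserving (lt γ) mu mu := by
  have := mp_mu _ (det_castR γ)
  convert this using 1
  funext h; rw [lmL_lt]

open MvPolynomial
set_option linter.all false
open MeasureTheory ENNReal

noncomputable def pw (T t : ℝ) : ℝ≥0∞ := if |t| ≤ T then (ENNReal.ofReal |t|) ^ (-(3/4) : ℝ) else 0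

theorem pw_meas (T : ℝ) : Measurable (pw T) := by
  unfold pw
  refine Measurable.ite (measurableSet_le continuous_abs.measurable measurable_const) ?_ measurable_const
  fun_prop

theorem pw_int (T : ℝ) (hT : 0 < T) : ∫⁻ t, pw T t ≤ ENNReal.ofReal (8 * T ^ (1/4 : ℝ)) := by
  let q : ℝ → ℝ≥0∞ := (Set.Ioc 0 T).indicator (fun t => ENNReal.ofReal (t ^ (-(3/4) : ℝ)))
  have hq : ∫⁻ t, q t = ENNReal.ofReal (4 * T ^ (1/4 : ℝ)) := by
    simp only [q]
    rw [lintegral_indicator measurableSet_Ioc, ← ofReal_integral_eq_lintegral_ofReal]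
    · rw [← intervalIntegral.integral_of_le hT.le, integral_rpow (Or.inl (by norm_num))]
      congr 1
      norm_num
      ring
    · have := (intervalIntegral.intervalIntegrable_rpow' (a := 0) (b := T) (r := -(3/4)) (by norm_num))
      rwa [intervalIntegrable_iff_integrableOn_Ioc_of_le hT.le] at this
    · exact (ae_restrict_iff' measurableSet_Ioc).2 (Filter.Eventually.of_forall fun t ht => Real.rpow_nonneg ht.1.le _)
  have hqm : Measurable q := by
    refine Measurable.indicator ?_ measurableSet_Ioc
    fun_prop
  have hle : ∀ᵐ t : ℝ, pw T t ≤ q t + q (-t) := by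
    have : ∀ᵐ t : ℝ, t ≠ 0 := by
      simp [ae_iff]
    filter_upwards [this] with t ht
    unfold pw
    split_ifs with h
    · rw [ENNReal.ofReal_rpow_of_pos (abs_pos.2 ht)]
      rcases lt_or_gt_of_ne ht with h0 | h0
      · rw [abs_of_neg h0] at h ⊢
        have : q (-t) = ENNReal.ofReal ((-t) ^ (-(3/4) : ℝ)) := by
          simp only [q]; rw [Set.indicator_of_mem]; exact ⟨by linarith, h⟩
        rw [this]; exact le_add_self
      · rw [abs_of_pos h0] at h ⊢
        have : q t = ENNReal.ofReal (t ^ (-(3/4) : ℝ)) := by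
          simp only [q]; rw [Set.indicator_of_mem]; exact ⟨by linarith, h⟩
        rw [this]; exact le_self_add
    · exact zero_le
  refine (lintegral_mono_ae hle).trans ?_
  rw [lintegral_add_left hqm, lintegral_neg_eq_self (f := q), hq, ← ENNReal.ofReal_add (by positivity) (by positivity)]
  apply le_of_eq; congr 1; ring

theorem rr_le (x T y : ℝ) (hx : 0 < x) (hy : y ^ 2 ≤ x) (hT : |y| ≤ T) :
    ENNReal.ofReal (x ^ (-(3/8) : ℝ)) ≤ pw T y := by
  unfold pw
  rw [if_pos hT]
  by_cases h0 : y = 0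
  · subst h0; simp
  · have hp := abs_pos.2 h0
    rw [ENNReal.ofReal_rpow_of_pos hp]
    apply ENNReal.ofReal_le_ofReal
    have : |y| ^ (-(3/4) : ℝ) = (|y| ^ 2) ^ (-(3/8) : ℝ) := by
      rw [← Real.rpow_natCast, ← Real.rpow_mul hp.le]; norm_num
    rw [this]
    apply Real.rpow_le_rpow_of_nonpos (by positivity) (by rwa [sq_abs]) (by norm_num)

theorem lint_succ {E : Type*} [MeasureSpace E] [SigmaFinite (volume : Measure E)] {n : ℕ} (k : Fin (n+1))
    (f : (Fin (n+1) → E) → ℝ≥0∞) (hf : Measurable f) :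
    ∫⁻ b, f b = ∫⁻ y : Fin n → E, ∫⁻ t : E, f (k.insertNth t y) := by
  have h1 := (volume_preserving_piFinSuccAbove (fun _ : Fin (n+1) => E) k).symm
  rw [← h1.lintegral_comp hf]
  have := lintegral_prod_symm (μ := (volume : Measure E)) (ν := (volume : Measure (Fin n → E))) 
    (fun z : E × (Fin n → E) => f ((MeasurableEquiv.piFinSuccAbove (fun _ : Fin (n+1) => E) k).symm z))
    (hf.comp (MeasurableEquiv.measurable _)).aemeasurable
  exact this

theorem lint_prod {n : ℕ} (p : ℝ → ℝ≥0∞) (hp : Measurable p) :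
    ∫⁻ b : Fin n → ℝ, ∏ i, p (b i) = (∫⁻ t, p t) ^ n := by
  induction n with
  | zero => simp [volume_pi, Measure.pi_of_empty]
  | succ n ih =>
    have hm : ∀ m, Measurable (fun b : Fin m → ℝ => ∏ i, p (b i)) := fun m =>
      Finset.measurable_prod _ fun i _ => hp.comp (measurable_pi_apply i)
    rw [lint_succ 0 _ (hm (n+1))]
    simp_rw [Fin.prod_univ_succAbove _ (0 : Fin (n+1)), Fin.insertNth_apply_same, Fin.insertNth_apply_succAbove]
    simp_rw [lintegral_mul_const _ hp]
    rw [lintegral_const_mul _ (hm n), ih, pow_succ, mul_comm]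

theorem lint3 {E : Type*} [MeasureSpace E] [SigmaFinite (volume : Measure E)]
    (f : (Fin 3 → E) → ℝ≥0∞) (hf : Measurable f) :
    ∫⁻ b, f b = ∫⁻ a : E, ∫⁻ b : E, ∫⁻ c : E, f ![a, b, c] := by
  rw [lint_succ 2 f hf]
  have hm : Measurable (fun z : (Fin 2 → E) × E => f ((2 : Fin 3).insertNth z.2 z.1)) :=
    hf.comp ((MeasurableEquiv.piFinSuccAbove (fun _ : Fin 3 => E) 2).symm.measurable.comp measurable_swap)
  have hm2 : Measurable (fun y : Fin 2 → E => ∫⁻ t : E, f ((2 : Fin 3).insertNth t y)) := hm.lintegral_prod_right'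
  have h2 := (volume_preserving_finTwoArrow E).symm
  rw [← h2.lintegral_comp hm2]
  rw [show (volume : Measure (E × E)) = (volume : Measure E).prod volume from rfl,
    lintegral_prod _ (show AEMeasurable (fun z : E × E => ∫⁻ (t : E), f (Fin.insertNth 2 t (MeasurableEquiv.finTwoArrow.symm z))) _ from (hm2.comp h2.measurable).aemeasurable)]
  refine lintegral_congr fun a => lintegral_congr fun b => lintegral_congr fun c => ?_
  congr 1
  funext i
  fin_cases i
  · rfl
  · rfl
  · exact Fin.insertNth_apply_same (α := fun _ => E) 2 c _

/-- volume of the slice in the third row -/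
theorem slice_c (a b : Fin 3 → ℝ) (hN : dot a a * dot b b ≤ 4 * (dot a a * dot b b - dot a b ^ 2))
    (ha : 0 < dot a a) (hb : 0 < dot b b) :
    volume {c : Fin 3 → ℝ | |dot a c| ≤ dot a a ∧ |dot b c| ≤ dot b b ∧ 1 < dt ![a, b, c] ∧ dt ![a, b, c] < 2} ≤ 16 := by
  let x : Fin 3 → ℝ := ![a 1 * b 2 - a 2 * b 1, a 2 * b 0 - a 0 * b 2, a 0 * b 1 - a 1 * b 0]
  let M : Matrix (Fin 3) (Fin 3) ℝ := Matrix.of ![a, b, x]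
  have hdet : M.det = dot a a * dot b b - dot a b ^ 2 := by
    rw [Matrix.det_fin_three]; simp [M, x, dot]; ring
  have hpos : 0 < M.det := by rw [hdet]; nlinarith [mul_pos ha hb]
  have hsub : {c : Fin 3 → ℝ | |dot a c| ≤ dot a a ∧ |dot b c| ≤ dot b b ∧ 1 < dt ![a, b, c] ∧ dt ![a, b, c] < 2}
      ⊆ (Matrix.toLin' M) ⁻¹' (Set.Icc ![-dot a a, -dot b b, 1] ![dot a a, dot b b, 2]) := by
    rintro c ⟨h1, h2, h3, h4⟩
    have e0 : (Matrix.toLin' M c) 0 = dot a c := by simp [M, Matrix.mulVec, dotProduct, Fin.sum_univ_three, dot]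
    have e1 : (Matrix.toLin' M c) 1 = dot b c := by simp [M, Matrix.mulVec, dotProduct, Fin.sum_univ_three, dot]
    have e2 : (Matrix.toLin' M c) 2 = dt ![a, b, c] := by
      rw [dt_eq]; simp [M, Matrix.mulVec, dotProduct, Fin.sum_univ_three, x]; ring
    rw [abs_le] at h1 h2
    constructor
    · intro i; fin_cases i
      · simpa [e0] using h1.1
      · simpa [e1] using h2.1
      · simpa [e2] using h3.le
    · intro i; fin_cases i
      · simpa [e0] using h1.2
      · simpa [e1] using h2.2
      · simpa [e2] using h4.le
  refine (measure_mono hsub).trans ?_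
  have hld : LinearMap.det (Matrix.toLin' M) = M.det := LinearMap.det_toLin' M
  rw [Measure.addHaar_preimage_linearMap _ (by rw [hld]; exact hpos.ne'), Real.volume_Icc_pi, hld, Fin.prod_univ_three]
  simp only [Matrix.cons_val]
  rw [← ENNReal.ofReal_mul (by linarith), ← ENNReal.ofReal_mul (by nlinarith), ← ENNReal.ofReal_mul (by positivity)]
  rw [show (16 : ℝ≥0∞) = ENNReal.ofReal 16 by norm_num]
  apply ENNReal.ofReal_le_ofReal
  rw [abs_of_pos (inv_pos.2 hpos), inv_mul_le_iff₀ hpos, hdet]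
  nlinarith

/-- the b-integral, slab in direction k -/
theorem slice_b (a : Fin 3 → ℝ) (k : Fin 3) (hk : dot a a ≤ 3 * a k ^ 2) (ha : 0 < dot a a) (T : ℝ) (hT : 0 < T) :
    ∫⁻ b : Fin 3 → ℝ, (if |dot a b| ≤ dot a a then ∏ i : Fin 2, pw T (b (k.succAbove i)) else 0) ≤
      ENNReal.ofReal (4 * (dot a a) ^ (1/2 : ℝ)) * ENNReal.ofReal (8 * T ^ (1/4 : ℝ)) ^ 2 := by
  have hm : Measurable (fun b : Fin 3 → ℝ => (if |dot a b| ≤ dot a a then ∏ i : Fin 2, pw T (b (k.succAbove i)) else 0)) := by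
    refine Measurable.ite (measurableSet_le ?_ measurable_const) ?_ measurable_const
    · have : Continuous (fun b : Fin 3 → ℝ => |dot a b|) := by unfold dot; fun_prop
      exact this.measurable
    · exact Finset.measurable_prod _ fun i _ => (pw_meas T).comp (measurable_pi_apply _)
  rw [lint_succ k _ hm]
  simp only [Fin.insertNth_apply_succAbove]
  have hak : 0 < |a k| := by
    rw [abs_pos]; intro h; rw [h] at hk; norm_num at hk; linarith
  have hdot : ∀ (t : ℝ) (y : Fin 2 → ℝ), dot a (k.insertNth t y) = a k * t + ∑ i, a (k.succAbove i) * y i := by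
    intro t y
    have : ∀ v w : Fin 3 → ℝ, dot v w = ∑ i, v i * w i := by intro v w; rw [Fin.sum_univ_three]; rfl
    rw [this, Fin.sum_univ_succAbove _ k]
    simp
  have inner : ∀ y : Fin 2 → ℝ, ∫⁻ t : ℝ, (if |dot a (k.insertNth t y)| ≤ dot a a then ∏ i : Fin 2, pw T (y i) else 0)
      ≤ ENNReal.ofReal (4 * (dot a a) ^ (1/2 : ℝ)) * ∏ i : Fin 2, pw T (y i) := by
    intro y
    set s := ∑ i, a (k.succAbove i) * y i
    have hle : ∀ t : ℝ, (if |dot a (k.insertNth t y)| ≤ dot a a then ∏ i : Fin 2, pw T (y i) else 0) ≤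
        (Metric.closedBall (-s / a k) (dot a a / |a k|)).indicator (fun _ => ∏ i : Fin 2, pw T (y i)) t := by
      intro t
      split_ifs with h
      · rw [Set.indicator_of_mem]
        rw [hdot] at h
        rw [Metric.mem_closedBall, Real.dist_eq, le_div_iff₀ hak, ← abs_mul]
        have h9 : a k ≠ 0 := abs_pos.1 hak
        have e9 : (t - -s / a k) * a k = a k * t + s := by
          rw [sub_mul, div_mul_cancel₀ _ h9]; ring
        rw [e9]; exact h
      · exact zero_le
    refine (lintegral_mono hle).trans ?_
    rw [lintegral_indicator Metric.isClosed_closedBall.measurableSet, setLIntegral_const, Real.volume_closedBall, mul_comm]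
    refine mul_le_mul_left ?_ _
    apply ENNReal.ofReal_le_ofReal
    rw [← Real.sqrt_eq_rpow]
    have hs := Real.sqrt_pos.2 ha
    have hsq := Real.sq_sqrt ha.le
    have : Real.sqrt (dot a a) ≤ 2 * |a k| := by
      rw [Real.sqrt_le_left (by positivity), mul_pow, sq_abs]; nlinarith
    rw [show 2 * (dot a a / |a k|) = 2 * dot a a / |a k| by ring, div_le_iff₀ hak]
    nlinarith
  refine (lintegral_mono inner).trans ?_
  have hmp : Measurable (fun y : Fin 2 → ℝ => ∏ i : Fin 2, pw T (y i)) :=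
    Finset.measurable_prod _ fun i _ => (pw_meas T).comp (measurable_pi_apply _)
  rw [lintegral_const_mul _ hmp, lint_prod _ (pw_meas T)]
  gcongr
  exact pw_int T hT

noncomputable def Fh (h : M3) : ℝ := (dot (h 2) (h 2) / dot (h 0) (h 0)) ^ (3/4 : ℝ)

theorem dot_pos_of_dt (h : M3) (hd : dt h ≠ 0) (i : Fin 3) : 0 < dot (h i) (h i) := by
  refine lt_of_le_of_ne (dot_self_nonneg _) fun h0 => hd ?_
  have hz : ∀ j, h i j = 0 := by
    unfold dot at h0
    intro j
    have := sq_nonneg (h i 0); have := sq_nonneg (h i 1); have := sq_nonneg (h i 2)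
    fin_cases j
    · have : h i 0 * h i 0 = 0 := by nlinarith
      simpa using this
    · have : h i 1 * h i 1 = 0 := by nlinarith
      simpa using this
    · have : h i 2 * h i 2 = 0 := by nlinarith
      simpa using this
  exact Matrix.det_eq_zero_of_row_eq_zero i hz

theorem Fh_meas : Measurable Fh := by
  unfold Fh
  exact ((dot_meas 2 2).measurable.div (dot_meas 0 0).measurable).pow_const _

theorem Sie_facts (h : M3) (hs : h ∈ Sie) (h1 : 1 < dt h) (h2 : dt h < 2) :
    0 < dot (h 0) (h 0) ∧ dot (h 0) (h 0) ≤ dot (h 1) (h 1) ∧ dot (h 1) (h 1) ≤ dot (h 2) (h 2) ∧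
    dot (h 0) (h 0) * dot (h 1) (h 1) * dot (h 2) (h 2) ≤ 16 ∧
    dot (h 0) (h 0) * dot (h 1) (h 1) ≤ 4 * (dot (h 0) (h 0) * dot (h 1) (h 1) - dot (h 0) (h 1) ^ 2) := by
  obtain ⟨-, s1, s2, s3, s4, s5, s6⟩ := hs
  have hc := dot_pos_of_dt h (by linarith) 2
  refine ⟨dot_pos_of_dt h (by linarith) 0, s4, s5, by nlinarith, ?_⟩
  have hCS : dt h ^ 2 ≤ (dot (h 0) (h 0) * dot (h 1) (h 1) - dot (h 0) (h 1) ^ 2) * dot (h 2) (h 2) := by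
    have e : (dot (h 0) (h 0) * dot (h 1) (h 1) - dot (h 0) (h 1) ^ 2) * dot (h 2) (h 2) - dt h ^ 2 =
      dot (h 0) (h 0) * dot (h 1) (h 2) ^ 2 + dot (h 1) (h 1) * dot (h 0) (h 2) ^ 2 - 2 * dot (h 1) (h 2) * dot (h 0) (h 2) * dot (h 0) (h 1) := by
      rw [gram]; ring
    have e2 : dot (h 0) (h 0) * dot (h 1) (h 2) ^ 2 + dot (h 1) (h 1) * dot (h 0) (h 2) ^ 2 - 2 * dot (h 1) (h 2) * dot (h 0) (h 2) * dot (h 0) (h 1)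
      = dot (fun j => dot (h 1) (h 2) * h 0 j - dot (h 0) (h 2) * h 1 j) (fun j => dot (h 1) (h 2) * h 0 j - dot (h 0) (h 2) * h 1 j) := by
      generalize dot (h 1) (h 2) = p
      generalize dot (h 0) (h 2) = q
      unfold dot; ring
    have := dot_self_nonneg (fun j => dot (h 1) (h 2) * h 0 j - dot (h 0) (h 2) * h 1 j)
    linarith
  by_contra hcon
  push Not at hcon
  have := mul_lt_mul_of_pos_right hcon hc
  linarith

theorem Fh_bound (h : M3) (hs : h ∈ Sie) (h1 : 1 < dt h) (h2 : dt h < 2) :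
    Fh h ≤ 8 * (dot (h 0) (h 0) ^ (-(3/8) : ℝ)) ^ 4 * (dot (h 1) (h 1) ^ (-(3/8) : ℝ)) ^ 2 := by
  obtain ⟨ha, hab, hbc, habc, -⟩ := Sie_facts h hs h1 h2
  unfold Fh
  generalize dot (h 0) (h 0) = α at *
  generalize dot (h 1) (h 1) = β at *
  generalize dot (h 2) (h 2) = γ at *
  have hb : 0 < β := by linarith
  have hγ : 0 < γ := by linarith
  have h16 : (16 : ℝ) ^ (3/4 : ℝ) = 8 := by
    rw [show (16:ℝ) = 2 ^ (4:ℝ) by norm_num, ← Real.rpow_mul (by norm_num)]; norm_num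
  have e1 : (α ^ (-(3/8) : ℝ)) ^ 4 = (α ^ 2) ^ (-(3/4) : ℝ) := by
    rw [← Real.rpow_natCast, ← Real.rpow_natCast, ← Real.rpow_mul ha.le, ← Real.rpow_mul ha.le]; norm_num
  have e2 : (β ^ (-(3/8) : ℝ)) ^ 2 = β ^ (-(3/4) : ℝ) := by
    rw [← Real.rpow_natCast, ← Real.rpow_mul hb.le]; norm_num
  rw [e1, e2, ← h16, Real.rpow_neg (by positivity), Real.rpow_neg (by positivity), ← Real.inv_rpow (by positivity),
    ← Real.inv_rpow (by positivity), ← Real.mul_rpow (by positivity) (by positivity), ← Real.mul_rpow (by positivity) (by positivity)]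
  apply Real.rpow_le_rpow (by positivity) _ (by norm_num)
  rw [div_le_iff₀ ha]
  have : γ = (α * β * γ) / (α * β) := by field_simp
  rw [this]
  calc _ ≤ 16 / (α * β) := by gcongr
    _ = _ := by field_simp

theorem Fh_int : ∫⁻ h, Sie.indicator (fun h => ENNReal.ofReal (Fh h)) h ∂mu < ∞ := by
  classical
  let D : Set M3 := Sie ∩ {h | 1 < dt h ∧ dt h < 2}
  have hDm : MeasurableSet D := Sie_meas.inter mset_meas
  have hfm : Measurable (D.indicator (fun h => ENNReal.ofReal (Fh h))) :=
    (ENNReal.measurable_ofReal.comp Fh_meas).indicator hDm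
  have e0 : ∫⁻ h, Sie.indicator (fun h => ENNReal.ofReal (Fh h)) h ∂mu =
      ∫⁻ h, D.indicator (fun h => ENNReal.ofReal (Fh h)) h := by
    unfold mu
    rw [← lintegral_indicator mset_meas]
    refine lintegral_congr fun h => ?_
    rw [← Set.indicator_indicator]
    by_cases h1 : h ∈ {h : M3 | 1 < dt h ∧ dt h < 2}
    · by_cases h2 : h ∈ Sie <;> simp [h1, h2]
    · by_cases h2 : h ∈ Sie <;> simp [h1, h2]
  rw [e0, lint3 _ hfm]
  let r : ℝ → ℝ := fun x => x ^ (-(3/8) : ℝ)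
  let T : ℝ → ℝ := fun α => 4 * α ^ (-(1/4) : ℝ)
  let Gk : (Fin 3 → ℝ) → Fin 3 → (Fin 3 → ℝ) → ℝ≥0∞ := fun a k b =>
    if |dot a b| ≤ dot a a then ∏ i : Fin 2, pw (T (dot a a)) (b (k.succAbove i)) else 0
  let E : (Fin 3 → ℝ) → (Fin 3 → ℝ) → ℝ≥0∞ := fun a b =>
    if 0 < dot a a ∧ dot a a ^ 3 ≤ 16 then
      ∑ k : Fin 3, if dot a a ≤ 3 * a k ^ 2 then ENNReal.ofReal (8 * r (dot a a) ^ 4) * Gk a k b else 0 else 0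
  -- step 1
  have st1 : ∀ a b, ∫⁻ c, D.indicator (fun h => ENNReal.ofReal (Fh h)) ![a, b, c] ≤ 16 * E a b := by
    intro a b
    let S : Set (Fin 3 → ℝ) := {c | |dot a c| ≤ dot a a ∧ |dot b c| ≤ dot b b ∧ 1 < dt ![a, b, c] ∧ dt ![a, b, c] < 2}
    by_cases hN : dot a a * dot b b ≤ 4 * (dot a a * dot b b - dot a b ^ 2) ∧ 0 < dot a a ∧ 0 < dot b b
    · have hle : ∀ c, D.indicator (fun h => ENNReal.ofReal (Fh h)) ![a, b, c] ≤ S.indicator (fun _ => E a b) c := by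
        intro c
        by_cases hc : ![a, b, c] ∈ D
        · obtain ⟨hs, hd1, hd2⟩ := hc
          have hcD : ![a, b, c] ∈ D := ⟨hs, hd1, hd2⟩
          have hs' := hs
          obtain ⟨-, s1, s2, s3, s4, s5, s6⟩ := hs'
          obtain ⟨f1, f2, f3, f4, f5⟩ := Sie_facts _ hs hd1 hd2
          have hcS : c ∈ S := ⟨s2, s3, hd1, hd2⟩
          rw [Set.indicator_of_mem hcD, Set.indicator_of_mem hcS]
          have hb := Fh_bound _ hs hd1 hd2
          simp only [Matrix.cons_val] at *
          have hα : 0 < dot a a := f1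
          have hβ : 0 < dot b b := by linarith
          have hab2 : dot a a * dot b b ^ 2 ≤ 16 := by nlinarith [mul_pos hα hβ]
          have ha3 : dot a a ^ 3 ≤ 16 := by nlinarith [mul_pos hα hβ, mul_pos hα hα]
          have hk : ∃ k : Fin 3, dot a a ≤ 3 * a k ^ 2 := by
            by_contra hcon
            push Not at hcon
            have e0 := hcon 0; have e1 := hcon 1; have e2 := hcon 2
            unfold dot at e0 e1 e2; nlinarith
          obtain ⟨k, hk⟩ := hk
          have hbT : ∀ i : Fin 3, b i ^ 2 ≤ dot b b := by
            intro i; unfold dot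
            have := sq_nonneg (b 0); have := sq_nonneg (b 1); have := sq_nonneg (b 2)
            fin_cases i
            · show b 0 ^ 2 ≤ _
              nlinarith
            · show b 1 ^ 2 ≤ _
              nlinarith
            · show b 2 ^ 2 ≤ _
              nlinarith
          have hT2 : dot b b ≤ T (dot a a) ^ 2 := by
            have e : T (dot a a) ^ 2 = 16 * (dot a a ^ (1/2 : ℝ))⁻¹ := by
              simp only [T]
              rw [mul_pow, ← Real.rpow_natCast (_ ^ _), ← Real.rpow_mul hα.le, ← Real.rpow_neg hα.le]; norm_num
            rw [e, ← Real.sqrt_eq_rpow, ← div_eq_mul_inv, le_div_iff₀ (Real.sqrt_pos.2 hα)]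
            apply le_of_sq_le_sq _ (by norm_num)
            rw [mul_pow, Real.sq_sqrt hα.le]; nlinarith
          have hTp : 0 ≤ T (dot a a) := by simp only [T]; positivity
          have hE : ENNReal.ofReal (8 * r (dot a a) ^ 4) * Gk a k b ≤ E a b := by
            simp only [E]
            rw [if_pos ⟨hα, ha3⟩]
            refine le_trans ?_ (Finset.single_le_sum (f := fun k : Fin 3 => if dot a a ≤ 3 * a k ^ 2 then ENNReal.ofReal (8 * r (dot a a) ^ 4) * Gk a k b else 0) (fun _ _ => zero_le) (Finset.mem_univ k))
            simp only [if_pos hk]; exact le_rfl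
          refine le_trans (ENNReal.ofReal_le_ofReal hb) (le_trans ?_ hE)
          rw [ENNReal.ofReal_mul (by positivity)]
          refine mul_le_mul_right ?_ _
          simp only [Gk]
          rw [if_pos s1, ENNReal.ofReal_pow (by positivity)]
          calc (ENNReal.ofReal (dot b b ^ (-(3/8) : ℝ))) ^ 2 = ∏ i : Fin 2, ENNReal.ofReal (dot b b ^ (-(3/8) : ℝ)) := by simp
            _ ≤ _ := Finset.prod_le_prod (fun _ _ => zero_le) fun i _ => rr_le _ _ _ hβ (hbT _)
              (abs_le_of_sq_le_sq ((hbT _).trans hT2) hTp)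
        · rw [Set.indicator_of_notMem hc]; exact zero_le
      refine (lintegral_mono hle).trans ?_
      refine (lintegral_indicator_const_le _ _).trans ?_
      rw [mul_comm]
      exact mul_le_mul_left (slice_c a b hN.1 hN.2.1 hN.2.2) _
    · have : ∀ c, D.indicator (fun h => ENNReal.ofReal (Fh h)) ![a, b, c] = 0 := by
        intro c
        rw [Set.indicator_of_notMem]
        rintro ⟨hs, hd1, hd2⟩
        obtain ⟨f1, f2, f3, f4, f5⟩ := Sie_facts _ hs hd1 hd2
        exact hN ⟨f5, f1, lt_of_lt_of_le f1 f2⟩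
      simp [this]
  -- step 2
  have hGm : ∀ a k, Measurable (Gk a k) := by
    intro a k
    refine Measurable.ite (measurableSet_le ?_ measurable_const) ?_ measurable_const
    · have : Continuous (fun b : Fin 3 → ℝ => |dot a b|) := by unfold dot; fun_prop
      exact this.measurable
    · exact Finset.measurable_prod _ fun i _ => (pw_meas _).comp (measurable_pi_apply _)
  have st2 : ∀ a, ∫⁻ b, E a b ≤ ENNReal.ofReal 49152 * ∏ i : Fin 3, pw 2 (a i) := by
    intro a
    by_cases hα : 0 < dot a a ∧ dot a a ^ 3 ≤ 16
    · simp only [E, if_pos hα]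
      rw [lintegral_finsetSum]
      swap
      · intro k _
        split_ifs
        · exact (hGm a k).const_mul _
        · exact measurable_const
      have hTp : 0 < T (dot a a) := by simp only [T]; have := hα.1; positivity
      have key : ∀ k : Fin 3, ∫⁻ b, (if dot a a ≤ 3 * a k ^ 2 then ENNReal.ofReal (8 * r (dot a a) ^ 4) * Gk a k b else 0)
          ≤ ENNReal.ofReal 16384 * ∏ i : Fin 3, pw 2 (a i) := by
        intro k
        by_cases hk : dot a a ≤ 3 * a k ^ 2
        · simp only [if_pos hk]
          rw [lintegral_const_mul _ (hGm a k)]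
          refine (mul_le_mul_right (slice_b a k hk hα.1 _ hTp) _).trans ?_
          have hr : ENNReal.ofReal (r (dot a a)) ^ 3 ≤ ∏ i : Fin 3, pw 2 (a i) := by
            calc (ENNReal.ofReal (r (dot a a))) ^ 3 = ∏ i : Fin 3, ENNReal.ofReal (r (dot a a)) := by simp
            _ ≤ _ := Finset.prod_le_prod (fun _ _ => zero_le) fun i _ => by
              have hai : a i ^ 2 ≤ dot a a := by
                unfold dot
                have := sq_nonneg (a 0); have := sq_nonneg (a 1); have := sq_nonneg (a 2)
                fin_cases i
                · show a 0 ^ 2 ≤ _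
                  nlinarith
                · show a 1 ^ 2 ≤ _
                  nlinarith
                · show a 2 ^ 2 ≤ _
                  nlinarith
              refine rr_le _ _ _ hα.1 hai (abs_le_of_sq_le_sq (hai.trans ?_) (by norm_num))
              by_contra hcon
              push Not at hcon
              nlinarith [hα.2, mul_pos hα.1 hα.1]
          refine le_trans ?_ (mul_le_mul_right hr _)
          have hr0 : 0 ≤ r (dot a a) := Real.rpow_nonneg hα.1.le _
          rw [← ENNReal.ofReal_pow (by positivity), ← ENNReal.ofReal_mul (by have := hα.1; positivity), ← ENNReal.ofReal_pow (by have := hα.1; positivity), ← ENNReal.ofReal_mul (by have := hα.1; positivity), ← ENNReal.ofReal_mul (by norm_num)]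
          apply ENNReal.ofReal_le_ofReal
          -- real inequality
          have h1 := hα.1
          generalize dot a a = α at h1
          simp only [r, T]
          let u := α ^ (1/16 : ℝ)
          have hu : 0 < u := Real.rpow_pos_of_pos h1 _
          have p1 : α ^ (-(3/8) : ℝ) = (u ^ 6)⁻¹ := by
            rw [← Real.rpow_natCast, ← Real.rpow_mul h1.le, ← Real.rpow_neg h1.le]; norm_num
          have p2 : α ^ (1/2 : ℝ) = u ^ 8 := by
            rw [← Real.rpow_natCast, ← Real.rpow_mul h1.le]; norm_num
          have p3 : (4 * α ^ (-(1/4) : ℝ)) ^ (1/4 : ℝ) ≤ 2 * u⁻¹ := by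
            rw [Real.mul_rpow (by norm_num) (by positivity), ← Real.rpow_mul h1.le]
            have : α ^ (-(1/4) * (1/4) : ℝ) = u⁻¹ := by
              rw [← Real.rpow_neg h1.le]; norm_num
            rw [this]
            gcongr
            calc (4:ℝ) ^ (1/4 : ℝ) ≤ 4 ^ (1/2 : ℝ) := Real.rpow_le_rpow_of_exponent_le (by norm_num) (by norm_num)
              _ = 2 := by rw [← Real.sqrt_eq_rpow, show (4:ℝ) = 2 ^ 2 by norm_num, Real.sqrt_sq (by norm_num)]
          rw [p1, p2]
          calc _ ≤ 8 * (u ^ 6)⁻¹ ^ 4 * (4 * u ^ 8 * (8 * (2 * u⁻¹)) ^ 2) := by gcongr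
            _ = 8192 * (u ^ 6)⁻¹ ^ 3 := by field_simp; norm_num
            _ ≤ _ := by gcongr; norm_num
        · simp [hk]
      refine (Finset.sum_le_sum fun k _ => key k).trans ?_
      rw [Finset.sum_const, Finset.card_univ, Fintype.card_fin, nsmul_eq_mul, ← mul_assoc]
      refine mul_le_mul_left ?_ _
      rw [show ((3:ℕ) : ℝ≥0∞) = ENNReal.ofReal 3 by norm_num, ← ENNReal.ofReal_mul (by norm_num)]
      apply ENNReal.ofReal_le_ofReal; norm_num
    · simp only [E, if_neg hα]; simp
  calc _ ≤ ∫⁻ a, ∫⁻ b, 16 * E a b := lintegral_mono fun a => lintegral_mono fun b => st1 a b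
    _ = ∫⁻ a, 16 * ∫⁻ b, E a b := lintegral_congr fun a => lintegral_const_mul' _ _ (by norm_num)
    _ ≤ ∫⁻ a, 16 * (ENNReal.ofReal 49152 * ∏ i : Fin 3, pw 2 (a i)) := lintegral_mono fun a => mul_le_mul_right (st2 a) _
    _ = 16 * (ENNReal.ofReal 49152 * (∫⁻ t, pw 2 t) ^ 3) := by
      rw [lintegral_const_mul' _ _ (by norm_num), lintegral_const_mul' _ _ ENNReal.ofReal_ne_top, lint_prod _ (pw_meas 2)]
    _ < ∞ := by
      refine ENNReal.mul_lt_top (by norm_num) (ENNReal.mul_lt_top ENNReal.ofReal_lt_top (ENNReal.pow_lt_top ?_))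
      exact lt_of_le_of_lt (pw_int 2 (by norm_num)) ENNReal.ofReal_lt_top

theorem Fh_ge_one (h : M3) (hs : h ∈ Sie) (h1 : 1 < dt h) (h2 : dt h < 2) : 1 ≤ Fh h := by
  obtain ⟨ha, hab, hbc, habc, -⟩ := Sie_facts h hs h1 h2
  unfold Fh
  apply Real.one_le_rpow _ (by norm_num)
  rw [le_div_iff₀ ha]; linarith

open MvPolynomial
set_option linter.all false
open MeasureTheory ENNReal
open scoped Pointwise

theorem tsum_ind {Y : Type*} (S : Set Y) : ∑' y, S.indicator (fun _ => (1:ℝ≥0∞)) y = ((S.encard : ℕ∞) : ℝ≥0∞) := by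
  rw [← tsum_subtype, ENNReal.tsum_set_one]

theorem mem_L {ι : Type*} [Fintype ι] (v : ι → ℝ) :
    v ∈ (Submodule.span ℤ (Set.range (Pi.basisFun ℝ ι)) : Submodule ℤ (ι → ℝ)) ↔ ∃ x : ι → ℤ, v = fun i => (x i : ℝ) := by
  classical
  rw [Module.Basis.mem_span_iff_repr_mem]
  constructor
  · intro h
    choose x hx using h
    exact ⟨x, funext fun i => by simpa using (hx i).symm⟩
  · rintro ⟨x, rfl⟩ i
    exact ⟨x i, by simp⟩

theorem count_lim {ι : Type*} [Fintype ι] (s : Set (ι → ℝ)) (h1 : Bornology.IsBounded s) (h2 : MeasurableSet s)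
    (h3 : volume (frontier s) = 0) :
    Filter.Tendsto (fun n : ℕ => (∑' x : ι → ℤ, s.indicator (fun _ => (1:ℝ≥0∞)) ((n:ℝ)⁻¹ • (fun i => (x i : ℝ)))) / (n:ℝ≥0∞) ^ Fintype.card ι)
      Filter.atTop (nhds (volume s)) := by
  classical
  have key := tendsto_card_div_pow_atTop_volume s h1 h2 h3
  have hfin : volume s ≠ ∞ := h1.measure_lt_top.ne
  have k2 := ENNReal.tendsto_ofReal key
  rw [ofReal_measureReal hfin] at k2
  refine k2.congr' ?_
  filter_upwards [Filter.eventually_gt_atTop 0] with n hn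
  have hn0 : (n:ℝ) ≠ 0 := by positivity
  let f : (ι → ℤ) → (ι → ℝ) := fun x => (n:ℝ)⁻¹ • (fun i => (x i : ℝ))
  have hinj : Function.Injective f := by
    intro x y hxy
    funext i
    have := congrFun hxy i
    simpa [f, hn0] using this
  have himg : s ∩ (n:ℝ)⁻¹ • ((Submodule.span ℤ (Set.range (Pi.basisFun ℝ ι)) : Submodule ℤ (ι → ℝ)) : Set (ι → ℝ)) = f '' (f ⁻¹' s) := by
    rw [Set.image_preimage_eq_inter_range]
    congr 1
    ext v
    rw [Set.mem_smul_set]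
    constructor
    · rintro ⟨w, hw, rfl⟩
      obtain ⟨x, rfl⟩ := (mem_L w).1 hw
      exact ⟨x, rfl⟩
    · rintro ⟨x, rfl⟩
      exact ⟨_, (mem_L _).2 ⟨x, rfl⟩, rfl⟩
  have hSfin : (f ⁻¹' s).Finite := by
    obtain ⟨R, hR⟩ := h1.subset_closedBall 0
    have : (f ⁻¹' s) ⊆ Set.pi Set.univ (fun _ : ι => Set.Icc (-⌈n * R⌉) ⌈n * R⌉) := by
      intro x hx i _
      have h5 := hR hx
      rw [mem_closedBall_zero_iff] at h5
      have h6 := (norm_le_pi_norm (f x) i).trans h5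
      simp only [f, Pi.smul_apply, smul_eq_mul, Real.norm_eq_abs, abs_mul, abs_inv, Nat.abs_cast] at h6
      rw [inv_mul_le_iff₀ (by positivity)] at h6
      have h7 := (abs_le.1 (h6.trans (Int.le_ceil _)))
      constructor
      · exact_mod_cast h7.1
      · exact_mod_cast h7.2
    exact (Set.Finite.pi fun _ => Set.finite_Icc _ _).subset this
  have e1 : ∑' x : ι → ℤ, s.indicator (fun _ => (1:ℝ≥0∞)) (f x) = (((f ⁻¹' s).encard : ℕ∞) : ℝ≥0∞) := by
    rw [← tsum_ind]; rfl
  rw [e1, himg, Nat.card_image_of_injective hinj, ENNReal.ofReal_div_of_pos (by positivity), ENNReal.ofReal_natCast,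
    ENNReal.ofReal_pow (by positivity), ENNReal.ofReal_natCast, Nat.card_coe_set_eq, ← hSfin.cast_ncard_eq]
  rfl

instance haarM3 : Measure.IsAddHaarMeasure (volume : Measure M3) := by
  have : ∀ i : Fin 3, Measure.IsAddHaarMeasure ((fun _ : Fin 3 => (volume : Measure (Fin 3 → ℝ))) i) := fun i => inferInstance
  exact Measure.pi.isAddHaarMeasure (fun _ : Fin 3 => (volume : Measure (Fin 3 → ℝ)))

theorem mp_curry : MeasurePreserving (fun (v : Fin 3 × Fin 3 → ℝ) => (fun i j => v (i, j) : M3)) volume volume := by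
  let L : (Fin 3 × Fin 3 → ℝ) ≃ₗ[ℝ] M3 := LinearEquiv.curry ℝ ℝ (Fin 3) (Fin 3)
  have hL : ∀ v, L v = fun i j => v (i, j) := fun v => rfl
  let e := L.toContinuousLinearEquiv
  have hm : Measure.IsAddHaarMeasure (Measure.map e (volume : Measure (Fin 3 × Fin 3 → ℝ))) := inferInstance
  have hme : Measurable e := e.continuous.measurable
  refine ⟨hme, ?_⟩
  change Measure.map e volume = volume
  have hs := Measure.isAddLeftInvariant_eq_smul (Measure.map e (volume : Measure (Fin 3 × Fin 3 → ℝ))) (volume : Measure M3)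
  have h1 : (volume : Measure M3) (Set.Icc 0 1) = 1 := by
    have : (Set.Icc 0 1 : Set M3) = Set.pi Set.univ (fun _ => Set.Icc 0 1) := by
      rw [← Set.pi_univ_Icc]; rfl
    rw [this, volume_pi_pi]
    simp [Real.volume_Icc_pi]
  have h2 : (Measure.map e (volume : Measure (Fin 3 × Fin 3 → ℝ))) (Set.Icc 0 1) = 1 := by
    rw [Measure.map_apply hme measurableSet_Icc]
    have : e ⁻¹' (Set.Icc 0 1) = Set.Icc 0 1 := by
      ext v
      simp only [Set.mem_preimage, Set.mem_Icc, Pi.le_def]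
      constructor
      · rintro ⟨a, b⟩; exact ⟨fun i => a i.1 i.2, fun i => b i.1 i.2⟩
      · rintro ⟨a, b⟩; exact ⟨fun i j => a (i, j), fun i j => b (i, j)⟩
    rw [this, Real.volume_Icc_pi]; simp
  have h3 := congrArg (fun m : Measure M3 => m (Set.Icc 0 1)) hs
  simp only [h2, Measure.smul_apply, h1, smul_eq_mul] at h3
  rw [hs]
  have : (Measure.map e (volume : Measure (Fin 3 × Fin 3 → ℝ))).addHaarScalarFactor volume = 1 := by
    have h4 : (1 : ℝ≥0∞) = (((Measure.map e (volume : Measure (Fin 3 × Fin 3 → ℝ))).addHaarScalarFactor volume : NNReal) : ℝ≥0∞) := by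
      simpa [ENNReal.smul_def] using h3
    exact_mod_cast h4.symm
  rw [this, one_smul]

theorem count_limM (s : Set M3) (h1 : Bornology.IsBounded s) (h2 : MeasurableSet s)
    (h3 : volume (frontier s) = 0) :
    Filter.Tendsto (fun n : ℕ => (∑' x : Fin 3 → Fin 3 → ℤ, s.indicator (fun _ => (1:ℝ≥0∞)) ((n:ℝ)⁻¹ • (fun i j => (x i j : ℝ)))) / (n:ℝ≥0∞) ^ 9)
      Filter.atTop (nhds (volume s)) := by
  let L : (Fin 3 × Fin 3 → ℝ) ≃ₗ[ℝ] M3 := LinearEquiv.curry ℝ ℝ (Fin 3) (Fin 3)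
  let e := L.toContinuousLinearEquiv
  have hmp : MeasurePreserving e volume volume := mp_curry
  have hb : Bornology.IsBounded (e ⁻¹' s) := by
    have : e ⁻¹' s = e.symm '' s := by
      ext v
      simp only [Set.mem_preimage, Set.mem_image]
      exact ⟨fun h => ⟨_, h, by simp⟩, by rintro ⟨w, hw, rfl⟩; simpa using hw⟩
    rw [this]
    exact e.symm.lipschitz.isBounded_image h1
  have hf : volume (frontier (e ⁻¹' s)) = 0 := by
    have : frontier (e ⁻¹' s) = e ⁻¹' (frontier s) := (e.toHomeomorph.preimage_frontier s).symm
    rw [this, hmp.measure_preimage isClosed_frontier.measurableSet.nullMeasurableSet, h3]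
  have := count_lim (e ⁻¹' s) hb (hmp.measurable h2) hf
  rw [hmp.measure_preimage h2.nullMeasurableSet] at this
  refine this.congr fun n => ?_
  have h9 : Fintype.card (Fin 3 × Fin 3) = 9 := by simp
  rw [h9, ← (Equiv.curry (Fin 3) (Fin 3) ℤ).tsum_eq]
  rfl

open MvPolynomial
set_option linter.all false
open MeasureTheory ENNReal
open scoped Pointwise

/-- the open convex cone of matrices close to a positive multiple of the identity -/
def KK : Set M3 := {g | ∀ i j, |g i j - if i = j then g 0 0 else 0| < (1/100) * g 0 0}

theorem KK_pos {g : M3} (hg : g ∈ KK) : 0 < g 0 0 := by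
  have := (abs_nonneg _).trans_lt (hg 0 0); linarith

theorem KK_smul {t : ℝ} (ht : 0 < t) (g : M3) : t • g ∈ KK ↔ g ∈ KK := by
  have key : ∀ i j, (|(t • g) i j - if i = j then (t • g) 0 0 else 0| < (1/100) * (t • g) 0 0) ↔
      (|g i j - if i = j then g 0 0 else 0| < (1/100) * g 0 0) := by
    intro i j
    have e : ((t • g) i j - if i = j then (t • g) 0 0 else 0) = t * (g i j - if i = j then g 0 0 else 0) := by
      split_ifs <;> simp [mul_sub]
    rw [e, abs_mul, abs_of_pos ht]
    have : (1/100) * (t • g) 0 0 = t * ((1/100) * g 0 0) := by simp; ring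
    rw [this, mul_lt_mul_iff_right₀ ht]
  exact forall_congr' fun i => forall_congr' fun j => key i j

theorem KK_open : IsOpen KK := by
  have : KK = ⋂ i, ⋂ j, {g : M3 | |g i j - if i = j then g 0 0 else 0| < (1/100) * g 0 0} := by
    ext g; simp [KK]
  rw [this]
  refine isOpen_iInter_of_finite fun i => isOpen_iInter_of_finite fun j => ?_
  refine isOpen_lt ?_ (by fun_prop)
  split_ifs <;> fun_prop

theorem KK_convex : Convex ℝ KK := by
  intro x hx y hy a b ha hb hab i j
  have h1 := hx i j
  have h2 := hy i j
  have e : ((a • x + b • y) i j - if i = j then (a • x + b • y) 0 0 else 0) =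
      a * (x i j - if i = j then x 0 0 else 0) + b * (y i j - if i = j then y 0 0 else 0) := by
    split_ifs <;> simp <;> ring
  rw [e]
  refine (abs_add_le _ _).trans_lt ?_
  rw [abs_mul, abs_mul, abs_of_nonneg ha, abs_of_nonneg hb]
  have e2 : (1/100) * (a • x + b • y) 0 0 = a * ((1/100) * x 0 0) + b * ((1/100) * y 0 0) := by
    simp; ring
  rw [e2]
  rcases ha.eq_or_lt with rfl | ha'
  · have : b = 1 := by linarith
    subst this; simpa using h2
  · have := mul_lt_mul_of_pos_left h1 ha'
    have := mul_le_mul_of_nonneg_left h2.le hb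
    linarith

theorem KK_entry {g : M3} (hg : g ∈ KK) (i j) : |g i j| ≤ 2 * g 0 0 := by
  have h := hg i j
  have hp := KK_pos hg
  rw [abs_lt] at h
  rw [abs_le]
  split_ifs at h <;> constructor <;> linarith

theorem KK_dt {g : M3} (hg : g ∈ KK) : g 0 0 ^ 3 / 2 ≤ dt g := by
  have hp := KK_pos hg
  have h := fun i j => abs_lt.1 (hg i j)
  set t := g 0 0 with ht
  have b11 := h 1 1
  have b22 := h 2 2
  have off : ∀ i j, i ≠ j → |g i j| ≤ t / 100 := by
    intro i j hij
    have := h i j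
    simp only [hij, if_false] at this
    rw [abs_le]; constructor <;> linarith
  simp only [if_true] at b11 b22
  rw [dt_eq]
  have two : ∀ x y : ℝ, |x| ≤ t/100 → |y| ≤ t/100 → |x * y| ≤ t^2/10000 := by
    intro x y hx hy
    rw [abs_mul]
    calc _ ≤ (t/100) * (t/100) := mul_le_mul hx hy (abs_nonneg _) (by positivity)
      _ = _ := by ring
  have d : ∀ i, |g i i| ≤ 2 * t := fun i => KK_entry hg i i
  have mm : ∀ x y : ℝ, |x| ≤ t^2/10000 → |y| ≤ 2 * t → |x * y| ≤ t^3/5000 := by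
    intro x y hx hy
    rw [abs_mul]
    calc _ ≤ (t^2/10000) * (2*t) := mul_le_mul hx hy (abs_nonneg _) (by positivity)
      _ = _ := by ring
  have e1 := mm _ _ (two _ _ (off 1 2 (by decide)) (off 2 1 (by decide))) (d 0)
  have e2 := mm _ _ (two _ _ (off 0 1 (by decide)) (off 1 0 (by decide))) (d 2)
  have e3 := mm _ _ (two _ _ (off 0 2 (by decide)) (off 2 0 (by decide))) (d 1)
  have e4 := mm _ _ (two _ _ (off 0 1 (by decide)) (off 1 2 (by decide))) (KK_entry hg 2 0)
  have e5 := mm _ _ (two _ _ (off 0 2 (by decide)) (off 1 0 (by decide))) (KK_entry hg 2 1)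
  have m : (99/100 * t) * (99/100 * t) ≤ g 1 1 * g 2 2 := mul_le_mul (by linarith) (by linarith) (by positivity) (by linarith)
  have m2 := mul_le_mul_of_nonneg_left m hp.le
  rw [abs_le] at e1 e2 e3 e4 e5
  rw [← ht] at *
  have t3 : 0 < t^3 := by positivity
  have f2 : t * (99/100 * t * (99/100 * t)) = 9801/10000 * t^3 := by ring
  rw [f2] at m2
  linarith

theorem KK_dt_pos {g : M3} (hg : g ∈ KK) : 0 < dt g := by
  have := KK_dt hg
  have := pow_pos (KK_pos hg) 3
  linarith

theorem KK_bd {g : M3} (hg : g ∈ KK) {T : ℝ} (hT : 0 ≤ T) (h : dt g ≤ 4 * T ^ 3) (i j) : |g i j| ≤ 4 * T := by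
  have h1 := KK_dt hg
  have h2 : g 0 0 ≤ 2 * T := by
    by_contra hc
    push Not at hc
    have := pow_lt_pow_left₀ hc (by positivity) (n := 3) (by norm_num)
    nlinarith
  have := KK_entry hg i j
  linarith

theorem lmL_inj {g : Matrix (Fin 3) (Fin 3) ℝ} (hg : g.det = 1) (h : M3) : lmL g (lmL g⁻¹ h) = h ∧ lmL g⁻¹ (lmL g h) = h := by
  have hu : IsUnit g.det := by rw [hg]; exact isUnit_one
  constructor
  · rw [← lmL_mul, Matrix.mul_nonsing_inv _ hu, lmL_one]
  · rw [← lmL_mul, Matrix.nonsing_inv_mul _ hu, lmL_one]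

theorem dt_smul (t : ℝ) (h : M3) : dt (t • h) = t ^ 3 * dt h := by
  rw [dt_eq, dt_eq]; simp; ring

/-- scaling a matrix of positive determinant to determinant one -/
theorem scale_one (h : M3) (hd : 0 < dt h) : ∃ r : ℝ, 0 < r ∧ ∃ h1 : M3, dt h1 = 1 ∧ h = r • h1 := by
  obtain ⟨r, hr0, hr⟩ := cube_root (a := dt h) hd.ne'
  have hr1 : 0 < r := by
    by_contra hc
    push Not at hc
    nlinarith [sq_nonneg r, pow_two_nonneg r, mul_nonneg (sq_nonneg r) (neg_nonneg.2 hc)]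
  refine ⟨r, hr1, r⁻¹ • h, ?_, ?_⟩
  · rw [dt_smul, ← hr]; field_simp
  · rw [smul_smul, mul_inv_cancel₀ hr0, one_smul]

theorem adj_lmL (g : Matrix (Fin 3) (Fin 3) ℝ) (hg : g.det = 1) (h x : M3) :
    lmL (Matrix.adjugate (Matrix.of (lmL g h))) (lmL g x) = lmL (Matrix.adjugate (Matrix.of h)) x := by
  rw [of_lmL, Matrix.adjugate_mul_distrib, ← lmL_mul, Matrix.mul_assoc, Matrix.adjugate_mul, hg, one_smul, Matrix.mul_one]

def id3 : M3 := fun i j => if i = j then 1 else 0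
theorem of_id3 : Matrix.of id3 = 1 := by ext i j; simp [id3, Matrix.one_apply]
theorem dt_id3 : dt id3 = 1 := by unfold dt; rw [of_id3, Matrix.det_one]

noncomputable def kap' : ℝ≥0∞ := mu {h | lmL (Matrix.adjugate (Matrix.of h)) id3 ∈ KK}
noncomputable def UU : Set M3 := KK ∩ {g | dt g < 1}
noncomputable def kap : ℝ≥0∞ := volume UU

theorem lmL_smul_left (t : ℝ) (g h) : lmL (t • g) h = t • lmL g h := by
  ext i j; simp [lmL, Finset.mul_sum, mul_assoc]

theorem lmadj_cont (x : M3) : Continuous (fun h : M3 => lmL (Matrix.adjugate (Matrix.of h)) x) := by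
  have : Continuous (fun h : M3 => Matrix.adjugate (Matrix.of h)) :=
    Continuous.matrix_adjugate (A := fun h : M3 => Matrix.of h) continuous_id
  refine continuous_pi fun i => continuous_pi fun j => ?_
  change Continuous (fun h : M3 => ∑ k, Matrix.adjugate (Matrix.of h) i k * x k j)
  refine continuous_finsetSum _ fun k _ => (Continuous.mul ?_ continuous_const)
  exact this.matrix_elem i k

theorem lmL_id3 (h : M3) : lmL (Matrix.of h) id3 = h := by
  apply Matrix.of.injective; rw [of_lmL, of_id3, Matrix.mul_one]

theorem mu_KK (x : M3) (hx : 0 < dt x) : mu {h | lmL (Matrix.adjugate (Matrix.of h)) x ∈ KK} = kap' := by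
  obtain ⟨r, hr, x1, hx1, rfl⟩ := scale_one x hx
  have hm : MeasurableSet {h : M3 | lmL (Matrix.adjugate (Matrix.of h)) (r • x1) ∈ KK} :=
    (KK_open.preimage (lmadj_cont _)).measurableSet
  rw [← (mp_mu (Matrix.of x1) hx1).measure_preimage hm.nullMeasurableSet]
  unfold kap'
  congr 1
  ext h
  simp only [Set.mem_preimage, Set.mem_setOf_eq]
  rw [map_smul, KK_smul hr]
  have := adj_lmL (Matrix.of x1) hx1 h id3
  rw [lmL_id3] at this
  rw [this]

theorem lmL_adj_one (h : M3) (i j) : lmL (Matrix.adjugate (Matrix.of h)) id3 i j = Matrix.adjugate (Matrix.of h) i j := by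
  simp [lmL, id3]

theorem kap'_pos : 0 < kap' := by
  unfold kap' mu
  have ho : IsOpen {h : M3 | lmL (Matrix.adjugate (Matrix.of h)) id3 ∈ KK} :=
    KK_open.preimage (lmadj_cont _)
  rw [Measure.restrict_apply ho.measurableSet]
  have ho2 : IsOpen {h : M3 | 1 < dt h ∧ dt h < 2} :=
    (isOpen_lt continuous_const dt_cont).inter (isOpen_lt dt_cont continuous_const)
  refine (ho.inter ho2).measure_pos _ ⟨(11/10 : ℝ) • id3, ?_, ?_⟩
  · rw [Set.mem_setOf_eq]
    have e2 : Matrix.adjugate (Matrix.of ((11/10 : ℝ) • id3)) = ((11/10:ℝ)^2) • (1 : Matrix (Fin 3) (Fin 3) ℝ) := by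
      have := Matrix.adjugate_smul (11/10 : ℝ) (1 : Matrix (Fin 3) (Fin 3) ℝ)
      rw [← of_id3] at this
      have e : Matrix.of ((11/10 : ℝ) • id3) = (11/10 : ℝ) • Matrix.of id3 := rfl
      rw [e, this, of_id3]; simp
    intro i j
    rw [lmL_adj_one, lmL_adj_one, e2]
    fin_cases i <;> fin_cases j <;> norm_num [Matrix.one_apply]
  · rw [Set.mem_setOf_eq, dt_smul, dt_id3]; norm_num

theorem bdd_of_entry (s : Set M3) (T : ℝ) (h : ∀ g ∈ s, ∀ i j, |g i j| ≤ T) : Bornology.IsBounded s := by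
  rcases s.eq_empty_or_nonempty with rfl | ⟨g0, hg0⟩
  · exact Bornology.isBounded_empty
  have hT : 0 ≤ T := (abs_nonneg _).trans (h g0 hg0 0 0)
  refine (Metric.isBounded_closedBall (x := (0 : M3)) (r := T)).subset fun g hg => ?_
  rw [mem_closedBall_zero_iff, pi_norm_le_iff_of_nonneg hT]
  intro i
  rw [pi_norm_le_iff_of_nonneg hT]
  exact fun j => h g hg i j

theorem kap'_fin : kap' < ∞ := by
  unfold kap' mu
  have ho : IsOpen {h : M3 | lmL (Matrix.adjugate (Matrix.of h)) id3 ∈ KK} :=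
    KK_open.preimage (lmadj_cont _)
  rw [Measure.restrict_apply ho.measurableSet]
  refine Bornology.IsBounded.measure_lt_top (bdd_of_entry _ 96 ?_)
  rintro h ⟨h1, h2, h3⟩ i j
  rw [Set.mem_setOf_eq] at h1
  have hbd := KK_bd h1 (T := 1) (by norm_num) (by
    rw [dt_lmL, Matrix.det_adjugate]
    change (dt h) ^ (Fintype.card (Fin 3) - 1) * dt id3 ≤ _
    rw [dt_id3]
    simp
    nlinarith)
  simp only [lmL_adj_one] at hbd
  have h4 : Matrix.adjugate (Matrix.adjugate (Matrix.of h)) = dt h • Matrix.of h := by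
    rw [Matrix.adjugate_adjugate _ (by simp)]; simp; rfl
  have h5 : |Matrix.adjugate (Matrix.adjugate (Matrix.of h)) i j| ≤ 96 := by
    generalize Matrix.adjugate (Matrix.of h) = G at hbd
    rw [Matrix.adjugate_fin_three]
    have m : ∀ i j k l, |G i j * G k l| ≤ 16 := by
      intro i j k l
      rw [abs_mul]
      calc _ ≤ (4*1:ℝ) * (4*1) := mul_le_mul (hbd _ _) (hbd _ _) (abs_nonneg _) (by norm_num)
        _ = _ := by norm_num
    have tri : ∀ x y : ℝ, |x| ≤ 16 → |y| ≤ 16 → |x - y| ≤ 96 ∧ |-x + y| ≤ 96 := by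
      intro x y hx hy
      rw [abs_le] at *
      rw [abs_le]
      refine ⟨⟨?_, ?_⟩, ?_, ?_⟩ <;> linarith
    fin_cases i <;> fin_cases j <;> simp <;>
      first
      | exact (tri _ _ (m _ _ _ _) (m _ _ _ _)).1
      | exact (tri _ _ (m _ _ _ _) (m _ _ _ _)).2
  rw [h4, Matrix.smul_apply, smul_eq_mul, abs_mul, abs_of_pos (by linarith)] at h5
  have : |h i j| ≤ dt h * |h i j| := by nlinarith [abs_nonneg (h i j)]
  exact this.trans h5

/-- level set of the determinant is null -/
theorem dt_null : volume {g : M3 | dt g = 1} = 0 := by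
  by_contra hne
  have hpos : ∀ t : ℝ, 0 < t → 0 < volume {g : M3 | dt g = t} := by
    intro t ht
    let D : Matrix (Fin 3) (Fin 3) ℝ := Matrix.diagonal ![t⁻¹, 1, 1]
    have hD : D.det = t⁻¹ := by simp [D, Matrix.det_diagonal, Fin.prod_univ_three]
    have hD0 : D.det ≠ 0 := by rw [hD]; exact inv_ne_zero ht.ne'
    have e : {g : M3 | dt g = t} = lmL D ⁻¹' {g : M3 | dt g = 1} := by
      ext g
      simp only [Set.mem_setOf_eq, Set.mem_preimage, dt_lmL, hD]
      rw [inv_mul_eq_one₀ ht.ne', eq_comm]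
    rw [e, Measure.addHaar_preimage_linearMap _ (by rw [det_lmL _ hD0]; exact pow_ne_zero _ hD0), det_lmL _ hD0]
    refine ENNReal.mul_pos ?_ hne
    simp [hD, ht, ht.ne']
  have hc := Measure.countable_meas_level_set_pos (μ := (volume : Measure M3)) dt_cont.measurable
  have hu : Set.Ioi (0:ℝ) ⊆ {t : ℝ | 0 < volume {a : M3 | dt a = t}} := fun t ht => hpos t ht
  have hcc := hc.mono hu
  have := hcc.measure_zero volume
  simp at this

theorem UU_open : IsOpen UU := KK_open.inter (isOpen_lt dt_cont continuous_const)

theorem UU_bdd : Bornology.IsBounded UU := bdd_of_entry _ 4 fun g hg i j => by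
  have := KK_bd hg.1 (T := 1) (by norm_num) (by have := hg.2; simp only [Set.mem_setOf_eq] at this; linarith) i j
  linarith

theorem UU_front : volume (frontier UU) = 0 := by
  refine measure_mono_null (frontier_inter_subset _ _) ?_
  refine measure_union_null (measure_mono_null Set.inter_subset_left (KK_convex.addHaar_frontier volume))
    (measure_mono_null (Set.inter_subset_right.trans (frontier_lt_subset_eq dt_cont continuous_const)) dt_null)

theorem kap_pos : 0 < kap := by
  refine UU_open.measure_pos _ ⟨(1/2 : ℝ) • id3, ?_, ?_⟩
  · intro i j
    fin_cases i <;> fin_cases j <;> norm_num [id3]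
  · rw [Set.mem_setOf_eq, dt_smul, dt_id3]; norm_num

theorem kap_fin : kap < ∞ := UU_bdd.measure_lt_top

/-- translated region -/
theorem Uh_props (h : M3) (hd : 0 < dt h) :
    let s : Set M3 := {g | lmL (Matrix.adjugate (Matrix.of h)) g ∈ KK ∧ dt g < 1}
    Bornology.IsBounded s ∧ MeasurableSet s ∧ volume (frontier s) = 0 ∧ volume s = kap := by
  obtain ⟨r, hr, h1', hh1', rfl⟩ := scale_one h hd
  intro s
  obtain ⟨h1, rfl⟩ : ∃ h1 : Matrix (Fin 3) (Fin 3) ℝ, Matrix.of.symm h1 = h1' := ⟨Matrix.of h1', rfl⟩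
  have hh1 : h1.det = 1 := hh1'
  have hu : IsUnit h1.det := by rw [hh1]; exact isUnit_one
  have hinv : h1⁻¹.det = 1 := by rw [Matrix.det_nonsing_inv, hh1]; simp
  have hadj : Matrix.adjugate (Matrix.of (r • Matrix.of.symm h1)) = r ^ 2 • h1⁻¹ := by
    have := Matrix.adjugate_smul r h1
    change Matrix.adjugate (r • h1) = _
    rw [this, Matrix.inv_def, hh1]; simp
  have hs : s = lmL h1⁻¹ ⁻¹' UU := by
    ext g
    simp only [s, Set.mem_setOf_eq, Set.mem_preimage, UU, Set.mem_inter_iff, dt_lmL, hinv, one_mul]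
    rw [hadj, lmL_smul_left, KK_smul (by positivity)]
  let e : M3 ≃ₜ M3 := ⟨⟨lmL h1⁻¹, lmL h1, fun x => (lmL_inj hh1 x).1, fun x => (lmL_inj hh1 x).2⟩, lmL_cont _, lmL_cont _⟩
  have hs' : s = e ⁻¹' UU := hs
  refine ⟨?_, ?_, ?_, ?_⟩
  · have : s = lmL h1 '' UU := by
      rw [hs]
      ext g
      constructor
      · intro hg; exact ⟨_, hg, (lmL_inj hh1 g).1⟩
      · rintro ⟨g, hg, rfl⟩; simpa [(lmL_inj hh1 g).2] using hg
    rw [this]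
    exact (LinearMap.toContinuousLinearMap (lmL h1)).lipschitz.isBounded_image UU_bdd
  · rw [hs]; exact (UU_open.preimage (lmL_cont _)).measurableSet
  · rw [hs', ← e.preimage_frontier]
    exact ((mp_vol _ hinv).measure_preimage isClosed_frontier.measurableSet.nullMeasurableSet).trans UU_front
  · rw [hs, (mp_vol _ hinv).measure_preimage UU_open.measurableSet.nullMeasurableSet]; rfl

open MvPolynomial
set_option linter.all false
open MeasureTheory ENNReal
open scoped Pointwise

def YM := Fin 3 → Fin 3 → ℤ
instance : Countable YM := inferInstanceAs (Countable (Fin 3 → Fin 3 → ℤ))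

instance : MulAction SLZ YM where
  smul γ M := Matrix.of.symm ((γ : Matrix (Fin 3) (Fin 3) ℤ) * Matrix.of M)
  one_smul M := by
    change Matrix.of.symm (((1 : SLZ) : Matrix (Fin 3) (Fin 3) ℤ) * Matrix.of M) = M
    simp
    rfl
  mul_smul γ δ M := by
    change Matrix.of.symm (((γ * δ : SLZ) : Matrix (Fin 3) (Fin 3) ℤ) * Matrix.of M) =
      Matrix.of.symm ((γ : Matrix (Fin 3) (Fin 3) ℤ) * Matrix.of (Matrix.of.symm ((δ : Matrix (Fin 3) (Fin 3) ℤ) * Matrix.of M)))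
    simp [Matrix.mul_assoc]

theorem YM_smul (γ : SLZ) (M : YM) : Matrix.of (γ • M : YM) = (γ : Matrix (Fin 3) (Fin 3) ℤ) * Matrix.of M := rfl

def toR (M : YM) : M3 := fun i j => (M i j : ℝ)
def dz (M : YM) : ℤ := Matrix.det (Matrix.of M)

theorem of_toR (M : YM) : Matrix.of (toR M) = (Matrix.of M).map (Int.castRingHom ℝ) := rfl

theorem toR_smul (γ : SLZ) (M : YM) : toR (γ • M) = lt γ (toR M) := by
  apply Matrix.of.injective
  rw [of_toR, YM_smul, lt_eq, of_toR, Matrix.map_mul]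

theorem dt_toR (M : YM) : dt (toR M) = (dz M : ℝ) := by
  unfold dt dz
  rw [of_toR]
  have := RingHom.map_det (Int.castRingHom ℝ) (Matrix.of M)
  simpa using this.symm

theorem dz_smul (γ : SLZ) (M : YM) : dz (γ • M) = dz M := by
  unfold dz; rw [YM_smul, Matrix.det_mul, γ.2, one_mul]

theorem stab_YM (M : YM) (hM : dz M ≠ 0) (γ : SLZ) (h : γ • M = M) : γ = 1 := by
  have h1 : (γ : Matrix (Fin 3) (Fin 3) ℤ) * Matrix.of M = Matrix.of M := by rw [← YM_smul, h]
  have h2 : ((γ : Matrix (Fin 3) (Fin 3) ℤ) * Matrix.of M) * (Matrix.of M).adjugate = Matrix.of M * (Matrix.of M).adjugate := by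
    rw [h1]
  rw [Matrix.mul_assoc, Matrix.mul_adjugate] at h2
  change _ * (dz M • 1) = dz M • 1 at h2
  rw [Matrix.mul_smul, Matrix.mul_one] at h2
  apply Subtype.ext
  have := smul_right_injective (Matrix (Fin 3) (Fin 3) ℤ) hM h2
  simpa using this

noncomputable def CM (n : ℕ) (h : M3) : Set YM := {M | lmL (Matrix.adjugate (Matrix.of h)) (toR M) ∈ KK ∧ dt (toR M) < (n:ℝ) ^ 3}
def SM (n : ℕ) : Set YM := {M | 0 < dz M ∧ dz M < (n:ℤ)^3}
noncomputable def orbM (n : ℕ) : ℝ≥0∞ :=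
  ((Set.encard {o : Set YM | ∃ y ∈ SM n, o = MulAction.orbit SLZ y} : ℕ∞) : ℝ≥0∞)

theorem CM_sub (n : ℕ) (h : M3) : CM n h ⊆ SM n := by
  rintro M ⟨h1, h2⟩
  have h3 := KK_dt_pos h1
  rw [dt_lmL, Matrix.det_adjugate, dt_toR] at h3
  rw [dt_toR] at h2
  have h4 : (0:ℝ) ≤ (Matrix.of h).det ^ (Fintype.card (Fin 3) - 1) := by
    simp; positivity
  have := pos_of_mul_pos_right h3 h4
  exact ⟨by exact_mod_cast this, by exact_mod_cast h2⟩

theorem toR_meas_set (n : ℕ) (M : YM) : MeasurableSet {h | M ∈ CM n h} := by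
  have : {h | M ∈ CM n h} = {h | lmL (Matrix.adjugate (Matrix.of h)) (toR M) ∈ KK} ∩ {h | dt (toR M) < (n:ℝ)^3} := rfl
  rw [this]
  exact (KK_open.preimage (lmadj_cont _)).measurableSet.inter (MeasurableSet.const _)

theorem mu_pos_ae : ∀ᵐ h ∂mu, 1 < dt h ∧ dt h < 2 := ae_restrict_mem mset_meas

theorem unfoldM (n : ℕ) : ∫⁻ h, wt h * ∑' M, (CM n h).indicator (fun _ => (1:ℝ≥0∞)) M ∂mu = kap' * orbM n := by
  have key := unfold_general (Γ := SLZ) (Y := YM) mu (fun γ => lt γ) mp_lt wt wt_meas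
    (by filter_upwards [mu_pos_ae] with h hh; exact sum_wt h (by linarith [hh.1]))
    (fun h M => (CM n h).indicator (fun _ => (1:ℝ≥0∞)) M)
    (fun M => by
      have : (fun h => (CM n h).indicator (fun _ => (1:ℝ≥0∞)) M) = {h | M ∈ CM n h}.indicator (fun _ => 1) := by
        ext h; simp [Set.indicator]
      rw [this]
      exact measurable_const.indicator (toR_meas_set n M))
    (by
      intro γ h M
      have : γ • M ∈ CM n (lt γ h) ↔ M ∈ CM n h := by
        unfold CM
        simp only [Set.mem_setOf_eq, toR_smul, dt_lt]
        rw [← lmL_lt, ← lmL_lt, adj_lmL _ (det_castR γ)]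
      by_cases hM : M ∈ CM n h
      · simp [hM, this.2 hM]
      · simp [hM, mt this.1 hM])
    kap' (SM n) (fun γ M => by unfold SM; simp only [Set.mem_setOf_eq, dz_smul])
    (by
      intro M hM
      have : (fun h => (CM n h).indicator (fun _ => (1:ℝ≥0∞)) M) = {h | M ∈ CM n h}.indicator (fun _ => 1) := by
        ext h; simp [Set.indicator]
      rw [this, lintegral_indicator (toR_meas_set n M), setLIntegral_const, one_mul]
      rw [← mu_KK (toR M) (by rw [dt_toR]; exact_mod_cast hM.1)]
      congr 1
      ext h
      have h2 : dt (toR M) < (n:ℝ)^3 := by rw [dt_toR]; exact_mod_cast hM.2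
      simp [CM, h2])
    (by
      intro M hM h
      exact Set.indicator_of_notMem (fun h' => hM (CM_sub n h h')) _)
    (by
      intro M hM
      have : Subsingleton (MulAction.stabilizer SLZ M) := ⟨fun a b => Subtype.ext (by
        rw [stab_YM M hM.1.ne' a.1 a.2, stab_YM M hM.1.ne' b.1 b.2])⟩
      infer_instance)
  unfold orbM
  rw [← key]
  refine lintegral_congr fun h => ?_
  congr 1
  refine tsum_congr fun M => ?_
  by_cases hM : M ∈ CM n h
  · have hS := CM_sub n h hM
    have : Subsingleton (MulAction.stabilizer SLZ M) := ⟨fun a b => Subtype.ext (by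
        rw [stab_YM M hS.1.ne' a.1 a.2, stab_YM M hS.1.ne' b.1 b.2])⟩
    have : Nat.card (MulAction.stabilizer SLZ M) = 1 := Nat.card_unique
    rw [this]; simp
  · simp [hM]

theorem limM (h : M3) (hd : 0 < dt h) :
    Filter.Tendsto (fun n : ℕ => (∑' M, (CM n h).indicator (fun _ => (1:ℝ≥0∞)) M) / (n:ℝ≥0∞)^9) Filter.atTop (nhds kap) := by
  obtain ⟨h1, h2, h3, h4⟩ := Uh_props h hd
  have := count_limM _ h1 h2 h3
  rw [h4] at this
  refine this.congr' ?_
  filter_upwards [Filter.eventually_gt_atTop 0] with n hn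
  have hn' : (0:ℝ) < n := by exact_mod_cast hn
  congr 1
  refine tsum_congr fun M => ?_
  have e : (n:ℝ)⁻¹ • (fun i j => (M i j : ℝ)) ∈ {g | lmL (Matrix.adjugate (Matrix.of h)) g ∈ KK ∧ dt g < 1} ↔ M ∈ CM n h := by
    change lmL _ ((n:ℝ)⁻¹ • toR M) ∈ KK ∧ dt ((n:ℝ)⁻¹ • toR M) < 1 ↔ _
    rw [map_smul, KK_smul (by positivity), dt_smul, inv_pow, inv_mul_lt_iff₀ (by positivity), mul_one]
    rfl
  by_cases hM : M ∈ CM n h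
  · rw [Set.indicator_of_mem (e.2 hM)]; exact (Set.indicator_of_mem hM (fun _ => (1:ℝ≥0∞))).symm
  · rw [Set.indicator_of_notMem (mt e.1 hM)]; exact (Set.indicator_of_notMem hM (fun _ => (1:ℝ≥0∞))).symm

theorem row_count (T : ℝ) (hT : 0 ≤ T) :
    ((((Fintype.piFinset fun _ : Fin 3 => Finset.Icc (-⌊T⌋) ⌊T⌋).erase 0).card : ℕ) : ℝ) ≤ 27 * T ^ 3 := by
  have hf : 0 ≤ ⌊T⌋ := Int.floor_nonneg.2 hT
  have h0 : (0 : Fin 3 → ℤ) ∈ Fintype.piFinset fun _ : Fin 3 => Finset.Icc (-⌊T⌋) ⌊T⌋ := by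
    rw [Fintype.mem_piFinset]; intro i; simp [hf]
  rw [Finset.card_erase_of_mem h0, Fintype.card_piFinset]
  simp only [Int.card_Icc, Finset.prod_const, Finset.card_univ, Fintype.card_fin]
  rcases lt_or_ge T 1 with h1 | h1
  · have : ⌊T⌋ = 0 := Int.floor_eq_zero_iff.2 ⟨hT, h1⟩
    rw [this]; simp; positivity
  · have h2 : (((⌊T⌋ + 1 - -⌊T⌋).toNat : ℕ) : ℝ) ≤ 3 * T := by
      have : (((⌊T⌋ + 1 - -⌊T⌋).toNat : ℕ) : ℤ) = 2 * ⌊T⌋ + 1 := by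
        rw [Int.toNat_of_nonneg (by omega)]; ring
      have h3 : (((⌊T⌋ + 1 - -⌊T⌋).toNat : ℕ) : ℝ) = 2 * (⌊T⌋ : ℝ) + 1 := by exact_mod_cast this
      rw [h3]
      have := Int.floor_le T
      linarith
    calc _ ≤ (((⌊T⌋ + 1 - -⌊T⌋).toNat : ℕ) : ℝ) ^ 3 := by
            rw [← Nat.cast_pow]; exact_mod_cast Nat.sub_le _ _
      _ ≤ (3 * T) ^ 3 := by gcongr
      _ = _ := by ring

theorem abs_le_sqrt_dot (v : Fin 3 → ℝ) (j : Fin 3) : |v j| ≤ Real.sqrt (dot v v) := by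
  apply Real.abs_le_sqrt
  unfold dot
  fin_cases j <;> simp <;> nlinarith [sq_nonneg (v 0), sq_nonneg (v 1), sq_nonneg (v 2)]

theorem boundM (n : ℕ) (h : M3) (hs : h ∈ Sie) (h1 : 1 < dt h) (h2 : dt h < 2) :
    (∑' M, (CM n h).indicator (fun _ => (1:ℝ≥0∞)) M) ≤ ENNReal.ofReal (27^3 * 12^9 * 64) * (n:ℝ≥0∞)^9 := by
  classical
  rw [tsum_ind]
  let T : Fin 3 → ℝ := fun i => 12 * n * Real.sqrt (dot (h i) (h i))
  have hT : ∀ i, 0 ≤ T i := fun i => by positivity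
  let F : Finset (Fin 3 → Fin 3 → ℤ) := Fintype.piFinset fun i => (Fintype.piFinset fun _ : Fin 3 => Finset.Icc (-⌊T i⌋) ⌊T i⌋).erase 0
  have hsub : CM n h ⊆ (F : Set (Fin 3 → Fin 3 → ℤ)) := by
    intro M hM
    have hdz := CM_sub n h hM
    obtain ⟨hk, hd⟩ := hM
    have hdd : dt (lmL (Matrix.adjugate (Matrix.of h)) (toR M)) ≤ 4 * (n:ℝ)^3 := by
      rw [dt_lmL, Matrix.det_adjugate]
      change dt h ^ (Fintype.card (Fin 3) - 1) * _ ≤ _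
      simp only [Fintype.card_fin]
      have h0 : 0 < dt (toR M) := by rw [dt_toR]; exact_mod_cast hdz.1
      calc dt h ^ (3-1) * dt (toR M) ≤ 2 ^ 2 * (n:ℝ)^3 := by
            apply mul_le_mul _ hd.le h0.le (by norm_num)
            exact pow_le_pow_left₀ (by linarith) h2.le _
        _ = _ := by norm_num
    have hb := KK_bd hk (T := n) (by positivity) hdd
    have hMe : lmL (Matrix.of h) (lmL (Matrix.adjugate (Matrix.of h)) (toR M)) = dt h • toR M := by
      rw [← lmL_mul, Matrix.mul_adjugate, lmL_smul_left, lmL_one]; rfl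
    have hent : ∀ i j, |(M i j : ℝ)| ≤ T i := by
      intro i j
      have e := congrFun (congrFun hMe i) j
      have e2 : |dt h * (M i j : ℝ)| ≤ T i := by
        change _ = dt h * (M i j : ℝ) at e
        rw [← e]
        change |∑ k, h i k * lmL (Matrix.adjugate (Matrix.of h)) (toR M) k j| ≤ _
        refine (Finset.abs_sum_le_sum_abs _ _).trans ?_
        calc _ ≤ ∑ k : Fin 3, Real.sqrt (dot (h i) (h i)) * (4 * n) := by
              refine Finset.sum_le_sum fun k _ => ?_
              rw [abs_mul]
              exact mul_le_mul (abs_le_sqrt_dot _ _) (hb k j) (abs_nonneg _) (Real.sqrt_nonneg _)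
          _ = T i := by simp [T]; ring
      rw [abs_mul, abs_of_pos (by linarith)] at e2
      nlinarith [abs_nonneg (M i j : ℝ)]
    refine Finset.mem_coe.2 (Fintype.mem_piFinset.2 ?_)
    simp only [Fintype.mem_piFinset, Finset.mem_erase, Finset.mem_Icc]
    intro i
    refine ⟨?_, fun j => ?_⟩
    · intro hz
      have : dz M = 0 := Matrix.det_eq_zero_of_row_eq_zero i (fun j => congrFun hz j)
      have := hdz.1
      omega
    · have h3 := abs_le.1 (hent i j)
      constructor
      · rw [neg_le, Int.le_floor]; push_cast; linarith
      · rw [Int.le_floor]; exact h3.2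
  have hcard : ((F.card : ℕ) : ℝ) ≤ 27^3 * 12^9 * 64 * (n:ℝ)^9 := by
    simp only [F]
    rw [Fintype.card_piFinset, Nat.cast_prod]
    calc _ ≤ ∏ i, (27 * T i ^ 3) := Finset.prod_le_prod (fun _ _ => by positivity) (fun i _ => row_count _ (hT i))
      _ = 27^3 * 12^9 * (n:ℝ)^9 * (Real.sqrt (dot (h 0) (h 0)) * Real.sqrt (dot (h 1) (h 1)) * Real.sqrt (dot (h 2) (h 2)))^3 := by
          rw [Fin.prod_univ_three]; simp only [T]; ring
      _ ≤ 27^3 * 12^9 * (n:ℝ)^9 * 4^3 := by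
          refine mul_le_mul_of_nonneg_left (pow_le_pow_left₀ (by positivity) ?_ _) (by positivity)
          rw [← Real.sqrt_mul (dot_self_nonneg _), ← Real.sqrt_mul (mul_nonneg (dot_self_nonneg _) (dot_self_nonneg _))]
          rw [Real.sqrt_le_left (by norm_num)]
          have := (Sie_facts h hs h1 h2).2.2.2.1
          linarith
      _ = _ := by ring
  calc (((CM n h).encard : ℕ∞) : ℝ≥0∞) ≤ ((((F : Set (Fin 3 → Fin 3 → ℤ)).encard : ℕ∞)) : ℝ≥0∞) := by
        exact ENat.toENNReal_le.2 (Set.encard_le_encard hsub)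
    _ = ENNReal.ofReal ((F.card : ℕ) : ℝ) := by
        rw [Set.encard_coe_eq_coe_finsetCard, ENNReal.ofReal_natCast]; simp
    _ ≤ ENNReal.ofReal (27^3 * 12^9 * 64 * (n:ℝ)^9) := ENNReal.ofReal_le_ofReal hcard
    _ = _ := by
        rw [ENNReal.ofReal_mul (by norm_num), ENNReal.ofReal_pow (by positivity), ENNReal.ofReal_natCast]

noncomputable def v0 : ℝ≥0∞ := ∫⁻ h, wt h ∂mu

theorem Sie_int : ∫⁻ h, Sie.indicator 1 h ∂mu < ∞ := by
  refine lt_of_le_of_lt (lintegral_mono_ae ?_) Fh_int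
  filter_upwards [mu_pos_ae] with h hh
  by_cases hs : h ∈ Sie
  · simp [hs]
    exact Fh_ge_one h hs hh.1 hh.2
  · simp [hs]

theorem v0_fin : v0 < ∞ := lt_of_le_of_lt (lintegral_mono fun h => wt_le h) Sie_int

theorem tendM : Filter.Tendsto (fun n : ℕ => kap' * orbM n / (n:ℝ≥0∞)^9) Filter.atTop (nhds (v0 * kap)) := by
  have key := tendsto_lintegral_filter_of_dominated_convergence (μ := mu) (l := Filter.atTop (α := ℕ))
    (F := fun n h => wt h * ((∑' M, (CM n h).indicator (fun _ => (1:ℝ≥0∞)) M) / (n:ℝ≥0∞)^9))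
    (f := fun h => wt h * kap)
    (fun h => ENNReal.ofReal (27^3 * 12^9 * 64) * Sie.indicator 1 h)
    (Filter.Eventually.of_forall fun n => by
      refine wt_meas.mul (Measurable.div_const (Measurable.ennreal_tsum fun M => ?_) _)
      have : (fun h => (CM n h).indicator (fun _ => (1:ℝ≥0∞)) M) = {h | M ∈ CM n h}.indicator (fun _ => 1) := by
        ext h; simp [Set.indicator]
      rw [this]
      exact measurable_const.indicator (toR_meas_set n M))
    (by
      filter_upwards [Filter.eventually_gt_atTop 0] with n hn
      filter_upwards [mu_pos_ae] with h hh
      rw [mul_comm (ENNReal.ofReal _)]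
      by_cases hs : h ∈ Sie
      · refine mul_le_mul' (wt_le h) (ENNReal.div_le_of_le_mul (boundM n h hs hh.1 hh.2))
      · have : wt h = 0 := by simpa [hs] using wt_le h
        simp [this])
    (by
      rw [lintegral_const_mul _ (measurable_one.indicator Sie_meas)]
      exact ENNReal.mul_ne_top ENNReal.ofReal_ne_top Sie_int.ne)
    (by
      filter_upwards [mu_pos_ae] with h hh
      refine ENNReal.Tendsto.const_mul (limM h (by linarith [hh.1])) (Or.inr ?_)
      have := wt_le h
      refine ne_top_of_le_ne_top ?_ this
      by_cases hs : h ∈ Sie <;> simp [hs])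
  rw [lintegral_mul_const _ wt_meas] at key
  refine key.congr fun n => ?_
  simp_rw [div_eq_mul_inv, ← mul_assoc]
  rw [lintegral_mul_const, unfoldM]
  refine wt_meas.mul (Measurable.ennreal_tsum fun M => ?_)
  have : (fun h => (CM n h).indicator (fun _ => (1:ℝ≥0∞)) M) = {h | M ∈ CM n h}.indicator (fun _ => 1) := by
    ext h; simp [Set.indicator]
  rw [this]
  exact measurable_const.indicator (toR_meas_set n M)

open MvPolynomial
set_option linter.all false
open MeasureTheory ENNReal
open scoped Pointwise

theorem YM_ap (γ : SLZ) (M : YM) (i j : Fin 3) : (γ • M : YM) i j = γ.1 i 0 * M 0 j + γ.1 i 1 * M 1 j + γ.1 i 2 * M 2 j := by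
  have : (γ • M : YM) i j = ((γ : Matrix (Fin 3) (Fin 3) ℤ) * Matrix.of M) i j := rfl
  rw [this, Matrix.mul_apply, Fin.sum_univ_three]; rfl

theorem bez (p q : ℤ) : ∃ s t u v : ℤ, s * v - t * u = 1 ∧ 0 ≤ s * p + t * q ∧ u * p + v * q = 0 := by
  by_cases h : Int.gcd p q = 0
  · obtain ⟨rfl, rfl⟩ := Int.gcd_eq_zero_iff.1 h
    exact ⟨1, 0, 0, 1, by norm_num, by norm_num, by norm_num⟩
  · have hg : ((Int.gcd p q : ℕ) : ℤ) ≠ 0 := by exact_mod_cast h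
    obtain ⟨p', hp⟩ : ((Int.gcd p q : ℕ) : ℤ) ∣ p := Int.gcd_dvd_left ..
    obtain ⟨q', hq⟩ : ((Int.gcd p q : ℕ) : ℤ) ∣ q := Int.gcd_dvd_right ..
    have hb := Int.gcd_eq_gcd_ab p q
    set g : ℤ := ((Int.gcd p q : ℕ) : ℤ) with hgd
    refine ⟨Int.gcdA p q, Int.gcdB p q, -q', p', ?_, ?_, ?_⟩
    · apply mul_left_cancel₀ hg
      have e : g * (Int.gcdA p q * p' - Int.gcdB p q * -q') = (g * p') * Int.gcdA p q + (g * q') * Int.gcdB p q := by ring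
      rw [e, ← hp, ← hq, ← hb, mul_one]
    · have : Int.gcdA p q * p + Int.gcdB p q * q = g := by rw [hb]; ring
      rw [this, hgd]; positivity
    · have : -q' * p + p' * q = -q' * (g * p') + p' * (g * q') := by rw [← hp, ← hq]
      rw [this]; ring

def b12 (s t u v : ℤ) (h : s * v - t * u = 1) : SLZ := ⟨!![1, 0, 0; 0, s, t; 0, u, v], by simp [Matrix.det_fin_three]; linarith⟩
def b01 (s t u v : ℤ) (h : s * v - t * u = 1) : SLZ := ⟨!![s, t, 0; u, v, 0; 0, 0, 1], by simp [Matrix.det_fin_three]; linarith⟩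
def upp (x y z : ℤ) : SLZ := ⟨!![1, x, y; 0, 1, z; 0, 0, 1], by simp [Matrix.det_fin_three]⟩

def HN : Set YM := {M | M 1 0 = 0 ∧ M 2 0 = 0 ∧ M 2 1 = 0 ∧ 0 < M 0 0 ∧ 0 < M 1 1 ∧ 0 < M 2 2 ∧
  0 ≤ M 0 1 ∧ M 0 1 < M 1 1 ∧ 0 ≤ M 0 2 ∧ M 0 2 < M 2 2 ∧ 0 ≤ M 1 2 ∧ M 1 2 < M 2 2}

theorem dz_eq (M : YM) : dz M = M 0 0 * M 1 1 * M 2 2 - M 0 0 * M 1 2 * M 2 1 - M 0 1 * M 1 0 * M 2 2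
    + M 0 1 * M 1 2 * M 2 0 + M 0 2 * M 1 0 * M 2 1 - M 0 2 * M 1 1 * M 2 0 := by
  unfold dz; rw [Matrix.det_fin_three]; rfl

theorem HN_exists (M : YM) (hM : 0 < dz M) : ∃ γ : SLZ, γ • M ∈ HN := by
  obtain ⟨s, t, u, v, h1, -, h2⟩ := bez (M 1 0) (M 2 0)
  obtain ⟨M1, hM1⟩ : ∃ M1, M1 = b12 s t u v h1 • M := ⟨_, rfl⟩
  have e20 : M1 2 0 = 0 := by rw [hM1, YM_ap]; simp [b12]; linarith
  obtain ⟨s', t', u', v', h1', h0', h2'⟩ := bez (M1 0 0) (M1 1 0)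
  obtain ⟨M2, hM2⟩ : ∃ M2, M2 = b01 s' t' u' v' h1' • M1 := ⟨_, rfl⟩
  have f00 : 0 ≤ M2 0 0 := by rw [hM2, YM_ap]; simp [b01]; linarith
  have f10 : M2 1 0 = 0 := by rw [hM2, YM_ap]; simp [b01]; linarith
  have f20 : M2 2 0 = 0 := by rw [hM2, YM_ap]; simp [b01]; linarith
  obtain ⟨p, q, r, w, k1, k0, k2⟩ := bez (M2 1 1) (M2 2 1)
  obtain ⟨M3, hM3⟩ : ∃ M3, M3 = b12 p q r w k1 • M2 := ⟨_, rfl⟩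
  have g00 : 0 ≤ M3 0 0 := by rw [hM3, YM_ap]; simp [b12]; linarith
  have g10 : M3 1 0 = 0 := by rw [hM3, YM_ap]; simp [b12, f10, f20]
  have g20 : M3 2 0 = 0 := by rw [hM3, YM_ap]; simp [b12, f10, f20]
  have g11 : 0 ≤ M3 1 1 := by rw [hM3, YM_ap]; simp [b12]; linarith
  have g21 : M3 2 1 = 0 := by rw [hM3, YM_ap]; simp [b12]; linarith
  have hd : dz M3 = dz M := by rw [hM3, dz_smul, hM2, dz_smul, hM1, dz_smul]
  have hd2 : 0 < M3 0 0 * M3 1 1 * M3 2 2 := by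
    rw [← hd, dz_eq, g10, g20, g21] at hM; linarith
  have p00 : 0 < M3 0 0 := lt_of_le_of_ne g00 (fun h => by rw [← h] at hd2; simp at hd2)
  have p11 : 0 < M3 1 1 := lt_of_le_of_ne g11 (fun h => by rw [← h] at hd2; simp at hd2)
  have p22 : 0 < M3 2 2 := pos_of_mul_pos_right hd2 (by positivity)
  let z := - (M3 1 2 / M3 2 2)
  let x := - (M3 0 1 / M3 1 1)
  let y := - ((M3 0 2 + x * M3 1 2) / M3 2 2)
  refine ⟨upp x y z * b12 p q r w k1 * b01 s' t' u' v' h1' * b12 s t u v h1, ?_⟩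
  rw [mul_smul, mul_smul, mul_smul, ← hM1, ← hM2, ← hM3]
  have hz1 := Int.emod_nonneg (M3 1 2) p22.ne'
  have hz2 := Int.emod_lt_of_pos (M3 1 2) p22
  have hz3 := Int.emod_def (M3 1 2) (M3 2 2)
  have hx1 := Int.emod_nonneg (M3 0 1) p11.ne'
  have hx2 := Int.emod_lt_of_pos (M3 0 1) p11
  have hx3 := Int.emod_def (M3 0 1) (M3 1 1)
  have hy1 := Int.emod_nonneg (M3 0 2 + x * M3 1 2) p22.ne'
  have hy2 := Int.emod_lt_of_pos (M3 0 2 + x * M3 1 2) p22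
  have hy3 := Int.emod_def (M3 0 2 + x * M3 1 2) (M3 2 2)
  unfold HN
  have u : ∀ i j, (upp x y z).1 i j = !![1, x, y; 0, 1, z; 0, 0, 1] i j := fun i j => rfl
  simp only [Set.mem_setOf_eq, YM_ap, g10, g20, g21, u]
  simp
  have ez : M3 1 2 % M3 2 2 = M3 1 2 + z * M3 2 2 := by rw [hz3]; simp only [z]; ring
  have ex : M3 0 1 % M3 1 1 = M3 0 1 + x * M3 1 1 := by rw [hx3]; simp only [x]; ring
  have ey : (M3 0 2 + x * M3 1 2) % M3 2 2 = M3 0 2 + x * M3 1 2 + y * M3 2 2 := by rw [hy3]; simp only [y]; ring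
  rw [ez] at hz1 hz2
  rw [ex] at hx1 hx2
  rw [ey] at hy1 hy2
  and_intros <;> linarith

theorem HN_unique (M : YM) (γ : SLZ) (h1 : M ∈ HN) (h2 : γ • M ∈ HN) : γ • M = M := by
  obtain ⟨a1, a2, a3, a4, a5, a6, a7, a8, a9, a10, a11, a12⟩ := h1
  obtain ⟨b1, b2, b3, b4, b5, b6, b7, b8, b9, b10, b11, b12⟩ := h2
  simp only [YM_ap, a1, a2, a3, mul_zero, add_zero] at b1 b2 b3 b4 b5 b6 b7 b8 b9 b10 b11 b12
  have g10 : γ.1 1 0 = 0 := (mul_eq_zero.1 b1).resolve_right a4.ne'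
  have g20 : γ.1 2 0 = 0 := (mul_eq_zero.1 b2).resolve_right a4.ne'
  rw [g20, zero_mul, zero_add] at b3
  have g21 : γ.1 2 1 = 0 := (mul_eq_zero.1 b3).resolve_right a5.ne'
  have hd := γ.2
  rw [Matrix.det_fin_three, g10, g20, g21] at hd
  have hd' : γ.1 0 0 * γ.1 1 1 * γ.1 2 2 = 1 := by linarith
  simp only [g10, g20, g21, zero_mul, zero_add] at b5 b6 b8 b10 b11 b12
  have p0 : 0 < γ.1 0 0 := pos_of_mul_pos_left b4 a4.le
  have p1 : 0 < γ.1 1 1 := pos_of_mul_pos_left b5 a5.le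
  have p2 : 0 < γ.1 2 2 := pos_of_mul_pos_left b6 a6.le
  have q2 : γ.1 2 2 = 1 := by
    have : γ.1 2 2 ∣ 1 := ⟨γ.1 0 0 * γ.1 1 1, by linarith⟩
    exact Int.eq_one_of_dvd_one p2.le this
  have q1 : γ.1 1 1 = 1 := by
    have : γ.1 1 1 ∣ 1 := ⟨γ.1 0 0 * γ.1 2 2, by linarith⟩
    exact Int.eq_one_of_dvd_one p1.le this
  have q0 : γ.1 0 0 = 1 := by
    have : γ.1 0 0 ∣ 1 := ⟨γ.1 1 1 * γ.1 2 2, by linarith⟩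
    exact Int.eq_one_of_dvd_one p0.le this
  rw [q0] at b7 b8 b9 b10
  rw [q1] at b8 b11 b12
  rw [q2] at b10 b12
  have small : ∀ x y c k : ℤ, 0 ≤ x → x < c → 0 ≤ x + k * c → x + k * c < c → k = 0 := by
    intro x y c k h1 h2 h3 h4
    have hc : 0 < c := by linarith
    have : k < 1 := by nlinarith
    have : -1 < k := by nlinarith
    omega
  have q12 : γ.1 1 2 = 0 := small (M 1 2) 0 (M 2 2) _ a11 a12 (by linarith) (by linarith)
  have q01 : γ.1 0 1 = 0 := small (M 0 1) 0 (M 1 1) _ a7 a8 (by linarith) (by linarith)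
  rw [q01] at b9 b10
  have q02 : γ.1 0 2 = 0 := small (M 0 2) 0 (M 2 2) _ a9 a10 (by linarith) (by linarith)
  have : γ = 1 := by
    apply Subtype.ext
    ext i j
    fin_cases i <;> fin_cases j
    · simpa using q0
    · simpa using q01
    · simpa using q02
    · simpa using g10
    · simpa using q1
    · simpa using q12
    · simpa using g20
    · simpa using g21
    · simpa using q2
  rw [this, one_smul]

theorem orbM_HN (n : ℕ) : orbM n = (((HN ∩ SM n).encard : ℕ∞) : ℝ≥0∞) := by
  unfold orbM
  congr 1
  have hS : ∀ (γ : SLZ) M, M ∈ SM n → γ • M ∈ SM n := by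
    intro γ M hM; unfold SM; simp only [Set.mem_setOf_eq, dz_smul]; exact hM
  have himg : {o : Set YM | ∃ y ∈ SM n, o = MulAction.orbit SLZ y} = (fun y => MulAction.orbit SLZ y) '' (HN ∩ SM n) := by
    ext o
    constructor
    · rintro ⟨y, hy, rfl⟩
      obtain ⟨γ, hγ⟩ := HN_exists y hy.1
      exact ⟨γ • y, ⟨hγ, hS γ y hy⟩, MulAction.orbit_smul γ y⟩
    · rintro ⟨y, hy, rfl⟩
      exact ⟨y, hy.2, rfl⟩
  rw [himg, Set.InjOn.encard_image]
  intro y hy y' hy' h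
  have : y' ∈ MulAction.orbit SLZ y := by
    have h' : MulAction.orbit SLZ y = MulAction.orbit SLZ y' := h
    rw [h']; exact MulAction.mem_orbit_self _
  obtain ⟨γ, rfl⟩ := this
  exact (HN_unique y γ hy.1 hy'.1).symm

/-- tuple (a,b,c,x,y,z) to matrix -/
def mkH (t : ℕ × ℕ × ℕ × ℕ × ℕ × ℕ) : YM :=
  ![![(t.1 : ℤ) + 1, t.2.2.2.1, t.2.2.2.2.1], ![0, (t.2.1 : ℤ) + 1, t.2.2.2.2.2], ![0, 0, (t.2.2.1 : ℤ) + 1]]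

def QH (n : ℕ) : Set (ℕ × ℕ × ℕ × ℕ × ℕ × ℕ) := {t | (t.1 + 1) * (t.2.1 + 1) * (t.2.2.1 + 1) < n ^ 3 ∧
  t.2.2.2.1 < t.2.1 + 1 ∧ t.2.2.2.2.1 < t.2.2.1 + 1 ∧ t.2.2.2.2.2 < t.2.2.1 + 1}

theorem mkH_inj : Function.Injective mkH := by
  rintro ⟨a, b, c, x, y, z⟩ ⟨a', b', c', x', y', z'⟩ h
  have e := fun i j => congrFun (congrFun h i) j
  have e00 := e 0 0
  have e01 := e 0 1
  have e02 := e 0 2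
  have e11 := e 1 1
  have e12 := e 1 2
  have e22 := e 2 2
  simp [mkH] at e00 e01 e02 e11 e12 e22
  simp [*]

theorem dz_mkH (t) : dz (mkH t) = ((t.1:ℤ) + 1) * ((t.2.1:ℤ) + 1) * ((t.2.2.1:ℤ) + 1) := by
  rw [dz_eq]; simp [mkH]

theorem HN_QH (n : ℕ) : HN ∩ SM n = mkH '' QH n := by
  ext M
  constructor
  · rintro ⟨⟨a1, a2, a3, a4, a5, a6, a7, a8, a9, a10, a11, a12⟩, h1, h2⟩
    have hM : M = mkH ((M 0 0 - 1).toNat, (M 1 1 - 1).toNat, (M 2 2 - 1).toNat, (M 0 1).toNat, (M 0 2).toNat, (M 1 2).toNat) := by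
      funext i j
      fin_cases i <;> fin_cases j <;> simp [mkH] <;> omega
    refine ⟨_, ?_, hM.symm⟩
    rw [hM, dz_mkH] at h2
    refine ⟨?_, ?_, ?_, ?_⟩
    · exact_mod_cast h2
    · change (M 0 1).toNat < (M 1 1 - 1).toNat + 1; omega
    · change (M 0 2).toNat < (M 2 2 - 1).toNat + 1; omega
    · change (M 1 2).toNat < (M 2 2 - 1).toNat + 1; omega
  · rintro ⟨t, ⟨h1, h2, h3, h4⟩, rfl⟩
    refine ⟨?_, ?_, ?_⟩
    · refine ⟨rfl, rfl, rfl, ?_, ?_, ?_, ?_, ?_, ?_, ?_, ?_, ?_⟩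
      · change (0:ℤ) < (t.1:ℤ) + 1; omega
      · change (0:ℤ) < (t.2.1:ℤ) + 1; omega
      · change (0:ℤ) < (t.2.2.1:ℤ) + 1; omega
      · change (0:ℤ) ≤ (t.2.2.2.1:ℤ); omega
      · change (t.2.2.2.1:ℤ) < (t.2.1:ℤ) + 1; omega
      · change (0:ℤ) ≤ (t.2.2.2.2.1:ℤ); omega
      · change (t.2.2.2.2.1:ℤ) < (t.2.2.1:ℤ) + 1; omega
      · change (0:ℤ) ≤ (t.2.2.2.2.2:ℤ); omega
      · change (t.2.2.2.2.2:ℤ) < (t.2.2.1:ℤ) + 1; omega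
    · rw [dz_mkH]; positivity
    · rw [dz_mkH]; exact_mod_cast h1

open MvPolynomial
set_option linter.all false
open MeasureTheory ENNReal
open scoped Pointwise

theorem tsum_lt (k : ℕ) : ∑' x : ℕ, (if x < k then (1:ℝ≥0∞) else 0) = k := by
  rw [tsum_eq_sum (s := Finset.range k)]
  · rw [Finset.sum_congr rfl (fun x hx => if_pos (Finset.mem_range.1 hx))]; simp
  · intro x hx; rw [if_neg]; simpa using hx

theorem orbM_sum (n : ℕ) : orbM n = ∑' a : ℕ, ∑' b : ℕ, ∑' c : ℕ,
    (if (a+1)*(b+1)*(c+1) < n^3 then ((b:ℝ≥0∞)+1) * ((c:ℝ≥0∞)+1)^2 else 0) := by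
  classical
  rw [orbM_HN, HN_QH, Function.Injective.encard_image mkH_inj, ← tsum_ind]
  rw [ENNReal.tsum_prod']
  refine tsum_congr fun a => ?_
  rw [ENNReal.tsum_prod']
  refine tsum_congr fun b => ?_
  rw [ENNReal.tsum_prod']
  refine tsum_congr fun c => ?_
  rw [ENNReal.tsum_prod']
  have e : ∀ x y z, (QH n).indicator (fun _ => (1:ℝ≥0∞)) (a, b, c, x, y, z) =
      (if (a+1)*(b+1)*(c+1) < n^3 then 1 else 0) * ((if x < b+1 then 1 else 0) * ((if y < c+1 then 1 else 0) * (if z < c+1 then 1 else 0))) := by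
    intro x y z
    simp only [Set.indicator, QH, Set.mem_setOf_eq]
    split_ifs <;> first | (exfalso; tauto) | (simp; done)
  have e2 : ∀ x, ∑' p : ℕ × ℕ, (QH n).indicator (fun _ => (1:ℝ≥0∞)) (a, b, c, x, p) =
     (if (a+1)*(b+1)*(c+1) < n^3 then 1 else 0) * ((if x < b+1 then 1 else 0) * (((c:ℝ≥0∞)+1) * ((c:ℝ≥0∞)+1))) := by
    intro x
    rw [ENNReal.tsum_prod']
    simp_rw [e, ENNReal.tsum_mul_left, ENNReal.tsum_mul_right, tsum_lt]
    push_cast; rfl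
  simp_rw [e2, ENNReal.tsum_mul_left, ENNReal.tsum_mul_right, tsum_lt]
  push_cast
  split_ifs
  · ring
  · simp

theorem innr_sum (N k : ℕ) (hk : 0 < k) : ∑' c : ℕ, (if k*(c+1) < N then ((c:ℝ≥0∞)+1)^2 else 0)
    = ∑ c ∈ Finset.range ((N-1)/k), ((c:ℝ≥0∞)+1)^2 := by
  have hiff : ∀ c, k*(c+1) < N ↔ c < (N-1)/k := by
    intro c
    rw [Nat.lt_iff_add_one_le (m := c), Nat.le_div_iff_mul_le hk, mul_comm k (c+1)]
    have : 0 < (c+1) * k := by positivity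
    generalize (c+1) * k = z at *
    omega
  rw [tsum_eq_sum (s := Finset.range ((N-1)/k))]
  · refine Finset.sum_congr rfl fun c hc => if_pos ((hiff c).2 (Finset.mem_range.1 hc))
  · intro c hc; rw [if_neg]; rw [hiff]; simpa using hc

noncomputable def sq_sum (m : ℕ) : ℝ := ∑ c ∈ Finset.range m, ((c:ℝ)+1)^2
theorem sq_sum_eq (m : ℕ) : sq_sum m = m * (m+1) * (2*m+1) / 6 := by
  unfold sq_sum
  induction m with
  | zero => simp
  | succ m ih => rw [Finset.sum_range_succ, ih]; push_cast; ring
theorem sq_sum_le (m : ℕ) : sq_sum m ≤ (m:ℝ)^3 := by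
  rw [sq_sum_eq]
  rcases Nat.eq_zero_or_pos m with rfl | h
  · simp
  · have : (1:ℝ) ≤ m := by exact_mod_cast h
    nlinarith [mul_nonneg (sub_nonneg.2 this) (sub_nonneg.2 this), pow_pos (by linarith : (0:ℝ) < m) 2, mul_pos (by linarith : (0:ℝ) < m) (by linarith : (0:ℝ) < m)]
theorem sq_sum_nonneg (m : ℕ) : 0 ≤ sq_sum m := Finset.sum_nonneg fun _ _ => by positivity

noncomputable def fab (n : ℕ) (p : ℕ × ℕ) : ℝ := (p.2 + 1) * sq_sum ((n^3-1)/((p.1+1)*(p.2+1))) / (n:ℝ)^9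

theorem div_le' (N k : ℕ) : (((N-1)/k : ℕ) : ℝ) ≤ N / k := by
  refine Nat.cast_div_le.trans ?_
  gcongr
  exact Nat.sub_le _ _

theorem fab_le (n : ℕ) (p : ℕ × ℕ) : fab n p ≤ (1/((p.1:ℝ)+1)^3) * (1/((p.2:ℝ)+1)^2) := by
  unfold fab
  rcases Nat.eq_zero_or_pos n with rfl | hn
  · simp; positivity
  have hn' : (0:ℝ) < n := by exact_mod_cast hn
  have h1 := sq_sum_le ((n^3-1)/((p.1+1)*(p.2+1)))
  have h2 := div_le' (n^3) ((p.1+1)*(p.2+1))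
  have h3 : sq_sum ((n^3-1)/((p.1+1)*(p.2+1))) ≤ ((n:ℝ)^3/(((p.1:ℝ)+1)*((p.2:ℝ)+1)))^3 := by
    refine h1.trans (pow_le_pow_left₀ (by positivity) ?_ _)
    exact_mod_cast h2
  rw [div_le_iff₀ (by positivity)]
  calc _ ≤ ((p.2:ℝ)+1) * ((n:ℝ)^3/(((p.1:ℝ)+1)*((p.2:ℝ)+1)))^3 := by gcongr
    _ = _ := by field_simp

theorem orbM_fab (n : ℕ) (hn : 0 < n) : orbM n / (n:ℝ≥0∞)^9 = ENNReal.ofReal (∑' p, fab n p) := by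
  rw [orbM_sum]
  have e : ∀ a b : ℕ, ∑' c : ℕ, (if (a+1)*(b+1)*(c+1) < n^3 then ((b:ℝ≥0∞)+1) * ((c:ℝ≥0∞)+1)^2 else 0) / (n:ℝ≥0∞)^9 =
      ENNReal.ofReal (fab n (a,b)) := by
    intro a b
    have e1 : ∀ c : ℕ, (if (a+1)*(b+1)*(c+1) < n^3 then ((b:ℝ≥0∞)+1) * ((c:ℝ≥0∞)+1)^2 else 0) =
       ((b:ℝ≥0∞)+1) * (if (a+1)*(b+1)*(c+1) < n^3 then ((c:ℝ≥0∞)+1)^2 else 0) := by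
      intro c; split_ifs <;> simp
    simp_rw [e1, div_eq_mul_inv]
    rw [ENNReal.tsum_mul_right, ENNReal.tsum_mul_left, innr_sum _ _ (by positivity)]
    unfold fab sq_sum
    rw [ENNReal.ofReal_div_of_pos (by positivity), ENNReal.ofReal_mul (by positivity), ENNReal.ofReal_sum_of_nonneg (fun _ _ => by positivity)]
    rw [div_eq_mul_inv, ENNReal.ofReal_pow (by positivity), ENNReal.ofReal_natCast]
    congr 2
    · rw [ENNReal.ofReal_add (by positivity) (by positivity)]; simp
    · refine Finset.sum_congr rfl fun c _ => ?_
      rw [ENNReal.ofReal_pow (by positivity), ENNReal.ofReal_add (by positivity) (by positivity)]; simp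
  have hnn : ∀ p, 0 ≤ fab n p := fun p => by
    unfold fab
    have := sq_sum_nonneg ((n^3-1)/((p.1+1)*(p.2+1)))
    positivity
  have hsum : Summable (fab n) := by
    refine Summable.of_nonneg_of_le hnn (fab_le n) ?_
    have s3 : Summable (fun a : ℕ => 1/((a:ℝ)+1)^3) := by
      have := (summable_nat_add_iff 1).2 (Real.summable_one_div_nat_pow.2 (by norm_num : 1 < 3))
      simpa using this
    have s2 : Summable (fun a : ℕ => 1/((a:ℝ)+1)^2) := by
      have := (summable_nat_add_iff 1).2 (Real.summable_one_div_nat_pow.2 (by norm_num : 1 < 2))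
      simpa using this
    exact s3.mul_of_nonneg s2 (fun _ => by positivity) (fun _ => by positivity)
  rw [ENNReal.ofReal_tsum_of_nonneg hnn hsum, ENNReal.tsum_prod', div_eq_mul_inv, ← ENNReal.tsum_mul_right]
  refine tsum_congr fun a => ?_
  rw [← ENNReal.tsum_mul_right]
  refine tsum_congr fun b => ?_
  rw [← ENNReal.tsum_mul_right, ← e]
  simp_rw [div_eq_mul_inv]

theorem fab_lim (p : ℕ × ℕ) : Filter.Tendsto (fun n => fab n p) Filter.atTop (nhds ((1/3) * ((1/((p.1:ℝ)+1)^3) * (1/((p.2:ℝ)+1)^2)))) := by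
  set k : ℕ := (p.1+1)*(p.2+1) with hk
  have hk0 : 0 < k := by positivity
  have hkR : (0:ℝ) < k := by exact_mod_cast hk0
  have hinv : Filter.Tendsto (fun n : ℕ => ((n:ℝ)^3)⁻¹) Filter.atTop (nhds 0) := by
    refine tendsto_inv_atTop_zero.comp ((Filter.tendsto_pow_atTop (by norm_num)).comp tendsto_natCast_atTop_atTop)
  have hm : Filter.Tendsto (fun n : ℕ => (((n^3-1)/k : ℕ):ℝ) * ((n:ℝ)^3)⁻¹) Filter.atTop (nhds (1/k)) := by
    have hl : Filter.Tendsto (fun n : ℕ => (1:ℝ)/k - ((n:ℝ)^3)⁻¹) Filter.atTop (nhds (1/k)) := by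
      simpa using hinv.const_sub ((1:ℝ)/k)
    refine tendsto_of_tendsto_of_tendsto_of_le_of_le' hl tendsto_const_nhds ?_ ?_
    · filter_upwards [Filter.eventually_gt_atTop 0] with n hn
      have hn' : (0:ℝ) < n := by exact_mod_cast hn
      have h1 : n^3 ≤ k * ((n^3-1)/k + 1) := by
        have := Nat.lt_mul_div_succ (n^3-1) hk0
        have : 0 < n^3 := by positivity
        omega
      have h2 : ((n:ℝ)^3) ≤ k * ((((n^3-1)/k : ℕ):ℝ) + 1) := by exact_mod_cast h1
      rw [← sub_nonneg]
      have : (((n^3-1)/k : ℕ):ℝ) * ((n:ℝ)^3)⁻¹ - (1/k - ((n:ℝ)^3)⁻¹) = (k * ((((n^3-1)/k : ℕ):ℝ) + 1) - (n:ℝ)^3) / (k * (n:ℝ)^3) := by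
        field_simp; ring
      rw [this]
      exact div_nonneg (by linarith) (by positivity)
    · filter_upwards [Filter.eventually_gt_atTop 0] with n hn
      have hn' : (0:ℝ) < n := by exact_mod_cast hn
      have := div_le' (n^3) k
      rw [← div_eq_mul_inv, div_le_iff₀ (by positivity)]
      refine this.trans (le_of_eq ?_)
      push_cast; ring
  have h := ((hm.mul (hm.add hinv)).mul ((hm.const_mul 2).add hinv)).const_mul (((p.2:ℝ)+1)/6)
  have e : (((p.2:ℝ)+1)/6) * (1/(k:ℝ) * (1/(k:ℝ) + 0) * (2 * (1/(k:ℝ)) + 0)) = (1/3) * ((1/((p.1:ℝ)+1)^3) * (1/((p.2:ℝ)+1)^2)) := by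
    rw [hk]; push_cast; field_simp; ring
  rw [e] at h
  refine h.congr' ?_
  filter_upwards [Filter.eventually_gt_atTop 0] with n hn
  have hn' : (0:ℝ) < n := by exact_mod_cast hn
  unfold fab
  rw [sq_sum_eq, ← hk]
  field_simp

theorem orbM_lim : Filter.Tendsto (fun n : ℕ => orbM n / (n:ℝ≥0∞)^9) Filter.atTop (nhds (ENNReal.ofReal (zeta2 * zeta3 / 3))) := by
  have s3 : Summable (fun a : ℕ => 1/((a:ℝ)+1)^3) := by
    have := (summable_nat_add_iff 1).2 (Real.summable_one_div_nat_pow.2 (by norm_num : 1 < 3))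
    simpa using this
  have s2 : Summable (fun a : ℕ => 1/((a:ℝ)+1)^2) := by
    have := (summable_nat_add_iff 1).2 (Real.summable_one_div_nat_pow.2 (by norm_num : 1 < 2))
    simpa using this
  have s32 := s3.mul_of_nonneg s2 (fun _ => by positivity) (fun _ => by positivity)
  have key := tendsto_tsum_of_dominated_convergence (f := fun n p => fab n p) (𝓕 := Filter.atTop) s32 fab_lim
    (Filter.Eventually.of_forall fun n p => by
      rw [Real.norm_of_nonneg]
      · exact fab_le n p
      · unfold fab
        have := sq_sum_nonneg ((n^3-1)/((p.1+1)*(p.2+1)))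
        positivity)
  have e : ∑' p : ℕ × ℕ, (1/3 : ℝ) * ((1/((p.1:ℝ)+1)^3) * (1/((p.2:ℝ)+1)^2)) = zeta2 * zeta3 / 3 := by
    rw [tsum_mul_left, ← s3.tsum_mul_tsum s2 s32]
    unfold zeta2 zeta3
    ring
  rw [e] at key
  refine (ENNReal.tendsto_ofReal key).congr' ?_
  filter_upwards [Filter.eventually_gt_atTop 0] with n hn
  rw [orbM_fab n hn]

/-- the constant: covolume computation -/
theorem v0_kap : v0 * kap = kap' * ENNReal.ofReal (zeta2 * zeta3 / 3) := by
  refine tendsto_nhds_unique tendM ?_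
  refine Filter.Tendsto.congr (fun n => (mul_div_assoc _ _ _).symm) ?_
  exact ENNReal.Tendsto.const_mul orbM_lim (Or.inr kap'_fin.ne)

open MvPolynomial
set_option linter.all false
open MeasureTheory ENNReal
open scoped Pointwise

section Sseven
variable {F : Type*} [Field F]

theorem noncube [Fintype F] (h3 : 3 ∣ Fintype.card F - 1) : ∃ u : F, u ≠ 0 ∧ ∀ t : F, t ^ 3 ≠ u := by
  classical
  haveI : Fact (Nat.Prime 3) := ⟨Nat.prime_three⟩
  rw [← Fintype.card_units] at h3
  obtain ⟨w, hw⟩ := exists_prime_orderOf_dvd_card 3 h3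
  have hni : ¬ Function.Injective (fun t : Fˣ => t ^ 3) := by
    intro hi
    have : w = 1 := hi (by simp [← hw, pow_orderOf_eq_one])
    rw [this, orderOf_one] at hw
    norm_num at hw
  rw [Finite.injective_iff_surjective] at hni
  simp only [Function.Surjective, not_forall, not_exists] at hni
  obtain ⟨u, hu⟩ := hni
  refine ⟨u, u.ne_zero, fun t ht => ?_⟩
  have ht0 : t ≠ 0 := by rintro rfl; apply u.ne_zero; rw [← ht]; simp
  exact hu (Units.mk0 t ht0) (by ext; simpa using ht)

/-- the Hesse form x³+u y³+u² z³+d xyz -/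
def hsf (u d : F) : Fin 10 → F := ![1, u, u ^ 2, 0, 0, 0, 0, 0, 0, d]

theorem fe_hsf (u d : F) (v : Fin 3 → F) : fe (hsf u d) v = v 0 ^ 3 + u * v 1 ^ 3 + u ^ 2 * v 2 ^ 3 + d * (v 0 * v 1 * v 2) := by
  simp [fe, hsf]; ring

theorem he_hsf (u d : F) (v : Fin 3 → F) : he (hsf u d) v =
    8 * (27 * u ^ 3 + d ^ 3) * (v 0 * v 1 * v 2) - 6 * d ^ 2 * fe (hsf u d) v := by
  rw [fe_hsf]
  simp [he, hsf, Matrix.det_fin_three]; ring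

theorem noz {u : F} (hu : ∀ t : F, t ^ 3 ≠ u) (x y : F) (h : x ^ 3 + u * y ^ 3 = 0) : x = 0 ∧ y = 0 := by
  have hy : y = 0 := by
    by_contra hy
    apply hu (-x / y)
    field_simp
    linear_combination -h
  subst hy
  simpa using h

theorem noz2 {u : F} (h0 : u ≠ 0) (hu : ∀ t : F, t ^ 3 ≠ u) (x y : F) (h : x ^ 3 + u ^ 2 * y ^ 3 = 0) : x = 0 ∧ y = 0 := by
  have hx : x = 0 := by
    by_contra hx
    apply hu (-u * y / x)
    field_simp
    linear_combination -h
  subst hx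
  simpa [h0] using h

theorem hsf_flexless (h2 : (2:F) ≠ 0) {u d : F} (h0 : u ≠ 0) (hu : ∀ t : F, t ^ 3 ≠ u) (hd : 27 * u ^ 3 + d ^ 3 ≠ 0)
    (v : Fin 3 → F) (h1 : fe (hsf u d) v = 0) (hh : he (hsf u d) v = 0) : v = 0 := by
  rw [he_hsf, h1] at hh
  have h8 : (8:F) ≠ 0 := by
    have : (8:F) = 2 ^ 3 := by norm_num
    rw [this]; exact pow_ne_zero _ h2
  have hx : v 0 * v 1 * v 2 = 0 := by
    simpa [h8, hd] using hh
  rw [fe_hsf, hx] at h1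
  have : v 0 = 0 ∧ v 1 = 0 ∧ v 2 = 0 := by
    rcases mul_eq_zero.1 hx with h | h
    · rcases mul_eq_zero.1 h with h | h
      · rw [h] at h1
        have := noz hu (v 1) (v 2) (mul_left_cancel₀ h0 (by linear_combination h1))
        exact ⟨h, this⟩
      · rw [h] at h1
        have := noz2 h0 hu (v 0) (v 2) (by linear_combination h1)
        exact ⟨this.1, h, this.2⟩
    · rw [h] at h1
      have := noz hu (v 0) (v 1) (by linear_combination h1)
      exact ⟨this.1, this.2, h⟩
  funext i; fin_cases i <;> simp [this]

theorem three_forms [Fintype F] (hF : 3 < Fintype.card F) (a b : Fin 3 → F)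
    (h : ∀ t : F, (a 0 + t * b 0) * (a 1 + t * b 1) * (a 2 + t * b 2) = 0) : ∃ j, a j = 0 ∧ b j = 0 := by
  have : ∀ t : F, ∃ j : Fin 3, a j + t * b j = 0 := by
    intro t
    rcases mul_eq_zero.1 (h t) with h | h
    · rcases mul_eq_zero.1 h with h | h
      · exact ⟨0, h⟩
      · exact ⟨1, h⟩
    · exact ⟨2, h⟩
  choose f hf using this
  obtain ⟨s, t, hst, hj⟩ := Fintype.exists_ne_map_eq_of_card_lt f (by simpa using hF)
  have e1 := hf s
  have e2 := hf t
  rw [← hj] at e2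
  have hb : b (f s) = 0 := by
    have : (s - t) * b (f s) = 0 := by linear_combination e1 - e2
    rcases mul_eq_zero.1 this with h | h
    · exact absurd (sub_eq_zero.1 h) hst
    · exact h
  exact ⟨f s, by simpa [hb] using e1, hb⟩

def hv3 (u : F) : Fin 3 → F := ![1, u, u ^ 2]

theorem fin3_aux (j j' k l : Fin 3) (h : j' ≠ j) (h' : k ≠ l) : j = k ∨ j = l ∨ j' = k ∨ j' = l := by omega

theorem hsf_uniq [Fintype F] (hF : 3 < Fintype.card F) (h2 : (2:F) ≠ 0) {u d d' : F} (h0 : u ≠ 0) (hu : ∀ t : F, t ^ 3 ≠ u)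
    (hd : 27 * u ^ 3 + d ^ 3 ≠ 0) (g : Matrix (Fin 3) (Fin 3) F) (hg : g.det ≠ 0) (h : act g (hsf u d) = hsf u d') :
    ∀ i j j', g i j ≠ 0 → j' ≠ j → g i j' = 0 := by
  have h8 : (8:F) ≠ 0 := by
    have : (8:F) = 2 ^ 3 := by norm_num
    rw [this]; exact pow_ne_zero _ h2
  set K := g.det ^ 2 * (8 * (27 * u ^ 3 + d ^ 3)) with hK
  have hK0 : K ≠ 0 := by rw [hK]; exact mul_ne_zero (pow_ne_zero _ hg) (mul_ne_zero h8 hd)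
  have key : ∀ v : Fin 3 → F, ∃ w : Fin 3 → F, w = Matrix.vecMul v g ∧ K * (w 0 * w 1 * w 2) = 8 * (27 * u ^ 3 + d' ^ 3) * (v 0 * v 1 * v 2)
      + (g.det ^ 2 * (6 * d ^ 2) - 6 * d' ^ 2) * fe (hsf u d') v := by
    intro v
    refine ⟨_, rfl, ?_⟩
    have e1 := fe_act g (hsf u d) v
    have e2 := he_act g (hsf u d) v
    rw [h] at e1 e2
    rw [he_hsf, he_hsf, ← e1] at e2
    rw [hK]
    linear_combination -e2
  have hcol : ∀ v : Fin 3 → F, ∀ j, Matrix.vecMul v g j = v 0 * g 0 j + v 1 * g 1 j + v 2 * g 2 j := by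
    intro v j; simp [Matrix.vecMul, dotProduct, Fin.sum_univ_three]
  have hb : g.det ^ 2 * (6 * d ^ 2) - 6 * d' ^ 2 = 0 := by
    by_contra hne
    have main : ∀ x y : F, x * g 0 0 + y * g 1 0 = 0 → x = 0 ∧ y = 0 := by
      intro x y hxy
      obtain ⟨w, hw, hk⟩ := key ![x, y, 0]
      have hw0 : w 0 = 0 := by rw [hw, hcol]; simpa using hxy
      rw [hw0, fe_hsf] at hk
      simp at hk
      rcases hk with hk | hk
      · exact absurd hk hne
      · exact noz hu x y hk
    have m1 := main (g 1 0) (-g 0 0) (by ring)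
    have m2 := main 1 0 (by rw [neg_eq_zero.1 m1.2]; simp)
    exact one_ne_zero m2.1
  have key2 : ∀ v : Fin 3 → F, v 0 * v 1 * v 2 = 0 → (v 0 * g 0 0 + v 1 * g 1 0 + v 2 * g 2 0) * (v 0 * g 0 1 + v 1 * g 1 1 + v 2 * g 2 1)
      * (v 0 * g 0 2 + v 1 * g 1 2 + v 2 * g 2 2) = 0 := by
    intro v hv
    obtain ⟨w, hw, hk⟩ := key v
    rw [hb, hv, mul_zero, zero_mul, zero_add, hw, hcol, hcol, hcol] at hk
    exact (mul_eq_zero.1 hk).resolve_left hK0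
  obtain ⟨j01, a1, a2⟩ := three_forms hF (fun j => g 0 j) (fun j => g 1 j) (fun t => by simpa using key2 ![1, t, 0] (by simp))
  obtain ⟨j02, b1, b2⟩ := three_forms hF (fun j => g 0 j) (fun j => g 2 j) (fun t => by simpa using key2 ![1, 0, t] (by simp))
  obtain ⟨j12, c1, c2⟩ := three_forms hF (fun j => g 1 j) (fun j => g 2 j) (fun t => by simpa using key2 ![0, 1, t] (by simp))
  have hnz : ∀ j, ¬ (g 0 j = 0 ∧ g 1 j = 0 ∧ g 2 j = 0) := by
    rintro j ⟨e0, e1, e2⟩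
    apply hg
    apply Matrix.det_eq_zero_of_column_eq_zero j
    intro i; fin_cases i <;> assumption
  have n1 : j01 ≠ j02 := by rintro rfl; exact hnz _ ⟨a1, a2, b2⟩
  have n2 : j01 ≠ j12 := by rintro rfl; exact hnz _ ⟨a1, a2, c2⟩
  have n3 : j02 ≠ j12 := by rintro rfl; exact hnz _ ⟨b1, c1, b2⟩
  ·
    intro i j j' hne hjj
    have := fun k l (_ : Fin 3) => fin3_aux j j' k l hjj
    fin_cases i
    · rcases this j01 j02 j01 n1 with h | h | h | h <;> subst h <;> first | assumption | exact absurd ‹_› hne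
    · rcases this j01 j12 j01 n2 with h | h | h | h <;> subst h <;> first | assumption | exact absurd ‹_› hne
    · rcases this j02 j12 j01 n3 with h | h | h | h <;> subst h <;> first | assumption | exact absurd ‹_› hne

theorem hsf_mono [Fintype F] (hF : 3 < Fintype.card F) (h2 : (2:F) ≠ 0) {u d d' : F} (h0 : u ≠ 0) (hu : ∀ t : F, t ^ 3 ≠ u)
    (hd : 27 * u ^ 3 + d ^ 3 ≠ 0) (g : Matrix (Fin 3) (Fin 3) F) (hg : g.det ≠ 0) (h : act g (hsf u d) = hsf u d') (i j : Fin 3)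
    (hij : g i j ≠ 0) : hv3 u j * g i j ^ 3 = hv3 u i := by
  have uniq := hsf_uniq hF h2 h0 hu hd g hg h
  have hfe : fe (hsf u d) (g i) = hv3 u i := by
    have e0 : fe (hsf u d) (g 0) = 1 := (congrFun h 0)
    have e1 : fe (hsf u d) (g 1) = u := (congrFun h 1)
    have e2 : fe (hsf u d) (g 2) = u ^ 2 := (congrFun h 2)
    clear * - e0 e1 e2
    fin_cases i
    · exact e0
    · exact e1
    · exact e2
  rw [fe_hsf] at hfe
  rw [← hfe]
  clear hfe h
  fin_cases j
  · have p1 := uniq i 0 1 hij (by decide)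
    have p2 := uniq i 0 2 hij (by decide)
    rw [p1, p2]; change 1 * g i 0 ^ 3 = _; ring
  · have p1 := uniq i 1 0 hij (by decide)
    have p2 := uniq i 1 2 hij (by decide)
    rw [p1, p2]; change u * g i 1 ^ 3 = _; ring
  · have p1 := uniq i 2 0 hij (by decide)
    have p2 := uniq i 2 1 hij (by decide)
    rw [p1, p2]; change u ^ 2 * g i 2 ^ 3 = _; ring

/-- flexless forms -/
def Flx (F : Type*) [Field F] : Set (Fin 10 → F) := {c | ∀ v : Fin 3 → F, fe c v = 0 → he c v = 0 → v = 0}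

theorem cube_roots_card [Fintype F] [DecidableEq F] (a b : F) (ha : a ≠ 0) : (Finset.univ.filter (fun t : F => a * t ^ 3 = b)).card ≤ 3 := by
  have hne : (Polynomial.C a * Polynomial.X ^ 3 - Polynomial.C b : Polynomial F) ≠ 0 := by
    intro h
    have := congrArg (fun p => Polynomial.coeff p 3) h
    simp [Polynomial.coeff_C] at this
    exact ha this
  have hsub : (Finset.univ.filter (fun t : F => a * t ^ 3 = b)) ⊆ (Polynomial.C a * Polynomial.X ^ 3 - Polynomial.C b : Polynomial F).roots.toFinset := by
    intro t ht
    simp at ht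
    simp [Polynomial.mem_roots hne, ht]
  refine (Finset.card_le_card hsub).trans ((Multiset.toFinset_card_le _).trans ((Polynomial.card_roots' _).trans ?_))
  compute_degree

theorem Flx_card [Fintype F] (hF : 7 ≤ Fintype.card F) (h2 : (2:F) ≠ 0) (h3 : 3 ∣ Fintype.card F - 1) :
    Fintype.card F ^ 10 ≤ 16 * 4 ^ 9 * (Flx F).ncard := by
  classical
  obtain ⟨u, h0, hu⟩ := noncube h3
  set q := Fintype.card F with hq
  let D : Finset F := Finset.univ.filter (fun d => 27 * u ^ 3 + d ^ 3 ≠ 0)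
  have hD : q ≤ 2 * D.card := by
    have e := Finset.card_filter_add_card_filter_not (s := (Finset.univ : Finset F)) (fun d => 27 * u ^ 3 + d ^ 3 ≠ 0)
    have e2 : (Finset.univ.filter (fun d : F => ¬ (27 * u ^ 3 + d ^ 3 ≠ 0))).card ≤ 3 := by
      refine le_trans (Finset.card_le_card ?_) (cube_roots_card (1:F) (-27 * u ^ 3) one_ne_zero)
      intro d hd
      simp at hd ⊢
      linear_combination hd
    rw [Finset.card_univ, ← hq] at e
    change D.card + _ = _ at e
    omega
  let Y : Finset (GL (Fin 3) F × F) := Finset.univ ×ˢ D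
  let φ : GL (Fin 3) F × F → (Fin 10 → F) := fun t => act (t.1 : Matrix (Fin 3) (Fin 3) F) (hsf u t.2)
  have hact : ∀ (g : GL (Fin 3) F) c c', act (g : Matrix (Fin 3) (Fin 3) F) c = c' → c = act ((g⁻¹ : GL (Fin 3) F) : Matrix (Fin 3) (Fin 3) F) c' := by
    rintro g c c' rfl
    rw [← act_mul, ← Units.val_mul, inv_mul_cancel, Units.val_one, act_one]
  have hfib : ∀ b ∈ Y.image φ, (Y.filter fun x => φ x = b).card ≤ 4 ^ 9 := by
    intro b hb
    obtain ⟨⟨g0, d0⟩, hm, rfl⟩ := Finset.mem_image.1 hb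
    have hd0 : 27 * u ^ 3 + d0 ^ 3 ≠ 0 := by
      have := (Finset.mem_product.1 hm).2
      simpa [D] using this
    let T : Finset (Fin 3 → Fin 3 → F) := Fintype.piFinset fun i => Fintype.piFinset fun j =>
      insert 0 (Finset.univ.filter (fun t : F => hv3 u j * t ^ 3 = hv3 u i))
    have hT : T.card ≤ 4 ^ 9 := by
      rw [Fintype.card_piFinset]
      refine (Finset.prod_le_pow_card _ _ (4 ^ 3) ?_).trans (by simp)
      intro i _
      rw [Fintype.card_piFinset]
      refine (Finset.prod_le_pow_card _ _ 4 ?_).trans (by simp)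
      intro j _
      refine (Finset.card_insert_le _ _).trans (Nat.succ_le_succ (cube_roots_card _ _ ?_))
      fin_cases j <;> simp [hv3, h0]
    refine (Finset.card_le_card_of_injOn (fun x => (((x.1⁻¹ * g0 : GL (Fin 3) F) : Matrix (Fin 3) (Fin 3) F) : Fin 3 → Fin 3 → F)) ?_ ?_).trans hT
    · rintro ⟨g, d⟩ hx
      have hx2 := (Finset.mem_filter.1 hx).2
      have e := hact g _ _ hx2
      change hsf u d = act _ (act _ (hsf u d0)) at e
      rw [← act_mul, ← Units.val_mul] at e
      have hdet : ((g⁻¹ * g0 : GL (Fin 3) F) : Matrix (Fin 3) (Fin 3) F).det ≠ 0 := by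
        have := ((Matrix.isUnit_iff_isUnit_det _).1 (Units.isUnit (g⁻¹ * g0)))
        exact this.ne_zero
      have hmono := hsf_mono (by omega) h2 h0 hu hd0 _ hdet e.symm
      refine Finset.mem_coe.2 (Fintype.mem_piFinset.2 fun i => Fintype.mem_piFinset.2 fun j => ?_)
      rw [Finset.mem_insert, Finset.mem_filter]
      by_cases hz : ((g⁻¹ * g0 : GL (Fin 3) F) : Matrix (Fin 3) (Fin 3) F) i j = 0
      · exact Or.inl hz
      · exact Or.inr ⟨Finset.mem_univ _, hmono i j hz⟩
    · rintro ⟨g, d⟩ hx ⟨g', d'⟩ hx' he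
      have e1 : g⁻¹ * g0 = g'⁻¹ * g0 := Units.ext he
      have e2 : g = g' := inv_injective (mul_right_cancel e1)
      subst e2
      have a1 := hact g _ _ (Finset.mem_filter.1 hx).2
      have a2 := hact g _ _ (Finset.mem_filter.1 hx').2
      have a3 := congrFun (a1.trans a2.symm) 9
      simp [hsf] at a3
      rw [a3]
  have hcard := Finset.card_le_mul_card_image Y (4 ^ 9) hfib
  have himg : ((Y.image φ : Finset _) : Set (Fin 10 → F)) ⊆ Flx F := by
    intro c hc
    obtain ⟨⟨g, d⟩, hm, rfl⟩ := Finset.mem_image.1 (Finset.mem_coe.1 hc)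
    have hd0 : 27 * u ^ 3 + d ^ 3 ≠ 0 := by
      have := (Finset.mem_product.1 hm).2
      simpa [D] using this
    intro v h1 h2'
    simp only [φ] at h1 h2'
    rw [fe_act] at h1
    rw [he_act] at h2'
    have hu' := ((Matrix.isUnit_iff_isUnit_det _).1 (Units.isUnit g))
    have h3' := (mul_eq_zero.1 h2').resolve_left (pow_ne_zero _ hu'.ne_zero)
    have := hsf_flexless h2 h0 hu hd0 _ h1 h3'
    have e : Matrix.vecMul (Matrix.vecMul v (g : Matrix (Fin 3) (Fin 3) F)) ((g⁻¹ : GL (Fin 3) F) : Matrix (Fin 3) (Fin 3) F) = v := by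
      rw [Matrix.vecMul_vecMul, ← Units.val_mul, mul_inv_cancel, Units.val_one, Matrix.vecMul_one]
    rw [← e, this, Matrix.zero_vecMul]
  have hle : (Y.image φ).card ≤ (Flx F).ncard := by
    rw [← Set.ncard_coe_finset]; exact Set.ncard_le_ncard himg (Set.toFinite _)
  have hY : Y.card = (∏ i : Fin 3, (q ^ 3 - q ^ (i : ℕ))) * D.card := by
    rw [Finset.card_product, Finset.card_univ, ← Nat.card_eq_fintype_card, Matrix.card_GL_field]
  have hGL : q ^ 9 ≤ 8 * ∏ i : Fin 3, (q ^ 3 - q ^ (i : ℕ)) := by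
    have hh : ∀ i : Fin 3, q ^ 3 ≤ 2 * (q ^ 3 - q ^ (i : ℕ)) := by
      intro i
      have : q ^ (i:ℕ) ≤ q ^ 2 := Nat.pow_le_pow_right (by omega) (by omega)
      have : 2 * q ^ 2 ≤ q ^ 3 := by nlinarith [sq_nonneg q]
      omega
    calc q ^ 9 = ∏ i : Fin 3, q ^ 3 := by simp; ring
      _ ≤ ∏ i : Fin 3, 2 * (q ^ 3 - q ^ (i : ℕ)) := Finset.prod_le_prod' fun i _ => hh i
      _ = _ := by rw [Finset.prod_mul_distrib]; simp
  calc q ^ 10 = q ^ 9 * q := by ring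
    _ ≤ (8 * ∏ i : Fin 3, (q ^ 3 - q ^ (i : ℕ))) * (2 * D.card) := Nat.mul_le_mul hGL hD
    _ = 16 * Y.card := by rw [hY]; ring
    _ ≤ 16 * (4 ^ 9 * (Flx F).ncard) := Nat.mul_le_mul_left _ (hcard.trans (Nat.mul_le_mul_left _ hle))
    _ = _ := by ring
end Sseven

open MvPolynomial
set_option linter.all false
open MeasureTheory ENNReal
open scoped Pointwise

theorem fe_map {R S : Type*} [CommRing R] [CommRing S] (φ : R →+* S) (c : Fin 10 → R) (v : Fin 3 → R) :
    fe (fun k => φ (c k)) (fun i => φ (v i)) = φ (fe c v) := by simp [fe]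
theorem he_map {R S : Type*} [CommRing R] [CommRing S] (φ : R →+* S) (c : Fin 10 → R) (v : Fin 3 → R) :
    he (fun k => φ (c k)) (fun i => φ (v i)) = φ (he c v) := by
  have e6 : φ 6 = 6 := map_ofNat φ 6
  have e2 : φ 2 = 2 := map_ofNat φ 2
  simp [he, Matrix.det_fin_three, e6, e2]
theorem fe_hom {R : Type*} [CommRing R] (t : R) (c : Fin 10 → R) (v : Fin 3 → R) :
    fe c (fun i => t * v i) = t ^ 3 * fe c v := by simp [fe]; ring
theorem he_hom {R : Type*} [CommRing R] (t : R) (c : Fin 10 → R) (v : Fin 3 → R) :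
    he c (fun i => t * v i) = t ^ 3 * he c v := by simp [he, Matrix.det_fin_three]; ring

/-- forms mod p with a flex -/
def Bdp (p : ℕ) : Set (Fin 10 → ZMod p) := {c | ∃ v : Fin 3 → ZMod p, v ≠ 0 ∧ fe c v = 0 ∧ he c v = 0}

theorem nonSI_mod (c : Fin 10 → ℤ) (h : ¬ StronglyIrred c) (p : ℕ) (hp : p.Prime) : (fun k => (c k : ZMod p)) ∈ Bdp p := by
  rw [SI_iff, not_not] at h
  obtain ⟨v, hv, h1, h2⟩ := h
  obtain ⟨d, hd, w, hw⟩ : ∃ d : ℤ, d ≠ 0 ∧ ∃ w : Fin 3 → ℤ, ∀ i, (w i : ℚ) = d * v i := by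
    obtain ⟨b, hb⟩ := IsLocalization.exist_integer_multiples_of_finite (nonZeroDivisors ℤ) v
    refine ⟨b, nonZeroDivisors.coe_ne_zero b, fun i => (hb i).choose, fun i => ?_⟩
    have := (hb i).choose_spec
    simpa [Algebra.smul_def] using this
  obtain ⟨w', hw', hg⟩ := Finset.extract_gcd w (s := Finset.univ) Finset.univ_nonempty
  set g := Finset.univ.gcd w with hgd
  have hg0 : g ≠ 0 := by
    intro h0
    apply hv
    funext i
    have := hw i
    rw [hw' i (Finset.mem_univ _), h0, zero_mul] at this
    have hd' : (d:ℚ) ≠ 0 := by exact_mod_cast hd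
    simp [hd'] at this
    simpa using this
  have hwv : (fun i => (d:ℚ) * v i) = fun i => (g:ℚ) * ((w' i : ℤ) : ℚ) := by
    funext i; rw [← hw i, hw' i (Finset.mem_univ _)]; push_cast; rfl
  have hgQ : (g:ℚ) ≠ 0 := by exact_mod_cast hg0
  have f1 : fe c w' = 0 := by
    have e := fe_hom (d:ℚ) (fun k => (c k : ℚ)) v
    rw [h1, mul_zero, hwv, fe_hom] at e
    have e2 := (mul_eq_zero.1 e).resolve_left (pow_ne_zero _ hgQ)
    have e3 := fe_map (Int.castRingHom ℚ) c w'
    simp only [eq_intCast] at e3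
    rw [e3] at e2
    exact_mod_cast e2
  have f2 : he c w' = 0 := by
    have e := he_hom (d:ℚ) (fun k => (c k : ℚ)) v
    rw [h2, mul_zero, hwv, he_hom] at e
    have e2 := (mul_eq_zero.1 e).resolve_left (pow_ne_zero _ hgQ)
    have e3 := he_map (Int.castRingHom ℚ) c w'
    simp only [eq_intCast] at e3
    rw [e3] at e2
    exact_mod_cast e2
  refine ⟨fun i => (w' i : ZMod p), ?_, ?_, ?_⟩
  · intro h0
    have : (p:ℤ) ∣ Finset.univ.gcd w' := by
      refine Finset.dvd_gcd fun i _ => ?_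
      exact (ZMod.intCast_zmod_eq_zero_iff_dvd _ _).1 (congrFun h0 i)
    rw [hg] at this
    have := Int.isUnit_iff.1 (isUnit_of_dvd_one this)
    have := hp.two_le
    omega
  · have e3 := fe_map (Int.castRingHom (ZMod p)) c w'
    simp only [eq_intCast] at e3
    rw [e3, f1]; simp
  · have e3 := he_map (Int.castRingHom (ZMod p)) c w'
    simp only [eq_intCast] at e3
    rw [e3, f2]; simp

noncomputable def cz : ℝ := 1 - 1 / (16 * 4 ^ 9)

theorem Bdp_card (p : ℕ) (hp : p.Prime) (h7 : 7 ≤ p) (h3 : p % 3 = 1) : ((Bdp p).ncard : ℝ) ≤ cz * (p:ℝ) ^ 10 := by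
  haveI : Fact p.Prime := ⟨hp⟩
  have hc : Bdp p = (Flx (ZMod p))ᶜ := by
    ext c; simp only [Bdp, Flx, Set.mem_setOf_eq, Set.mem_compl_iff, not_forall]
    constructor
    · rintro ⟨v, a, b, c⟩; exact ⟨v, b, c, a⟩
    · rintro ⟨v, a, b, c⟩; exact ⟨v, c, a, b⟩
  have h2 : (2 : ZMod p) ≠ 0 := by
    intro h
    have : ((2:ℕ) : ZMod p) = 0 := by exact_mod_cast h
    rw [ZMod.natCast_eq_zero_iff] at this
    have := Nat.le_of_dvd (by norm_num) this
    omega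
  have hF := Flx_card (F := ZMod p) (by rw [ZMod.card]; exact h7) h2 (by rw [ZMod.card]; omega)
  rw [ZMod.card] at hF
  have hs := Set.ncard_add_ncard_compl (Flx (ZMod p))
  rw [← hc, Nat.card_eq_fintype_card, Fintype.card_fun, ZMod.card, Fintype.card_fin] at hs
  have hs' : ((Flx (ZMod p)).ncard : ℝ) + ((Bdp p).ncard : ℝ) = (p:ℝ)^10 := by exact_mod_cast hs
  have hF' : (p:ℝ)^10 ≤ 16 * 4 ^ 9 * ((Flx (ZMod p)).ncard : ℝ) := by exact_mod_cast hF
  unfold cz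
  linarith

theorem sieve (s : Finset ℕ) (hs : ∀ p ∈ s, p.Prime ∧ 7 ≤ p ∧ p % 3 = 1) (L : ℕ) (T : Finset (Fin 10 → ℤ))
    (hT : ∀ c ∈ T, (∀ i, |c i| ≤ L) ∧ ¬ StronglyIrred c) :
    (T.card : ℝ) ≤ cz ^ s.card * (2 * L + 2 * (∏ p ∈ s, p : ℕ)) ^ 10 := by
  classical
  set Q : ℕ := ∏ p ∈ s, p with hQ
  have hQ0 : 0 < Q := Finset.prod_pos fun p hp => (hs p hp).1.pos
  haveI : ∀ p : s, NeZero (p : ℕ) := fun p => ⟨(hs p p.2).1.ne_zero⟩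
  let f : (Fin 10 → ℤ) → (∀ p : s, Fin 10 → ZMod p) := fun c p k => (c k : ZMod p)
  let U : Finset (∀ p : s, Fin 10 → ZMod p) := Fintype.piFinset fun p => (Set.toFinite (Bdp p)).toFinset
  have hmaps : ∀ c ∈ T, f c ∈ U := by
    intro c hc
    refine Fintype.mem_piFinset.2 fun p => ?_
    rw [Set.Finite.mem_toFinset]
    exact nonSI_mod c (hT c hc).2 p (hs p p.2).1
  let m : ℕ := 2 * (L / Q) + 2
  have hfib : ∀ b ∈ U, (T.filter fun x => f x = b).card ≤ m ^ 10 := by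
    intro b _
    let Z : Finset (Fin 10 → ℤ) := Fintype.piFinset fun _ => Finset.Icc (-(L / Q : ℕ) - 1 : ℤ) (L / Q : ℕ)
    have hZ : Z.card ≤ m ^ 10 := by
      rw [Fintype.card_piFinset]
      refine (Finset.prod_le_pow_card _ _ m ?_).trans (by simp)
      intro i _
      rw [Int.card_Icc]
      omega
    refine (Finset.card_le_card_of_injOn (fun x i => x i / (Q:ℤ)) ?_ ?_).trans hZ
    · intro x hx
      have hx1 := (hT x (Finset.mem_filter.1 hx).1).1
      refine Finset.mem_coe.2 (Fintype.mem_piFinset.2 fun i => ?_)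
      have := abs_le.1 (hx1 i)
      have hQ' : (0:ℤ) < Q := by exact_mod_cast hQ0
      rw [Finset.mem_Icc]
      push_cast
      constructor
      · have h1 := Int.lt_ediv_add_one_mul_self (L:ℤ) hQ'
        rw [Int.le_ediv_iff_mul_le hQ']
        nlinarith
      · exact Int.ediv_le_ediv hQ' this.2
    · intro x hx y hy hxy
      have hx1 := (Finset.mem_filter.1 hx).2
      have hy1 := (Finset.mem_filter.1 hy).2
      funext i
      have hdvd : (Q:ℤ) ∣ x i - y i := by
        rw [hQ]; push_cast
        refine Finset.prod_dvd_of_coprime ?_ ?_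
        · intro p hp q hq hpq
          exact Nat.isCoprime_iff_coprime.2 ((Nat.coprime_primes (hs p hp).1 (hs q hq).1).2 hpq)
        · intro p hp
          have := congrFun (congrFun (hx1.trans hy1.symm) ⟨p, hp⟩) i
          have h' : ((x i - y i : ℤ) : ZMod p) = 0 := by push_cast; exact sub_eq_zero.2 this
          exact (ZMod.intCast_zmod_eq_zero_iff_dvd _ _).1 h'
      have e1 : x i % (Q:ℤ) = y i % (Q:ℤ) := Int.ModEq.symm ((Int.modEq_iff_dvd).2 hdvd)
      have e2 : x i / (Q:ℤ) = y i / (Q:ℤ) := congrFun hxy i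
      rw [← Int.mul_ediv_add_emod (x i) Q, ← Int.mul_ediv_add_emod (y i) Q, e1, e2]
  have hmain := Finset.card_le_mul_card_image_of_maps_to hmaps (m ^ 10) hfib
  have hU : (U.card : ℝ) ≤ cz ^ s.card * (Q:ℝ) ^ 10 := by
    rw [Fintype.card_piFinset]
    push_cast
    calc ∏ p : s, (((Set.toFinite (Bdp p)).toFinset.card : ℕ) : ℝ) ≤ ∏ p : s, (cz * ((p:ℕ):ℝ) ^ 10) := by
          refine Finset.prod_le_prod (fun _ _ => by positivity) fun p _ => ?_
          rw [← Set.ncard_eq_toFinset_card]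
          exact Bdp_card p (hs p p.2).1 (hs p p.2).2.1 (hs p p.2).2.2
      _ = _ := by
          rw [Finset.prod_mul_distrib, Finset.prod_const, Finset.card_univ, Fintype.card_coe, Finset.prod_pow, hQ]
          push_cast
          rw [← Finset.prod_coe_sort s (fun p => (p:ℝ))]
  have hcz : 0 ≤ cz := by unfold cz; norm_num
  calc (T.card : ℝ) ≤ (m:ℝ) ^ 10 * U.card := by exact_mod_cast hmain
    _ ≤ (m:ℝ)^10 * (cz ^ s.card * (Q:ℝ) ^ 10) := by gcongr
    _ = cz ^ s.card * ((m:ℝ) * Q) ^ 10 := by ring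
    _ ≤ _ := by
      gcongr
      have : m * Q ≤ 2 * L + 2 * Q := by
        have := Nat.div_mul_le_self L Q
        simp only [m]; nlinarith
      exact_mod_cast this

theorem many_primes (k : ℕ) : ∃ s : Finset ℕ, (∀ p ∈ s, p.Prime ∧ 7 ≤ p ∧ p % 3 = 1) ∧ s.card = k := by
  have hinf : {p : ℕ | p.Prime ∧ 7 ≤ p ∧ p % 3 = 1}.Infinite := by
    rw [Set.infinite_iff_exists_gt]
    intro n
    obtain ⟨p, h1, h2, h3⟩ := Nat.exists_prime_gt_modEq_one (k := 3) (n + 7) (by norm_num)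
    exact ⟨p, ⟨h1, by omega, h3⟩, by omega⟩
  obtain ⟨s, h1, h2⟩ := hinf.exists_subset_card_eq k
  exact ⟨s, fun p hp => h1 hp, h2⟩

/-- non strongly irreducible forms have density zero -/
theorem nonSI_density (M : ℕ) (S : ℕ → Set (Fin 10 → ℤ)) (hS : ∀ n, ∀ c ∈ S n, (∀ i, |c i| ≤ M * n) ∧ ¬ StronglyIrred c) :
    Filter.Tendsto (fun n : ℕ => (∑' c, (S n).indicator (fun _ => (1:ℝ≥0∞)) c) / (n:ℝ≥0∞) ^ 10) Filter.atTop (nhds 0) := by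
  classical
  rw [ENNReal.tendsto_nhds_zero]
  intro ε hε
  have hcz : 0 ≤ cz := by unfold cz; norm_num
  have hcz1 : cz < 1 := by unfold cz; norm_num
  have hlim : Filter.Tendsto (fun k : ℕ => ENNReal.ofReal (cz ^ k * (2 * M + 2) ^ 10)) Filter.atTop (nhds 0) := by
    have := (tendsto_pow_atTop_nhds_zero_of_lt_one hcz hcz1).mul_const ((2 * (M:ℝ) + 2) ^ 10)
    rw [zero_mul] at this
    simpa using ENNReal.tendsto_ofReal this
  obtain ⟨k, hk⟩ := (hlim.eventually (eventually_le_nhds hε)).exists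
  obtain ⟨s, hs, hsk⟩ := many_primes k
  filter_upwards [Filter.eventually_ge_atTop (∏ p ∈ s, p), Filter.eventually_gt_atTop 0] with n hn hn0
  have hfin : (S n).Finite := by
    refine Set.Finite.subset (Fintype.piFinset fun _ : Fin 10 => Finset.Icc (-(M * n : ℤ)) (M * n)).finite_toSet ?_
    intro c hc
    refine Finset.mem_coe.2 (Fintype.mem_piFinset.2 fun i => ?_)
    exact Finset.mem_Icc.2 (abs_le.1 ((hS n c hc).1 i))
  rw [tsum_ind, ← hfin.cast_ncard_eq]
  refine le_trans ?_ hk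
  have := sieve s hs (M * n) hfin.toFinset (fun c hc => by
    have := hS n c (hfin.mem_toFinset.1 hc)
    push_cast; exact this)
  rw [← Set.ncard_eq_toFinset_card _ hfin, hsk] at this
  have hn' : (0:ℝ) < (n:ℝ) ^ 10 := by positivity
  have h2 : ((S n).ncard : ℝ) / (n:ℝ) ^ 10 ≤ cz ^ k * (2 * M + 2) ^ 10 := by
    rw [div_le_iff₀ hn']
    refine this.trans ?_
    rw [mul_assoc, ← mul_pow]
    gcongr
    have : ((∏ p ∈ s, p : ℕ) : ℝ) ≤ n := by exact_mod_cast hn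
    push_cast at this ⊢
    linarith
  have h3 := ENNReal.ofReal_le_ofReal h2
  rw [ENNReal.ofReal_div_of_pos hn', ENNReal.ofReal_natCast, ENNReal.ofReal_pow (by positivity), ENNReal.ofReal_natCast] at h3
  simpa using h3

open MvPolynomial
set_option linter.all false
open MeasureTheory ENNReal
open scoped Pointwise

abbrev SS := M3 × (ℝ × ℝ)
abbrev TT := ℝ × (Fin 10 → ℝ)

/-- the orbit map -/
noncomputable def Tv (p : SS) : Fin 10 → ℝ := (dt p.1)⁻¹ • act (Matrix.of p.1) (wcoeffs p.2.1 p.2.2)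
noncomputable def Th (p : SS) : TT := (dt p.1 ^ 3, Tv p)

theorem act_W (g : M3) (A B : ℝ) (k : Fin 10) : act (Matrix.of g) (wcoeffs A B) k =
  (![g 0 0 ^ 3 + A * g 0 0 * g 0 2 ^ 2 + B * g 0 2 ^ 3 - g 0 1 ^ 2 * g 0 2,
    g 1 0 ^ 3 + A * g 1 0 * g 1 2 ^ 2 + B * g 1 2 ^ 3 - g 1 1 ^ 2 * g 1 2,
    g 2 0 ^ 3 + A * g 2 0 * g 2 2 ^ 2 + B * g 2 2 ^ 3 - g 2 1 ^ 2 * g 2 2,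
    g 1 0 * (3 * g 0 0 ^ 2 + A * g 0 2 ^ 2) + g 1 1 * (-2 * g 0 1 * g 0 2) + g 1 2 * (3 * B * g 0 2 ^ 2 - g 0 1 ^ 2 + 2 * A * g 0 0 * g 0 2),
    g 2 0 * (3 * g 0 0 ^ 2 + A * g 0 2 ^ 2) + g 2 1 * (-2 * g 0 1 * g 0 2) + g 2 2 * (3 * B * g 0 2 ^ 2 - g 0 1 ^ 2 + 2 * A * g 0 0 * g 0 2),
    g 0 0 * (3 * g 1 0 ^ 2 + A * g 1 2 ^ 2) + g 0 1 * (-2 * g 1 1 * g 1 2) + g 0 2 * (3 * B * g 1 2 ^ 2 - g 1 1 ^ 2 + 2 * A * g 1 0 * g 1 2),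
    g 2 0 * (3 * g 1 0 ^ 2 + A * g 1 2 ^ 2) + g 2 1 * (-2 * g 1 1 * g 1 2) + g 2 2 * (3 * B * g 1 2 ^ 2 - g 1 1 ^ 2 + 2 * A * g 1 0 * g 1 2),
    g 0 0 * (3 * g 2 0 ^ 2 + A * g 2 2 ^ 2) + g 0 1 * (-2 * g 2 1 * g 2 2) + g 0 2 * (3 * B * g 2 2 ^ 2 - g 2 1 ^ 2 + 2 * A * g 2 0 * g 2 2),
    g 1 0 * (3 * g 2 0 ^ 2 + A * g 2 2 ^ 2) + g 1 1 * (-2 * g 2 1 * g 2 2) + g 1 2 * (3 * B * g 2 2 ^ 2 - g 2 1 ^ 2 + 2 * A * g 2 0 * g 2 2),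
    6 * g 0 0 * g 1 0 * g 2 0 + 6 * B * g 0 2 * g 1 2 * g 2 2 - 2 * (g 0 1 * g 1 1 * g 2 2 + g 0 1 * g 1 2 * g 2 1 + g 0 2 * g 1 1 * g 2 1)
      + 2 * A * (g 0 0 * g 1 2 * g 2 2 + g 0 2 * g 1 0 * g 2 2 + g 0 2 * g 1 2 * g 2 0)] : Fin 10 → ℝ) k := by
  fin_cases k <;> simp [act, fe, fd, fg, ft, wcoeffs] <;> ring_nf <;> simp

theorem act_W_smooth (k : Fin 10) : ContDiff ℝ 1 (fun p : SS => act (Matrix.of p.1) (wcoeffs p.2.1 p.2.2) k) := by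
  simp_rw [act_W]
  fin_cases k <;> simp <;> fun_prop

theorem dt_smooth : ContDiff ℝ 1 (fun p : SS => dt p.1) := by
  simp_rw [dt_eq]; fun_prop

theorem Th_smooth (p : SS) (hp : dt p.1 ≠ 0) : ContDiffAt ℝ 1 Th p := by
  refine ContDiffAt.prodMk (dt_smooth.contDiffAt.pow 3) ?_
  refine contDiffAt_pi.2 fun k => ?_
  exact (dt_smooth.contDiffAt.inv hp).mul (act_W_smooth k).contDiffAt

/-- derivative of the action part at the identity -/
def dW (A B : ℝ) (X : M3) (a b : ℝ) : Fin 10 → ℝ :=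
  ![3 * X 0 0, -X 1 2, A * X 2 0 + 3 * B * X 2 2 + b, 3 * X 1 0, 3 * X 2 0 + 2 * A * X 0 2, -X 0 2, -2 * X 1 1 - X 2 2,
    A * X 0 0 + 2 * A * X 2 2 + 3 * B * X 0 2 + a, A * X 1 0 + 3 * B * X 1 2 - 2 * X 2 1, -2 * X 0 1 + 2 * A * X 1 2]

theorem der_act (A B : ℝ) (X : M3) (a b : ℝ) (k : Fin 10) :
    HasDerivAt (fun t : ℝ => act (Matrix.of (id3 + t • X)) (wcoeffs (A + t * a) (B + t * b)) k) (dW A B X a b k) 0 := by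
  simp_rw [act_W]
  have hg : ∀ i j, HasDerivAt (fun t : ℝ => (id3 + t • X) i j) (X i j) 0 := by
    intro i j
    have := ((hasDerivAt_id (0:ℝ)).mul_const (X i j)).const_add (id3 i j)
    simpa using this
  have hA : HasDerivAt (fun t : ℝ => A + t * a) a 0 := by
    simpa using ((hasDerivAt_id (0:ℝ)).mul_const a).const_add A
  have hB : HasDerivAt (fun t : ℝ => B + t * b) b 0 := by
    simpa using ((hasDerivAt_id (0:ℝ)).mul_const b).const_add B
  have v : ∀ i j, (id3 + (0:ℝ) • X) i j = id3 i j := by intro i j; simp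
  have fe' : ∀ i, HasDerivAt (fun t : ℝ => (id3 + t • X) i 0 ^ 3 + (A + t * a) * (id3 + t • X) i 0 * (id3 + t • X) i 2 ^ 2 + (B + t * b) * (id3 + t • X) i 2 ^ 3
      - (id3 + t • X) i 1 ^ 2 * (id3 + t • X) i 2) _ 0 := fun i =>
    ((((hg i 0).pow 3).add ((hA.mul (hg i 0)).mul ((hg i 2).pow 2))).add (hB.mul ((hg i 2).pow 3))).sub (((hg i 1).pow 2).mul (hg i 2))
  have fd' : ∀ i j, HasDerivAt (fun t : ℝ => (id3 + t • X) j 0 * (3 * (id3 + t • X) i 0 ^ 2 + (A + t * a) * (id3 + t • X) i 2 ^ 2)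
      + (id3 + t • X) j 1 * (-2 * (id3 + t • X) i 1 * (id3 + t • X) i 2) + (id3 + t • X) j 2 * (3 * (B + t * b) * (id3 + t • X) i 2 ^ 2
      - (id3 + t • X) i 1 ^ 2 + 2 * (A + t * a) * (id3 + t • X) i 0 * (id3 + t • X) i 2)) _ 0 := fun i j =>
    (((hg j 0).mul ((((hg i 0).pow 2).const_mul 3).add (hA.mul ((hg i 2).pow 2)))).add ((hg j 1).mul (((hg i 1).const_mul (-2)).mul (hg i 2)))).add
      ((hg j 2).mul ((((hB.const_mul 3).mul ((hg i 2).pow 2)).sub ((hg i 1).pow 2)).add (((hA.const_mul 2).mul (hg i 0)).mul (hg i 2))))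
  have ft' : HasDerivAt (fun t : ℝ => 6 * (id3 + t • X) 0 0 * (id3 + t • X) 1 0 * (id3 + t • X) 2 0 + 6 * (B + t * b) * (id3 + t • X) 0 2 * (id3 + t • X) 1 2 * (id3 + t • X) 2 2
      - 2 * ((id3 + t • X) 0 1 * (id3 + t • X) 1 1 * (id3 + t • X) 2 2 + (id3 + t • X) 0 1 * (id3 + t • X) 1 2 * (id3 + t • X) 2 1 + (id3 + t • X) 0 2 * (id3 + t • X) 1 1 * (id3 + t • X) 2 1)
      + 2 * (A + t * a) * ((id3 + t • X) 0 0 * (id3 + t • X) 1 2 * (id3 + t • X) 2 2 + (id3 + t • X) 0 2 * (id3 + t • X) 1 0 * (id3 + t • X) 2 2 + (id3 + t • X) 0 2 * (id3 + t • X) 1 2 * (id3 + t • X) 2 0)) _ 0 :=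
    (((((((hg 0 0).const_mul 6).mul (hg 1 0)).mul (hg 2 0)).add ((((hB.const_mul 6).mul (hg 0 2)).mul (hg 1 2)).mul (hg 2 2))).sub
      ((((((hg 0 1).mul (hg 1 1)).mul (hg 2 2)).add (((hg 0 1).mul (hg 1 2)).mul (hg 2 1))).add (((hg 0 2).mul (hg 1 1)).mul (hg 2 1))).const_mul 2)).add
      ((hA.const_mul 2).mul (((((hg 0 0).mul (hg 1 2)).mul (hg 2 2)).add (((hg 0 2).mul (hg 1 0)).mul (hg 2 2))).add (((hg 0 2).mul (hg 1 2)).mul (hg 2 0)))))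
  fin_cases k
  · refine (fe' 0).congr_deriv ?_; simp only [Pi.mul_apply, Pi.pow_apply, v]; simp [id3, dW]
  · refine (fe' 1).congr_deriv ?_; simp only [Pi.mul_apply, Pi.pow_apply, v]; simp [id3, dW]
  · refine (fe' 2).congr_deriv ?_; simp only [Pi.mul_apply, Pi.pow_apply, v]; simp [id3, dW]; ring
  · refine (fd' 0 1).congr_deriv ?_; simp only [Pi.mul_apply, Pi.pow_apply, v]; simp [id3, dW]; try ring
  · refine (fd' 0 2).congr_deriv ?_; simp only [Pi.mul_apply, Pi.pow_apply, v]; simp [id3, dW]; try ring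
  · refine (fd' 1 0).congr_deriv ?_; simp only [Pi.mul_apply, Pi.pow_apply, v]; simp [id3, dW]; try ring
  · refine (fd' 1 2).congr_deriv ?_; simp only [Pi.mul_apply, Pi.pow_apply, v]; simp [id3, dW]; try ring
  · refine (fd' 2 0).congr_deriv ?_; simp only [Pi.mul_apply, Pi.pow_apply, v]; simp [id3, dW]; try ring
  · refine (fd' 2 1).congr_deriv ?_; simp only [Pi.mul_apply, Pi.pow_apply, v]; simp [id3, dW]; try ring
  · refine ft'.congr_deriv ?_; simp only [Pi.mul_apply, Pi.pow_apply, v]; simp [id3, dW]; try ring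

open MvPolynomial
set_option linter.all false
open MeasureTheory ENNReal
open scoped Pointwise

theorem mp_cube {n : ℕ} {F : Type*} [NormedAddCommGroup F] [NormedSpace ℝ F] [FiniteDimensional ℝ F] [MeasurableSpace F] [BorelSpace F]
    (ν : Measure F) [ν.IsAddHaarMeasure] (e : (Fin n → ℝ) ≃L[ℝ] F) (Q : Set F) (hQ : MeasurableSet Q) (h1 : ν Q = 1)
    (hp : e ⁻¹' Q = Set.Icc 0 1) : MeasurePreserving e volume ν := by
  have hm : Measure.IsAddHaarMeasure (Measure.map e (volume : Measure (Fin n → ℝ))) := inferInstance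
  have hme : Measurable e := e.continuous.measurable
  refine ⟨hme, ?_⟩
  have hs := Measure.isAddLeftInvariant_eq_smul (Measure.map e (volume : Measure (Fin n → ℝ))) ν
  have h2 : (Measure.map e (volume : Measure (Fin n → ℝ))) Q = 1 := by
    rw [Measure.map_apply hme hQ, hp, Real.volume_Icc_pi]; simp
  have h3 := congrArg (fun m : Measure F => m Q) hs
  simp only [h2, Measure.smul_apply, h1, smul_eq_mul] at h3
  rw [hs]
  have : (Measure.map e (volume : Measure (Fin n → ℝ))).addHaarScalarFactor ν = 1 := by
    have h4 : (1 : ℝ≥0∞) = (((Measure.map e (volume : Measure (Fin n → ℝ))).addHaarScalarFactor ν : NNReal) : ℝ≥0∞) := by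
      simpa [ENNReal.smul_def] using h3
    exact_mod_cast h4.symm
  rw [this, one_smul]

abbrev EE := Fin 11 → ℝ

def La0 : EE ≃ₗ[ℝ] SS where
  toFun v := (![![v 1, v 6, v 4], ![v 3, v 8, v 2], ![v 5, v 7, v 0]], (v 9, v 10))
  invFun p := ![p.1 2 2, p.1 0 0, p.1 1 2, p.1 1 0, p.1 0 2, p.1 2 0, p.1 0 1, p.1 2 1, p.1 1 1, p.2.1, p.2.2]
  map_add' v w := by
    refine Prod.ext ?_ rfl
    funext i j; fin_cases i <;> fin_cases j <;> rfl
  map_smul' t v := by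
    refine Prod.ext ?_ rfl
    funext i j; fin_cases i <;> fin_cases j <;> rfl
  left_inv v := by funext i; fin_cases i <;> rfl
  right_inv p := by
    refine Prod.ext ?_ rfl
    funext i j; fin_cases i <;> fin_cases j <;> rfl

def Pi0 : EE ≃ₗ[ℝ] TT where
  toFun v := (v 0, ![v 1, v 2, v 10, v 3, v 5, v 4, v 8, v 9, v 7, v 6])
  invFun q := ![q.1, q.2 0, q.2 1, q.2 3, q.2 5, q.2 4, q.2 9, q.2 8, q.2 6, q.2 7, q.2 2]
  map_add' v w := by
    refine Prod.ext rfl ?_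
    funext i; fin_cases i <;> rfl
  map_smul' t v := by
    refine Prod.ext rfl ?_
    funext i; fin_cases i <;> rfl
  left_inv v := by funext i; fin_cases i <;> rfl
  right_inv p := by
    refine Prod.ext rfl ?_
    funext i; fin_cases i <;> rfl

noncomputable def La : EE ≃L[ℝ] SS := La0.toContinuousLinearEquiv
noncomputable def Pj : EE ≃L[ℝ] TT := Pi0.toContinuousLinearEquiv

theorem La_app (v : EE) : La v = (![![v 1, v 6, v 4], ![v 3, v 8, v 2], ![v 5, v 7, v 0]], (v 9, v 10)) := rfl
theorem Pj_app (v : EE) : Pj v = (v 0, ![v 1, v 2, v 10, v 3, v 5, v 4, v 8, v 9, v 7, v 6]) := rfl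
theorem Pj_symm (q : TT) : Pj.symm q = ![q.1, q.2 0, q.2 1, q.2 3, q.2 5, q.2 4, q.2 9, q.2 8, q.2 6, q.2 7, q.2 2] := rfl

theorem vol_cubeM3 : (volume : Measure M3) (Set.Icc 0 1) = 1 := by
  have : (Set.Icc 0 1 : Set M3) = Set.pi Set.univ (fun _ => Set.Icc 0 1) := by
    rw [← Set.pi_univ_Icc]; rfl
  rw [this, volume_pi_pi]
  simp [Real.volume_Icc_pi]

instance haarSS : Measure.IsAddHaarMeasure (volume : Measure SS) := by
  haveI : Measure.IsAddHaarMeasure (volume : Measure (ℝ × ℝ)) := Measure.prod.instIsAddHaarMeasure volume volume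
  haveI := haarM3
  exact Measure.prod.instIsAddHaarMeasure (volume : Measure M3) (volume : Measure (ℝ × ℝ))

theorem La_mp : MeasurePreserving La (volume : Measure EE) (volume : Measure SS) := by
  refine mp_cube _ La (Set.Icc 0 1 ×ˢ (Set.Icc 0 1 ×ˢ Set.Icc 0 1)) (measurableSet_Icc.prod (measurableSet_Icc.prod measurableSet_Icc)) ?_ ?_
  · rw [Measure.volume_eq_prod, Measure.prod_prod, vol_cubeM3, Measure.volume_eq_prod, Measure.prod_prod]; simp
  · ext v
    simp only [Set.mem_preimage, Set.mem_prod, Set.mem_Icc, Pi.le_def, La_app]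
    constructor
    · rintro ⟨⟨a, b⟩, ⟨c, d⟩, ⟨e, f⟩⟩
      have a' := a; have b' := b
      refine ⟨fun i => ?_, fun i => ?_⟩
      · fin_cases i
        exacts [a 2 2, a 0 0, a 1 2, a 1 0, a 0 2, a 2 0, a 0 1, a 2 1, a 1 1, c, e]
      · fin_cases i
        exacts [b 2 2, b 0 0, b 1 2, b 1 0, b 0 2, b 2 0, b 0 1, b 2 1, b 1 1, d, f]
    · rintro ⟨a, b⟩
      refine ⟨⟨fun i j => ?_, fun i j => ?_⟩, ⟨a 9, b 9⟩, ⟨a 10, b 10⟩⟩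
      · fin_cases i <;> fin_cases j
        exacts [a 1, a 6, a 4, a 3, a 8, a 2, a 5, a 7, a 0]
      · fin_cases i <;> fin_cases j
        exacts [b 1, b 6, b 4, b 3, b 8, b 2, b 5, b 7, b 0]

instance haarTT : Measure.IsAddHaarMeasure (volume : Measure TT) :=
  Measure.prod.instIsAddHaarMeasure (volume : Measure ℝ) (volume : Measure (Fin 10 → ℝ))

theorem Pj_mp : MeasurePreserving Pj (volume : Measure EE) (volume : Measure TT) := by
  refine mp_cube _ Pj (Set.Icc 0 1 ×ˢ Set.Icc 0 1) (measurableSet_Icc.prod measurableSet_Icc) ?_ ?_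
  · rw [Measure.volume_eq_prod, Measure.prod_prod, Real.volume_Icc_pi]; simp
  · ext v
    simp only [Set.mem_preimage, Set.mem_prod, Set.mem_Icc, Pi.le_def, Pj_app]
    constructor
    · rintro ⟨⟨c, d⟩, ⟨a, b⟩⟩
      refine ⟨fun i => ?_, fun i => ?_⟩
      · fin_cases i
        exacts [c, a 0, a 1, a 3, a 5, a 4, a 9, a 8, a 6, a 7, a 2]
      · fin_cases i
        exacts [d, b 0, b 1, b 3, b 5, b 4, b 9, b 8, b 6, b 7, b 2]
    · rintro ⟨a, b⟩
      refine ⟨⟨a 0, b 0⟩, fun i => ?_, fun i => ?_⟩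
      · fin_cases i
        exacts [a 1, a 2, a 10, a 3, a 5, a 4, a 8, a 9, a 7, a 6]
      · fin_cases i
        exacts [b 1, b 2, b 10, b 3, b 5, b 4, b 8, b 9, b 7, b 6]

/-- derivative of dt at the identity -/
theorem der_dt (X : M3) : HasDerivAt (fun t : ℝ => dt (id3 + t • X)) (X 0 0 + X 1 1 + X 2 2) 0 := by
  have hg : ∀ i j, HasDerivAt (fun t : ℝ => (id3 + t • X) i j) (X i j) 0 := by
    intro i j
    have := ((hasDerivAt_id (0:ℝ)).mul_const (X i j)).const_add (id3 i j)
    simpa using this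
  have v : ∀ i j, (id3 + (0:ℝ) • X) i j = id3 i j := by intro i j; simp
  have tp : ∀ i j k, HasDerivAt (fun t : ℝ => (id3 + t • X) 0 i * (id3 + t • X) 1 j * (id3 + t • X) 2 k)
      ((X 0 i * id3 1 j + id3 0 i * X 1 j) * id3 2 k + id3 0 i * id3 1 j * X 2 k) 0 := by
    intro i j k
    have := ((hg 0 i).mul (hg 1 j)).mul (hg 2 k)
    simp only [Pi.mul_apply, v] at this
    exact this
  have e : (fun t : ℝ => dt (id3 + t • X)) = fun t : ℝ =>
      (id3 + t • X) 0 0 * (id3 + t • X) 1 1 * (id3 + t • X) 2 2 - (id3 + t • X) 0 0 * (id3 + t • X) 1 2 * (id3 + t • X) 2 1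
      - (id3 + t • X) 0 1 * (id3 + t • X) 1 0 * (id3 + t • X) 2 2 + (id3 + t • X) 0 1 * (id3 + t • X) 1 2 * (id3 + t • X) 2 0
      + (id3 + t • X) 0 2 * (id3 + t • X) 1 0 * (id3 + t • X) 2 1 - (id3 + t • X) 0 2 * (id3 + t • X) 1 1 * (id3 + t • X) 2 0 := by
    funext t; rw [dt_eq]; try ring
  rw [e]
  refine ((((((tp 0 1 2).sub (tp 0 2 1)).sub (tp 1 0 2)).add (tp 1 2 0)).add (tp 2 0 1)).sub (tp 2 1 0)).congr_deriv ?_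
  simp [id3]

noncomputable def Ds (A B : ℝ) (p : SS) : TT :=
  (3 * (p.1 0 0 + p.1 1 1 + p.1 2 2), dW A B p.1 p.2.1 p.2.2 - (p.1 0 0 + p.1 1 1 + p.1 2 2) • wcoeffs A B)

theorem fderiv_Th_one (A B : ℝ) (p : SS) : fderiv ℝ Th (id3, (A, B)) p = Ds A B p := by
  have hd : dt id3 = 1 := dt_id3
  have h1 : HasFDerivAt Th (fderiv ℝ Th (id3, (A, B))) (id3, (A, B)) :=
    ((Th_smooth (id3, (A, B)) (by rw [hd]; norm_num)).differentiableAt (by norm_num)).hasFDerivAt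
  obtain ⟨X, a, b⟩ := p
  have hc : HasDerivAt (fun t : ℝ => ((id3 + t • X, (A + t * a, B + t * b)) : SS)) (X, (a, b)) 0 := by
    have hx : HasDerivAt (fun t : ℝ => id3 + t • X) X 0 := by
      simpa using ((hasDerivAt_id (0:ℝ)).smul_const X).const_add id3
    have hA : HasDerivAt (fun t : ℝ => A + t * a) a 0 := by
      simpa using ((hasDerivAt_id (0:ℝ)).mul_const a).const_add A
    have hB : HasDerivAt (fun t : ℝ => B + t * b) b 0 := by
      simpa using ((hasDerivAt_id (0:ℝ)).mul_const b).const_add B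
    exact hx.prodMk (hA.prodMk hB)
  have hz : ((id3 + (0:ℝ) • X, (A + (0:ℝ) * a, B + (0:ℝ) * b)) : SS) = (id3, (A, B)) := by simp
  have h2 := HasFDerivAt.comp_hasDerivAt (0:ℝ) (hz ▸ h1) hc
  have hdt := der_dt X
  have hv : dt (id3 + (0:ℝ) • X) = 1 := by rw [zero_smul, add_zero, hd]
  have h3 : HasDerivAt (Th ∘ fun t : ℝ => ((id3 + t • X, (A + t * a, B + t * b)) : SS)) (Ds A B (X, (a, b))) 0 := by
    refine HasDerivAt.prodMk ?_ ?_
    · refine (hdt.pow 3).congr_deriv ?_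
      rw [hv]; norm_num
    · refine hasDerivAt_pi.2 fun k => ?_
      refine ((hdt.inv (by rw [hv]; norm_num)).mul (der_act A B X a b k)).congr_deriv ?_
      simp only [hv, hd, Pi.inv_apply, zero_smul, add_zero, zero_mul]
      have : act (Matrix.of id3) (wcoeffs A B) = wcoeffs A B := by rw [of_id3, act_one]
      rw [this]
      simp
      ring
  have h4 := h2.unique h3
  rw [← h4, hz]

def shM (v : EE) : EE := ![v 0 - v 1 - v 8, v 1, v 2, v 3, v 4, v 5, v 6, v 7, v 8, v 9, v 10]
def sh : EE →ₗ[ℝ] EE where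
  toFun := shM
  map_add' v w := by funext i; fin_cases i <;> simp [shM]; ring
  map_smul' t v := by funext i; fin_cases i <;> simp [shM]; ring

theorem det_sh : LinearMap.det sh = 1 := by
  rw [← LinearMap.det_toMatrix', Matrix.det_of_upperTriangular]
  · rw [Finset.prod_eq_one]
    intro i _
    rw [LinearMap.toMatrix'_apply]
    change shM _ i = 1
    fin_cases i <;> simp [shM]
  · intro i j hij
    rw [LinearMap.toMatrix'_apply]
    change shM _ i = 0
    have hij : j < i := hij
    fin_cases i <;> fin_cases j <;> first | exact absurd hij (by decide) | simp [shM]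

noncomputable def Tr (A B : ℝ) (v : EE) : EE := ![3 * v 0, 3 * v 1 - v 0, - v 2, 3 * v 3, - v 4, 3 * v 5 + 2 * A * v 4, - 2 * v 6 + 2 * A * v 2,
  A * v 3 + 3 * B * v 2 - 2 * v 7, - v 8 + v 1, A * v 1 + 2 * A * (v 0 - v 1 - v 8) + 3 * B * v 4 + v 9 - v 0 * A, A * v 5 + 3 * B * (v 0 - v 1 - v 8) + v 10 - v 0 * B]

theorem Tr_eq (A B : ℝ) (v : EE) : Pj.symm (Ds A B (La (sh v))) = Tr A B v := by
  change Pj.symm (Ds A B (La (shM v))) = Tr A B v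
  rw [Pj_symm, La_app]
  funext i
  fin_cases i <;> simp [Ds, dW, shM, Tr, wcoeffs] <;> ring

theorem det_Tr (A B : ℝ) (L : EE →ₗ[ℝ] EE) (hL : ∀ v, L v = Tr A B v) : LinearMap.det L = -324 := by
  rw [← LinearMap.det_toMatrix', Matrix.det_of_lowerTriangular]
  · simp only [Fin.prod_univ_succ, LinearMap.toMatrix'_apply, hL]
    simp [Tr]
    norm_num
  · intro i j hij
    rw [LinearMap.toMatrix'_apply, hL]
    have hij : i < j := hij
    fin_cases i <;> fin_cases j <;> first | exact absurd hij (by decide) | simp [Tr]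

noncomputable def LgS (g : M3) : SS →ₗ[ℝ] SS := LinearMap.prodMap (lmL (Matrix.of g)) LinearMap.id
noncomputable def LgT (g : M3) : TT →ₗ[ℝ] TT := LinearMap.prodMap ((dt g ^ 3) • LinearMap.id) ((dt g)⁻¹ • actL (Matrix.of g))

theorem det_LgS (g : M3) (hg : dt g ≠ 0) : LinearMap.det (LgS g) = dt g ^ 3 := by
  unfold LgS; rw [LinearMap.det_prodMap, det_lmL _ hg]; simp [dt]

theorem det_LgT (g : M3) (hg : dt g ≠ 0) : LinearMap.det (LgT g) = dt g ^ 3 := by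
  unfold LgT; rw [LinearMap.det_prodMap, LinearMap.det_smul, LinearMap.det_smul, det_actL _ hg]
  simp
  change dt g ^ 3 * ((dt g ^ 10)⁻¹ * dt g ^ 10) = dt g ^ 3
  field_simp

theorem Th_equi (g : M3) (hg : dt g ≠ 0) (p : SS) : Th (LgS g p) = LgT g (Th p) := by
  obtain ⟨h, q⟩ := p
  refine Prod.ext ?_ ?_
  · change dt (lmL (Matrix.of g) h) ^ 3 = dt g ^ 3 * dt h ^ 3
    rw [dt_lmL, mul_pow]; rfl
  · change (dt (lmL (Matrix.of g) h))⁻¹ • act (Matrix.of (lmL (Matrix.of g) h)) _ = (dt g)⁻¹ • act (Matrix.of g) ((dt h)⁻¹ • act (Matrix.of h) _)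
    rw [dt_lmL, of_lmL, act_mul, act_smul, smul_smul, mul_inv]; rfl

theorem Th_cd (p : SS) (hp : dt p.1 ≠ 0) : HasFDerivAt Th (fderiv ℝ Th p) p :=
  ((Th_smooth p hp).differentiableAt (by norm_num)).hasFDerivAt

noncomputable def DE (p : SS) : EE →L[ℝ] EE := (Pj.symm : TT →L[ℝ] EE).comp ((fderiv ℝ Th p).comp (La : EE →L[ℝ] SS))

theorem det_DE_one (A B : ℝ) : LinearMap.det (DE (id3, (A, B)) : EE →ₗ[ℝ] EE) = -324 := by
  have h := det_Tr A B ((DE (id3, (A, B)) : EE →ₗ[ℝ] EE) ∘ₗ sh) (fun v => by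
    change Pj.symm (fderiv ℝ Th (id3, (A, B)) (La (sh v))) = _
    rw [fderiv_Th_one, Tr_eq])
  rwa [LinearMap.det_comp, det_sh, mul_one] at h

theorem det_DE (p : SS) (hp : dt p.1 ≠ 0) : (DE p).det = -324 := by
  obtain ⟨g, A, B⟩ := p
  have hp : dt g ≠ 0 := hp
  have e1 : LgS g (id3, (A, B)) = (g, (A, B)) := by
    change (lmL (Matrix.of g) id3, (A, B)) = _
    rw [lmL_id3]
  have c1 : HasFDerivAt (fun q => Th (LgS g q)) ((fderiv ℝ Th (g, (A, B))).comp (LgS g).toContinuousLinearMap) (id3, (A, B)) := by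
    have : HasFDerivAt Th (fderiv ℝ Th (g, (A, B))) (LgS g (id3, (A, B))) := by rw [e1]; exact Th_cd _ hp
    exact this.comp _ (LgS g).toContinuousLinearMap.hasFDerivAt
  have c2 : HasFDerivAt (fun q => Th (LgS g q)) ((LgT g).toContinuousLinearMap.comp (fderiv ℝ Th (id3, (A, B)))) (id3, (A, B)) := by
    simp_rw [Th_equi g hp]
    have : HasFDerivAt Th (fderiv ℝ Th (id3, (A, B))) (id3, (A, B)) := Th_cd _ (by change dt id3 ≠ 0; rw [dt_id3]; norm_num)
    exact (LgT g).toContinuousLinearMap.hasFDerivAt.comp _ this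
  have c3 := c1.unique c2
  have c4 : (DE (g, (A, B)) : EE →ₗ[ℝ] EE) ∘ₗ (La.symm.toLinearEquiv.toLinearMap ∘ₗ LgS g ∘ₗ La.symm.toLinearEquiv.symm.toLinearMap)
      = (Pj.symm.toLinearEquiv.toLinearMap ∘ₗ LgT g ∘ₗ Pj.symm.toLinearEquiv.symm.toLinearMap) ∘ₗ (DE (id3, (A, B)) : EE →ₗ[ℝ] EE) := by
    ext1 v
    apply LinearMap.ext; intro w
    have := congrArg (fun L : SS →L[ℝ] TT => Pj.symm (L (La (LinearMap.single ℝ (fun _ => ℝ) v w)))) c3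
    simp only [ContinuousLinearMap.comp_apply, LinearMap.coe_toContinuousLinearMap'] at this
    simp only [LinearMap.comp_apply]
    change Pj.symm (fderiv ℝ Th (g, (A, B)) (La (La.symm (LgS g (La _))))) = Pj.symm (LgT g (Pj (Pj.symm (fderiv ℝ Th (id3, (A, B)) (La _)))))
    rw [La.apply_symm_apply, Pj.apply_symm_apply]
    exact this
  have c5 := congrArg LinearMap.det c4
  rw [LinearMap.det_comp, LinearMap.det_comp, LinearMap.det_conj, LinearMap.det_conj, det_LgS g hp, det_LgT g hp, det_DE_one] at c5
  have h3 : dt g ^ 3 ≠ 0 := pow_ne_zero _ hp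
  change LinearMap.det (DE (g, (A, B)) : EE →ₗ[ℝ] EE) = -324
  apply mul_right_cancel₀ h3
  rw [c5]; ring

open MvPolynomial
set_option linter.all false
open MeasureTheory ENNReal
open scoped Pointwise

theorem T2 {k l : M3} (hk : k ∈ KK) (hl : l ∈ KK) : 0 < (Matrix.adjugate (Matrix.of l) * Matrix.of k) 1 1 := by
  have key : ∀ k ∈ KK, ∀ l ∈ KK, k 0 0 = 1 → l 0 0 = 1 → 0 < (Matrix.adjugate (Matrix.of l) * Matrix.of k) 1 1 := by
    clear hk hl k l
    intro k hk l hl hk0 hl0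
    have e : (Matrix.adjugate (Matrix.of l) * Matrix.of k) 1 1 = (-(l 1 0 * l 2 2) + l 1 2 * l 2 0) * k 0 1
        + (l 0 0 * l 2 2 - l 0 2 * l 2 0) * k 1 1 + (-(l 0 0 * l 1 2) + l 0 2 * l 1 0) * k 2 1 := by
      rw [Matrix.mul_apply, Fin.sum_univ_three, Matrix.adjugate_fin_three]
      simp
    rw [e, hl0]
    have hb : ∀ {x y p q : ℝ}, |x| ≤ p → |y| ≤ q → |x * y| ≤ p * q := fun h1 h2 => by
      rw [abs_mul]; exact mul_le_mul h1 h2 (abs_nonneg _) ((abs_nonneg _).trans h1)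
    have l10 := (hl 1 0).le; have l12 := (hl 1 2).le; have l20 := (hl 2 0).le; have l02 := (hl 0 2).le; have l22 := (hl 2 2).le
    have k01 := (hk 0 1).le; have k11 := (hk 1 1).le; have k21 := (hk 2 1).le
    simp [hk0, hl0] at l10 l12 l20 l02 l22 k01 k11 k21
    have l22' : |l 2 2| ≤ 2 := abs_le.2 ⟨by have := abs_le.1 l22; linarith [this.1], by have := abs_le.1 l22; linarith [this.2]⟩
    have a1 := abs_le.1 (hb (hb l10 l22') k01)
    have a2 := abs_le.1 (hb (hb l12 l20) k01)
    have b1 := abs_le.1 (hb l02 l20)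
    have c1 := abs_le.1 (hb l12 k21)
    have c2 := abs_le.1 (hb (hb l02 l10) k21)
    have d1 := abs_le.1 l22
    have d2 := abs_le.1 k11
    have : (9/10 : ℝ) * (9/10) ≤ (1 * l 2 2 - l 0 2 * l 2 0) * k 1 1 := by
      apply mul_le_mul <;> linarith
    linarith
  have hk0 := KK_pos hk
  have hl0 := KK_pos hl
  have := key ((k 0 0)⁻¹ • k) ((KK_smul (inv_pos.2 hk0) k).2 hk) ((l 0 0)⁻¹ • l) ((KK_smul (inv_pos.2 hl0) l).2 hl)
    (by simp [hk0.ne']) (by simp [hl0.ne'])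
  have e2 : (Matrix.adjugate (Matrix.of ((l 0 0)⁻¹ • l)) * Matrix.of ((k 0 0)⁻¹ • k)) 1 1 =
      ((l 0 0)⁻¹) ^ 2 * (k 0 0)⁻¹ * (Matrix.adjugate (Matrix.of l) * Matrix.of k) 1 1 := by
    simp only [Matrix.mul_apply, Fin.sum_univ_three, Matrix.adjugate_fin_three]
    simp
    ring
  rw [e2] at this
  by_contra hc
  push Not at hc
  have : ((l 0 0)⁻¹) ^ 2 * (k 0 0)⁻¹ * (Matrix.adjugate (Matrix.of l) * Matrix.of k) 1 1 ≤ 0 :=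
    mul_nonpos_of_nonneg_of_nonpos (by positivity) hc
  linarith

theorem sg_11 (m y : ℝ) (hy : y ≠ 0) : sg m y 1 1 = -1/2 := by
  simp [sg]; field_simp; ring

theorem stab_gen (A B : ℝ) (hAB : 4 * A ^ 3 + 27 * B ^ 2 ≠ 0) (g : Matrix (Fin 3) (Fin 3) ℝ)
    (hd : 0 < g.det) (hg : act g (wcoeffs A B) = g.det • wcoeffs A B) :
    ∃ r : ℝ, 0 < r ∧ (g = r • (1 : Matrix (Fin 3) (Fin 3) ℝ) ∨ ∃ m y, y ≠ 0 ∧ A = Amy m y ∧ B = Bmy m y ∧ g = r • sg m y) := by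
  obtain ⟨r, hr0, hr⟩ := cube_root _ hd.ne'
  have hr1 : 0 < r := by
    by_contra hc
    have : r < 0 := lt_of_le_of_ne (not_lt.1 hc) hr0
    have : r ^ 3 < 0 := by
      have h2 : 0 < r ^ 2 := by positivity
      nlinarith
    linarith
  have e : g = r • (r⁻¹ • g) := by rw [smul_smul, mul_inv_cancel₀ hr0, one_smul]
  have h1 : (r⁻¹ • g).det = 1 := by
    rw [Matrix.det_smul, ← hr]; simp [hr0]
  have h2 : act (r⁻¹ • g) (wcoeffs A B) = wcoeffs A B := by
    rw [act_smul_left, hg, ← hr, smul_smul]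
    have : r⁻¹ ^ 3 * r ^ 3 = 1 := by rw [← mul_pow, inv_mul_cancel₀ hr0, one_pow]
    rw [this, one_smul]
  refine ⟨r, hr1, ?_⟩
  rcases stab_cases A B hAB _ h1 h2 with h | ⟨m, y, hy, hA, hB, h⟩
  · left; rw [← h, ← e]
  · right; exact ⟨m, y, hy, hA, hB, by rw [← h, ← e]⟩

theorem I_smul {I J : (Fin 10 → ℝ) → ℝ} (h : InvPair I J) (t : ℝ) (ht : t ≠ 0) (c) : I (t • c) = t ^ 4 * I c ∧ J (t • c) = t ^ 6 * J c := by
  obtain ⟨r, hr0, hr⟩ := cube_root _ ht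
  have e : act (r • (1 : Matrix (Fin 3) (Fin 3) ℝ)) c = t • c := by rw [act_smul_left, act_one, hr]
  have d : (r • (1 : Matrix (Fin 3) (Fin 3) ℝ)).det = t := by rw [Matrix.det_smul]; simp [hr]
  have h1 := h.actI (r • (1 : Matrix (Fin 3) (Fin 3) ℝ)) c
  have h2 := h.actJ (r • (1 : Matrix (Fin 3) (Fin 3) ℝ)) c
  rw [e, d] at h1 h2
  exact ⟨h1, h2⟩

theorem IJ_Tv {I J : (Fin 10 → ℝ) → ℝ} (h : InvPair I J) (p : SS) (hp : dt p.1 ≠ 0) : I (Tv p) = -3 * p.2.1 ∧ J (Tv p) = -27 * p.2.2 := by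
  unfold Tv
  obtain ⟨h1, h2⟩ := I_smul h (dt p.1)⁻¹ (inv_ne_zero hp) (act (Matrix.of p.1) (wcoeffs p.2.1 p.2.2))
  rw [h1, h2, h.actI, h.actJ, h.wI, h.wJ]
  change (dt p.1)⁻¹ ^ 4 * (dt p.1 ^ 4 * _) = _ ∧ (dt p.1)⁻¹ ^ 6 * (dt p.1 ^ 6 * _) = _
  constructor <;> field_simp

theorem Tv_smul (t : ℝ) (ht : t ≠ 0) (g : M3) (p : ℝ × ℝ) : Tv (t • g, p) = Tv (g, p) := by
  unfold Tv
  simp only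
  rw [dt_smul]
  change _ • act (t • Matrix.of g) _ = _
  rw [act_smul_left, smul_smul]
  congr 1
  rw [mul_inv]; field_simp

/-- two representations in the cone differ by a scalar -/
theorem Tv_inj {I J : (Fin 10 → ℝ) → ℝ} (hI : InvPair I J) {k l : M3} (hk : k ∈ KK) (hl : l ∈ KK) {p q : ℝ × ℝ}
    (hp : 4 * p.1 ^ 3 + 27 * p.2 ^ 2 ≠ 0) (h : Tv (k, p) = Tv (l, q)) : p = q ∧ ∃ r : ℝ, 0 < r ∧ k = r • l := by
  have dk := KK_dt_pos hk
  have dl := KK_dt_pos hl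
  have i1 := IJ_Tv hI (k, p) dk.ne'
  have i2 := IJ_Tv hI (l, q) dl.ne'
  rw [h] at i1
  have hpq : p = q := Prod.ext (by have := i1.1.symm.trans i2.1; simp only at this; linarith) (by have := i1.2.symm.trans i2.2; simp only at this; linarith)
  refine ⟨hpq, ?_⟩
  subst hpq
  have dl' : (Matrix.of l).det = dt l := rfl
  have dk' : (Matrix.of k).det = dt k := rfl
  have h1 := congrArg (act (Matrix.adjugate (Matrix.of l))) h
  unfold Tv at h1
  simp only at h1
  rw [act_smul, act_smul, ← act_mul, ← act_mul, Matrix.adjugate_mul, act_smul_left, act_one, dl'] at h1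
  have dg : (Matrix.adjugate (Matrix.of l) * Matrix.of k).det = dt l ^ 2 * dt k := by
    rw [Matrix.det_mul, Matrix.det_adjugate, dl', dk']; simp
  have h2 : act (Matrix.adjugate (Matrix.of l) * Matrix.of k) (wcoeffs p.1 p.2) = (Matrix.adjugate (Matrix.of l) * Matrix.of k).det • wcoeffs p.1 p.2 := by
    have := congrArg (fun c => dt k • c) h1
    simp only [smul_smul] at this
    rw [mul_inv_cancel₀ dk.ne', one_smul] at this
    rw [this, dg]
    congr 1
    field_simp
  obtain ⟨r, hr, hc⟩ := stab_gen p.1 p.2 hp _ (by rw [dg]; positivity) h2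
  have t2 := T2 hk hl
  rcases hc with hc | ⟨m, y, hy, _, _, hc⟩
  · refine ⟨r / dt l, by positivity, ?_⟩
    have h3 := congrArg (fun M => Matrix.of l * M) hc
    rw [← Matrix.mul_assoc, Matrix.mul_adjugate, dl', Matrix.smul_mul, Matrix.one_mul, Matrix.mul_smul, Matrix.mul_one] at h3
    apply Matrix.of.injective
    change Matrix.of k = (r / dt l) • Matrix.of l
    rw [div_eq_inv_mul, ← smul_smul, ← h3, smul_smul, inv_mul_cancel₀ dl.ne', one_smul]
  · rw [hc, Matrix.smul_apply, sg_11 _ _ hy, smul_eq_mul] at t2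
    linarith

noncomputable def Bset (R : Set (ℝ × ℝ)) : Set (Fin 10 → ℝ) := Tv '' (KK ×ˢ R)

theorem norm_dt {g : M3} (hg : g ∈ KK) {s : ℝ} (hs : 0 < s) : ∃ t : ℝ, 0 < t ∧ dt (t • g) ^ 3 = s := by
  have hd := KK_dt_pos hg
  refine ⟨(s ^ ((1:ℝ)/3) / dt g) ^ ((1:ℝ)/3), by positivity, ?_⟩
  rw [dt_smul, ← Real.rpow_natCast (_ ^ ((1:ℝ)/3)), ← Real.rpow_mul (by positivity)]
  norm_num
  rw [div_mul_cancel₀ _ hd.ne', ← Real.rpow_natCast, ← Real.rpow_mul hs.le]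
  norm_num

theorem Th_image (R : Set (ℝ × ℝ)) : Th '' (UU ×ˢ R) = Set.Ioo 0 1 ×ˢ Bset R := by
  ext ⟨s, b⟩
  constructor
  · rintro ⟨⟨g, p⟩, ⟨hg, hp⟩, h⟩
    have h1 := congrArg Prod.fst h
    have h2 := congrArg Prod.snd h
    have hd := KK_dt_pos hg.1
    have hd1 : dt g < 1 := hg.2
    refine ⟨?_, ⟨(g, p), ⟨hg.1, hp⟩, h2⟩⟩
    rw [← h]
    exact ⟨pow_pos hd 3, pow_lt_one₀ hd.le hd1 (by norm_num)⟩
  · rintro ⟨⟨hs0, hs1⟩, ⟨⟨g, p⟩, ⟨hg, hp⟩, h⟩⟩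
    obtain ⟨t, ht, hts⟩ := norm_dt hg hs0
    have hkg : t • g ∈ KK := (KK_smul ht g).2 hg
    refine ⟨(t • g, p), ⟨⟨hkg, ?_⟩, hp⟩, ?_⟩
    · change dt (t • g) < 1
      by_contra hc
      have := one_le_pow₀ (not_lt.1 hc) (n := 3)
      rw [hts] at this
      exact absurd hs1 (not_lt.2 this)
    · refine Prod.ext hts ?_
      change Tv (t • g, p) = b
      rw [Tv_smul t ht.ne', h]

noncomputable def thE (v : EE) : EE := Pj.symm (Th (La v))

theorem thE_der (v : EE) (hv : dt (La v).1 ≠ 0) : HasFDerivAt thE (DE (La v)) v :=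
  (Pj.symm : TT →L[ℝ] EE).hasFDerivAt.comp v ((Th_cd _ hv).comp v (La : EE →L[ℝ] SS).hasFDerivAt)

theorem thE_image (S : Set SS) : thE '' (La ⁻¹' S) = Pj ⁻¹' (Th '' S) := by
  ext w
  constructor
  · rintro ⟨v, hv, rfl⟩
    exact ⟨La v, hv, by simp [thE]⟩
  · rintro ⟨q, hq, h⟩
    refine ⟨La.symm q, by simpa using hq, ?_⟩
    simp [thE, h]

theorem La_vol (S : Set SS) : volume (La ⁻¹' S) = volume S :=
  La_mp.measure_preimage_emb La.toHomeomorph.measurableEmbedding S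
theorem Pj_vol (S : Set TT) : volume (Pj ⁻¹' S) = volume S :=
  Pj_mp.measure_preimage_emb Pj.toHomeomorph.measurableEmbedding S

theorem vol_B {I J : (Fin 10 → ℝ) → ℝ} (hI : InvPair I J) (R : Set (ℝ × ℝ)) (hR : MeasurableSet R)
    (hD : ∀ p ∈ R, 4 * p.1 ^ 3 + 27 * p.2 ^ 2 ≠ 0) : volume (Bset R) = 324 * kap * volume R := by
  have hm : MeasurableSet (La ⁻¹' (UU ×ˢ R)) := La_mp.measurable (UU_open.measurableSet.prod hR)
  have h := lintegral_abs_det_fderiv_eq_addHaar_image (volume : Measure EE) hm (f := thE) (f' := fun v => DE (La v))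
    (fun v hv => (thE_der v (KK_dt_pos hv.1.1).ne').hasFDerivWithinAt) (by
      intro v hv w hw hvw
      apply La.injective
      have e : Th (La v) = Th (La w) := Pj.symm.injective hvw
      have hv : La v ∈ UU ×ˢ R := hv
      have hw : La w ∈ UU ×ˢ R := hw
      generalize La v = p at hv e ⊢
      generalize La w = q at hw e ⊢
      obtain ⟨k, p⟩ := p
      obtain ⟨l, q⟩ := q
      obtain ⟨hpq, r, hr, hkl⟩ := Tv_inj hI hv.1.1 hw.1.1 (hD _ hv.2) (congrArg Prod.snd e)
      simp only at hpq hkl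
      have e1 : dt k ^ 3 = dt l ^ 3 := congrArg Prod.fst e
      have dl : 0 < dt l := KK_dt_pos hw.1.1
      rw [hkl, dt_smul] at e1
      have e2 : (r ^ 9 - 1) * dt l ^ 3 = 0 := by linear_combination e1
      have e3 : r ^ 9 = 1 := by
        rcases mul_eq_zero.1 e2 with h | h
        · linarith
        · exact absurd h (by positivity)
      have e4 : r = 1 := (pow_eq_one_iff_of_nonneg hr.le (by norm_num)).1 e3
      rw [hkl, e4, one_smul, hpq])
  rw [thE_image, Pj_vol, Th_image, Measure.volume_eq_prod, Measure.prod_prod] at h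
  rw [setLIntegral_congr_fun (g := fun _ => (324 : ℝ≥0∞)) hm (fun v hv => by
    simp only
    rw [det_DE _ (KK_dt_pos hv.1.1).ne']; norm_num)] at h
  rw [setLIntegral_const, La_vol, Measure.volume_eq_prod, Measure.prod_prod] at h
  simp at h
  rw [← h, mul_assoc]; rfl

open MvPolynomial
set_option linter.all false
open MeasureTheory ENNReal
open scoped Pointwise

theorem Th_open (U : Set SS) (hU : IsOpen U) (h0 : ∀ p ∈ U, dt p.1 ≠ 0) : IsOpen (Th '' U) := by
  rw [isOpen_iff_mem_nhds]
  rintro _ ⟨p, hp, rfl⟩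
  have hd := h0 p hp
  have hs : HasStrictFDerivAt Th (fderiv ℝ Th p) p := (Th_smooth p hd).hasStrictFDerivAt (by norm_num)
  have hr : (fderiv ℝ Th p).range = ⊤ := by
    rw [LinearMap.range_eq_top]
    intro q
    have hu : IsUnit (LinearMap.det (DE p : EE →ₗ[ℝ] EE)) := by
      have : LinearMap.det (DE p : EE →ₗ[ℝ] EE) = -324 := det_DE p hd
      rw [this]; exact (by norm_num : (-324:ℝ) ≠ 0).isUnit
    have h2 := ((LinearMap.isUnit_iff_isUnit_det _).2 hu)
    have h3 : Function.Surjective (DE p : EE →ₗ[ℝ] EE) := ((Module.End.isUnit_iff _).1 h2).2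
    obtain ⟨v, hv⟩ := h3 (Pj.symm q)
    exact ⟨La v, Pj.symm.injective hv⟩
  rw [← hs.map_nhds_eq_of_surj hr]
  exact Filter.image_mem_map (hU.mem_nhds hp)

theorem Bset_open (R : Set (ℝ × ℝ)) (hR : IsOpen R) : IsOpen (Bset R) := by
  have h := Th_open (UU ×ˢ R) (UU_open.prod hR) (fun p hp => (KK_dt_pos hp.1.1).ne')
  rw [Th_image] at h
  have hc : Continuous (fun b : Fin 10 → ℝ => ((1/2 : ℝ), b)) := by fun_prop
  have := h.preimage hc
  convert this using 1
  ext b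
  simp
  intro _; norm_num

theorem Tv_cont (p : SS) (hp : dt p.1 ≠ 0) : ContinuousAt Tv p := ((Th_smooth p hp).continuousAt).snd

theorem clos_B (R : Set (ℝ × ℝ)) (hb : Bornology.IsBounded R) (s : ℝ) (hs : 0 < s) :
    ∃ C : Set SS, IsCompact C ∧ (∀ p ∈ C, p.1 ∈ closure KK ∧ dt p.1 ^ 3 = s ∧ p.2 ∈ closure R) ∧ Bset R ⊆ Tv '' C ∧ IsCompact (Tv '' C) := by
  set K1 := KK ∩ {g | dt g ^ 3 = s}
  have hcl : IsClosed {g : M3 | dt g ^ 3 = s} := isClosed_eq (dt_cont.pow 3) continuous_const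
  have hK1 : Bornology.IsBounded K1 := by
    refine bdd_of_entry _ (4 * (1 + s)) fun g hg i j => KK_bd hg.1 (by positivity) ?_ i j
    have h1 : dt g ^ 3 = s := hg.2
    have h2 := KK_dt_pos hg.1
    have h3 : dt g ≤ 1 + s := by
      by_contra hc
      push Not at hc
      have : 1 ≤ dt g := by linarith
      have : dt g ≤ dt g ^ 3 := le_self_pow₀ this (by norm_num)
      linarith
    have h4 : 1 + s ≤ (1 + s) ^ 3 := le_self_pow₀ (by linarith) (by norm_num)
    linarith
  have hC : IsCompact (closure K1 ×ˢ closure R) := hK1.isCompact_closure.prod hb.isCompact_closure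
  have hm : ∀ p ∈ closure K1 ×ˢ closure R, p.1 ∈ closure KK ∧ dt p.1 ^ 3 = s ∧ p.2 ∈ closure R := by
    rintro ⟨g, p⟩ ⟨h1, h2⟩
    refine ⟨closure_mono Set.inter_subset_left h1, ?_, h2⟩
    have := closure_mono (Set.inter_subset_right (s := KK)) h1
    rwa [hcl.closure_eq] at this
  refine ⟨closure K1 ×ˢ closure R, hC, hm, ?_, ?_⟩
  · rintro _ ⟨⟨g, p⟩, ⟨hg, hp⟩, rfl⟩
    obtain ⟨t, ht, hts⟩ := norm_dt hg hs
    exact ⟨(t • g, p), ⟨subset_closure ⟨(KK_smul ht g).2 hg, hts⟩, subset_closure hp⟩, Tv_smul t ht.ne' g p⟩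
  · refine hC.image_of_continuousOn fun p hp => (Tv_cont p ?_).continuousWithinAt
    intro h0
    have := (hm p hp).2.1
    rw [h0] at this
    simp at this
    linarith

theorem Bset_bdd (R : Set (ℝ × ℝ)) (hb : Bornology.IsBounded R) : Bornology.IsBounded (Bset R) := by
  obtain ⟨C, _, _, h1, h2⟩ := clos_B R hb 1 one_pos
  exact h2.isBounded.subset h1

theorem Bset_front (R : Set (ℝ × ℝ)) (hR : IsOpen R) (hb : Bornology.IsBounded R) (hf : volume (frontier R) = 0) :
    volume (frontier (Bset R)) = 0 := by
  set Z : Set SS := {p | p.1 ∈ closure KK ∧ dt p.1 ≠ 0 ∧ p.2 ∈ closure R ∧ ¬ (p.1 ∈ KK ∧ p.2 ∈ R)}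
  have hZ : volume Z = 0 := by
    have : Z ⊆ (frontier KK ×ˢ Set.univ) ∪ (Set.univ ×ˢ frontier R) := by
      rintro p ⟨h1, _, h2, h3⟩
      by_cases h : p.1 ∈ KK
      · right
        refine ⟨trivial, ?_⟩
        rw [hR.frontier_eq]
        exact ⟨h2, fun h' => h3 ⟨h, h'⟩⟩
      · left
        refine ⟨?_, trivial⟩
        rw [KK_open.frontier_eq]
        exact ⟨h1, h⟩
    refine measure_mono_null this (measure_union_null ?_ ?_)
    · rw [Measure.volume_eq_prod, Measure.prod_prod, KK_convex.addHaar_frontier volume, zero_mul]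
    · rw [Measure.volume_eq_prod, Measure.prod_prod, hf, mul_zero]
  have h1 : volume (thE '' (La ⁻¹' Z)) = 0 := by
    refine addHaar_image_eq_zero_of_differentiableOn_of_addHaar_eq_zero volume ?_ (by rw [La_vol, hZ])
    intro v hv
    exact (thE_der v hv.2.1).differentiableAt.differentiableWithinAt
  rw [thE_image, Pj_vol] at h1
  have h2 : Set.Ioo (0:ℝ) 1 ×ˢ frontier (Bset R) ⊆ Th '' Z := by
    rintro ⟨s, b⟩ ⟨hs, hbf⟩
    rw [(Bset_open R hR).frontier_eq] at hbf
    obtain ⟨C, _, hC, hC1, hC2⟩ := clos_B R hb s hs.1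
    obtain ⟨p, hp, hpb⟩ := closure_minimal hC1 hC2.isClosed hbf.1
    obtain ⟨c1, c2, c3⟩ := hC p hp
    refine ⟨p, ⟨c1, ?_, c3, ?_⟩, Prod.ext c2 hpb⟩
    · intro h0
      rw [h0] at c2
      have := hs.1
      simp at c2
      exact absurd c2 this.ne
    · rintro ⟨h3, h4⟩
      exact hbf.2 ⟨p, ⟨h3, h4⟩, hpb⟩
  have h3 := measure_mono_null h2 h1
  rw [Measure.volume_eq_prod, Measure.prod_prod] at h3
  simpa using h3

open MvPolynomial
set_option linter.all false
open MeasureTheory ENNReal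
open scoped Pointwise

def Dq (p : ℝ × ℝ) : ℝ := -(4 * p.1 ^ 3 + 27 * p.2 ^ 2)
def RR (e α β : ℝ) : Set (ℝ × ℝ) := {p | |p.1| < 1/3 ∧ |p.2| < 2/27 ∧ α < e * Dq p ∧ e * Dq p < β}

theorem Dq_cont : Continuous Dq := by unfold Dq; fun_prop

theorem RR_open (e α β : ℝ) : IsOpen (RR e α β) := by
  have h1 : IsOpen {p : ℝ × ℝ | |p.1| < 1/3} := isOpen_lt (by fun_prop) continuous_const
  have h2 : IsOpen {p : ℝ × ℝ | |p.2| < 2/27} := isOpen_lt (by fun_prop) continuous_const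
  have hD : Continuous fun p => e * Dq p := continuous_const.mul Dq_cont
  have h3 : IsOpen {p : ℝ × ℝ | α < e * Dq p} := isOpen_lt continuous_const hD
  have h4 : IsOpen {p : ℝ × ℝ | e * Dq p < β} := isOpen_lt hD continuous_const
  exact h1.inter (h2.inter (h3.inter h4))

theorem RR_bdd (e α β : ℝ) : Bornology.IsBounded (RR e α β) := by
  refine (Metric.isBounded_ball (x := (0 : ℝ × ℝ)) (r := 1)).subset ?_
  intro p hp
  rw [mem_ball_zero_iff, Prod.norm_def, max_lt_iff]
  exact ⟨by rw [Real.norm_eq_abs]; linarith [hp.1], by rw [Real.norm_eq_abs]; linarith [hp.2.1]⟩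

theorem RR_ne {e α β : ℝ} (hα : 0 ≤ α) {p : ℝ × ℝ} (hp : p ∈ RR e α β) : 4 * p.1 ^ 3 + 27 * p.2 ^ 2 ≠ 0 := by
  intro h
  have := hp.2.2.1
  unfold Dq at this
  rw [h] at this
  simp at this
  linarith

theorem lvl_null (s : Set (ℝ × ℝ)) (hs : MeasurableSet s) (h : ∀ x, (Prod.mk x ⁻¹' s).Finite) : volume s = 0 := by
  rw [Measure.volume_eq_prod, Measure.measure_prod_null hs]
  exact Filter.Eventually.of_forall fun x => (h x).measure_zero _

theorem lvlA_null (s : Set ℝ) (hs : s.Finite) : volume (s ×ˢ (Set.univ : Set ℝ)) = 0 := by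
  rw [Measure.volume_eq_prod, Measure.prod_prod, hs.measure_zero, zero_mul]
theorem lvlB_null (s : Set ℝ) (hs : s.Finite) : volume ((Set.univ : Set ℝ) ×ˢ s) = 0 := by
  rw [Measure.volume_eq_prod, Measure.prod_prod, hs.measure_zero, mul_zero]

theorem fin_abs (a : ℝ) : {x : ℝ | |x| = a}.Finite := by
  refine (Set.toFinite {a, -a}).subset fun x hx => ?_
  have hx : |x| = a := hx
  rcases abs_cases x with ⟨h, _⟩ | ⟨h, _⟩
  · left; linarith
  · right; simp; linarith

theorem fin_sq (a : ℝ) : {x : ℝ | x ^ 2 = a}.Finite := by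
  refine (fin_abs (Real.sqrt a)).subset fun x hx => ?_
  have hx : x ^ 2 = a := hx
  change |x| = _
  rw [← hx, Real.sqrt_sq_eq_abs]

theorem Dq_null (e α : ℝ) (he : e ≠ 0) : volume {p | e * Dq p = α} = 0 := by
  refine lvl_null _ (isClosed_eq (Dq_cont.const_mul e |> id) continuous_const).measurableSet fun x => ?_
  refine (fin_sq ((-(α / e) - 4 * x ^ 3) / 27)).subset fun y hy => ?_
  have hy : e * Dq (x, y) = α := hy
  unfold Dq at hy
  change y ^ 2 = _
  rw [← hy]; field_simp; ring

theorem RR_front (e α β : ℝ) (he : e ≠ 0) : volume (frontier (RR e α β)) = 0 := by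
  have : frontier (RR e α β) ⊆ ({x : ℝ | |x| = 1/3} ×ˢ Set.univ) ∪ ((Set.univ ×ˢ {x : ℝ | |x| = 2/27}) ∪ ({p | e * Dq p = α} ∪ {p | e * Dq p = β})) := by
    intro p hp
    rw [(RR_open e α β).frontier_eq] at hp
    obtain ⟨h1, h2⟩ := hp
    have hc : p ∈ {p : ℝ × ℝ | |p.1| ≤ 1/3 ∧ |p.2| ≤ 2/27 ∧ α ≤ e * Dq p ∧ e * Dq p ≤ β} := by
      have h1' : IsClosed {p : ℝ × ℝ | |p.1| ≤ 1/3} := isClosed_le (by fun_prop) continuous_const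
      have h2' : IsClosed {p : ℝ × ℝ | |p.2| ≤ 2/27} := isClosed_le (by fun_prop) continuous_const
      have hD : Continuous fun p => e * Dq p := continuous_const.mul Dq_cont
      have h3' : IsClosed {p : ℝ × ℝ | α ≤ e * Dq p} := isClosed_le continuous_const hD
      have h4' : IsClosed {p : ℝ × ℝ | e * Dq p ≤ β} := isClosed_le hD continuous_const
      have hcl : IsClosed {p : ℝ × ℝ | |p.1| ≤ 1/3 ∧ |p.2| ≤ 2/27 ∧ α ≤ e * Dq p ∧ e * Dq p ≤ β} :=
        h1'.inter (h2'.inter (h3'.inter h4'))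
      refine closure_minimal (fun q (hq : q ∈ RR e α β) => ?_) hcl h1
      exact ⟨hq.1.le, hq.2.1.le, hq.2.2.1.le, hq.2.2.2.le⟩
    by_contra hn
    simp only [Set.mem_union, Set.mem_prod, Set.mem_setOf_eq, Set.mem_univ, and_true, true_and, not_or] at hn
    obtain ⟨n1, n2, n3, n4⟩ := hn
    exact h2 ⟨lt_of_le_of_ne hc.1 n1, lt_of_le_of_ne hc.2.1 n2, lt_of_le_of_ne hc.2.2.1 (Ne.symm n3), lt_of_le_of_ne hc.2.2.2 n4⟩
  exact measure_mono_null this (measure_union_null (lvlA_null _ (fin_abs _)) (measure_union_null (lvlB_null _ (fin_abs _))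
    (measure_union_null (Dq_null e α he) (Dq_null e β he))))

theorem Dq_lt {p : ℝ × ℝ} (h1 : |p.1| < 1/3) (h2 : |p.2| < 2/27) : |Dq p| < 10 := by
  have a1 : |p.1 ^ 3| ≤ 1 := by rw [abs_pow]; exact pow_le_one₀ (abs_nonneg _) (by linarith)
  have a2 : |p.2 ^ 2| ≤ (2/27)^2 := by rw [abs_pow]; exact pow_le_pow_left₀ (abs_nonneg _) h2.le _
  rw [abs_le] at a1 a2
  unfold Dq
  rw [abs_lt]; constructor <;> linarith

theorem RR_small (e : ℝ) (δ : ℝ≥0∞) (hδ : 0 < δ) : ∃ ε : ℝ, 0 < ε ∧ ε < 10 ∧ volume (RR e 0 ε) < δ := by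
  have h := tendsto_measure_iInter_atTop (μ := (volume : Measure (ℝ × ℝ))) (s := fun k : ℕ => RR e 0 (1 / (k + 1 : ℝ)))
    (fun k => (RR_open _ _ _).measurableSet.nullMeasurableSet) (fun i j hij p hp => ⟨hp.1, hp.2.1, hp.2.2.1, hp.2.2.2.trans_le (by
      apply one_div_le_one_div_of_le (by positivity); have : (i:ℝ) ≤ j := by exact_mod_cast hij
      linarith)⟩) ⟨0, (RR_bdd _ _ _).measure_lt_top.ne⟩
  have e0 : (⋂ k : ℕ, RR e 0 (1 / (k + 1 : ℝ))) = ∅ := by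
    rw [Set.eq_empty_iff_forall_notMem]
    intro p hp
    rw [Set.mem_iInter] at hp
    have h0 := (hp 0).2.2.1
    obtain ⟨k, hk⟩ := exists_nat_one_div_lt h0
    exact absurd (hp k).2.2.2 (not_lt.2 hk.le)
  rw [e0, measure_empty] at h
  obtain ⟨k, hk⟩ := ((tendsto_order.1 h).2 δ hδ).exists
  refine ⟨1 / (k + 1 : ℝ), by positivity, ?_, hk⟩
  have : 1 / (k + 1 : ℝ) ≤ 1 := by
    rw [div_le_one (by positivity)]; have : (0:ℝ) ≤ k := by positivity
    linarith
  linarith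

theorem area_pos : volume (RR 1 0 10) = ENNReal.ofReal (8/405) := by
  let f : ℝ → ℝ := fun x => (2 / Real.sqrt 27) * (-x) ^ ((3:ℝ)/2)
  have hfc : Continuous f := by
    have : Continuous (fun x : ℝ => (-x) ^ ((3:ℝ)/2)) := continuous_neg.rpow_const (fun x => Or.inr (by norm_num))
    exact this.const_mul _ |> id
  have hs27 : Real.sqrt 27 ^ 2 = 27 := Real.sq_sqrt (by norm_num)
  have hs0 : 0 < Real.sqrt 27 := Real.sqrt_pos.2 (by norm_num)
  have hf2 : ∀ x ≤ 0, f x ^ 2 = (4/27) * (-x)^3 := by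
    intro x hx
    simp only [f]
    rw [mul_pow, div_pow, hs27, ← Real.rpow_natCast (_ ^ _), ← Real.rpow_mul (by linarith)]
    norm_num
  have hf0 : ∀ x ≤ 0, 0 ≤ f x := fun x hx => mul_nonneg (by positivity) (Real.rpow_nonneg (by linarith) _)
  have hreg : RR 1 0 10 = regionBetween (fun x => - f x) f (Set.Ioo (-(1/3)) 0) := by
    ext ⟨x, y⟩
    simp only [RR, regionBetween, Set.mem_setOf_eq, Set.mem_Ioo]
    constructor
    · rintro ⟨h1, h2, h3, h4⟩
      unfold Dq at h3
      simp only at h3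
      have hx : x < 0 := by
        by_contra hc
        have : 0 ≤ x ^ 3 := pow_nonneg (not_lt.1 hc) 3
        nlinarith [sq_nonneg y]
      have hy : |y| < f x := by
        apply abs_lt_of_sq_lt_sq _ (hf0 x hx.le)
        rw [hf2 x hx.le]
        have : (-x)^3 = -x^3 := by ring
        rw [this]; linarith
      exact ⟨⟨(abs_lt.1 h1).1, hx⟩, (abs_lt.1 hy).1, (abs_lt.1 hy).2⟩
    · rintro ⟨⟨h1, h2⟩, h3, h4⟩
      have hy := sq_lt_sq.2 ((abs_lt.2 ⟨h3, h4⟩).trans_le (le_abs_self _))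
      rw [hf2 x h2.le] at hy
      have hx3 : (-x)^3 ≤ (1/3)^3 := pow_le_pow_left₀ (by linarith) (by linarith) _
      have hx1 : |x| < 1/3 := abs_lt.2 ⟨by linarith, by linarith⟩
      have hy1 : |y| < 2/27 := by
        apply abs_lt_of_sq_lt_sq _ (by norm_num)
        refine hy.trans_le ?_
        linarith
      refine ⟨hx1, hy1, ?_, ?_⟩
      · unfold Dq; simp only
        have : (-x)^3 = -x^3 := by ring
        rw [this] at hy; linarith
      · have := (abs_lt.1 (Dq_lt (p := (x, y)) hx1 hy1)).2
        linarith
  rw [hreg, Measure.volume_eq_prod, volume_regionBetween_eq_integral]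
  · congr 1
    rw [← integral_Ioc_eq_integral_Ioo, ← intervalIntegral.integral_of_le (by norm_num)]
    have e1 : ∀ x, (f - fun x => - f x) x = (4 / Real.sqrt 27) * (-x) ^ ((3:ℝ)/2) := by
      intro x; simp only [f, Pi.sub_apply]; ring
    simp_rw [e1]
    rw [intervalIntegral.integral_const_mul, intervalIntegral.integral_comp_neg (fun x => x ^ ((3:ℝ)/2))]
    rw [integral_rpow (Or.inl (by norm_num))]
    have e2 : Real.sqrt 27 = 3 * Real.sqrt 3 := by
      rw [show (27:ℝ) = 3 ^ 2 * 3 by norm_num, Real.sqrt_mul (by norm_num), Real.sqrt_sq (by norm_num)]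
    have e3 : ((1:ℝ)/3) ^ ((5:ℝ)/2) = 1 / (9 * Real.sqrt 3) := by
      rw [Real.div_rpow (by norm_num) (by norm_num), Real.one_rpow, show (5:ℝ)/2 = 2 + 1/2 by norm_num,
        Real.rpow_add (by norm_num), ← Real.sqrt_eq_rpow]
      norm_num
    norm_num
    rw [show (1/3:ℝ) ^ ((5:ℝ)/2) = _ from e3, e2]
    have h3 : Real.sqrt 3 * Real.sqrt 3 = 3 := Real.mul_self_sqrt (by norm_num)
    have h3' : Real.sqrt 3 ≠ 0 := (Real.sqrt_pos.2 (by norm_num)).ne'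
    field_simp
    nlinarith
  · exact (hfc.neg.integrableOn_Icc).mono_set Set.Ioo_subset_Icc_self
  · exact (hfc.integrableOn_Icc).mono_set Set.Ioo_subset_Icc_self
  · exact measurableSet_Ioo
  · intro x hx
    have := hf0 x hx.2.le
    change -f x ≤ f x
    linarith

theorem area_neg : volume (RR (-1) 0 10) = ENNReal.ofReal (32/405) := by
  have hbox : volume (Set.Ioo (-(1/3) : ℝ) (1/3) ×ˢ Set.Ioo (-(2/27) : ℝ) (2/27)) = ENNReal.ofReal (8/81) := by
    rw [Measure.volume_eq_prod, Measure.prod_prod, Real.volume_Ioo, Real.volume_Ioo, ← ENNReal.ofReal_mul (by norm_num)]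
    norm_num
  have hu : Set.Ioo (-(1/3) : ℝ) (1/3) ×ˢ Set.Ioo (-(2/27) : ℝ) (2/27) =
      RR 1 0 10 ∪ RR (-1) 0 10 ∪ ((Set.Ioo (-(1/3) : ℝ) (1/3) ×ˢ Set.Ioo (-(2/27) : ℝ) (2/27)) ∩ {p | 1 * Dq p = 0}) := by
    ext p
    simp only [Set.mem_union, Set.mem_prod, Set.mem_Ioo, RR, Set.mem_setOf_eq, ← abs_lt, Set.mem_inter_iff]
    constructor
    · rintro ⟨h1, h2⟩
      have h3 := abs_lt.1 (Dq_lt h1 h2)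
      rcases lt_trichotomy (Dq p) 0 with h | h | h
      · left; right; exact ⟨h1, h2, by linarith, by linarith⟩
      · right; exact ⟨⟨h1, h2⟩, by linarith⟩
      · left; left; exact ⟨h1, h2, by linarith, by linarith⟩
    · rintro ((⟨h1, h2, -⟩ | ⟨h1, h2, -⟩) | ⟨⟨h1, h2⟩, -⟩) <;> exact ⟨h1, h2⟩
  have hd : Disjoint (RR 1 0 10) (RR (-1) 0 10) := by
    rw [Set.disjoint_left]
    intro p h1 h2
    have := h1.2.2.1; have := h2.2.2.1
    linarith
  have h1 : volume (RR 1 0 10 ∪ RR (-1) 0 10) = ENNReal.ofReal (8/81) := by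
    apply le_antisymm
    · rw [← hbox]
      apply measure_mono
      rw [hu]; exact Set.subset_union_left
    · rw [← hbox, hu]
      refine (measure_union_le _ _).trans ?_
      rw [measure_mono_null Set.inter_subset_right (Dq_null 1 0 one_ne_zero), add_zero]
  rw [measure_union hd (RR_open _ _ _).measurableSet, area_pos] at h1
  have h2 : ENNReal.ofReal (8/81) = ENNReal.ofReal (8/405) + ENNReal.ofReal (32/405) := by
    rw [← ENNReal.ofReal_add (by norm_num) (by norm_num)]; norm_num
  rw [h2] at h1
  exact (ENNReal.add_right_inj ENNReal.ofReal_ne_top).1 h1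

open MvPolynomial
set_option linter.all false
open MeasureTheory ENNReal
open scoped Pointwise

/-- right multiplication -/
noncomputable def mR (g : M3) (s : Matrix (Fin 3) (Fin 3) ℝ) : M3 := Matrix.of.symm (Matrix.of g * s)

theorem of_mR (g s) : Matrix.of (mR g s) = Matrix.of g * s := rfl
theorem dt_mR (g : M3) (s) (hs : s.det = 1) : dt (mR g s) = dt g := by
  unfold dt; rw [of_mR, Matrix.det_mul, hs, mul_one]
theorem lmL_mR (u : Matrix (Fin 3) (Fin 3) ℝ) (g s) : lmL u (mR g s) = mR (lmL u g) s := by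
  apply Matrix.of.injective
  rw [of_lmL, of_mR, of_mR, of_lmL, Matrix.mul_assoc]

theorem Tv_mR (g : M3) (s) (hs : s.det = 1) (p : ℝ × ℝ) (hW : act s (wcoeffs p.1 p.2) = wcoeffs p.1 p.2) : Tv (mR g s, p) = Tv (g, p) := by
  unfold Tv
  simp only
  rw [dt_mR g s hs, of_mR, act_mul, hW]

theorem Tv_lmL (u : Matrix (Fin 3) (Fin 3) ℝ) (g : M3) (p : ℝ × ℝ) : Tv (lmL u g, p) = u.det⁻¹ • act u (Tv (g, p)) := by
  unfold Tv
  simp only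
  rw [dt_lmL, of_lmL, act_mul, act_smul, smul_smul, mul_inv]

/-- all representations of a given point -/
theorem Tv_fib (g g0 : M3) (hg : 0 < dt g) (hg0 : 0 < dt g0) (p : ℝ × ℝ) (hp : 4 * p.1 ^ 3 + 27 * p.2 ^ 2 ≠ 0)
    (h : Tv (g, p) = Tv (g0, p)) : ∃ r : ℝ, 0 < r ∧ (g = r • g0 ∨ ∃ m y, y ≠ 0 ∧ p.1 = Amy m y ∧ p.2 = Bmy m y ∧ g = r • mR g0 (sg m y)) := by
  have dl' : (Matrix.of g0).det = dt g0 := rfl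
  have dk' : (Matrix.of g).det = dt g := rfl
  have h1 := congrArg (act (Matrix.adjugate (Matrix.of g0))) h
  unfold Tv at h1
  simp only at h1
  rw [act_smul, act_smul, ← act_mul, ← act_mul, Matrix.adjugate_mul, act_smul_left, act_one, dl'] at h1
  have dg : (Matrix.adjugate (Matrix.of g0) * Matrix.of g).det = dt g0 ^ 2 * dt g := by
    rw [Matrix.det_mul, Matrix.det_adjugate, dl', dk']; simp
  have h2 : act (Matrix.adjugate (Matrix.of g0) * Matrix.of g) (wcoeffs p.1 p.2) = (Matrix.adjugate (Matrix.of g0) * Matrix.of g).det • wcoeffs p.1 p.2 := by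
    have := congrArg (fun c => dt g • c) h1
    simp only [smul_smul] at this
    rw [mul_inv_cancel₀ hg.ne', one_smul] at this
    rw [this, dg]
    congr 1
    field_simp
  obtain ⟨r, hr, hc⟩ := stab_gen p.1 p.2 hp _ (by rw [dg]; positivity) h2
  have fin : ∀ s : Matrix (Fin 3) (Fin 3) ℝ, Matrix.adjugate (Matrix.of g0) * Matrix.of g = r • s → g = (r / dt g0) • mR g0 s := by
    intro s hc
    have h3 := congrArg (fun M => Matrix.of g0 * M) hc
    rw [← Matrix.mul_assoc, Matrix.mul_adjugate, dl', Matrix.smul_mul, Matrix.one_mul, Matrix.mul_smul] at h3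
    apply Matrix.of.injective
    change Matrix.of g = (r / dt g0) • (Matrix.of g0 * s)
    rw [div_eq_inv_mul, ← smul_smul, ← h3, smul_smul, inv_mul_cancel₀ hg0.ne', one_smul]
  refine ⟨r / dt g0, by positivity, ?_⟩
  rcases hc with hc | ⟨m, y, hy, hA, hB, hc⟩
  · left
    have := fin _ hc
    have e : mR g0 1 = g0 := by apply Matrix.of.injective; rw [of_mR, Matrix.mul_one]
    rwa [e] at this
  · right; exact ⟨m, y, hy, hA, hB, fin _ hc⟩

def Bh (R : Set (ℝ × ℝ)) (h : M3) : Set (Fin 10 → ℝ) :=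
  {b | ∃ g : M3, ∃ p ∈ R, lmL (Matrix.adjugate (Matrix.of h)) g ∈ KK ∧ b = Tv (g, p)}

theorem KK_adj {h g : M3} (hk : lmL (Matrix.adjugate (Matrix.of h)) g ∈ KK) : 0 < dt g := by
  have h3 := KK_dt_pos hk
  rw [dt_lmL, Matrix.det_adjugate] at h3
  have h4 : (0:ℝ) ≤ (Matrix.of h).det ^ (Fintype.card (Fin 3) - 1) := by
    simp; positivity
  exact pos_of_mul_pos_right h3 h4

theorem h_adj (h : M3) (g : M3) : lmL (Matrix.of h) (lmL (Matrix.adjugate (Matrix.of h)) g) = dt h • g := by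
  rw [← lmL_mul, Matrix.mul_adjugate, lmL_smul_left, lmL_one]; rfl
theorem adj_h (h : M3) (g : M3) : lmL (Matrix.adjugate (Matrix.of h)) (lmL (Matrix.of h) g) = dt h • g := by
  rw [← lmL_mul, Matrix.adjugate_mul, lmL_smul_left, lmL_one]; rfl

theorem Bh_eq (R : Set (ℝ × ℝ)) (h : M3) (hd : 0 < dt h) : Bh R h = (fun b => (dt h)⁻¹ • act (Matrix.of h) b) '' Bset R := by
  ext b
  constructor
  · rintro ⟨g, p, hp, hk, rfl⟩
    refine ⟨_, ⟨(_, p), ⟨hk, hp⟩, rfl⟩, ?_⟩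
    simp only
    rw [show (dt h)⁻¹ = (Matrix.of h).det⁻¹ from rfl, ← Tv_lmL, h_adj, Tv_smul _ hd.ne']
  · rintro ⟨_, ⟨⟨k, p⟩, ⟨hk, hp⟩, rfl⟩, rfl⟩
    refine ⟨lmL (Matrix.of h) k, p, hp, ?_, ?_⟩
    · rw [adj_h, KK_smul hd]; exact hk
    · rw [Tv_lmL]; rfl

theorem Bh_mono {R R' : Set (ℝ × ℝ)} (hR : R ⊆ R') (h : M3) : Bh R h ⊆ Bh R' h := by
  rintro b ⟨g, p, hp, hk⟩; exact ⟨g, p, hR hp, hk⟩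

theorem det_hE (h : M3) (hd : 0 < dt h) : LinearMap.det ((dt h)⁻¹ • actL (Matrix.of h)) = 1 := by
  rw [LinearMap.det_smul, det_actL _ hd.ne']
  simp only [Module.finrank_fintype_fun_eq_card, Fintype.card_fin]
  change (dt h)⁻¹ ^ 10 * dt h ^ 10 = 1
  rw [← mul_pow, inv_mul_cancel₀ hd.ne', one_pow]

noncomputable def hE (h : M3) (hd : 0 < dt h) : (Fin 10 → ℝ) ≃L[ℝ] (Fin 10 → ℝ) :=
  (LinearEquiv.ofIsUnitDet (f := (dt h)⁻¹ • actL (Matrix.of h)) (v := Pi.basisFun ℝ (Fin 10)) (v' := Pi.basisFun ℝ (Fin 10)) (by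
    rw [LinearMap.det_toMatrix, det_hE h hd]; exact isUnit_one)).toContinuousLinearEquiv

theorem Bh_props (R : Set (ℝ × ℝ)) (hR : IsOpen R) (hb : Bornology.IsBounded R) (hf : volume (frontier R) = 0) (h : M3) (hd : 0 < dt h) :
    IsOpen (Bh R h) ∧ Bornology.IsBounded (Bh R h) ∧ volume (frontier (Bh R h)) = 0 ∧ volume (Bh R h) = volume (Bset R) := by
  have e : Bh R h = hE h hd '' Bset R := Bh_eq R h hd
  have hv : ∀ s, volume (hE h hd '' s) = volume s := by
    intro s
    have := Measure.addHaar_image_linearMap (volume : Measure (Fin 10 → ℝ)) ((dt h)⁻¹ • actL (Matrix.of h)) s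
    rw [det_hE h hd, abs_one, ENNReal.ofReal_one, one_mul] at this
    exact this
  refine ⟨?_, ?_, ?_, ?_⟩
  · rw [e]; exact (hE h hd).toHomeomorph.isOpenMap _ (Bset_open R hR)
  · rw [e]; exact (hE h hd).lipschitz.isBounded_image (Bset_bdd R hb)
  · rw [e]
    have := (hE h hd).toHomeomorph.image_frontier (Bset R)
    change hE h hd '' frontier _ = frontier (hE h hd '' _) at this
    rw [← this, hv, Bset_front R hR hb hf]
  · rw [e, hv]

def YV := Fin 10 → ℤ
instance : Countable YV := inferInstanceAs (Countable (Fin 10 → ℤ))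

instance : MulAction SLZ YV where
  smul γ c := act (γ : Matrix (Fin 3) (Fin 3) ℤ) c
  one_smul c := by
    change act ((1 : SLZ) : Matrix (Fin 3) (Fin 3) ℤ) c = c
    exact act_one c
  mul_smul γ δ c := by
    change act ((γ * δ : SLZ) : Matrix (Fin 3) (Fin 3) ℤ) c = act (γ : Matrix (Fin 3) (Fin 3) ℤ) (act (δ : Matrix (Fin 3) (Fin 3) ℤ) c)
    exact act_mul _ _ _

def toV (c : YV) : Fin 10 → ℝ := fun i => (c i : ℝ)
noncomputable def cR (γ : SLZ) : Matrix (Fin 3) (Fin 3) ℝ := (γ : Matrix (Fin 3) (Fin 3) ℤ).map (Int.castRingHom ℝ)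

theorem toV_smul (γ : SLZ) (c : YV) : toV (γ • c) = act (cR γ) (toV c) :=
  act_map (Int.castRingHom ℝ) (γ : Matrix (Fin 3) (Fin 3) ℤ) c

theorem orbitZ_YV (c : YV) : @Eq (Set YV) (orbitZ c) (MulAction.orbit SLZ c) := orbitZ_eq c

def SI (c : YV) : Prop := StronglyIrred (c : Fin 10 → ℤ)

theorem SI_act (γ : SLZ) (c : Fin 10 → ℤ) (hc : StronglyIrred c) : StronglyIrred (act (γ : Matrix (Fin 3) (Fin 3) ℤ) c) := by
  rw [SI_iff] at hc ⊢
  rintro ⟨v, hv, h1, h2⟩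
  have e : (fun k => ((act (γ : Matrix (Fin 3) (Fin 3) ℤ) c k : ℤ) : ℚ)) =
      act ((γ : Matrix (Fin 3) (Fin 3) ℤ).map (Int.castRingHom ℚ)) (fun k => (c k : ℚ)) := act_map (Int.castRingHom ℚ) _ c
  have hd : ((γ : Matrix (Fin 3) (Fin 3) ℤ).map (Int.castRingHom ℚ)).det = 1 := by
    have := RingHom.map_det (Int.castRingHom ℚ) (γ : Matrix (Fin 3) (Fin 3) ℤ)
    rw [γ.2, map_one] at this
    exact this.symm
  rw [e, fe_act] at h1
  rw [e, he_act, hd] at h2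
  refine hc ⟨_, ?_, h1, by simpa using h2⟩
  intro h0
  apply hv
  have := congrArg (fun w => Matrix.vecMul w ((γ : Matrix (Fin 3) (Fin 3) ℤ).map (Int.castRingHom ℚ)).adjugate) h0
  rwa [Matrix.vecMul_vecMul, Matrix.mul_adjugate, hd, one_smul, Matrix.vecMul_one, Matrix.zero_vecMul] at this

theorem SI_smul (γ : SLZ) (c : YV) : SI (γ • c) ↔ SI c := by
  refine ⟨fun h => ?_, SI_act γ c⟩
  have : SI (γ⁻¹ • (γ • c)) := SI_act γ⁻¹ _ h
  rwa [inv_smul_smul] at this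

def CV (R : Set (ℝ × ℝ)) (n : ℕ) (h : M3) : Set YV := {c | SI c ∧ (n:ℝ)⁻¹ • toV c ∈ Bh R h}
def SV (R : Set (ℝ × ℝ)) (n : ℕ) : Set YV := {c | SI c ∧ ∃ p ∈ R, ∃ g : M3, 0 < dt g ∧ (n:ℝ)⁻¹ • toV c = Tv (g, p)}
noncomputable def orbV (R : Set (ℝ × ℝ)) (n : ℕ) : ℝ≥0∞ :=
  ((Set.encard {o : Set YV | ∃ y ∈ SV R n, o = MulAction.orbit SLZ y} : ℕ∞) : ℝ≥0∞)

theorem CV_sub (R n h) : CV R n h ⊆ SV R n := by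
  rintro c ⟨h1, g, p, hp, hk, e⟩
  exact ⟨h1, p, hp, g, KK_adj hk, e⟩

theorem Bh_inv (R) (γ : SLZ) (h : M3) (b) (hb : b ∈ Bh R h) : act (cR γ) b ∈ Bh R (lt γ h) := by
  obtain ⟨g, p, hp, hk, rfl⟩ := hb
  refine ⟨lmL (cR γ) g, p, hp, ?_, ?_⟩
  · rw [← lmL_lt]
    unfold cR
    rw [adj_lmL _ (det_castR γ)]; exact hk
  · rw [Tv_lmL]; unfold cR; rw [det_castR, inv_one, one_smul]

theorem CV_inv1 (R n) (γ : SLZ) (h : M3) (c : YV) (hc : c ∈ CV R n h) : γ • c ∈ CV R n (lt γ h) := by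
  refine ⟨(SI_smul γ c).2 hc.1, ?_⟩
  rw [toV_smul, ← act_smul]
  exact Bh_inv R γ h _ hc.2

theorem lt_inv (γ : SLZ) (h : M3) : lt γ⁻¹ (lt γ h) = h := by
  apply Matrix.of.injective
  rw [lt_eq, lt_eq, ← Matrix.mul_assoc, ← Matrix.map_mul, ← Matrix.SpecialLinearGroup.coe_mul, inv_mul_cancel, Matrix.SpecialLinearGroup.coe_one]
  simp

theorem CV_inv (R n) (γ : SLZ) (h : M3) (c : YV) : γ • c ∈ CV R n (lt γ h) ↔ c ∈ CV R n h := by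
  refine ⟨fun hc => ?_, CV_inv1 R n γ h c⟩
  have := CV_inv1 R n γ⁻¹ _ _ hc
  rwa [lt_inv, inv_smul_smul] at this

theorem SV_inv1 (R n) (γ : SLZ) (c : YV) (hc : c ∈ SV R n) : γ • c ∈ SV R n := by
  obtain ⟨h1, p, hp, g, hg, e⟩ := hc
  refine ⟨(SI_smul γ c).2 h1, p, hp, lmL (cR γ) g, ?_, ?_⟩
  · rw [dt_lmL]; unfold cR; rw [det_castR, one_mul]; exact hg
  · rw [toV_smul, ← act_smul, e, Tv_lmL]; unfold cR; rw [det_castR, inv_one, one_smul]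

theorem SV_inv (R n) (γ : SLZ) (c : YV) : γ • c ∈ SV R n ↔ c ∈ SV R n := by
  refine ⟨fun hc => ?_, SV_inv1 R n γ c⟩
  have := SV_inv1 R n γ⁻¹ _ hc
  rwa [inv_smul_smul] at this

theorem three_sg (p : ℝ × ℝ) (hp : 4 * p.1 ^ 3 + 27 * p.2 ^ 2 ≠ 0) : ∃ F : Finset (Matrix (Fin 3) (Fin 3) ℝ), F.card = 3 ∧
    (∀ s ∈ F, s.det = 1 ∧ act s (wcoeffs p.1 p.2) = wcoeffs p.1 p.2) ∧ 1 ∈ F ∧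
    (∀ m y, y ≠ 0 → p.1 = Amy m y → p.2 = Bmy m y → sg m y ∈ F) := by
  classical
  obtain ⟨m, y, hy, hA, hB⟩ := exists_my p.1 p.2 hp
  refine ⟨{1, sg m y, sg (-m) (-y)}, ?_, ?_, by simp, ?_⟩
  · rw [Finset.card_eq_three]
    exact ⟨_, _, _, (sg_ne_one m y hy).symm, (sg_ne_one _ _ (neg_ne_zero.2 hy)).symm, sg_ne m y hy, rfl⟩
  · intro s hs
    simp only [Finset.mem_insert, Finset.mem_singleton] at hs
    rcases hs with rfl | rfl | rfl
    · exact ⟨Matrix.det_one, act_one _⟩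
    · rw [hA, hB]; exact ⟨det_sg _ _ hy, act_sg _ _ hy⟩
    · rw [hA, hB, ← A_neg, ← B_neg]; exact ⟨det_sg _ _ (neg_ne_zero.2 hy), act_sg _ _ (neg_ne_zero.2 hy)⟩
  · intro n w hw hA' hB'
    rcases unique_my m y n w hy hw (hA.symm.trans hA') (hB.symm.trans hB') with ⟨rfl, rfl⟩ | ⟨rfl, rfl⟩ <;> simp

theorem Tv_fib' (p : ℝ × ℝ) (hp : 4 * p.1 ^ 3 + 27 * p.2 ^ 2 ≠ 0) : ∃ F : Finset (Matrix (Fin 3) (Fin 3) ℝ), F.card = 3 ∧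
    (∀ s ∈ F, s.det = 1 ∧ act s (wcoeffs p.1 p.2) = wcoeffs p.1 p.2) ∧
    ∀ g g0 : M3, 0 < dt g → 0 < dt g0 → Tv (g, p) = Tv (g0, p) → ∃ r : ℝ, 0 < r ∧ ∃ s ∈ F, g = r • mR g0 s := by
  obtain ⟨F, h1, h2, h3, h4⟩ := three_sg p hp
  refine ⟨F, h1, h2, fun g g0 hg hg0 h => ?_⟩
  obtain ⟨r, hr, h | ⟨m, y, hy, hA, hB, h⟩⟩ := Tv_fib g g0 hg hg0 p hp h
  · refine ⟨r, hr, 1, h3, ?_⟩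
    rw [h]; congr 1; apply Matrix.of.injective; rw [of_mR, Matrix.mul_one]
  · exact ⟨r, hr, _, h4 m y hy hA hB, h⟩

theorem meas_C {I J : (Fin 10 → ℝ) → ℝ} (hI : InvPair I J) (R : Set (ℝ × ℝ)) (p : ℝ × ℝ) (hpR : p ∈ R)
    (hp : 4 * p.1 ^ 3 + 27 * p.2 ^ 2 ≠ 0) (g0 : M3) (hg0 : 0 < dt g0) :
    MeasurableSet {h | Tv (g0, p) ∈ Bh R h} ∧ mu {h | Tv (g0, p) ∈ Bh R h} = 3 * kap' := by
  obtain ⟨F, h1, h2, h3⟩ := Tv_fib' p hp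
  have e : {h | Tv (g0, p) ∈ Bh R h} = ⋃ s ∈ F, {h | lmL (Matrix.adjugate (Matrix.of h)) (mR g0 s) ∈ KK} := by
    ext h
    simp only [Set.mem_iUnion, Set.mem_setOf_eq, exists_prop]
    constructor
    · rintro ⟨g, q, hq, hk, hT⟩
      have dg := KK_adj hk
      have i1 := IJ_Tv hI (g0, p) hg0.ne'
      have i2 := IJ_Tv hI (g, q) dg.ne'
      rw [hT] at i1
      have hpq : p = q := Prod.ext (by have := i1.1.symm.trans i2.1; simp only at this; linarith) (by have := i1.2.symm.trans i2.2; simp only at this; linarith)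
      subst hpq
      obtain ⟨r, hr, s, hs, rfl⟩ := h3 g g0 dg hg0 hT.symm
      rw [map_smul, KK_smul hr] at hk
      exact ⟨s, hs, hk⟩
    · rintro ⟨s, hs, hk⟩
      exact ⟨_, p, hpR, hk, (Tv_mR g0 s (h2 s hs).1 p (h2 s hs).2).symm⟩
  have hm : ∀ s, MeasurableSet {h | lmL (Matrix.adjugate (Matrix.of h)) (mR g0 s) ∈ KK} := fun s =>
    (KK_open.preimage (lmadj_cont _)).measurableSet
  rw [e]
  refine ⟨Finset.measurableSet_biUnion _ fun s _ => hm s, ?_⟩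
  rw [measure_biUnion_finset]
  · rw [Finset.sum_congr rfl (fun s hs => mu_KK (mR g0 s) (by rw [dt_mR _ _ (h2 s hs).1]; exact hg0)), Finset.sum_const, h1]
    simp
  · intro s hs t ht hst
    rw [Function.onFun, Set.disjoint_left]
    intro h hk hl
    have hk : lmL (Matrix.adjugate (Matrix.of h)) (mR g0 s) ∈ KK := hk
    have hl : lmL (Matrix.adjugate (Matrix.of h)) (mR g0 t) ∈ KK := hl
    have ht' := h2 t ht
    have hs' := h2 s hs
    -- the quotient
    have hq : t * (t.adjugate * s) = s := by rw [← Matrix.mul_assoc, Matrix.mul_adjugate, ht'.1, one_smul, Matrix.one_mul]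
    have hqd : (t.adjugate * s).det = 1 := by
      have := congrArg Matrix.det hq
      rwa [Matrix.det_mul, ht'.1, hs'.1, one_mul] at this
    have hqa : act (t.adjugate * s) (wcoeffs p.1 p.2) = wcoeffs p.1 p.2 := by
      rw [act_mul, hs'.2]
      conv_lhs => rw [← ht'.2]
      rw [← act_mul, Matrix.adjugate_mul, ht'.1, one_smul, act_one]
    have ek : lmL (Matrix.adjugate (Matrix.of h)) (mR g0 s) = mR (lmL (Matrix.adjugate (Matrix.of h)) (mR g0 t)) (t.adjugate * s) := by
      rw [← lmL_mR]; congr 1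
      apply Matrix.of.injective
      rw [of_mR, of_mR, of_mR, Matrix.mul_assoc, hq]
    have t2 := T2 hk hl
    have dl := KK_dt_pos hl
    rw [ek, of_mR, ← Matrix.mul_assoc, Matrix.adjugate_mul, Matrix.smul_mul, Matrix.one_mul, Matrix.smul_apply] at t2
    change 0 < dt _ * _ at t2
    rcases stab_cases p.1 p.2 hp _ hqd hqa with h1 | ⟨m, y, hy, _, _, h1⟩
    · rw [h1, Matrix.mul_one] at hq; exact hst hq.symm
    · rw [h1, sg_11 m y hy] at t2; linarith
  · exact fun s _ => hm s

theorem cR_inj {γ δ : SLZ} (h : cR γ = cR δ) : γ = δ := by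
  apply Subtype.ext
  ext i j
  have := congrFun (congrFun h i) j
  simpa [cR] using this

theorem stab_rel {R : Set (ℝ × ℝ)} {n : ℕ} (c : YV) (γ : SLZ) (hγ : γ • c = c) (g : M3) (hg : 0 < dt g) (p : ℝ × ℝ)
    (e : (n:ℝ)⁻¹ • toV c = Tv (g, p)) : Tv (lmL (cR γ) g, p) = Tv (g, p) := by
  rw [Tv_lmL]; unfold cR; rw [det_castR, inv_one, one_smul, ← e, act_smul]
  change _ • act (cR γ) _ = _
  rw [← toV_smul, hγ]

theorem r_one {r : ℝ} (hr : 0 < r) (h : r ^ 3 = 1) : r = 1 := by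
  have : (r - 1) * (r ^ 2 + r + 1) = 0 := by ring_nf; linarith
  rcases mul_eq_zero.1 this with h | h
  · linarith
  · nlinarith

theorem stab_card {R : Set (ℝ × ℝ)} (hD : ∀ p ∈ R, 4 * p.1 ^ 3 + 27 * p.2 ^ 2 ≠ 0) {n : ℕ} (c : YV) (hc : c ∈ SV R n) :
    Finite (MulAction.stabilizer SLZ c) ∧ Nat.card (MulAction.stabilizer SLZ c) ≤ 3 := by
  obtain ⟨h1, p, hp, g, hg, e⟩ := hc
  obtain ⟨F, hF, h2, h3⟩ := Tv_fib' p (hD p hp)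
  have key : ∀ γ : MulAction.stabilizer SLZ c, ∃ s : F, lmL (cR γ.1) g = mR g s.1 := by
    rintro ⟨γ, hγ⟩
    obtain ⟨r, hr, s, hs, hh⟩ := h3 (lmL (cR γ) g) g (by rw [dt_lmL]; unfold cR; rw [det_castR, one_mul]; exact hg) hg
      (stab_rel (R := R) c γ hγ g hg p e)
    have hd := congrArg dt hh
    rw [dt_lmL, dt_smul, dt_mR _ _ (h2 s hs).1] at hd
    unfold cR at hd
    rw [det_castR, one_mul] at hd
    have : r = 1 := r_one hr (by have h0 := hg.ne'; field_simp at hd; linarith)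
    rw [this, one_smul] at hh
    exact ⟨⟨s, hs⟩, hh⟩
  choose f hf using key
  have inj : Function.Injective f := by
    intro γ δ h
    have h4 : lmL (cR γ.1) g = lmL (cR δ.1) g := by rw [hf, hf, h]
    apply Subtype.ext
    apply cR_inj
    have h5 := congrArg (fun M => Matrix.of M * Matrix.adjugate (Matrix.of g)) h4
    simp only [of_lmL, Matrix.mul_assoc, Matrix.mul_adjugate, Matrix.mul_smul, Matrix.mul_one] at h5
    exact smul_right_injective _ (show dt g ≠ 0 from hg.ne') h5
  have : Finite (MulAction.stabilizer SLZ c) := Finite.of_injective f inj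
  refine ⟨this, ?_⟩
  have := Nat.card_le_card_of_injective f inj
  have e3 : Nat.card F = 3 := by rw [Nat.card_eq_fintype_card, Fintype.card_coe, hF]
  rwa [e3] at this

/-- weighted count -/
noncomputable def WV (R : Set (ℝ × ℝ)) (n : ℕ) (h : M3) : ℝ≥0∞ :=
  ∑' c : YV, (Nat.card (MulAction.stabilizer SLZ c) : ℝ≥0∞) * (CV R n h).indicator (fun _ => (1:ℝ≥0∞)) c

theorem CV_meas {I J : (Fin 10 → ℝ) → ℝ} (hI : InvPair I J) (R : Set (ℝ × ℝ)) (hD : ∀ p ∈ R, 4 * p.1 ^ 3 + 27 * p.2 ^ 2 ≠ 0) (n : ℕ) (c : YV) :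
    MeasurableSet {h | c ∈ CV R n h} ∧ (c ∈ SV R n → mu {h | c ∈ CV R n h} = 3 * kap') := by
  by_cases hc : c ∈ SV R n
  · obtain ⟨h1, p, hp, g, hg, e⟩ := id hc
    have := meas_C hI R p hp (hD p hp) g hg
    rw [← e] at this
    have e2 : {h | c ∈ CV R n h} = {h | (n:ℝ)⁻¹ • toV c ∈ Bh R h} := by
      ext h; exact ⟨fun h => h.2, fun h => ⟨h1, h⟩⟩
    rw [e2]; exact ⟨this.1, fun _ => this.2⟩
  · have : {h | c ∈ CV R n h} = ∅ := by
      rw [Set.eq_empty_iff_forall_notMem]; exact fun h hh => hc (CV_sub R n h hh)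
    rw [this]; exact ⟨MeasurableSet.empty, fun h => absurd h hc⟩

theorem ind_eq (R : Set (ℝ × ℝ)) (n : ℕ) (c : YV) : (fun h => (CV R n h).indicator (fun _ => (1:ℝ≥0∞)) c) = {h | c ∈ CV R n h}.indicator (fun _ => 1) := by
  ext h; simp [Set.indicator]

theorem WV_meas {I J : (Fin 10 → ℝ) → ℝ} (hI : InvPair I J) (R : Set (ℝ × ℝ)) (hD : ∀ p ∈ R, 4 * p.1 ^ 3 + 27 * p.2 ^ 2 ≠ 0) (n : ℕ) :
    Measurable (WV R n) := by
  refine Measurable.ennreal_tsum fun c => Measurable.const_mul ?_ _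
  rw [ind_eq]; exact measurable_const.indicator (CV_meas hI R hD n c).1

theorem unfoldV {I J : (Fin 10 → ℝ) → ℝ} (hI : InvPair I J) (R : Set (ℝ × ℝ)) (hD : ∀ p ∈ R, 4 * p.1 ^ 3 + 27 * p.2 ^ 2 ≠ 0) (n : ℕ) :
    ∫⁻ h, wt h * WV R n h ∂mu = 3 * kap' * orbV R n := by
  exact unfold_general (Γ := SLZ) (Y := YV) mu (fun γ => lt γ) mp_lt wt wt_meas
    (by filter_upwards [mu_pos_ae] with h hh; exact sum_wt h (by linarith [hh.1]))
    (fun h c => (CV R n h).indicator (fun _ => (1:ℝ≥0∞)) c)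
    (fun c => by rw [ind_eq]; exact measurable_const.indicator (CV_meas hI R hD n c).1)
    (by
      intro γ h c
      by_cases hM : c ∈ CV R n h
      · simp [hM, (CV_inv R n γ h c).2 hM]
      · simp [hM, mt (CV_inv R n γ h c).1 hM])
    (3 * kap') (SV R n) (fun γ c => SV_inv R n γ c)
    (by
      intro c hc
      rw [ind_eq, lintegral_indicator (CV_meas hI R hD n c).1, setLIntegral_const, one_mul]
      exact (CV_meas hI R hD n c).2 hc)
    (by
      intro c hc h
      exact Set.indicator_of_notMem (fun h' => hc (CV_sub R n h h')) _)
    (by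
      intro c hc
      exact (stab_card hD c hc).1)

open MvPolynomial
set_option linter.all false
open MeasureTheory ENNReal
open scoped Pointwise

def EB (M : Matrix (Fin 3) (Fin 3) ℝ) (b : ℝ) : Prop := ∀ i j, |M i j| ≤ b
theorem EB_nn {M b} (h : EB M b) : 0 ≤ b := (abs_nonneg _).trans (h 0 0)
theorem EB_mul {M N a b} (hM : EB M a) (hN : EB N b) : EB (M * N) (3 * (a * b)) := by
  intro i j
  rw [Matrix.mul_apply]
  refine (Finset.abs_sum_le_sum_abs _ _).trans ?_
  calc _ ≤ ∑ k : Fin 3, a * b := Finset.sum_le_sum fun k _ => by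
        rw [abs_mul]; exact mul_le_mul (hM i k) (hN k j) (abs_nonneg _) (EB_nn hM)
    _ = _ := by simp
theorem EB_smul {M a} (t : ℝ) (hM : EB M a) : EB (t • M) (|t| * a) := by
  intro i j
  rw [Matrix.smul_apply, smul_eq_mul, abs_mul]
  exact mul_le_mul_of_nonneg_left (hM i j) (abs_nonneg _)
theorem EB_adj {M a} (hM : EB M a) : EB M.adjugate (2 * a ^ 2) := by
  have hp : ∀ i j k l, |M i j * M k l| ≤ a ^ 2 := fun i j k l => by
    rw [abs_mul, sq]; exact mul_le_mul (hM _ _) (hM _ _) (abs_nonneg _) (EB_nn hM)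
  have h2 : ∀ i j k l i' j' k' l', |M i j * M k l - M i' j' * M k' l'| ≤ 2 * a ^ 2 := fun i j k l i' j' k' l' => by
    refine (abs_sub _ _).trans ?_
    linarith [hp i j k l, hp i' j' k' l']
  intro i j
  rw [Matrix.adjugate_fin_three]
  fin_cases i <;> fin_cases j <;> simp only [Matrix.of_apply, Matrix.cons_val, Fin.zero_eta, Fin.mk_one, Fin.reduceFinMk, neg_add_eq_sub] <;> apply h2

theorem sg_bound (η : ℝ) (hη : 0 < η) : ∃ M : ℝ, ∀ m y : ℝ, |m| ≤ 3 → η ≤ |y| → |y| ≤ 6 → EB (sg m y) M := by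
  let K : Set (ℝ × ℝ) := {q | |q.1| ≤ 3 ∧ η ≤ |q.2| ∧ |q.2| ≤ 6}
  have hK : IsCompact K := by
    apply Metric.isCompact_of_isClosed_isBounded
    · have h1 : IsClosed {q : ℝ × ℝ | |q.1| ≤ 3} := isClosed_le (by fun_prop) continuous_const
      have h2 : IsClosed {q : ℝ × ℝ | η ≤ |q.2|} := isClosed_le continuous_const (by fun_prop)
      have h3 : IsClosed {q : ℝ × ℝ | |q.2| ≤ 6} := isClosed_le (by fun_prop) continuous_const
      exact h1.inter (h2.inter h3)
    · refine (Metric.isBounded_closedBall (x := (0 : ℝ × ℝ)) (r := 6)).subset ?_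
      intro q hq
      rw [mem_closedBall_zero_iff, Prod.norm_def, max_le_iff]
      exact ⟨by rw [Real.norm_eq_abs]; linarith [hq.1], hq.2.2⟩
  have hb : ∀ ij : Fin 3 × Fin 3, ∃ M : ℝ, ∀ q ∈ K, |sg q.1 q.2 ij.1 ij.2| ≤ M := by
    rintro ⟨i, j⟩
    refine hK.exists_bound_of_continuousOn (f := fun q => sg q.1 q.2 i j) ?_
    intro q hq
    have h0 : q.2 ≠ 0 := fun h => by have := hq.2.1; rw [h, abs_zero] at this; linarith
    have h6 : 6 * q.2 ≠ 0 := by simpa using h0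
    have h2 : 2 * q.2 ≠ 0 := by simpa using h0
    apply ContinuousAt.continuousWithinAt
    fin_cases i <;> fin_cases j <;> simp only [sg, Matrix.of_apply, Matrix.cons_val, Fin.zero_eta, Fin.mk_one, Fin.reduceFinMk] <;>
      fun_prop (disch := assumption)
  choose M hM using hb
  refine ⟨∑ ij, |M ij|, fun m y h1 h2 h3 i j => ?_⟩
  refine (hM (i, j) (m, y) ⟨h1, h2, h3⟩).trans ((le_abs_self _).trans ?_)
  exact Finset.single_le_sum (f := fun ij => |M ij|) (fun _ _ => abs_nonneg _) (Finset.mem_univ _)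

theorem y_low {m y ε : ℝ} (hA : |Amy m y| ≤ 1) (hB : |Bmy m y| ≤ 1) (h : ε < |4 * Amy m y ^ 3 + 27 * Bmy m y ^ 2|) :
    |m| ≤ 3 ∧ |y| ≤ 6 ∧ ε / 10000 ≤ |y| := by
  obtain ⟨h1, h2⟩ := my_bound m y hA hB
  refine ⟨h1, h2, ?_⟩
  rw [disc_my] at h
  have e : |y ^ 3 * (27 * y - 4 * m ^ 3)| ≤ |y| * 10000 := by
    rw [abs_mul, abs_pow, show |y| ^ 3 = |y| * |y| ^ 2 by ring, mul_assoc]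
    refine mul_le_mul_of_nonneg_left ?_ (abs_nonneg _)
    have a1 : |y| ^ 2 ≤ 6 ^ 2 := pow_le_pow_left₀ (abs_nonneg _) h2 _
    have a2 : |27 * y - 4 * m ^ 3| ≤ 270 := by
      refine (abs_sub _ _).trans ?_
      rw [abs_mul, abs_mul, abs_pow, abs_of_pos (by norm_num : (0:ℝ) < 27), abs_of_pos (by norm_num : (0:ℝ) < 4)]
      have : |m| ^ 3 ≤ 3 ^ 3 := pow_le_pow_left₀ (abs_nonneg _) h1 _
      linarith
    calc _ ≤ (6:ℝ)^2 * 270 := mul_le_mul a1 a2 (abs_nonneg _) (by norm_num)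
      _ ≤ _ := by norm_num
  linarith

/-- a non-identity element fixing a point of the region has bounded entries -/
theorem gam_bound (h : M3) (hd : 0 < dt h) (ε : ℝ) (hε : 0 < ε) : ∃ M : ℝ, ∀ (γ : SLZ) (g : M3) (p : ℝ × ℝ), γ ≠ 1 →
    |p.1| ≤ 1 → |p.2| ≤ 1 → ε < |4 * p.1 ^ 3 + 27 * p.2 ^ 2| → lmL (Matrix.adjugate (Matrix.of h)) g ∈ KK →
    Tv (lmL (cR γ) g, p) = Tv (g, p) → EB (cR γ) M := by
  obtain ⟨M, hM⟩ := sg_bound (ε / 10000) (by positivity)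
  obtain ⟨H, hH⟩ : ∃ H, EB (Matrix.of h) H := by
    refine ⟨∑ ij : Fin 3 × Fin 3, |h ij.1 ij.2|, fun i j => ?_⟩
    exact Finset.single_le_sum (f := fun ij : Fin 3 × Fin 3 => |h ij.1 ij.2|) (fun _ _ => abs_nonneg _) (Finset.mem_univ (i, j))
  refine ⟨|(dt h)⁻¹| * (3 * ((3 * (H * (2 * (3 * ((3 * (2 * M)) * (2 * 2 ^ 2)))))) * (2 * H ^ 2))), ?_⟩
  intro γ g p hγ h1 h2 hdisc hk hT
  have hg := KK_adj hk
  have hc1 : (cR γ).det = 1 := det_castR γ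
  have hp : 4 * p.1 ^ 3 + 27 * p.2 ^ 2 ≠ 0 := fun h0 => by rw [h0, abs_zero] at hdisc; linarith
  obtain ⟨r, hr, hh⟩ := Tv_fib (lmL (cR γ) g) g (by rw [dt_lmL, hc1, one_mul]; exact hg) hg p hp hT
  rcases hh with hh | ⟨m, y, hy, hA, hB, hh⟩
  · exfalso
    have hd := congrArg dt hh
    rw [dt_lmL, dt_smul, hc1, one_mul] at hd
    have : r = 1 := r_one hr (by have h0 := hg.ne'; field_simp at hd; linarith)
    rw [this, one_smul] at hh
    apply hγ
    apply cR_inj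
    have h5 := congrArg (fun M => Matrix.of M * Matrix.adjugate (Matrix.of g)) hh
    simp only [of_lmL, Matrix.mul_assoc, Matrix.mul_adjugate, Matrix.mul_smul, Matrix.mul_one] at h5
    have h6 : dt g • cR γ = dt g • (1 : Matrix (Fin 3) (Fin 3) ℝ) := h5
    rw [smul_right_injective _ hg.ne' h6]
    simp [cR]
  · have hdd := congrArg dt hh
    rw [dt_lmL, dt_smul, hc1, one_mul, dt_mR _ _ (det_sg m y hy)] at hdd
    have : r = 1 := r_one hr (by have h0 := hg.ne'; field_simp at hdd; linarith)
    rw [this, one_smul] at hh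
    rw [hA] at h1 hdisc
    rw [hB] at h2 hdisc
    obtain ⟨b1, b2, b3⟩ := y_low h1 h2 hdisc
    have hS := hM m y b1 b3 b2
    set k0 := lmL (Matrix.adjugate (Matrix.of h)) g with hk0
    have hkp := KK_pos hk
    set k := (k0 0 0)⁻¹ • k0 with hkdef
    have hkk : k ∈ KK := (KK_smul (inv_pos.2 hkp) k0).2 hk
    have hk00 : k 0 0 = 1 := by
      change (k0 0 0)⁻¹ * k0 0 0 = 1
      exact inv_mul_cancel₀ hkp.ne'
    have hkE : EB (Matrix.of k) 2 := fun i j => by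
      have := KK_entry hkk i j
      rw [hk00] at this; simpa using this
    have hkd := KK_dt hkk
    rw [hk00] at hkd
    have hkd0 : 0 < dt k := by linarith
    have hkd2 : |(dt k)⁻¹| ≤ 2 := by
      rw [abs_of_pos (by positivity)]
      exact inv_le_of_inv_le₀ (by norm_num) (by linarith)
    -- main relation
    have r1 : cR γ * Matrix.of g = Matrix.of g * sg m y := by
      have := congrArg Matrix.of hh
      rwa [of_lmL, of_mR] at this
    have r2 : Matrix.of h * Matrix.of k = (dt h * (k0 0 0)⁻¹) • Matrix.of g := by
      have := congrArg Matrix.of (h_adj h g)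
      rw [of_lmL] at this
      change _ = dt h • Matrix.of g at this
      rw [mul_comm, mul_smul, ← this]
      change _ * ((k0 0 0)⁻¹ • Matrix.of k0) = _
      rw [Matrix.mul_smul]
    have r3 : cR γ * (Matrix.of h * Matrix.of k) = (Matrix.of h * Matrix.of k) * sg m y := by
      rw [r2, Matrix.mul_smul, r1, Matrix.smul_mul]
    have r4 : cR γ = (dt h)⁻¹ • (Matrix.of h * ((dt k)⁻¹ • ((Matrix.of k * sg m y) * (Matrix.of k).adjugate)) * (Matrix.of h).adjugate) := by
      have e1 : (Matrix.of h * Matrix.of k) * ((Matrix.of k).adjugate * (Matrix.of h).adjugate) = (dt h * dt k) • (1 : Matrix (Fin 3) (Fin 3) ℝ) := by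
        rw [Matrix.mul_assoc, ← Matrix.mul_assoc (Matrix.of k), Matrix.mul_adjugate, Matrix.smul_mul, Matrix.one_mul, Matrix.mul_smul, Matrix.mul_adjugate, smul_smul, mul_comm]
        rfl
      have e2 := congrArg (fun N => N * ((Matrix.of k).adjugate * (Matrix.of h).adjugate)) r3
      rw [Matrix.mul_assoc (cR γ), e1, Matrix.mul_smul, Matrix.mul_one] at e2
      rw [Matrix.mul_smul, Matrix.smul_mul, smul_smul]
      have e3 : Matrix.of h * (Matrix.of k * sg m y * (Matrix.of k).adjugate) * (Matrix.of h).adjugate = (dt h * dt k) • cR γ := by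
        rw [e2]; simp only [Matrix.mul_assoc]
      rw [e3, smul_smul, show (dt h)⁻¹ * (dt k)⁻¹ * (dt h * dt k) = 1 by field_simp, one_smul]
    rw [r4]
    have hM0 := EB_nn hS
    have i1 : EB ((dt k)⁻¹ • ((Matrix.of k * sg m y) * (Matrix.of k).adjugate)) (2 * (3 * ((3 * (2 * M)) * (2 * 2 ^ 2)))) := by
      intro i j
      refine (EB_smul _ (EB_mul (EB_mul hkE hS) (EB_adj hkE)) i j).trans ?_
      exact mul_le_mul_of_nonneg_right hkd2 (by positivity)
    exact EB_smul _ (EB_mul (EB_mul hH i1) (EB_adj hH))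

theorem gam_fin (M : ℝ) : {γ : SLZ | EB (cR γ) M}.Finite := by
  have : {x : Fin 3 → Fin 3 → ℤ | ∀ i j, x i j ∈ Set.Icc (-⌊M⌋) ⌊M⌋}.Finite := by
    have := Set.Finite.pi' (t := fun i : Fin 3 => {v : Fin 3 → ℤ | ∀ j, v j ∈ Set.Icc (-⌊M⌋) ⌊M⌋})
      (fun i => Set.Finite.pi' (fun j => Set.finite_Icc _ _))
    exact this
  refine Set.Finite.of_finite_image (f := fun γ : SLZ => (fun i j => (γ : Matrix (Fin 3) (Fin 3) ℤ) i j)) (this.subset ?_) ?_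
  · rintro _ ⟨γ, hγ, rfl⟩ i j
    have h3 := abs_le.1 (hγ i j)
    change -M ≤ (((γ : Matrix (Fin 3) (Fin 3) ℤ) i j : ℤ) : ℝ) ∧ (((γ : Matrix (Fin 3) (Fin 3) ℤ) i j : ℤ) : ℝ) ≤ M at h3
    constructor
    · rw [neg_le, Int.le_floor]; push_cast; linarith
    · rw [Int.le_floor]; exact h3.2
  · intro γ _ δ _ hh
    apply Subtype.ext
    ext i j
    exact congrFun (congrFun hh i) j

theorem fix_null (γ : SLZ) (hγ : γ ≠ 1) : volume {b : Fin 10 → ℝ | act (cR γ) b = b} = 0 := by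
  let S : Submodule ℝ (Fin 10 → ℝ) := LinearMap.ker (actL (cR γ) - LinearMap.id)
  have e : {b : Fin 10 → ℝ | act (cR γ) b = b} = (S : Set (Fin 10 → ℝ)) := by
    ext b
    simp only [Set.mem_setOf_eq, S, SetLike.mem_coe, LinearMap.mem_ker, LinearMap.sub_apply, LinearMap.id_apply, actL_apply, sub_eq_zero]
  rw [e]
  apply Measure.addHaar_submodule
  intro hS
  apply hγ
  apply cR_inj
  have hall : ∀ b : Fin 10 → ℝ, act (cR γ) b = b := fun b => by
    have : b ∈ (S : Set (Fin 10 → ℝ)) := by rw [hS]; trivial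
    rw [← e] at this; exact this
  have k0 := hall ![1,0,0,0,0,0,0,0,0,0]
  have k1 := hall ![0,1,0,0,0,0,0,0,0,0]
  have k2 := hall ![0,0,1,0,0,0,0,0,0,0]
  have c1 : ∀ x : ℝ, x ^ 3 = 1 → x = 1 := fun x hx => by
    have h0 : 0 < x := by by_contra hc; have := Odd.pow_nonpos (by decide : Odd 3) (not_lt.1 hc); linarith
    exact r_one h0 hx
  have hone : cR γ = 1 := by
    ext i j
    have a0 := congrFun k0 ⟨i.1, by omega⟩
    have a1 := congrFun k1 ⟨i.1, by omega⟩
    have a2 := congrFun k2 ⟨i.1, by omega⟩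
    fin_cases i <;> fin_cases j <;> simp [act, fe] at a0 a1 a2 <;> simp <;> first | assumption | (apply c1; assumption)
  rw [hone]; simp [cR]

noncomputable def NV (s : Set (Fin 10 → ℝ)) (n : ℕ) : ℝ≥0∞ := ∑' c : YV, {c : YV | (n:ℝ)⁻¹ • toV c ∈ s}.indicator (fun _ => (1:ℝ≥0∞)) c

theorem NV_lim (s : Set (Fin 10 → ℝ)) (h1 : Bornology.IsBounded s) (h2 : MeasurableSet s) (h3 : volume (frontier s) = 0) :
    Filter.Tendsto (fun n : ℕ => NV s n / (n:ℝ≥0∞) ^ 10) Filter.atTop (nhds (volume s)) := by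
  have := count_lim s h1 h2 h3
  exact this

theorem ind_sum_le {Y : Type*} {A B D : Set Y} (h : A ⊆ B ∪ D) : ∑' y, A.indicator (fun _ => (1:ℝ≥0∞)) y ≤
    ∑' y, B.indicator (fun _ => (1:ℝ≥0∞)) y + ∑' y, D.indicator (fun _ => (1:ℝ≥0∞)) y := by
  rw [← ENNReal.tsum_add]
  refine ENNReal.tsum_le_tsum fun y => ?_
  by_cases hA : y ∈ A
  · rcases h hA with hB | hB <;> simp [hA, hB]
  · simp [hA]

def BAD (R : Set (ℝ × ℝ)) (n : ℕ) (h : M3) : Set YV := {c | c ∈ CV R n h ∧ ∃ γ : SLZ, γ ≠ 1 ∧ γ • c = c}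

theorem bad_zero {I J : (Fin 10 → ℝ) → ℝ} (hI : InvPair I J) (e : ℝ) (he : e = 1 ∨ e = -1) (h : M3) (hd : 0 < dt h) :
    Filter.Tendsto (fun n : ℕ => (∑' c, (BAD (RR e 0 10) n h).indicator (fun _ => (1:ℝ≥0∞)) c) / (n:ℝ≥0∞) ^ 10) Filter.atTop (nhds 0) := by
  have he0 : e ≠ 0 := by rcases he with rfl | rfl <;> norm_num
  have hkap : 324 * kap ≠ ∞ := ENNReal.mul_ne_top (by norm_num) kap_fin.ne
  rw [tendsto_order]
  refine ⟨fun a ha => absurd ha ENNReal.not_lt_zero, fun δ hδ => ?_⟩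
  obtain ⟨ε, hε, hε10, hvol⟩ := RR_small e (δ / (324 * kap)) (ENNReal.div_pos hδ.ne' hkap)
  obtain ⟨M, hM⟩ := gam_bound h hd (ε / 2) (by positivity)
  obtain ⟨_, hbd, _, _⟩ := Bh_props (RR e 0 10) (RR_open _ _ _) (RR_bdd _ _ _) (RR_front _ _ _ he0) h hd
  obtain ⟨ρ, hρ⟩ := hbd.subset_closedBall 0
  let F : Set SLZ := {γ | EB (cR γ) M ∧ γ ≠ 1}
  have hF : F.Finite := (gam_fin M).subset fun γ hγ => hγ.1
  let Z : Set (Fin 10 → ℝ) := Metric.closedBall 0 ρ ∩ ⋃ γ ∈ F, {b | act (cR γ) b = b}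
  have hZc : IsClosed Z := by
    refine Metric.isClosed_closedBall.inter (hF.isClosed_biUnion fun γ _ => ?_)
    exact isClosed_eq ((actL (cR γ)).continuous_of_finiteDimensional) continuous_id
  have hZ0 : volume Z = 0 := by
    refine measure_mono_null Set.inter_subset_right ((measure_biUnion_null_iff hF.countable).2 fun γ hγ => fix_null γ hγ.2)
  have l1 := NV_lim Z (Metric.isBounded_closedBall.subset Set.inter_subset_left) hZc.measurableSet
    (measure_mono_null hZc.frontier_subset hZ0)
  obtain ⟨q1, q2, q3, q4⟩ := Bh_props (RR e 0 ε) (RR_open _ _ _) (RR_bdd _ _ _) (RR_front _ _ _ he0) h hd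
  have l2 := NV_lim _ q2 q1.measurableSet q3
  have l3 := l2.add l1
  rw [hZ0, add_zero, q4, vol_B hI _ (RR_open _ _ _).measurableSet (fun p hp => RR_ne le_rfl hp)] at l3
  have hlt : 324 * kap * volume (RR e 0 ε) < δ := ENNReal.mul_lt_of_lt_div' hvol
  filter_upwards [(tendsto_order.1 l3).2 δ hlt] with n hn
  refine lt_of_le_of_lt ?_ hn
  rw [← ENNReal.add_div]
  refine ENNReal.div_le_div_right (ind_sum_le ?_) _
  rintro c ⟨⟨hS, hc⟩, γ, hγ, hγc⟩
  obtain ⟨g, p, hp, hk, hb⟩ := id hc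
  by_cases hpε : e * Dq p < ε
  · left; exact ⟨g, p, ⟨hp.1, hp.2.1, hp.2.2.1, hpε⟩, hk, hb⟩
  · right
    refine ⟨hρ hc, ?_⟩
    simp only [Set.mem_iUnion]
    refine ⟨γ, ⟨?_, hγ⟩, ?_⟩
    · refine hM γ g p hγ (by linarith [hp.1]) (by linarith [hp.2.1]) ?_ hk (stab_rel (R := RR e 0 10) c γ hγc g (KK_adj hk) p hb)
      have : |4 * p.1 ^ 3 + 27 * p.2 ^ 2| = |e * Dq p| := by
        unfold Dq
        rcases he with rfl | rfl
        · rw [one_mul, abs_neg]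
        · congr 1; ring
      rw [this]
      exact lt_of_lt_of_le (by linarith) (le_abs_self _)
    · change act _ _ = _
      rw [act_smul, ← toV_smul, hγc]

theorem limV {I J : (Fin 10 → ℝ) → ℝ} (hI : InvPair I J) (e : ℝ) (he : e = 1 ∨ e = -1) (h : M3) (hd : 0 < dt h) :
    Filter.Tendsto (fun n : ℕ => WV (RR e 0 10) n h / (n:ℝ≥0∞) ^ 10) Filter.atTop (nhds (324 * kap * volume (RR e 0 10))) := by
  have he0 : e ≠ 0 := by rcases he with rfl | rfl <;> norm_num
  obtain ⟨q1, q2, q3, q4⟩ := Bh_props (RR e 0 10) (RR_open _ _ _) (RR_bdd _ _ _) (RR_front _ _ _ he0) h hd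
  have l2 := NV_lim _ q2 q1.measurableSet q3
  rw [q4, vol_B hI _ (RR_open _ _ _).measurableSet (fun p hp => RR_ne le_rfl hp)] at l2
  have l3 := bad_zero hI e he h hd
  obtain ⟨ρ, hρ⟩ := q2.subset_closedBall 0
  obtain ⟨M, hM⟩ := exists_nat_ge ρ
  have l4 := nonSI_density M (fun n => {c : Fin 10 → ℤ | 0 < n ∧ ¬ StronglyIrred c ∧ (n:ℝ)⁻¹ • toV c ∈ Bh (RR e 0 10) h}) (by
    rintro n c ⟨hn, h1, h2⟩
    refine ⟨fun i => ?_, h1⟩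
    have hn' : (0:ℝ) < n := by exact_mod_cast hn
    have h3 := hρ h2
    rw [mem_closedBall_zero_iff] at h3
    have h4 := (norm_le_pi_norm _ i).trans (h3.trans hM)
    have h5 : |(n:ℝ)⁻¹ * (c i : ℝ)| ≤ M := h4
    rw [abs_mul, abs_of_pos (by positivity), inv_mul_le_iff₀ hn', mul_comm] at h5
    exact_mod_cast h5)
  have hlow : Filter.Tendsto (fun n : ℕ => NV (Bh (RR e 0 10) h) n / (n:ℝ≥0∞) ^ 10 -
      (∑' c, {c : Fin 10 → ℤ | 0 < n ∧ ¬ StronglyIrred c ∧ (n:ℝ)⁻¹ • toV c ∈ Bh (RR e 0 10) h}.indicator (fun _ => (1:ℝ≥0∞)) c) / (n:ℝ≥0∞) ^ 10)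
      Filter.atTop (nhds (324 * kap * volume (RR e 0 10))) := by
    have := ENNReal.Tendsto.sub l2 l4 (Or.inr ENNReal.zero_ne_top)
    rwa [tsub_zero] at this
  have hup : Filter.Tendsto (fun n : ℕ => NV (Bh (RR e 0 10) h) n / (n:ℝ≥0∞) ^ 10 +
      2 * ((∑' c, (BAD (RR e 0 10) n h).indicator (fun _ => (1:ℝ≥0∞)) c) / (n:ℝ≥0∞) ^ 10))
      Filter.atTop (nhds (324 * kap * volume (RR e 0 10))) := by
    have := l2.add (ENNReal.Tendsto.const_mul (a := 2) l3 (Or.inr (by norm_num)))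
    rwa [mul_zero, add_zero] at this
  refine tendsto_of_tendsto_of_tendsto_of_le_of_le' hlow hup ?_ ?_
  · filter_upwards [Filter.eventually_gt_atTop 0] with n hn
    rw [tsub_le_iff_right, ← ENNReal.add_div]
    refine ENNReal.div_le_div_right ?_ _
    have s1 : NV (Bh (RR e 0 10) h) n ≤ _ := ind_sum_le (Y := YV) (B := CV (RR e 0 10) n h)
      (D := {c : YV | 0 < n ∧ ¬ StronglyIrred c ∧ (n:ℝ)⁻¹ • toV c ∈ Bh (RR e 0 10) h}) (by
        intro c hc
        by_cases hS : SI c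
        · exact Or.inl ⟨hS, hc⟩
        · exact Or.inr ⟨hn, hS, hc⟩)
    refine s1.trans (add_le_add ?_ le_rfl)
    refine ENNReal.tsum_le_tsum fun c => ?_
    by_cases hc : c ∈ CV (RR e 0 10) n h
    · have hst := (stab_card (fun p hp => RR_ne (le_refl (0:ℝ)) hp) c (CV_sub _ _ _ hc)).1
      have : 0 < Nat.card (MulAction.stabilizer SLZ c) := Nat.card_pos
      simp only [hc, Set.indicator_of_mem, mul_one]
      exact_mod_cast this
    · simp [hc]
  · refine Filter.Eventually.of_forall fun n => ?_
    rw [← mul_div_assoc, ← ENNReal.add_div]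
    refine ENNReal.div_le_div_right ?_ _
    unfold WV NV
    rw [← ENNReal.tsum_mul_left, ← ENNReal.tsum_add]
    refine ENNReal.tsum_le_tsum fun c => ?_
    by_cases hc : c ∈ CV (RR e 0 10) n h
    · have hc' : c ∈ {c : YV | (n:ℝ)⁻¹ • toV c ∈ Bh (RR e 0 10) h} := hc.2
      have hst := stab_card (fun p hp => RR_ne (le_refl (0:ℝ)) hp) c (CV_sub _ _ _ hc)
      by_cases hb : c ∈ BAD (RR e 0 10) n h
      · rw [Set.indicator_of_mem hc, Set.indicator_of_mem hc', Set.indicator_of_mem hb, mul_one, mul_one]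
        calc ((Nat.card (MulAction.stabilizer SLZ c) : ℕ) : ℝ≥0∞) ≤ ((3:ℕ) : ℝ≥0∞) := by exact_mod_cast hst.2
          _ = 1 + 2 := by norm_num
      · have hsub : Subsingleton (MulAction.stabilizer SLZ c) := ⟨fun a b => by
          have key : ∀ a : MulAction.stabilizer SLZ c, a.1 = 1 := fun a => by
            by_contra ha
            exact hb ⟨hc, a.1, ha, a.2⟩
          exact Subtype.ext (by rw [key a, key b])⟩
        have : Nat.card (MulAction.stabilizer SLZ c) = 1 := Nat.card_unique
        rw [Set.indicator_of_mem hc, Set.indicator_of_mem hc', Set.indicator_of_notMem hb, this]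
        simp
    · simp [hc]

open MvPolynomial
set_option linter.all false
open MeasureTheory ENNReal
open scoped Pointwise

theorem box2 (S : Set YV) (T : Fin 10 → ℝ) (Z : Finset (Fin 10))
    (hS : ∀ c ∈ S, ∀ k, (k ∈ Z → c k = 0) ∧ |((c k : ℤ) : ℝ)| ≤ T k) (hT : ∀ k, k ∉ Z → 1 ≤ T k) :
    ∑' c, S.indicator (fun _ => (1:ℝ≥0∞)) c ≤ ENNReal.ofReal (∏ k, if k ∈ Z then 1 else 3 * T k) := by
  rw [tsum_ind]
  let G : Fin 10 → Finset ℤ := fun k => if k ∈ Z then {0} else Finset.Icc (-⌊T k⌋) ⌊T k⌋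
  have hsub : ∀ c : Fin 10 → ℤ, c ∈ (S : Set (Fin 10 → ℤ)) → c ∈ Fintype.piFinset G := by
    intro c hc
    rw [Fintype.mem_piFinset]
    intro k
    obtain ⟨h1, h2⟩ := hS c hc k
    by_cases hk : k ∈ Z
    · simp only [G, hk, if_true, Finset.mem_singleton]; exact h1 hk
    · simp only [G, hk, if_false, Finset.mem_Icc]
      rw [abs_le] at h2
      refine ⟨?_, Int.le_floor.2 h2.2⟩
      have : -c k ≤ ⌊T k⌋ := Int.le_floor.2 (by push_cast; linarith [h2.1])
      linarith
  have h1 : S.encard ≤ ((Fintype.piFinset G).card : ℕ∞) := by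
    have := Set.encard_le_encard (α := Fin 10 → ℤ) (s := S) (t := ↑(Fintype.piFinset G)) (fun c hc => Finset.mem_coe.2 (hsub c hc))
    rwa [Set.encard_coe_eq_coe_finsetCard] at this
  have h2 : ((S.encard : ℕ∞) : ℝ≥0∞) ≤ ((Fintype.piFinset G).card : ℝ≥0∞) := by
    have := ENat.toENNReal_le.2 h1
    rwa [ENat.toENNReal_coe] at this
  refine h2.trans ?_
  rw [← ENNReal.ofReal_natCast]
  apply ENNReal.ofReal_le_ofReal
  rw [Fintype.card_piFinset]
  push_cast
  apply Finset.prod_le_prod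
  · intro i _; positivity
  · intro k _
    by_cases hk : k ∈ Z
    · simp [G, hk]
    · have h3 := hT k hk
      have h4 : 0 ≤ ⌊T k⌋ := Int.floor_nonneg.2 (by linarith)
      simp only [G, hk, if_false, Int.card_Icc]
      have h5 : (((⌊T k⌋ + 1 - -⌊T k⌋).toNat : ℤ) : ℝ) = ((⌊T k⌋ + 1 - -⌊T k⌋ : ℤ) : ℝ) := by
        rw [Int.toNat_of_nonneg (by linarith)]
      rw [← Int.cast_natCast, h5]
      push_cast
      linarith [Int.floor_le (T k)]

def ww (a b c : ℝ) : Fin 10 → ℝ := ![a^3, b^3, c^3, a^2*b, a^2*c, a*b^2, b^2*c, a*c^2, b*c^2, a*b*c]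

theorem act_cont2 (k : Fin 10) : Continuous fun q : (Fin 3 → Fin 3 → ℝ) × (Fin 10 → ℝ) => act (Matrix.of q.1) q.2 k := by
  have hq : ∀ i j, Continuous fun q : (Fin 3 → Fin 3 → ℝ) × (Fin 10 → ℝ) => q.1 i j := by intro i j; fun_prop
  have hc : ∀ i, Continuous fun q : (Fin 3 → Fin 3 → ℝ) × (Fin 10 → ℝ) => q.2 i := by intro i; fun_prop
  have h1 : ∀ i, Continuous fun q : (Fin 3 → Fin 3 → ℝ) × (Fin 10 → ℝ) => fe q.2 (q.1 i) := by
    intro i; unfold fe; fun_prop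
  have hg : ∀ i l, Continuous fun q : (Fin 3 → Fin 3 → ℝ) × (Fin 10 → ℝ) => fg q.2 (q.1 i) l := by
    intro i l; unfold fg; fin_cases l <;> (simp only [Matrix.cons_val]; fun_prop)
  have h2 : ∀ i j, Continuous fun q : (Fin 3 → Fin 3 → ℝ) × (Fin 10 → ℝ) => fd q.2 (q.1 i) (q.1 j) := by
    intro i j; unfold fd
    exact (((hq j 0).mul (hg i 0)).add ((hq j 1).mul (hg i 1))).add ((hq j 2).mul (hg i 2))
  have h3 : Continuous fun q : (Fin 3 → Fin 3 → ℝ) × (Fin 10 → ℝ) => ft q.2 (q.1 0) (q.1 1) (q.1 2) := by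
    unfold ft; fun_prop
  fin_cases k
  exacts [h1 0, h1 1, h1 2, h2 0 1, h2 0 2, h2 1 0, h2 1 2, h2 2 0, h2 2 1, h3]

theorem act_bdd (M : ℝ) : ∃ M' > 0, ∀ (u : Fin 3 → Fin 3 → ℝ) (b : Fin 10 → ℝ), ‖u‖ ≤ 1 → ‖b‖ ≤ M →
    ∀ k, |act (Matrix.of u) b k| ≤ M' := by
  have h : ∀ k : Fin 10, ∃ m, ∀ q ∈ (Metric.closedBall (0 : Fin 3 → Fin 3 → ℝ) 1) ×ˢ (Metric.closedBall (0 : Fin 10 → ℝ) M),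
      ‖act (Matrix.of q.1) q.2 k‖ ≤ m := fun k =>
    ((isCompact_closedBall _ _).prod (isCompact_closedBall _ _)).exists_bound_of_continuousOn (act_cont2 k).continuousOn
  choose m hm using h
  refine ⟨1 + ∑ k, |m k|, by positivity, fun u b hu hb k => ?_⟩
  have h1 := hm k (u, b) ⟨by simpa using hu, by simpa using hb⟩
  have h2 := Finset.single_le_sum (f := fun k => |m k|) (fun i _ => abs_nonneg _) (Finset.mem_univ k)
  rw [Real.norm_eq_abs] at h1
  linarith [le_abs_self (m k)]

theorem act_row (h : M3) (hp : ∀ i, 0 < dot (h i) (h i)) (b : Fin 10 → ℝ) (M' : ℝ)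
    (hM : ∀ (u : Fin 3 → Fin 3 → ℝ), ‖u‖ ≤ 1 → ∀ k, |act (Matrix.of u) b k| ≤ M') (k : Fin 10) :
    |act (Matrix.of h) b k| ≤ M' * ww (√(dot (h 0) (h 0))) (√(dot (h 1) (h 1))) (√(dot (h 2) (h 2))) k := by
  let ρ : Fin 3 → ℝ := fun i => √(dot (h i) (h i))
  have hρ : ∀ i, 0 < ρ i := fun i => Real.sqrt_pos.2 (hp i)
  let u : Fin 3 → Fin 3 → ℝ := fun i j => h i j / ρ i
  have hu : ‖u‖ ≤ 1 := by
    rw [pi_norm_le_iff_of_nonneg zero_le_one]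
    intro i
    rw [pi_norm_le_iff_of_nonneg zero_le_one]
    intro j
    rw [Real.norm_eq_abs]
    change |h i j / ρ i| ≤ 1
    rw [abs_div, abs_of_pos (hρ i), div_le_one (hρ i)]
    exact abs_le_sqrt_dot (h i) j
  have e : Matrix.of h = Matrix.diagonal ρ * Matrix.of u := by
    ext i j
    rw [Matrix.diagonal_mul]
    change h i j = ρ i * (h i j / ρ i)
    field_simp [(hρ i).ne']
  have h1 := hM u hu k
  rw [e, act_mul, act_diag]
  have ha := hρ 0
  have hb := hρ 1
  have hc := hρ 2
  change _ ≤ M' * ww (ρ 0) (ρ 1) (ρ 2) k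
  generalize act (Matrix.of u) b = d at h1
  have key : ∀ x : ℝ, 0 < x → |x * d k| ≤ M' * x := fun x hx => by
    rw [abs_mul, abs_of_pos hx, mul_comm]; exact mul_le_mul_of_nonneg_right h1 hx.le
  fin_cases k <;> exact key _ (by positivity)

theorem SI_cases (c : YV) (hc : SI c) : c 0 ≠ 0 ∨ (c 0 = 0 ∧ c 3 ≠ 0) ∨ (c 0 = 0 ∧ c 3 = 0 ∧ c 4 ≠ 0 ∧ c 5 ≠ 0) := by
  by_contra hcon
  have h0 : c 0 = 0 := by by_contra h; exact hcon (Or.inl h)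
  have h3 : c 3 = 0 := by by_contra h; exact hcon (Or.inr (Or.inl ⟨h0, h⟩))
  have h45 : c 4 = 0 ∨ c 5 = 0 := by
    by_contra h; rw [not_or] at h; exact hcon (Or.inr (Or.inr ⟨h0, h3, h.1, h.2⟩))
  refine (SI_iff c).1 hc ⟨![1, 0, 0], ?_, ?_, ?_⟩
  · intro h; have := congrFun h 0; simp at this
  · simp [fe, h0]
  · rcases h45 with h | h <;> simp [he, Matrix.det_fin_three, h0, h3, h]

theorem one_le_abs_int {m : ℤ} (h : m ≠ 0) : (1:ℝ) ≤ |(m:ℝ)| := by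
  have := Int.one_le_abs h
  exact_mod_cast this

set_option maxHeartbeats 1000000 in
theorem dom_real (S : Set YV) (hSI : ∀ c ∈ S, SI c) (t a b c F : ℝ) (ht : 0 < t) (ha : 0 < a) (hab : a ≤ b) (hbc : b ≤ c)
    (h4 : a * b * c ≤ 4) (hF1 : 1 ≤ F) (hF2 : c / a ≤ F) (hF3 : F ^ 2 = (c / a) ^ 3)
    (hS : ∀ y ∈ S, ∀ k, |((y k : ℤ) : ℝ)| ≤ t * ww a b c k) :
    ∑' y, S.indicator (fun _ => (1:ℝ≥0∞)) y ≤ ENNReal.ofReal (3 * 12 ^ 10 * t ^ 10 * F) := by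
  have hb : 0 < b := by linarith
  have hc : 0 < c := by linarith
  have hP : (a*b*c)^10 ≤ 4^10 := pow_le_pow_left₀ (by positivity) h4 10
  have hgoal : ∀ Z : Finset (Fin 10), ∀ V : Set YV, V ⊆ S → (∀ y ∈ V, ∀ k ∈ Z, y k = 0) →
      (V.Nonempty → (∀ k, k ∉ Z → 1 ≤ t * ww a b c k) ∧ (∏ k, if k ∈ Z then 1 else 3 * (t * ww a b c k)) ≤ 3 ^ 10 * t ^ 10 * (a*b*c)^10 * F) →
      ∑' y, V.indicator (fun _ => (1:ℝ≥0∞)) y ≤ ENNReal.ofReal (12 ^ 10 * t ^ 10 * F) := by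
    intro Z V hV hZ h
    rcases V.eq_empty_or_nonempty with rfl | hne
    · simp
    · obtain ⟨h1, h2⟩ := h hne
      refine (box2 V (fun k => t * ww a b c k) Z (fun y hy k => ⟨hZ y hy k, hS y (hV hy) k⟩) h1).trans ?_
      apply ENNReal.ofReal_le_ofReal
      refine h2.trans ?_
      have : 3 ^ 10 * t ^ 10 * (a*b*c)^10 * F ≤ 3 ^ 10 * t ^ 10 * 4^10 * F := by gcongr
      refine this.trans (le_of_eq ?_)
      have : (12:ℝ)^10 = 3^10 * 4^10 := by norm_num
      rw [this]; ring
  have hac : a ≤ c := hab.trans hbc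
  have q1 : ∑' y, {y | y ∈ S ∧ y 0 ≠ 0}.indicator (fun _ => (1:ℝ≥0∞)) y ≤ ENNReal.ofReal (12 ^ 10 * t ^ 10 * F) := by
    refine hgoal ∅ _ (fun y hy => hy.1) (by simp) ?_
    rintro ⟨y, hy, hy0⟩
    have h0 : 1 ≤ t * a ^ 3 := (one_le_abs_int hy0).trans (hS y hy 0)
    refine ⟨fun k _ => h0.trans (mul_le_mul_of_nonneg_left ?_ ht.le), ?_⟩
    · have e : a ^ 3 = a * a * a := by ring
      have e1 : a * a * a ≤ a * b * b := by gcongr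
      have e2 : a * a * a ≤ b * b * b := by gcongr
      have e3 : a * a * a ≤ c * c * c := by gcongr
      have e4 : a * a * a ≤ a * a * c := by gcongr
      have e5 : a * a * a ≤ b * b * c := by gcongr
      have e6 : a * a * a ≤ a * c * c := by gcongr
      have e7 : a * a * a ≤ b * c * c := by gcongr
      have e8 : a * a * a ≤ a * b * c := by gcongr
      have e9 : a * a * a ≤ a * a * b := by gcongr
      fin_cases k <;> simp [ww] <;> nlinarith
    · simp only [Finset.notMem_empty, if_false, Finset.prod_mul_distrib, Finset.prod_const, Finset.card_univ, Fintype.card_fin]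
      have : ∏ k, ww a b c k = (a*b*c)^10 := by simp [ww, Fin.prod_univ_succ]; ring
      rw [this]
      have : 0 ≤ 3 ^ 10 * (t ^ 10 * (a*b*c)^10) := by positivity
      nlinarith
  have q2 : ∑' y, {y | y ∈ S ∧ y 0 = 0 ∧ y 3 ≠ 0}.indicator (fun _ => (1:ℝ≥0∞)) y ≤ ENNReal.ofReal (12 ^ 10 * t ^ 10 * F) := by
    refine hgoal {0} _ (fun y hy => hy.1) (fun y hy k hk => by rw [Finset.mem_singleton.1 hk]; exact hy.2.1) ?_
    rintro ⟨y, hy, hy0, hy3⟩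
    have h0 : 1 ≤ t * (a ^ 2 * b) := (one_le_abs_int hy3).trans (hS y hy 3)
    refine ⟨fun k hk => h0.trans (mul_le_mul_of_nonneg_left ?_ ht.le), ?_⟩
    · have e : a ^ 2 * b = a * a * b := by ring
      have e1 : a * a * b ≤ a * b * b := by gcongr
      have e2 : a * a * b ≤ b * b * b := by gcongr
      have e3 : a * a * b ≤ c * c * c := by gcongr
      have e4 : a * a * b ≤ a * a * c := by gcongr
      have e5 : a * a * b ≤ b * b * c := by gcongr
      have e6 : a * a * b ≤ a * c * c := by gcongr
      have e7 : a * a * b ≤ b * c * c := by gcongr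
      have e8 : a * a * b ≤ a * b * c := by gcongr
      fin_cases k <;> simp [ww] at hk ⊢ <;> nlinarith
    · have e : (∏ k : Fin 10, if k ∈ ({0} : Finset (Fin 10)) then 1 else 3 * (t * ww a b c k)) =
          3 ^ 9 * t ^ 9 * (a^7 * b^10 * c^10) := by simp [ww, Fin.prod_univ_succ]; ring
      rw [e]
      have hb' : b / a ≤ F := le_trans (by gcongr) hF2
      have hb2 : b ≤ F * a := by rwa [div_le_iff₀ ha] at hb'
      calc 3 ^ 9 * t ^ 9 * (a^7 * b^10 * c^10) ≤ 3 ^ 9 * t ^ 9 * (a^7 * b^10 * c^10) * (t * (a^2 * b)) :=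
            le_mul_of_one_le_right (by positivity) h0
        _ ≤ 3 ^ 9 * t ^ 9 * (a^7 * b^10 * c^10) * (t * (a^2 * (F * a))) := by gcongr
        _ = 3 ^ 9 * t ^ 10 * (a*b*c)^10 * F := by ring
        _ ≤ _ := by gcongr <;> norm_num
  have q3 : ∑' y, {y | y ∈ S ∧ y 0 = 0 ∧ y 3 = 0 ∧ y 4 ≠ 0 ∧ y 5 ≠ 0}.indicator (fun _ => (1:ℝ≥0∞)) y ≤ ENNReal.ofReal (12 ^ 10 * t ^ 10 * F) := by
    refine hgoal {0, 3} _ (fun y hy => hy.1) (fun y hy k hk => by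
      rw [Finset.mem_insert, Finset.mem_singleton] at hk
      rcases hk with rfl | rfl
      · exact hy.2.1
      · exact hy.2.2.1) ?_
    rintro ⟨y, hy, hy0, hy3, hy4, hy5⟩
    have h0 : 1 ≤ t * (a ^ 2 * c) := (one_le_abs_int hy4).trans (hS y hy 4)
    have h5 : 1 ≤ t * (a * b ^ 2) := (one_le_abs_int hy5).trans (hS y hy 5)
    constructor
    · intro k hk
      have f1 : t * (a * b * b) ≤ t * (b * b * b) := by gcongr
      have f2 : t * (a * b * b) ≤ t * (c * c * c) := by gcongr
      have f3 : t * (a * b * b) ≤ t * (b * b * c) := mul_le_mul_of_nonneg_left (by nlinarith [mul_pos hb hb]) ht.le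
      have f4 : t * (a * a * c) ≤ t * (a * c * c) := by gcongr
      have f5 : t * (a * a * c) ≤ t * (b * c * c) := by gcongr
      have f6 : t * (a * a * c) ≤ t * (a * b * c) := by gcongr
      fin_cases k <;> simp [ww] at hk ⊢ <;> nlinarith
    · have e : (∏ k : Fin 10, if k ∈ ({0, 3} : Finset (Fin 10)) then 1 else 3 * (t * ww a b c k)) =
          3 ^ 8 * t ^ 8 * (a^5 * b^9 * c^10) := by simp [ww, Fin.prod_univ_succ]; ring
      rw [e]
      have h6 : 1 ≤ t ^ 2 * (a ^ 5 * b) * F := by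
        have h7 : (1:ℝ) ≤ (t * (a ^ 2 * c)) ^ 3 * (t * (a * b ^ 2)) := one_le_mul_of_one_le_of_one_le (one_le_pow₀ h0) h5
        have h8 : (t ^ 2 * (a ^ 5 * b) * F) ^ 2 = (t * (a ^ 2 * c)) ^ 3 * (t * (a * b ^ 2)) := by
          rw [mul_pow, hF3]; field_simp
        rw [← h8] at h7
        have h9 : 0 ≤ t ^ 2 * (a ^ 5 * b) * F := by positivity
        by_contra hlt
        push Not at hlt
        nlinarith
      calc 3 ^ 8 * t ^ 8 * (a^5 * b^9 * c^10) ≤ 3 ^ 8 * t ^ 8 * (a^5 * b^9 * c^10) * (t ^ 2 * (a ^ 5 * b) * F) :=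
            le_mul_of_one_le_right (by positivity) h6
        _ = 3 ^ 8 * t ^ 10 * (a*b*c)^10 * F := by ring
        _ ≤ _ := by gcongr <;> norm_num
  have hsub : S ⊆ {y | y ∈ S ∧ y 0 ≠ 0} ∪ ({y | y ∈ S ∧ y 0 = 0 ∧ y 3 ≠ 0} ∪ {y | y ∈ S ∧ y 0 = 0 ∧ y 3 = 0 ∧ y 4 ≠ 0 ∧ y 5 ≠ 0}) := by
    intro y hy
    rcases SI_cases y (hSI y hy) with h | h | h
    · exact Or.inl ⟨hy, h⟩
    · exact Or.inr (Or.inl ⟨hy, h⟩)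
    · exact Or.inr (Or.inr ⟨hy, h⟩)
  have hE : ENNReal.ofReal (3 * 12 ^ 10 * t ^ 10 * F) = ENNReal.ofReal (12 ^ 10 * t ^ 10 * F) +
      (ENNReal.ofReal (12 ^ 10 * t ^ 10 * F) + ENNReal.ofReal (12 ^ 10 * t ^ 10 * F)) := by
    rw [← ENNReal.ofReal_add (by positivity) (by positivity), ← ENNReal.ofReal_add (by positivity) (by positivity)]
    congr 1; ring
  rw [hE]
  exact (ind_sum_le hsub).trans (add_le_add q1 ((ind_sum_le (le_refl _)).trans (add_le_add q2 q3)))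

theorem WV_le {R : Set (ℝ × ℝ)} (hD : ∀ p ∈ R, 4 * p.1 ^ 3 + 27 * p.2 ^ 2 ≠ 0) (n : ℕ) (h : M3) :
    WV R n h ≤ 3 * ∑' c, (CV R n h).indicator (fun _ => (1:ℝ≥0∞)) c := by
  unfold WV
  rw [← ENNReal.tsum_mul_left]
  refine ENNReal.tsum_le_tsum fun c => ?_
  by_cases hc : c ∈ CV R n h
  · refine mul_le_mul_left ?_ _
    exact_mod_cast (stab_card hD c (CV_sub R n h hc)).2
  · simp [hc]

theorem boundV (e : ℝ) : ∃ C : ℝ, 0 ≤ C ∧ ∀ (n : ℕ), 0 < n → ∀ h : M3, h ∈ Sie → 1 < dt h → dt h < 2 →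
    WV (RR e 0 10) n h ≤ ENNReal.ofReal C * (n:ℝ≥0∞) ^ 10 * ENNReal.ofReal (Fh h) := by
  obtain ⟨M, hM⟩ := (Bset_bdd (RR e 0 10) (RR_bdd e 0 10)).exists_norm_le
  obtain ⟨M', hM'0, hM'⟩ := act_bdd M
  refine ⟨9 * 12 ^ 10 * M' ^ 10, by positivity, fun n hn h hs h1 h2 => ?_⟩
  obtain ⟨s1, s2, s3, s4, -⟩ := Sie_facts h hs h1 h2
  have hn' : (0:ℝ) < n := by exact_mod_cast hn
  have hd : 0 < dt h := by linarith
  set A := dot (h 0) (h 0)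
  set B := dot (h 1) (h 1)
  set D := dot (h 2) (h 2)
  have hB : 0 < B := by linarith
  have hDp : 0 < D := by linarith
  have hp : ∀ i, 0 < dot (h i) (h i) := fun i => by fin_cases i; exacts [s1, hB, hDp]
  have hDA : 1 ≤ D / A := by rw [one_le_div s1]; linarith
  have hFe : Fh h = (D / A) ^ (3/4:ℝ) := rfl
  have hq : √D / √A = (D / A) ^ (1/2:ℝ) := by rw [← Real.sqrt_div hDp.le, Real.sqrt_eq_rpow]
  have hmem : ∀ c ∈ CV (RR e 0 10) n h, ∀ k, |((c k : ℤ) : ℝ)| ≤ (n * M') * ww √A √B √D k := by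
    rintro c ⟨-, hc⟩ k
    rw [Bh_eq _ _ hd] at hc
    obtain ⟨b, hb, e1⟩ := hc
    have e2 := congrFun e1 k
    simp only [Pi.smul_apply, smul_eq_mul] at e2
    have e3 : ((c k : ℤ) : ℝ) = n * ((dt h)⁻¹ * act (Matrix.of h) b k) := by
      rw [e2]
      change ((c k : ℤ) : ℝ) = n * ((n:ℝ)⁻¹ * ((c k : ℤ) : ℝ))
      field_simp
    rw [e3, abs_mul, abs_mul, abs_of_pos hn', abs_of_pos (inv_pos.2 hd)]
    have e4 := act_row h hp b M' (fun u hu k => hM' u b hu (hM b hb) k) k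
    have e5 : (dt h)⁻¹ ≤ 1 := inv_le_one_of_one_le₀ h1.le
    have e6 : (dt h)⁻¹ * |act (Matrix.of h) b k| ≤ 1 * |act (Matrix.of h) b k| := by gcongr
    rw [mul_assoc]
    exact mul_le_mul_of_nonneg_left (e6.trans (by rw [one_mul]; exact e4)) hn'.le
  have key := dom_real (CV (RR e 0 10) n h) (fun c hc => hc.1) (n * M') √A √B √D (Fh h) (by positivity)
    (Real.sqrt_pos.2 s1) (Real.sqrt_le_sqrt s2) (Real.sqrt_le_sqrt s3)
    (by
      rw [← Real.sqrt_mul s1.le, ← Real.sqrt_mul (by positivity)]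
      calc √(A * B * D) ≤ √16 := Real.sqrt_le_sqrt s4
        _ = 4 := by rw [show (16:ℝ) = 4^2 by norm_num]; exact Real.sqrt_sq (by norm_num))
    (by rw [hFe]; exact Real.one_le_rpow hDA (by norm_num))
    (by rw [hFe, hq]; exact Real.rpow_le_rpow_of_exponent_le hDA (by norm_num))
    (by
      rw [hFe, hq, ← Real.rpow_natCast, ← Real.rpow_mul (by positivity), ← Real.rpow_natCast, ← Real.rpow_mul (by positivity)]
      norm_num) hmem
  refine (WV_le (fun p hp => RR_ne le_rfl hp) n h).trans ((mul_le_mul_right key 3).trans (le_of_eq ?_))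
  have hF : 0 ≤ Fh h := by rw [hFe]; positivity
  rw [show (3:ℝ≥0∞) = ENNReal.ofReal 3 by simp, ← ENNReal.ofReal_mul (by norm_num), ← ENNReal.ofReal_natCast n,
    ← ENNReal.ofReal_pow hn'.le, ← ENNReal.ofReal_mul (by positivity), ← ENNReal.ofReal_mul (by positivity)]
  congr 1
  ring

open MvPolynomial
set_option linter.all false
open MeasureTheory ENNReal
open scoped Pointwise

section
variable {I J : (Fin 10 → ℝ) → ℝ}

theorem Fh_ind_meas : Measurable (Sie.indicator (fun h => ENNReal.ofReal (Fh h))) :=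
  Fh_meas.ennreal_ofReal.indicator Sie_meas

theorem wt_ne_top (h : M3) : wt h ≠ ∞ := by
  refine ne_top_of_le_ne_top ?_ (wt_le h)
  by_cases hs : h ∈ Sie <;> simp [hs]

theorem domV (e : ℝ) : ∃ C : ℝ, ∀ (n : ℕ), 0 < n → ∀ᵐ h ∂mu,
    wt h * (WV (RR e 0 10) n h / (n:ℝ≥0∞)^10) ≤ ENNReal.ofReal C * Sie.indicator (fun h => ENNReal.ofReal (Fh h)) h := by
  obtain ⟨C, -, hC⟩ := boundV e
  refine ⟨C, fun n hn => ?_⟩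
  filter_upwards [mu_pos_ae] with h hh
  by_cases hs : h ∈ Sie
  · have h1 : WV (RR e 0 10) n h / (n:ℝ≥0∞)^10 ≤ ENNReal.ofReal C * ENNReal.ofReal (Fh h) := by
      apply ENNReal.div_le_of_le_mul
      refine (hC n hn h hs hh.1 hh.2).trans (le_of_eq ?_)
      ring
    have h2 : wt h ≤ 1 := by simpa [hs] using wt_le h
    rw [Set.indicator_of_mem hs]
    calc _ ≤ 1 * (ENNReal.ofReal C * ENNReal.ofReal (Fh h)) := mul_le_mul' h2 h1
      _ = _ := one_mul _
  · have : wt h = 0 := by simpa [hs] using wt_le h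
    simp [this]

theorem tendV (hI : InvPair I J) (e : ℝ) (he : e = 1 ∨ e = -1) :
    Filter.Tendsto (fun n : ℕ => 3 * kap' * orbV (RR e 0 10) n / (n:ℝ≥0∞)^10) Filter.atTop
      (nhds (v0 * (324 * kap * volume (RR e 0 10)))) := by
  obtain ⟨C, hC⟩ := domV e
  have hm : ∀ n, Measurable (WV (RR e 0 10) n) := fun n => WV_meas hI _ (fun p hp => RR_ne le_rfl hp) n
  have key := tendsto_lintegral_filter_of_dominated_convergence (μ := mu) (l := Filter.atTop (α := ℕ))
    (F := fun n h => wt h * (WV (RR e 0 10) n h / (n:ℝ≥0∞)^10))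
    (f := fun h => wt h * (324 * kap * volume (RR e 0 10)))
    (fun h => ENNReal.ofReal C * Sie.indicator (fun h => ENNReal.ofReal (Fh h)) h)
    (Filter.Eventually.of_forall fun n => wt_meas.mul (Measurable.div_const (hm n) _))
    (by
      filter_upwards [Filter.eventually_gt_atTop 0] with n hn
      exact hC n hn)
    (by
      rw [lintegral_const_mul _ Fh_ind_meas]
      exact ENNReal.mul_ne_top ENNReal.ofReal_ne_top Fh_int.ne)
    (by
      filter_upwards [mu_pos_ae] with h hh
      exact ENNReal.Tendsto.const_mul (limV hI e he h (by linarith [hh.1])) (Or.inr (wt_ne_top h)))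
  rw [lintegral_mul_const _ wt_meas] at key
  refine key.congr fun n => ?_
  simp_rw [div_eq_mul_inv, ← mul_assoc]
  rw [lintegral_mul_const _ (show Measurable fun h => wt h * WV (RR e 0 10) n h from wt_meas.mul (hm n)), unfoldV hI _ (fun p hp => RR_ne le_rfl hp)]

theorem orbV_fin (hI : InvPair I J) (e : ℝ) (n : ℕ) (hn : 0 < n) : orbV (RR e 0 10) n ≠ ∞ := by
  obtain ⟨C, hC⟩ := domV e
  have h1 := lintegral_mono_ae (hC n hn)
  have hm := WV_meas hI (RR e 0 10) (fun p hp => RR_ne le_rfl hp) n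
  simp_rw [div_eq_mul_inv, ← mul_assoc] at h1
  rw [lintegral_mul_const _ (show Measurable fun h => wt h * WV (RR e 0 10) n h from wt_meas.mul hm), unfoldV hI _ (fun p hp => RR_ne le_rfl hp), lintegral_const_mul _ Fh_ind_meas] at h1
  intro h
  rw [h] at h1
  have h2 : (3 * kap' : ℝ≥0∞) ≠ 0 := mul_ne_zero (by norm_num) kap'_pos.ne'
  rw [ENNReal.mul_top h2, ENNReal.top_mul (by simp)] at h1
  exact (ENNReal.mul_ne_top ENNReal.ofReal_ne_top Fh_int.ne) (top_le_iff.1 h1)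

theorem orbV_lim (hI : InvPair I J) (e : ℝ) (he : e = 1 ∨ e = -1) (a : ℝ) (ha : 0 ≤ a) (hv : volume (RR e 0 10) = ENNReal.ofReal a) :
    Filter.Tendsto (fun n : ℕ => orbV (RR e 0 10) n / (n:ℝ≥0∞)^10) Filter.atTop (nhds (ENNReal.ofReal (36 * a * zeta2 * zeta3))) := by
  have h1 := tendV hI e he
  have h0 : (3 * kap' : ℝ≥0∞) ≠ 0 := mul_ne_zero (by norm_num) kap'_pos.ne'
  have h2 : (3 * kap' : ℝ≥0∞) ≠ ∞ := ENNReal.mul_ne_top (by norm_num) kap'_fin.ne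
  have e1 : v0 * (324 * kap * volume (RR e 0 10)) = 3 * kap' * ENNReal.ofReal (36 * a * zeta2 * zeta3) := by
    rw [hv, show v0 * (324 * kap * ENNReal.ofReal a) = (v0 * kap) * 324 * ENNReal.ofReal a by ring, v0_kap]
    rw [show (36 * a * zeta2 * zeta3) = 108 * a * (zeta2 * zeta3 / 3) by ring, ENNReal.ofReal_mul (by positivity),
      ENNReal.ofReal_mul (by positivity), show ENNReal.ofReal 108 = 108 by simp]
    ring
  rw [e1] at h1
  have h3 := ENNReal.Tendsto.const_mul (a := (3 * kap')⁻¹) h1 (Or.inr (ENNReal.inv_ne_top.2 h0))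
  rw [← mul_assoc, ENNReal.inv_mul_cancel h0 h2, one_mul] at h3
  refine h3.congr fun n => ?_
  rw [mul_div_assoc, ← mul_assoc, ENNReal.inv_mul_cancel h0 h2, one_mul]

theorem RR_num (e : ℝ) (he : e = 1 ∨ e = -1) (n A B : ℝ) (hn : 0 < n) :
    (A, B) ∈ RR e 0 10 ↔ 0 < e * (4 * (n^4 * (-3 * A)) ^ 3 - (n^6 * (-27 * B)) ^ 2) ∧ |n^4 * (-3 * A)| ^ 3 < n ^ 12 ∧
      (n^6 * (-27 * B)) ^ 2 / 4 < n ^ 12 := by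
  have e1 : e * (4 * (n^4 * (-3 * A)) ^ 3 - (n^6 * (-27 * B)) ^ 2) = (27 * n ^ 12) * (e * Dq (A, B)) := by
    unfold Dq; ring
  have e2 : |n^4 * (-3 * A)| ^ 3 < n ^ 12 ↔ |A| < 1/3 := by
    rw [show n ^ 12 = (n^4)^3 by ring, pow_lt_pow_iff_left₀ (abs_nonneg _) (by positivity) (by norm_num), abs_mul, abs_mul,
      abs_of_pos (by positivity : 0 < n^4)]
    rw [show |(-3:ℝ)| = 3 by norm_num]
    have : 0 < n ^ 4 := by positivity
    constructor
    · intro h; by_contra h'; push Not at h'; nlinarith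
    · intro h; nlinarith
  have e3 : (n^6 * (-27 * B)) ^ 2 / 4 < n ^ 12 ↔ |B| < 2/27 := by
    have h12 : 0 < n ^ 12 := by positivity
    rw [show (n^6 * (-27 * B)) ^ 2 / 4 = n ^ 12 * ((27 * B)^2 / 4) by ring, ← abs_of_pos (show (0:ℝ) < 2/27 by norm_num), ← sq_lt_sq]
    constructor
    · intro h; by_contra h'; push Not at h'; nlinarith
    · intro h; nlinarith
  rw [e1, e2, e3, mul_pos_iff_of_pos_left (by positivity)]
  constructor
  · rintro ⟨h1, h2, h3, h4⟩
    exact ⟨h3, h1, h2⟩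
  · rintro ⟨h3, h1, h2⟩
    refine ⟨h1, h2, h3, ?_⟩
    have := Dq_lt (p := (A, B)) h1 h2
    rw [abs_lt] at this
    rcases he with rfl | rfl <;> linarith [this.1, this.2]

theorem SV_iff (hI : InvPair I J) (e : ℝ) (he : e = 1 ∨ e = -1) (n : ℕ) (hn : 0 < n) (c : YV) :
    c ∈ SV (RR e 0 10) n ↔ SI c ∧ 0 < e * Dsc I J (toV c) ∧ |I (toV c)| ^ 3 < (n:ℝ) ^ 12 ∧ J (toV c) ^ 2 / 4 < (n:ℝ) ^ 12 := by
  have hn' : (0:ℝ) < n := by exact_mod_cast hn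
  obtain ⟨i1, i2⟩ := I_smul hI (n:ℝ) hn'.ne' ((n:ℝ)⁻¹ • toV c)
  rw [smul_smul, mul_inv_cancel₀ hn'.ne', one_smul] at i1 i2
  have main : ∀ A B, I ((n:ℝ)⁻¹ • toV c) = -3 * A → J ((n:ℝ)⁻¹ • toV c) = -27 * B →
      ((A, B) ∈ RR e 0 10 ↔ 0 < e * Dsc I J (toV c) ∧ |I (toV c)| ^ 3 < (n:ℝ) ^ 12 ∧ J (toV c) ^ 2 / 4 < (n:ℝ) ^ 12) := by
    intro A B hA hB
    unfold Dsc
    rw [i1, i2, hA, hB]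
    exact RR_num e he n A B hn'
  constructor
  · rintro ⟨h1, ⟨A, B⟩, hp, g, hg, e1⟩
    obtain ⟨j1, j2⟩ := IJ_Tv hI (g, (A, B)) hg.ne'
    rw [← e1] at j1 j2
    exact ⟨h1, (main A B j1 j2).1 hp⟩
  · rintro ⟨h1, h2⟩
    have hD : Dsc I J ((n:ℝ)⁻¹ • toV c) ≠ 0 := by
      intro h
      have : Dsc I J (toV c) = 0 := by
        have e2 : Dsc I J (toV c) = (n:ℝ)^12 * Dsc I J ((n:ℝ)⁻¹ • toV c) := by
          unfold Dsc; rw [i1, i2]; ring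
        rw [e2, h, mul_zero]
      rw [this] at h2
      simp at h2
    obtain ⟨g, hg, A, B, hgW⟩ := normal_form hI _ hD
    have e3 : (n:ℝ)⁻¹ • toV c = Tv (Matrix.of.symm (Matrix.adjugate g), (A, B)) := by
      have d1 : dt (Matrix.of.symm (Matrix.adjugate g)) = 1 := by
        change (Matrix.adjugate g).det = 1
        rw [Matrix.det_adjugate, hg]; simp
      unfold Tv
      change _ = (dt (Matrix.of.symm (Matrix.adjugate g)))⁻¹ • act (Matrix.adjugate g) (wcoeffs A B)
      rw [d1, inv_one, one_smul, ← hgW, ← act_mul, Matrix.adjugate_mul, hg, one_smul, act_one]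
    have d1 : dt (Matrix.of.symm (Matrix.adjugate g)) = 1 := by
      change (Matrix.adjugate g).det = 1
      rw [Matrix.det_adjugate, hg]; simp
    obtain ⟨j1, j2⟩ := IJ_Tv hI (Matrix.of.symm (Matrix.adjugate g), (A, B)) (by rw [d1]; exact one_ne_zero)
    rw [← e3] at j1 j2
    exact ⟨h1, (A, B), (main A B j1 j2).2 h2, _, by rw [d1]; exact one_pos, e3⟩

/-- the set of orbits with bounded height -/
def OX (I J : (Fin 10 → ℝ) → ℝ) (e X : ℝ) : Set (Set YV) :=
  {T | ∃ c : YV, SI c ∧ 0 < e * Dsc I J (toV c) ∧ |I (toV c)| ^ 3 < X ∧ J (toV c) ^ 2 / 4 < X ∧ T = MulAction.orbit SLZ c}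

theorem OX_mono (e : ℝ) {X Y : ℝ} (h : X ≤ Y) : OX I J e X ⊆ OX I J e Y := by
  rintro T ⟨c, h1, h2, h3, h4, h5⟩
  exact ⟨c, h1, h2, h3.trans_le h, h4.trans_le h, h5⟩

theorem OX_orbV (hI : InvPair I J) (e : ℝ) (he : e = 1 ∨ e = -1) (n : ℕ) (hn : 0 < n) :
    orbV (RR e 0 10) n = (((OX I J e ((n:ℝ)^12)).encard : ℕ∞) : ℝ≥0∞) := by
  unfold orbV
  congr 2
  ext T
  constructor
  · rintro ⟨c, hc, h⟩
    obtain ⟨h1, h2, h3, h4⟩ := (SV_iff hI e he n hn c).1 hc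
    exact ⟨c, h1, h2, h3, h4, h⟩
  · rintro ⟨c, h1, h2, h3, h4, h⟩
    exact ⟨c, (SV_iff hI e he n hn c).2 ⟨h1, h2, h3, h4⟩, h⟩

theorem OX_fin_nat (hI : InvPair I J) (e : ℝ) (he : e = 1 ∨ e = -1) (n : ℕ) (hn : 0 < n) : (OX I J e ((n:ℝ)^12)).Finite := by
  have h := orbV_fin hI e n hn
  rw [OX_orbV hI e he n hn] at h
  rw [← Set.encard_lt_top_iff, lt_top_iff_ne_top]
  intro h'
  rw [h'] at h
  exact h rfl

theorem OX_fin (hI : InvPair I J) (e : ℝ) (he : e = 1 ∨ e = -1) (X : ℝ) : (OX I J e X).Finite := by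
  obtain ⟨n, hn⟩ := exists_nat_gt X
  refine (OX_fin_nat hI e he (n + 1) (by omega)).subset (OX_mono e ?_)
  have h1 : (1:ℝ) ≤ ((n+1 : ℕ) : ℝ) := by push_cast; linarith [(Nat.cast_nonneg n : (0:ℝ) ≤ n)]
  have h2 := le_self_pow₀ h1 (show (12:ℕ) ≠ 0 by norm_num)
  push_cast at h2 ⊢
  linarith

theorem OX_lim (hI : InvPair I J) (e : ℝ) (he : e = 1 ∨ e = -1) (a : ℝ) (ha : 0 ≤ a) (hv : volume (RR e 0 10) = ENNReal.ofReal a) :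
    Filter.Tendsto (fun n : ℕ => ((OX I J e ((n:ℝ)^12)).ncard : ℝ) / (n:ℝ)^10) Filter.atTop (nhds (36 * a * zeta2 * zeta3)) := by
  have h := orbV_lim hI e he a ha hv
  have h0 : 0 ≤ 36 * a * zeta2 * zeta3 := by
    have : 0 ≤ zeta2 := tsum_nonneg fun n => by positivity
    have : 0 ≤ zeta3 := tsum_nonneg fun n => by positivity
    positivity
  have h2 := (ENNReal.tendsto_toReal ENNReal.ofReal_ne_top).comp h
  rw [ENNReal.toReal_ofReal h0] at h2
  refine h2.congr' ?_
  filter_upwards [Filter.eventually_gt_atTop 0] with n hn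
  change (orbV (RR e 0 10) n / (n:ℝ≥0∞)^10).toReal = _
  rw [OX_orbV hI e he n hn, ENNReal.toReal_div, ← (OX_fin_nat hI e he n hn).cast_ncard_eq]
  simp

end

theorem sandwich (N : ℝ → ℝ) (hm : Monotone N) (h0 : ∀ X, 0 ≤ N X) (L : ℝ)
    (h : Filter.Tendsto (fun n : ℕ => N ((n:ℝ)^12) / (n:ℝ)^10) Filter.atTop (nhds L)) :
    Filter.Tendsto (fun X : ℝ => N X / X ^ ((5:ℝ)/6)) Filter.atTop (nhds L) := by
  let m : ℝ → ℕ := fun X => ⌊X ^ ((1:ℝ)/12)⌋₊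
  have hmt : Filter.Tendsto m Filter.atTop Filter.atTop :=
    tendsto_nat_floor_atTop.comp (tendsto_rpow_atTop (by norm_num))
  have hq : Filter.Tendsto (fun n : ℕ => ((n:ℝ) / ((n:ℝ) + 1)) ^ 10) Filter.atTop (nhds 1) := by
    have := (tendsto_natCast_div_add_atTop (1:ℝ)).pow 10
    simpa using this
  have hlow : Filter.Tendsto (fun n : ℕ => N ((n:ℝ)^12) / ((n:ℝ)+1)^10) Filter.atTop (nhds L) := by
    have := h.mul hq
    rw [mul_one] at this
    refine this.congr' ?_
    filter_upwards [Filter.eventually_gt_atTop 0] with n hn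
    have hn' : (0:ℝ) < n := by exact_mod_cast hn
    field_simp
  have hup : Filter.Tendsto (fun n : ℕ => N (((n:ℝ)+1)^12) / (n:ℝ)^10) Filter.atTop (nhds L) := by
    have h1 := h.comp (Filter.tendsto_add_atTop_nat 1)
    have := h1.div hq one_ne_zero
    rw [div_one] at this
    refine this.congr' ?_
    filter_upwards [Filter.eventually_gt_atTop 0] with n hn
    have hn' : (0:ℝ) < n := by exact_mod_cast hn
    simp only [Function.comp, Pi.div_apply]
    push_cast
    field_simp
  refine tendsto_of_tendsto_of_tendsto_of_le_of_le' (hlow.comp hmt) (hup.comp hmt) ?_ ?_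
  all_goals
    filter_upwards [Filter.eventually_gt_atTop 0, hmt.eventually_gt_atTop 0] with X hX hmX
    have hY : 0 < X ^ ((1:ℝ)/12) := by positivity
    have e1 : (X ^ ((1:ℝ)/12)) ^ 12 = X := by
      rw [← Real.rpow_natCast, ← Real.rpow_mul hX.le]; norm_num
    have e2 : X ^ ((5:ℝ)/6) = (X ^ ((1:ℝ)/12)) ^ 10 := by
      rw [← Real.rpow_natCast, ← Real.rpow_mul hX.le]; norm_num
    have f1 : (m X : ℝ) ≤ X ^ ((1:ℝ)/12) := Nat.floor_le hY.le
    have f2 : X ^ ((1:ℝ)/12) < (m X : ℝ) + 1 := Nat.lt_floor_add_one _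
    have hmX' : (0:ℝ) < m X := by exact_mod_cast hmX
    have g1 : N ((m X : ℝ)^12) ≤ N X := hm ((pow_le_pow_left₀ hmX'.le f1 12).trans e1.le)
    have g2 : N X ≤ N (((m X : ℝ)+1)^12) := hm (e1.ge.trans (pow_le_pow_left₀ hY.le f2.le 12))
    simp only [Function.comp]
    rw [e2]
  · exact div_le_div₀ (h0 _) g1 (by positivity) (pow_le_pow_left₀ hY.le f2.le 10)
  · exact div_le_div₀ (h0 _) g2 (by positivity) (pow_le_pow_left₀ hmX'.le f1 10)

theorem aeval_castR (P : MvPolynomial (Fin 10) ℚ) (c : Fin 10 → ℤ) :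
    (((aeval (fun k => (c k : ℚ)) P : ℚ)) : ℝ) = aeval (toV c) P := by
  have := aeval_map' (Algebra.ofId ℚ ℝ) (fun k => (c k : ℚ)) P
  have e : (fun k => Algebra.ofId ℚ ℝ ((c k : ℚ))) = toV c := by
    funext k
    simp [toV, Algebra.ofId_apply]
  rw [e] at this
  rw [← this]
  simp [Algebra.ofId_apply]

theorem set_OX (P Q : MvPolynomial (Fin 10) ℚ) (c : Fin 10 → ℤ) (X : ℝ) :
    ((Δinv P Q c : ℚ) : ℝ) = Dsc (fun c => aeval c P) (fun c => aeval c Q) (toV c) / 27 ∧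
    ((Hinv P Q c : ℝ) < X ↔ |(aeval (toV c) P : ℝ)| ^ 3 < X ∧ (aeval (toV c) Q : ℝ) ^ 2 / 4 < X) := by
  unfold Δinv Hinv Iinv Jinv Dsc
  push_cast
  rw [aeval_castR, aeval_castR, max_lt_iff]
  exact ⟨rfl, Iff.rfl⟩

theorem Npos_OX (P Q : MvPolynomial (Fin 10) ℚ) (X : ℝ) :
    Npos P Q X = (OX (fun c => aeval c P) (fun c => aeval c Q) 1 X).ncard := by
  unfold Npos OX
  congr 1
  ext T
  refine exists_congr fun c => ?_
  obtain ⟨h1, h2⟩ := set_OX P Q c X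
  have h3 : 0 < Δinv P Q c ↔ 0 < 1 * Dsc (fun c => (aeval c P : ℝ)) (fun c => (aeval c Q : ℝ)) (toV c) := by
    rw [← Rat.cast_pos (K := ℝ), h1, one_mul]
    constructor <;> intro h <;> linarith
  have h4 : T = orbitZ c ↔ @Eq (Set YV) T (MulAction.orbit SLZ c) :=
    ⟨fun h => h.trans (orbitZ_YV c), fun h => h.trans (orbitZ_YV c).symm⟩
  rw [h3, h2, and_assoc]
  exact and_congr Iff.rfl (and_congr Iff.rfl (and_congr Iff.rfl (and_congr Iff.rfl h4)))

theorem Nneg_OX (P Q : MvPolynomial (Fin 10) ℚ) (X : ℝ) :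
    Nneg P Q X = (OX (fun c => aeval c P) (fun c => aeval c Q) (-1) X).ncard := by
  unfold Nneg OX
  congr 1
  ext T
  refine exists_congr fun c => ?_
  obtain ⟨h1, h2⟩ := set_OX P Q c X
  have h3 : Δinv P Q c < 0 ↔ 0 < -1 * Dsc (fun c => (aeval c P : ℝ)) (fun c => (aeval c Q : ℝ)) (toV c) := by
    rw [← Rat.cast_lt_zero (K := ℝ), h1]
    constructor <;> intro h <;> linarith
  have h4 : T = orbitZ c ↔ @Eq (Set YV) T (MulAction.orbit SLZ c) :=
    ⟨fun h => h.trans (orbitZ_YV c), fun h => h.trans (orbitZ_YV c).symm⟩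
  rw [h3, h2, and_assoc]
  exact and_congr Iff.rfl (and_congr Iff.rfl (and_congr Iff.rfl (and_congr Iff.rfl h4)))

theorem OX_final {I J : (Fin 10 → ℝ) → ℝ} (hI : InvPair I J) (e : ℝ) (he : e = 1 ∨ e = -1) (a : ℝ) (ha : 0 ≤ a) (hv : volume (RR e 0 10) = ENNReal.ofReal a) :
    Filter.Tendsto (fun X : ℝ => ((OX I J e X).ncard : ℝ) / X ^ ((5:ℝ)/6)) Filter.atTop (nhds (36 * a * zeta2 * zeta3)) :=
  sandwich (fun X => ((OX I J e X).ncard : ℝ))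
    (fun X Y h => by
      have := Set.ncard_le_ncard (OX_mono (I := I) (J := J) e h) (OX_fin hI e he Y)
      exact Nat.cast_le.2 this)
    (fun X => by positivity) _ (OX_lim hI e he a ha hv)

theorem stmt9 (P Q : MvPolynomial (Fin 10) ℚ) (hPQ : IsInvariantPair ℚ P Q) :
    Filter.Tendsto (fun X : ℝ => (Npos P Q X : ℝ) / X ^ ((5 : ℝ)/6)) Filter.atTop
      (nhds ((32/45) * zeta2 * zeta3)) ∧
    Filter.Tendsto (fun X : ℝ => (Nneg P Q X : ℝ) / X ^ ((5 : ℝ)/6)) Filter.atTop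
      (nhds ((128/45) * zeta2 * zeta3)) := by
  have h1 := OX_final (invPair hPQ) 1 (Or.inl rfl) (8/405) (by norm_num) area_pos
  have h2 := OX_final (invPair hPQ) (-1) (Or.inr rfl) (32/405) (by norm_num) area_neg
  rw [show (36 * (8/405) : ℝ) = 32/45 by norm_num] at h1
  rw [show (36 * (32/405) : ℝ) = 128/45 by norm_num] at h2
  simp only [Npos_OX, Nneg_OX]
  exact ⟨h1, h2⟩
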